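/- For any constant A > 0 there exists B = B(A) > 0 such that for all sufficiently large integers N, \sum_{k \le \sqrt{N} L^{-B}} \max_{(l,k)=1} \max_{J \in \mathcal{J}} \sum_{n \le N} | \Delta^{(2)}_{k,l}(n, J) | \ll N^2 L^{-A}, where L = log N, the inner maxima are over residues l coprime to k and over subintervals J of [1, N], and the implied constant depends only on A. -/

import Mathlib

open Finset

noncomputable section

/-- I⁽²⁾_{k,l}(n, J) for the interval J = [a, b]:
the sum of (log p₁)(log p₂) over ordered pairs of primes with p₁ + p₂ = n,
p₁ ≡ l (mod k) and p₁ ∈ [a, b]. -/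
def I2 (k : ℕ) (l : ℤ) (n a b : ℕ) : ℝ :=
  ∑ p1 ∈ Finset.range (n + 1), ∑ p2 ∈ Finset.range (n + 1),
    if p1.Prime ∧ p2.Prime ∧ p1 + p2 = n ∧ (k : ℤ) ∣ (p1 : ℤ) - l ∧ a ≤ p1 ∧ p1 ≤ b then
      Real.log p1 * Real.log p2
    else 0

/-- λ(k) = ∏_{p ∣ k, p > 2} (p-1)/(p-2). -/
def lam (k : ℕ) : ℝ := ∏ p ∈ k.primeFactors.filter (fun p => 2 < p), ((p : ℝ) - 1) / ((p : ℝ) - 2)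

/-- c₀ = 2 ∏_{p > 2} (1 - 1/(p-1)²). -/
def c0 : ℝ := 2 * ∏' p : Nat.Primes, (if 2 < (p : ℕ) then 1 - 1 / (((p : ℕ) : ℝ) - 1) ^ 2 else 1)

/-- The binary singular series 𝔖⁽²⁾_{k,l}(n). -/
def S2 (k : ℕ) (l : ℤ) (n : ℕ) : ℝ :=
  if Int.gcd (k : ℤ) ((n : ℤ) - l) = 1 ∧ 2 ∣ n then c0 * lam (n * k) else 0

/-- Φ⁽²⁾(n, J) for J = [a, b]: the number of pairs of positive integers
(m₁, m₂) with m₁ + m₂ = n and m₁ ∈ [a, b]. -/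
def Phi2 (n a b : ℕ) : ℕ :=
  ((Finset.Icc 1 n ×ˢ Finset.Icc 1 n).filter
    (fun q => q.1 + q.2 = n ∧ a ≤ q.1 ∧ q.1 ≤ b)).card

/-- Δ⁽²⁾_{k,l}(n, J) for J = [a, b]. -/
def Delta2 (k : ℕ) (l : ℤ) (n a b : ℕ) : ℝ :=
  I2 k l n a b - S2 k l n / (Nat.totient k : ℝ) * (Phi2 n a b : ℝ)

open MeasureTheory
open DirichletCharacter (LFunction differentiable_LFunction changeLevel LFunction_eq_LSeries LFunction_ne_zero_of_one_le_re LFunctionTrivChar)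
open ArithmeticFunction (vonMangoldt vonMangoldt_nonneg vonMangoldt_le_log prodPrimeFactors_apply)
open Complex (I norm_real ofReal_re continuous_re norm_natCast ofReal_mul ofReal_sub conj_ofReal abs_im_le_norm abs_re_le_norm)
open Real (log log_natCast_nonneg log_le_log norm_of_nonneg norm_eq_abs rpow_neg mul_rpow rpow_natCast)

theorem one_le_cast_of_neZero (q : ℕ) [NeZero q] : (1 : ℝ) ≤ q := by
  exact_mod_cast Nat.one_le_iff_ne_zero.2 (NeZero.ne q)

theorem hyper_aux (f : ℕ → ℂ) (X : ℕ) (hX : 1 ≤ X) (a : ℂ) (B : ℝ)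
    (hb : ∀ n, ‖f n‖ ≤ 1) (hf : ∀ n ≤ X, f n = 0)
    (hD : ∀ t : ℝ, (X : ℝ) ≤ t → ‖∑ k ∈ Icc 1 ⌊t⌋₊, f k - a * ((t : ℂ) - X)‖ ≤ B)
    (H : ℂ → ℂ) (hH : DifferentiableOn ℂ H {s | 0 < s.re})
    (hHs : ∀ s : ℂ, 1 < s.re → H s = (s - 1) * LSeries f s) (s : ℂ) (hs : 0 < s.re) :
    ‖H s - a * (X : ℂ) ^ (1 - s)‖ ≤ ‖s - 1‖ * ‖s‖ * (B * (X : ℝ) ^ (-s.re) / s.re) := by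
  have hX0 : (0 : ℝ) < X := by exact_mod_cast hX
  have hB : 0 ≤ B := (norm_nonneg _).trans (hD X le_rfl)
  set D : ℝ → ℂ := Set.indicator (Set.Ioi (X : ℝ))
    (fun t : ℝ => ∑ k ∈ Icc 1 ⌊t⌋₊, f k - a * ((t : ℂ) - X)) with hDdef
  have hDb : ∀ t, ‖D t‖ ≤ B := by
    intro t
    rw [hDdef]
    by_cases h : (X : ℝ) < t
    · rw [Set.indicator_of_mem (by exact h)]; exact hD t h.le
    · rw [Set.indicator_of_notMem (by exact h)]; simpa using hB
  have hDm : Measurable D := by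
    refine Measurable.indicator ?_ measurableSet_Ioi
    refine Measurable.sub ?_ (by fun_prop)
    exact (measurable_from_nat (f := fun m : ℕ => ∑ k ∈ Icc 1 m, f k)).comp Nat.measurable_floor
  have hDloc : LocallyIntegrableOn D (Set.Ioi 0) := by
    have : LocallyIntegrable (fun _ : ℝ => B) := continuous_const.locallyIntegrable
    refine (this.mono hDm.aestronglyMeasurable (Filter.Eventually.of_forall fun t => ?_)).locallyIntegrableOn _
    rw [norm_of_nonneg hB]; exact hDb t
  have hbot : ∀ b : ℝ, D =O[nhdsWithin 0 (Set.Ioi 0)] (fun x : ℝ => x ^ (-b)) := by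
    intro b
    have : D =ᶠ[nhdsWithin 0 (Set.Ioi 0)] fun _ => 0 := by
      filter_upwards [mem_nhdsWithin_of_mem_nhds (Iio_mem_nhds hX0)] with t ht
      rw [hDdef, Set.indicator_of_notMem]
      simpa using ht.le
    exact this.trans_isBigO (Asymptotics.isBigO_zero _ _)
  have htop : D =O[Filter.atTop] (fun x : ℝ => x ^ (-(0:ℝ))) := by
    refine Asymptotics.IsBigO.of_bound B (Filter.Eventually.of_forall fun t => ?_)
    simpa using hDb t
  have hmd : ∀ z : ℂ, 0 < z.re → DifferentiableAt ℂ (mellin D) (-z) := fun z hz =>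
    mellin_differentiableAt_of_isBigO_rpow hDloc htop (by simpa using hz) (hbot (-z.re - 1)) (by simp)
  have hmc : ∀ z : ℂ, 0 < z.re → MellinConvergent D (-z) := fun z hz =>
    mellinConvergent_of_isBigO_rpow hDloc htop (by simpa using hz) (hbot (-z.re - 1)) (by simp)
  set K : ℂ → ℂ := fun z => a * (X : ℂ) ^ (1 - z) + (z - 1) * z * mellin D (-z) with hK
  have hXc : (X : ℂ) ≠ 0 := by exact_mod_cast (by omega : X ≠ 0)
  have hKd : DifferentiableOn ℂ K {s | 0 < s.re} := by
    intro z hz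
    have h1 := hmd z hz
    have h2 : DifferentiableAt ℂ (fun z : ℂ => mellin D (-z)) z :=
      DifferentiableAt.fun_comp' (f := fun z : ℂ => -z) z h1 differentiableAt_id.fun_neg
    have h3 : DifferentiableAt ℂ (fun z : ℂ => (X : ℂ) ^ (1 - z)) z :=
      DifferentiableAt.const_cpow (by fun_prop) (Or.inl hXc)
    exact (by fun_prop : DifferentiableAt ℂ K z).differentiableWithinAt
  have hO : (fun n => ∑ k ∈ Icc 1 n, f k) =O[Filter.atTop] fun n : ℕ => (n : ℝ) ^ (1 : ℝ) := by
    refine Asymptotics.IsBigO.of_bound 1 (Filter.Eventually.of_forall fun n => ?_)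
    rw [Real.rpow_one, one_mul, norm_of_nonneg (by positivity)]
    refine (norm_sum_le _ _).trans ((sum_le_sum fun k _ => hb k).trans ?_)
    simp
  have hKH : ∀ z : ℂ, 1 < z.re → H z = K z := by
    intro z hz
    have hz0 : z ≠ 0 := fun h => by rw [h] at hz; simp at hz; linarith
    have hz1 : z - 1 ≠ 0 := fun h => by rw [sub_eq_zero.1 h] at hz; simp at hz
    rw [hHs z hz, LSeries_eq_mul_integral f (by norm_num) hz
      (LSeriesSummable_of_bounded_of_one_lt_re (fun n _ => hb n) hz) hO]
    have e1 : ∫ t in Set.Ioi (1 : ℝ), (∑ k ∈ Icc 1 ⌊t⌋₊, f k) * (t : ℂ) ^ (-(z + 1))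
        = ∫ t in Set.Ioi (X : ℝ), (∑ k ∈ Icc 1 ⌊t⌋₊, f k) * (t : ℂ) ^ (-(z + 1)) := by
      refine setIntegral_eq_of_subset_of_forall_sdiff_eq_zero measurableSet_Ioi
        (Set.Ioi_subset_Ioi (by exact_mod_cast hX)) ?_
      intro t ht
      have h2 : t ≤ X := by simpa using ht.2
      rw [sum_eq_zero, zero_mul]
      intro k hk
      exact hf k ((mem_Icc.1 hk).2.trans (Nat.floor_le_of_le h2))
    have e2 : mellin D (-z) = ∫ t in Set.Ioi (X : ℝ),
        (t : ℂ) ^ (-(z + 1)) * (∑ k ∈ Icc 1 ⌊t⌋₊, f k - a * ((t : ℂ) - X)) := by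
      rw [mellin]
      rw [← integral_indicator measurableSet_Ioi,
        ← integral_indicator measurableSet_Ioi]
      congr 1
      ext t
      by_cases h : (X : ℝ) < t
      · rw [Set.indicator_of_mem (by exact hX0.trans h), Set.indicator_of_mem (by exact h), hDdef,
          Set.indicator_of_mem (by exact h), smul_eq_mul]
        congr 2; ring
      · rw [Set.indicator_of_notMem (s := Set.Ioi (X : ℝ)) (by exact h)]
        by_cases h0 : 0 < t
        · rw [Set.indicator_of_mem (by exact h0), hDdef, Set.indicator_of_notMem (by exact h), smul_zero]
        · rw [Set.indicator_of_notMem (by exact h0)]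
    have i0 : IntegrableOn (fun t : ℝ => (t : ℂ) ^ (-(z + 1)) *
        (∑ k ∈ Icc 1 ⌊t⌋₊, f k - a * ((t : ℂ) - X))) (Set.Ioi (X : ℝ)) := by
      have := (hmc z (by linarith)).mono_set (Set.Ioi_subset_Ioi hX0.le)
      refine this.congr_fun (fun t ht => ?_) measurableSet_Ioi
      simp only [hDdef, Set.indicator_of_mem ht, smul_eq_mul]
      congr 2; ring
    have i1 : IntegrableOn (fun t : ℝ => (t : ℂ) ^ (-z)) (Set.Ioi (X : ℝ)) :=
      integrableOn_Ioi_cpow_of_lt (by simp; linarith) hX0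
    have i2 : IntegrableOn (fun t : ℝ => (t : ℂ) ^ (-(z + 1))) (Set.Ioi (X : ℝ)) :=
      integrableOn_Ioi_cpow_of_lt (by simp; linarith) hX0
    have e3 : ∫ t in Set.Ioi (X : ℝ), (∑ k ∈ Icc 1 ⌊t⌋₊, f k) * (t : ℂ) ^ (-(z + 1))
        = mellin D (-z) + (a * (∫ t in Set.Ioi (X : ℝ), (t : ℂ) ^ (-z)) -
          a * X * (∫ t in Set.Ioi (X : ℝ), (t : ℂ) ^ (-(z + 1)))) := by
      rw [e2, ← integral_const_mul, ← integral_const_mul,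
        ← integral_sub (i1.const_mul _) (i2.const_mul _),
        ← integral_add (g := fun t : ℝ => a * (t : ℂ) ^ (-z) - a * X * (t : ℂ) ^ (-(z + 1)))
          i0 ((i1.const_mul _).sub (i2.const_mul _))]
      refine setIntegral_congr_fun measurableSet_Ioi (fun t ht => ?_)
      have ht0 : (t : ℂ) ≠ 0 := by exact_mod_cast (hX0.trans ht).ne'
      have : (t : ℂ) ^ (-z) = t * (t : ℂ) ^ (-(z + 1)) := by
        rw [show -z = -(z+1) + 1 by ring, Complex.cpow_add _ _ ht0, Complex.cpow_one]; ring
      simp only [this]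
      ring
    rw [e1, e3, integral_Ioi_cpow_of_lt (by simp; linarith) hX0,
      integral_Ioi_cpow_of_lt (by simp; linarith) hX0, hK]
    have e4 : ((X : ℝ) : ℂ) ^ (-z + 1) = (X : ℂ) ^ (1 - z) := by
      rw [Complex.ofReal_natCast]; congr 1; ring
    have e5 : ((X : ℝ) : ℂ) ^ (-(z + 1) + 1) = (X : ℂ) ^ (1 - z) / X := by
      rw [Complex.ofReal_natCast, show -(z+1)+1 = (1 - z) - 1 by ring, Complex.cpow_sub _ _ hXc,
        Complex.cpow_one]
    rw [e4, e5]
    have : -z + 1 ≠ 0 := by intro h; apply hz1; linear_combination -h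
    have h3 : -(z + 1) + 1 ≠ 0 := by intro h; apply hz0; linear_combination -h
    field_simp
    ring
  have hEq : Set.EqOn H K {s | 0 < s.re} := by
    have hopen : IsOpen {s : ℂ | 0 < s.re} := isOpen_lt continuous_const continuous_re
    refine (hH.analyticOnNhd hopen).eqOn_of_preconnected_of_eventuallyEq
      (hKd.analyticOnNhd hopen) (convex_halfSpace_re_gt 0).isPreconnected (z₀ := 2) (by simp) ?_
    filter_upwards [(isOpen_lt continuous_const continuous_re).mem_nhds
      (show (2 : ℂ) ∈ {s : ℂ | 1 < s.re} by simp)] with z hz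
    exact hKH z hz
  rw [hEq hs, hK]
  simp only [add_sub_cancel_left, norm_mul]
  refine mul_le_mul_of_nonneg_left ?_ (by positivity)
  have e6 : mellin D (-s) = ∫ t in Set.Ioi (X : ℝ), (t : ℂ) ^ (-s - 1) * D t := by
    rw [mellin]
    refine setIntegral_eq_of_subset_of_forall_sdiff_eq_zero measurableSet_Ioi
      (Set.Ioi_subset_Ioi hX0.le) ?_
    intro t ht
    rw [hDdef, Set.indicator_of_notMem ht.2, smul_zero]
  rw [e6]
  have hlt : -s.re - 1 < -1 := by linarith
  calc _ ≤ ∫ t in Set.Ioi (X : ℝ), B * t ^ (-s.re - 1) := by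
        refine norm_integral_le_of_norm_le
          ((integrableOn_Ioi_rpow_of_lt hlt hX0).const_mul B) ?_
        refine (ae_restrict_iff' measurableSet_Ioi).2
          (Filter.Eventually.of_forall fun t ht => ?_)
        rw [norm_mul, Complex.norm_cpow_eq_rpow_re_of_pos (hX0.trans ht), mul_comm]
        simp only [Complex.sub_re, Complex.neg_re, Complex.one_re]
        exact mul_le_mul_of_nonneg_right (hDb t) (Real.rpow_nonneg (hX0.trans ht).le _)
    _ = B * (X : ℝ) ^ (-s.re) / s.re := by
        rw [integral_const_mul, integral_Ioi_rpow_of_lt hlt hX0]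
        rw [show -s.re - 1 + 1 = -s.re by ring]
        field_simp
    _ ≤ _ := le_rfl

theorem norm_sum_range_periodic_sub_le (g : ℕ → ℂ) (q : ℕ) (hq : 0 < q) (hg : ∀ n, ‖g n‖ ≤ 1)
    (hper : ∀ n, g (n + q) = g n) (n : ℕ) :
    ‖∑ k ∈ range n, g k - (∑ k ∈ range q, g k) / q * n‖ ≤ 2 * q := by
  have hS : ∀ m, ‖∑ k ∈ range m, g k‖ ≤ m := fun m =>
    (norm_sum_le _ _).trans ((sum_le_sum fun k _ => hg k).trans (by simp))
  have hqc : (q : ℂ) ≠ 0 := by exact_mod_cast hq.ne'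
  induction n using Nat.strong_induction_on with
  | _ n ih =>
    by_cases h : n < q
    · have h1 := hS n
      have h2 : ‖(∑ k ∈ range q, g k) / q * n‖ ≤ n := by
        rw [norm_mul, norm_div, norm_natCast, norm_natCast]
        have : ‖∑ k ∈ range q, g k‖ / q ≤ 1 := by
          rw [div_le_one (by exact_mod_cast hq)]; exact hS q
        nlinarith [(Nat.cast_nonneg n : (0:ℝ) ≤ n)]
      have h3 : (n : ℝ) ≤ q := by exact_mod_cast h.le
      exact (norm_sub_le _ _).trans (by linarith)
    · push Not at h
      have := ih (n - q) (by omega)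
      have e : ∑ k ∈ range n, g k = ∑ k ∈ range q, g k + ∑ k ∈ range (n - q), g k := by
        conv_lhs => rw [show n = q + (n - q) by omega, sum_range_add]
        congr 1
        exact sum_congr rfl fun k _ => by rw [add_comm, hper]
      rw [e]
      convert this using 2
      rw [Nat.cast_sub h]
      field_simp
      ring

/-- The function `(s - 1) L(s, χ)`, with the singularity at `s = 1` removed. -/
def polefree {q : ℕ} [NeZero q] (χ : DirichletCharacter ℂ q) (s : ℂ) : ℂ :=
  if χ = 1 then DirichletCharacter.LFunctionTrivChar₁ q s else (s - 1) * LFunction χ s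

theorem differentiable_polefree {q : ℕ} [NeZero q] (χ : DirichletCharacter ℂ q) :
    Differentiable ℂ (polefree χ) := by
  unfold polefree
  by_cases h : χ = 1
  · simpa only [h, if_true] using DirichletCharacter.differentiable_LFunctionTrivChar₁ q
  · simp only [h, if_false]
    have := differentiable_LFunction h
    fun_prop

theorem polefree_eq {q : ℕ} [NeZero q] (χ : DirichletCharacter ℂ q) {s : ℂ} (hs : s ≠ 1) :
    polefree χ s = (s - 1) * LFunction χ s := by
  unfold polefree
  split_ifs with h
  · simp [DirichletCharacter.LFunctionTrivChar₁, hs, h, LFunctionTrivChar]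
  · rfl

theorem sum_Icc_rpow_neg_le {η : ℝ} (hη : 0 < η) (X : ℕ) (hX : 1 ≤ X) :
    ∑ n ∈ Icc 1 X, (n : ℝ) ^ (η - 1) ≤ (1 + 1 / η) * (X : ℝ) ^ (2 * η) := by
  have hX0 : (1 : ℝ) ≤ X := by exact_mod_cast hX
  have h1 : ∑ n ∈ Icc 1 X, (n : ℝ) ^ (η - 1) ≤ ∑ n ∈ Icc 1 X, (X : ℝ) ^ η * (n : ℝ)⁻¹ := by
    refine sum_le_sum fun n hn => ?_
    have hn := mem_Icc.1 hn
    have hn0 : (0 : ℝ) < n := by exact_mod_cast hn.1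
    rw [Real.rpow_sub_one hn0.ne', div_eq_mul_inv]
    gcongr
    exact hn.2
  have h2 : ∑ n ∈ Icc 1 X, (n : ℝ)⁻¹ ≤ 1 + log X := by
    have := harmonic_le_one_add_log X
    rw [harmonic_eq_sum_Icc] at this
    simpa using this
  have h3 := Real.log_le_rpow_div (by linarith : (0:ℝ) ≤ X) hη
  have h4 : 1 ≤ (X : ℝ) ^ η := Real.one_le_rpow hX0 hη.le
  rw [← mul_sum] at h1
  refine h1.trans ?_
  rw [two_mul, Real.rpow_add (by linarith)]
  have h5 : 1 + log X ≤ (1 + 1 / η) * (X : ℝ) ^ η := by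
    have : (1 + 1 / η) * (X : ℝ) ^ η = (X : ℝ) ^ η + (X : ℝ) ^ η / η := by ring
    linarith
  calc (X : ℝ) ^ η * ∑ n ∈ Icc 1 X, (n : ℝ)⁻¹ ≤ (X : ℝ) ^ η * ((1 + 1 / η) * (X : ℝ) ^ η) := by
        gcongr; linarith
    _ = _ := by ring

theorem norm_polefree_sub_le {q : ℕ} [NeZero q] (χ : DirichletCharacter ℂ q) (X : ℕ) (hX : 1 ≤ X) :
    ∃ a : ℂ, ‖a‖ ≤ 1 ∧ (χ ≠ 1 → a = 0) ∧ ∀ s : ℂ, 0 < s.re →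
    ‖polefree χ s - (s - 1) * ∑ n ∈ Icc 1 X, χ (n : ZMod q) / (n : ℂ) ^ s - a * (X : ℂ) ^ (1 - s)‖ ≤
      ‖s - 1‖ * ‖s‖ * (5 * q * (X : ℝ) ^ (-s.re) / s.re) := by
  have hq : 0 < q := Nat.pos_of_ne_zero (NeZero.ne q)
  have hq1 : (1 : ℝ) ≤ q := by exact_mod_cast hq
  set g : ℕ → ℂ := fun n => χ ((n + 1 : ℕ) : ZMod q) with hg
  have hg1 : ∀ n, ‖g n‖ ≤ 1 := fun n => χ.norm_le_one _
  have hgper : ∀ n, g (n + q) = g n := by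
    intro n
    simp only [hg]
    congr 1
    push_cast
    simp
  set a : ℂ := (∑ k ∈ range q, g k) / q with ha
  have hsumq : ∑ k ∈ range q, g k = ∑ x : ZMod q, χ x := by
    have h0 : ∑ k ∈ range q, g k = ∑ k ∈ range q, χ (k : ZMod q) := by
      have h1 := sum_range_succ' (fun k : ℕ => χ (k : ZMod q)) q
      rw [sum_range_succ] at h1
      simp only [Nat.cast_zero, CharP.cast_eq_zero] at h1
      exact (add_right_cancel h1).symm
    rw [h0]
    refine sum_nbij' (fun k => (k : ZMod q)) (fun x => x.val) ?_ ?_ ?_ ?_ ?_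
    · intro k _; exact mem_univ _
    · intro x _; exact mem_range.2 (ZMod.val_lt x)
    · intro k hk; exact ZMod.val_cast_of_lt (mem_range.1 hk)
    · intro x _; exact ZMod.natCast_zmod_val x
    · intro k _; rfl
  have hIcc : ∀ n : ℕ, ∑ k ∈ Icc 1 n, χ (k : ZMod q) = ∑ k ∈ range n, g k := by
    intro n
    rw [range_eq_Ico, sum_Ico_add' (fun k : ℕ => χ (k : ZMod q)) 0 n 1]
    rfl
  have ha1 : ‖a‖ ≤ 1 := by
    rw [ha, norm_div, norm_natCast, div_le_one (by linarith)]
    exact (norm_sum_le _ _).trans ((sum_le_sum fun k _ => hg1 k).trans (by simp))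
  refine ⟨a, ha1, ?_, ?_⟩
  · intro h
    rw [ha, hsumq, MulChar.sum_eq_zero_of_ne_one h, zero_div]
  intro s hs
  set f : ℕ → ℂ := fun n => if n ≤ X then 0 else χ (n : ZMod q) with hfdef
  have hsplit : ∀ n, ∑ k ∈ Icc 1 n, f k = if n ≤ X then 0 else
      ∑ k ∈ range n, g k - ∑ k ∈ range X, g k := by
    intro n
    split_ifs with h
    · refine sum_eq_zero fun k hk => ?_
      simp only [hfdef, if_pos ((mem_Icc.1 hk).2.trans h)]
    · rw [← hIcc, ← hIcc]
      have : ∑ k ∈ Icc 1 X, χ (k : ZMod q) = ∑ k ∈ Icc 1 n, if k ≤ X then χ (k : ZMod q) else 0 := by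
        rw [← sum_filter]
        refine sum_congr ?_ fun _ _ => rfl
        ext k; simp only [mem_Icc, mem_filter]; omega
      rw [this, ← sum_sub_distrib]
      refine sum_congr rfl fun k _ => ?_
      simp only [hfdef]
      split_ifs <;> simp
  have hXc : (X : ℂ) ≠ 0 := by exact_mod_cast (by omega : X ≠ 0)
  have hHdiff : Differentiable ℂ (fun s : ℂ => polefree χ s - (s - 1) * ∑ n ∈ Icc 1 X, χ (n : ZMod q) / (n : ℂ) ^ s) := by
    refine (differentiable_polefree χ).sub ((by fun_prop : Differentiable ℂ fun s : ℂ => s - 1).mul ?_)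
    refine Differentiable.fun_sum fun n hn => ?_
    have hn0 : (n : ℂ) ≠ 0 := by exact_mod_cast (by have := (mem_Icc.1 hn).1; omega : n ≠ 0)
    refine Differentiable.div (by fun_prop) ?_ ?_
    · exact fun z => DifferentiableAt.const_cpow (by fun_prop) (Or.inl hn0)
    · intro z; simp [Complex.cpow_eq_zero_iff, hn0]
  have key := hyper_aux f X hX a (5 * q) ?_ ?_ ?_
    (fun s : ℂ => polefree χ s - (s - 1) * ∑ n ∈ Icc 1 X, χ (n : ZMod q) / (n : ℂ) ^ s)
    hHdiff.differentiableOn ?_ s hs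
  · exact key
  · intro n
    simp only [hfdef]
    split_ifs
    · simp
    · exact χ.norm_le_one _
  · intro n hn; simp only [hfdef, if_pos hn]
  · intro t ht
    have ht0 : 0 ≤ t := le_trans (by positivity) ht
    have hfl : X ≤ ⌊t⌋₊ := Nat.le_floor ht
    have e1 : ∑ k ∈ Icc 1 ⌊t⌋₊, f k = ∑ k ∈ range ⌊t⌋₊, g k - ∑ k ∈ range X, g k := by
      rw [hsplit]
      split_ifs with h
      · rw [le_antisymm h hfl]; simp
      · rfl
    have b1 := norm_sum_range_periodic_sub_le g q hq hg1 hgper ⌊t⌋₊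
    have b2 := norm_sum_range_periodic_sub_le g q hq hg1 hgper X
    have b3 : ‖a * ((⌊t⌋₊ : ℂ) - t)‖ ≤ 1 := by
      rw [norm_mul]
      have : ‖((⌊t⌋₊ : ℂ) - t)‖ ≤ 1 := by
        rw [show ((⌊t⌋₊ : ℂ) - t) = (((⌊t⌋₊ : ℝ) - t : ℝ) : ℂ) by push_cast; rfl, norm_real,
          norm_eq_abs, abs_le]
        constructor <;> linarith [Nat.floor_le ht0, Nat.lt_floor_add_one t]
      calc _ ≤ (1:ℝ) * 1 := mul_le_mul ha1 this (norm_nonneg _) zero_le_one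
        _ = 1 := one_mul _
    have e2 : ∑ k ∈ Icc 1 ⌊t⌋₊, f k - a * ((t : ℂ) - X) = (∑ k ∈ range ⌊t⌋₊, g k - a * ⌊t⌋₊)
      - (∑ k ∈ range X, g k - a * X) + a * ((⌊t⌋₊ : ℂ) - t) := by rw [e1]; ring
    rw [e2]
    refine (norm_add_le _ _).trans ?_
    have := norm_sub_le (∑ k ∈ range ⌊t⌋₊, g k - a * ⌊t⌋₊) (∑ k ∈ range X, g k - a * X)
    linarith
  · intro z hz
    have hz1 : z ≠ 1 := fun h => by rw [h] at hz; simp at hz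
    have hz0 : z ≠ 0 := fun h => by rw [h] at hz; simp at hz; linarith
    rw [polefree_eq χ hz1, LFunction_eq_LSeries χ hz, ← mul_sub]
    congr 1
    have hsum : LSeriesSummable (fun n => χ (n : ZMod q)) z :=
      LSeriesSummable_of_bounded_of_one_lt_re (m := 1) (fun n _ => χ.norm_le_one _) hz
    have e3 : ∑ n ∈ Icc 1 X, χ (n : ZMod q) / (n : ℂ) ^ z = LSeries (fun n => if n ≤ X then χ (n : ZMod q) else 0) z := by
      rw [LSeries, tsum_eq_sum (s := Icc 1 X)]
      · refine sum_congr rfl fun n hn => ?_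
        have := mem_Icc.1 hn
        rw [LSeries.term_of_ne_zero (by omega), if_pos this.2]
      · intro n hn
        rcases Nat.eq_zero_or_pos n with h | h
        · simp [h]
        · rw [LSeries.term_of_ne_zero h.ne', if_neg, zero_div]
          intro h2; exact hn (mem_Icc.2 ⟨h, h2⟩)
    have hsum2 : LSeriesSummable (fun n => if n ≤ X then χ (n : ZMod q) else 0) z := by
      refine LSeriesSummable_of_bounded_of_one_lt_re (m := 1) (fun n _ => ?_) hz
      split_ifs
      · exact χ.norm_le_one _
      · simp
    rw [e3, ← LSeries_sub hsum hsum2]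
    congr 1
    ext n
    simp only [hfdef, Pi.sub_apply]
    split_ifs <;> simp

theorem norm_polefree_le {η : ℝ} (hη : 0 < η) (hη2 : η ≤ 1 / 2) : ∃ C : ℝ, 1 ≤ C ∧
    ∀ (q : ℕ) [NeZero q] (χ : DirichletCharacter ℂ q) (s : ℂ), 1 - η ≤ s.re → s.re ≤ 4 →
      ‖polefree χ s‖ ≤ C * (q * (|s.im| + 2)) ^ (2 * η) * (‖s - 1‖ + if χ = 1 then 1 else 0) := by
  have hη1 : 0 < 1 / η := by positivity
  refine ⟨2 * (31 + 1 / η), by linarith, ?_⟩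
  intro q _ χ s hs1 hs2
  have hq : 0 < q := Nat.pos_of_ne_zero (NeZero.ne q)
  have hq1 : (1 : ℝ) ≤ q := by exact_mod_cast hq
  set Q : ℝ := q * (|s.im| + 2) with hQ
  have hQ2 : 2 ≤ Q := by nlinarith [abs_nonneg s.im]
  set X := ⌈Q⌉₊ with hXdef
  have hX1 : Q ≤ X := Nat.le_ceil _
  have hX2 : (X : ℝ) ≤ 2 * Q := by linarith [Nat.ceil_lt_add_one (by linarith : 0 ≤ Q)]
  have hX0 : (1 : ℝ) ≤ X := by linarith
  have hX : 1 ≤ X := by exact_mod_cast hX0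
  obtain ⟨a, ha, ha0, hmain⟩ := norm_polefree_sub_le χ X hX
  have hσ : 0 < s.re := by linarith
  have h := hmain s hσ
  have hXe : (X : ℝ) ^ (2 * η) ≤ 2 * Q ^ (2 * η) := by
    calc (X : ℝ) ^ (2 * η) ≤ (2 * Q) ^ (2 * η) := Real.rpow_le_rpow (by linarith) hX2 (by linarith)
      _ = 2 ^ (2 * η) * Q ^ (2 * η) := mul_rpow (by norm_num) (by linarith)
      _ ≤ _ := by
        gcongr
        calc (2 : ℝ) ^ (2 * η) ≤ 2 ^ (1 : ℝ) := Real.rpow_le_rpow_of_exponent_le (by norm_num) (by linarith)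
          _ = 2 := Real.rpow_one 2
  have hsum : ‖∑ n ∈ Icc 1 X, χ (n : ZMod q) / (n : ℂ) ^ s‖ ≤ (1 + 1 / η) * (X : ℝ) ^ (2 * η) := by
    refine (norm_sum_le _ _).trans (le_trans (sum_le_sum fun n hn => ?_) (sum_Icc_rpow_neg_le hη X hX))
    have hn0 : 0 < n := (mem_Icc.1 hn).1
    have hn1 : (1 : ℝ) ≤ n := by exact_mod_cast hn0
    rw [norm_div, Complex.norm_natCast_cpow_of_pos hn0]
    calc _ ≤ 1 / (n : ℝ) ^ s.re := by gcongr; exact χ.norm_le_one _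
      _ = (n : ℝ) ^ (-s.re) := by rw [rpow_neg (by linarith), one_div]
      _ ≤ _ := Real.rpow_le_rpow_of_exponent_le hn1 (by linarith)
  have ha2 : ‖a * (X : ℂ) ^ (1 - s)‖ ≤ (if χ = 1 then 1 else 0) * (X : ℝ) ^ (2 * η) := by
    split_ifs with h1
    · rw [norm_mul, Complex.norm_natCast_cpow_of_pos (by omega)]
      refine mul_le_mul ha (Real.rpow_le_rpow_of_exponent_le hX0 ?_) (by positivity) zero_le_one
      simp; linarith
    · rw [ha0 h1]; simp
  have hsn : ‖s‖ ≤ 2 * (|s.im| + 2) := by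
    have := Complex.norm_le_abs_re_add_abs_im s
    rw [abs_of_pos hσ] at this
    linarith [abs_nonneg s.im]
  have h3 : ‖s‖ * (5 * q * (X : ℝ) ^ (-s.re) / s.re) ≤ 20 * (X : ℝ) ^ (2 * η) := by
    have e1 : (X : ℝ) ^ (1 - s.re) ≤ (X : ℝ) ^ (2 * η) :=
      Real.rpow_le_rpow_of_exponent_le hX0 (by linarith)
    have e2 : (X : ℝ) ^ (1 - s.re) = X * (X : ℝ) ^ (-s.re) := by
      rw [sub_eq_add_neg, Real.rpow_add (by linarith), Real.rpow_one]
    have e3 : ‖s‖ * q ≤ 2 * X := by nlinarith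
    have e5 : 0 ≤ (X : ℝ) ^ (-s.re) := by positivity
    rw [mul_div_assoc', div_le_iff₀ hσ]
    have e6 : ‖s‖ * (5 * q * (X : ℝ) ^ (-s.re)) ≤ 10 * (X : ℝ) ^ (1 - s.re) := by
      rw [e2]; nlinarith
    have e7 : 0 ≤ (X : ℝ) ^ (2 * η) := by positivity
    nlinarith
  have h4 : polefree χ s = (polefree χ s - (s - 1) * ∑ n ∈ Icc 1 X, χ (n : ZMod q) / (n : ℂ) ^ s
      - a * (X : ℂ) ^ (1 - s)) + (s - 1) * ∑ n ∈ Icc 1 X, χ (n : ZMod q) / (n : ℂ) ^ s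
      + a * (X : ℂ) ^ (1 - s) := by ring
  have h5 := norm_add₃_le (a := polefree χ s - (s - 1) * ∑ n ∈ Icc 1 X, χ (n : ZMod q) / (n : ℂ) ^ s
      - a * (X : ℂ) ^ (1 - s)) (b := (s - 1) * ∑ n ∈ Icc 1 X, χ (n : ZMod q) / (n : ℂ) ^ s)
      (c := a * (X : ℂ) ^ (1 - s))
  rw [← h4, norm_mul (s - 1)] at h5
  have h6 : 0 ≤ ‖s - 1‖ := norm_nonneg _
  have h7 : 0 ≤ (X : ℝ) ^ (2 * η) := by positivity
  set δ : ℝ := if χ = 1 then 1 else 0 with hδ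
  have hδ0 : 0 ≤ δ := by rw [hδ]; split_ifs <;> norm_num
  have h8 : ‖polefree χ s‖ ≤ (31 + 1 / η) * (X : ℝ) ^ (2 * η) * (‖s - 1‖ + δ) := by
    have i1 := mul_le_mul_of_nonneg_left h3 h6
    have i2 := mul_le_mul_of_nonneg_left hsum h6
    rw [← mul_assoc] at i1
    have i3 : 0 ≤ δ * (X : ℝ) ^ (2 * η) := by positivity
    have i4 : 0 ≤ 1 / η * (δ * (X : ℝ) ^ (2 * η)) := by positivity
    have i5 : 0 ≤ ‖s - 1‖ * (X : ℝ) ^ (2 * η) := by positivity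
    nlinarith
  refine h8.trans ?_
  have : (31 + 1 / η) * (X : ℝ) ^ (2 * η) ≤ 2 * (31 + 1 / η) * Q ^ (2 * η) := by nlinarith
  gcongr

/-- Bound for `L(s, χ)` itself, `χ` nontrivial. -/
theorem norm_LFunction_le {η : ℝ} (hη : 0 < η) (hη2 : η ≤ 1 / 2) : ∃ C : ℝ, 1 ≤ C ∧
    ∀ (q : ℕ) [NeZero q] (χ : DirichletCharacter ℂ q) (s : ℂ), χ ≠ 1 → 1 - η ≤ s.re → s.re ≤ 4 →
      ‖LFunction χ s‖ ≤ C * (q * (|s.im| + 2)) ^ (2 * η) := by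
  obtain ⟨C, hC, h⟩ := norm_polefree_le hη hη2
  refine ⟨C, hC, ?_⟩
  intro q _ χ s hχ h1 h2
  have key : ∀ s : ℂ, s ≠ 1 → 1 - η ≤ s.re → s.re ≤ 4 →
      ‖LFunction χ s‖ ≤ C * (q * (|s.im| + 2)) ^ (2 * η) := by
    intro s hs h1 h2
    have := h q χ s h1 h2
    rw [polefree_eq χ hs, norm_mul, if_neg hχ, add_zero, mul_comm] at this
    exact le_of_mul_le_mul_right this (norm_pos_iff.2 (sub_ne_zero.2 hs))
  by_cases hs : s = 1
  · have hcont := (differentiable_LFunction hχ).continuous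
    have ht : Filter.Tendsto (fun x : ℝ => ‖LFunction χ (x : ℂ)‖)
        (nhdsWithin 1 (Set.Ioi 1)) (nhds ‖LFunction χ s‖) := by
      have : Continuous fun x : ℝ => ‖LFunction χ (x : ℂ)‖ := by fun_prop
      have := (this.tendsto 1).mono_left (nhdsWithin_le_nhds (s := Set.Ioi 1))
      simpa [hs] using this
    refine le_of_tendsto ht ?_
    filter_upwards [Ioo_mem_nhdsGT (show (1:ℝ) < 2 by norm_num)] with x hx
    have := key x (by exact_mod_cast hx.1.ne') (by simp; linarith [hx.1]) (by simp; linarith [hx.2])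
    simpa [hs] using this
  · exact key s hs h1 h2

theorem norm_iteratedDeriv_logDeriv_le (F : ℂ → ℂ) (hF : Differentiable ℂ F) (s₀ : ℂ) {R M m : ℝ}
    (hR : 0 < R) (hm : 0 < m) (hM : ∀ z, ‖z - s₀‖ < R → ‖F z‖ ≤ M) (hs : m ≤ ‖F s₀‖) (k : ℕ) :
    ‖iteratedDeriv k (fun s => deriv F s / F s) s₀‖ ≤ k.factorial * (8 * M / (R * m)) ^ (k + 1) := by
  have hmM : m ≤ M := hs.trans (hM s₀ (by simpa using hR))
  have hM0 : 0 < M := hm.trans_le hmM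
  have hd : ∀ z, ‖z - s₀‖ < R / 2 → ‖deriv F z‖ ≤ M / (R / 2) := by
    intro z hz
    refine Complex.norm_deriv_le_of_forall_mem_sphere_norm_le (by linarith) hF.diffContOnCl ?_
    intro w hw
    refine hM w ?_
    rw [mem_sphere_iff_norm] at hw
    have := norm_add_le (w - z) (z - s₀)
    rw [sub_add_sub_cancel] at this
    linarith
  set r : ℝ := m * R / (8 * M) with hr
  have hr0 : 0 < r := by positivity
  have hrR : r < R / 2 := by
    rw [hr, div_lt_iff₀ (by positivity)]; nlinarith
  have hFl : ∀ z, ‖z - s₀‖ ≤ r → m / 2 ≤ ‖F z‖ := by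
    intro z hz
    have h1 : ‖F z - F s₀‖ ≤ M / (R / 2) * ‖z - s₀‖ := by
      refine (convex_ball s₀ (R / 2)).norm_image_sub_le_of_norm_deriv_le
        (fun x _ => hF x) (fun x hx => hd x (mem_ball_iff_norm.1 hx)) (Metric.mem_ball_self (by linarith))
        (mem_ball_iff_norm.2 (hz.trans_lt hrR))
    have h2 : M / (R / 2) * ‖z - s₀‖ ≤ M / (R / 2) * r := by gcongr
    have h3 : M / (R / 2) * r = m / 4 := by rw [hr]; field_simp; norm_num
    have h4 := norm_sub_norm_le (F s₀) (F z)
    rw [norm_sub_rev] at h4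
    linarith
  have hq : ∀ z ∈ Metric.sphere s₀ r, ‖deriv F z / F z‖ ≤ 4 * M / (R * m) := by
    intro z hz
    rw [mem_sphere_iff_norm] at hz
    have h1 := hFl z hz.le
    have h2 := hd z (by linarith)
    rw [norm_div]
    calc _ ≤ M / (R / 2) / (m / 2) := by gcongr
      _ = _ := by field_simp; norm_num
  have hFne : ∀ z ∈ Metric.closedBall s₀ r, F z ≠ 0 := by
    intro z hz h0
    have := hFl z (mem_closedBall_iff_norm.1 hz)
    rw [h0, norm_zero] at this
    linarith
  have hdc : DiffContOnCl ℂ (fun s => deriv F s / F s) (Metric.ball s₀ r) := by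
    refine DifferentiableOn.diffContOnCl_ball (U := Metric.closedBall s₀ r) ?_ subset_rfl
    intro z hz
    have hd : Differentiable ℂ (deriv F) := by
      intro w
      exact (hF.analyticAt w).deriv.differentiableAt
    exact ((hd z).div (hF z) (hFne z hz)).differentiableWithinAt
  refine (Complex.norm_iteratedDeriv_le_of_forall_mem_sphere_norm_le k hr0 hdc hq).trans ?_
  have e : k.factorial * (4 * M / (R * m)) / r ^ k = k.factorial * (4 * M / (R * m)) * (8 * M / (R * m)) ^ k := by
    rw [hr, div_eq_mul_inv, ← inv_pow, inv_div]; ring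
  rw [e, pow_succ, mul_assoc, mul_comm (4 * M / (R * m))]
  have h4 : 4 * M / (R * m) ≤ 8 * M / (R * m) := by gcongr; norm_num
  gcongr

theorem norm_LFunction_le_of_one_lt {q : ℕ} [NeZero q] (χ : DirichletCharacter ℂ q) (s : ℂ)
    (hs : 1 < s.re) (hs2 : s.re ≤ 2) : ‖LFunction χ s‖ ≤ 7 / (s.re - 1) := by
  have hsum : ∀ {q : ℕ} (χ : DirichletCharacter ℂ q) (s : ℂ), 1 < s.re →
      LSeriesSummable (fun n => χ (n : ZMod q)) s := fun χ s hs =>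
    LSeriesSummable_of_bounded_of_one_lt_re (m := 1) (fun n _ => χ.norm_le_one _) hs
  have h1 : ‖LFunction χ s‖ ≤
      ‖LFunction (N := 1) 1 (s.re : ℂ)‖ := by
    rw [LFunction_eq_LSeries χ hs, LFunction_eq_LSeries _ (by simpa using hs)]
    have h2 : ∀ n, LSeries.term (fun n => (1 : DirichletCharacter ℂ 1) (n : ZMod 1)) (s.re : ℂ) n
        = ((if n = 0 then 0 else (n : ℝ) ^ (-s.re) : ℝ) : ℂ) := by
      intro n
      rcases eq_or_ne n 0 with h | h
      · simp [h]
      · rw [LSeries.term_of_ne_zero h, if_neg h, Subsingleton.elim (n : ZMod 1) 1, map_one,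
          rpow_neg (by positivity), Complex.ofReal_inv, Complex.ofReal_cpow (by positivity), one_div]
        simp
    have hS := hsum (1 : DirichletCharacter ℂ 1) (s.re : ℂ) (by simpa using hs)
    unfold LSeriesSummable at hS
    unfold LSeries
    rw [show LSeries.term (fun n => (1 : DirichletCharacter ℂ 1) (n : ZMod 1)) (s.re : ℂ) = _ from funext h2] at hS ⊢
    rw [← Complex.ofReal_tsum, norm_real]
    rw [Complex.summable_ofReal] at hS
    refine (tsum_of_norm_bounded hS.hasSum fun n => ?_).trans (le_abs_self _)
    rcases eq_or_ne n 0 with h | h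
    · simp [h]
    · rw [LSeries.term_of_ne_zero h, if_neg h, norm_div, Complex.norm_natCast_cpow_of_pos (by omega),
        rpow_neg (by positivity), ← one_div]
      gcongr
      exact χ.norm_le_one _
  refine h1.trans ?_
  have hx : 0 < s.re - 1 := by linarith
  have hne : (s.re : ℂ) ≠ 1 := by
    intro h; have := congrArg Complex.re h; simp at this; linarith
  obtain ⟨a, ha, -, h3⟩ := norm_polefree_sub_le (1 : DirichletCharacter ℂ 1) 1 le_rfl
  have h4 := h3 (s.re : ℂ) (by simp; linarith)
  rw [polefree_eq _ hne] at h4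
  have h5 : ‖((s.re : ℂ) - 1)‖ = s.re - 1 := by
    rw [← Complex.ofReal_one, ← ofReal_sub, norm_real, norm_of_nonneg hx.le]
  rw [le_div_iff₀ hx, mul_comm, ← h5, ← norm_mul]
  simp only [Icc_self, sum_singleton, Nat.cast_one, Complex.one_cpow, div_one, mul_one, map_one,
    Real.one_rpow, ofReal_re] at h4
  rw [h5, norm_real, norm_of_nonneg (by linarith : (0:ℝ) ≤ s.re)] at h4
  have h6 : (s.re - 1) * s.re * (5 / s.re) = 5 * (s.re - 1) := by
    have : s.re ≠ 0 := by linarith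
    field_simp
  rw [h6] at h4
  set w := ((s.re : ℂ) - 1) * LFunction (N := 1) 1 (s.re : ℂ)
  have h7 : w = (w - ((s.re : ℂ) - 1) - a) + ((s.re : ℂ) - 1) + a := by ring
  have h8 := norm_add₃_le (a := w - ((s.re : ℂ) - 1) - a) (b := ((s.re : ℂ) - 1)) (c := a)
  rw [← h7, h5] at h8
  linarith

theorem LFunction_pow_four_ge {q : ℕ} [NeZero q] (χ : DirichletCharacter ℂ q) {x : ℝ} (hx : 0 < x)
    (hx1 : x ≤ 1) (t W : ℝ)
    (hW : ‖LFunction (χ ^ 2) (1 + x + 2 * I * t)‖ ≤ W) :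
    x ^ 3 / (343 * W) ≤ ‖LFunction χ (1 + x + I * t)‖ ^ 4 := by
  have h := DirichletCharacter.norm_LFunction_product_ge_one χ hx t
  rw [norm_mul, norm_mul, norm_pow, norm_pow] at h
  have h1 := norm_LFunction_le_of_one_lt (1 : DirichletCharacter ℂ q) (1 + x : ℂ) (by simpa using hx)
    (by simp; linarith)
  have h2 : ‖LFunctionTrivChar q (1 + x)‖ ≤ 7 / x := by simpa using h1
  set u := ‖LFunction χ (1 + x + I * t)‖ ^ 4 with hu
  have hu0 : 0 ≤ u := by positivity
  set w := ‖LFunction (χ ^ 2) (1 + x + 2 * I * t)‖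
  have h3 : (1 : ℝ) ≤ (7 / x) ^ 3 * u * W := by
    refine ge_iff_le.1 h |>.trans ?_
    have : 0 ≤ w := norm_nonneg _
    gcongr
  have hWpos : 0 < W := by
    by_contra hW0
    push Not at hW0
    have : (7 / x) ^ 3 * u * W ≤ 0 := mul_nonpos_of_nonneg_of_nonpos (by positivity) hW0
    linarith
  rw [div_le_iff₀ (by positivity)]
  rw [div_pow] at h3
  have : 7 ^ 3 / x ^ 3 * u * W = (u * (343 * W)) / x ^ 3 := by ring
  rw [this, le_div_iff₀ (by positivity)] at h3
  linarith

theorem LFunction_lower_of_bounds {q : ℕ} [NeZero q] (χ : DirichletCharacter ℂ q) (t W : ℝ) (hχ : χ ≠ 1 ∨ t ≠ 0)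
    (hW1 : 1 ≤ W)
    (hW : ∀ x : ℝ, 0 < x → x ≤ 1 → ‖LFunction (χ ^ 2) (1 + x + 2 * I * t)‖ ≤ W)
    (hd : ∀ x : ℝ, 0 ≤ x → x ≤ 1 → ‖deriv (LFunction χ) (1 + x + I * t)‖ ≤ W)
    (x : ℝ) (hx : 0 < x) (hx1 : x ≤ 1) :
    1 / (5488 * W ^ 4) ≤ ‖LFunction χ (1 + x + I * t)‖ := by
  set δ : ℝ := 1 / (5488 * W ^ 5) with hδ
  have hδ0 : 0 < δ := by positivity
  have hW5 : 1 ≤ W ^ 5 := one_le_pow₀ hW1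
  have hδ1 : δ ≤ 1 := by rw [hδ, div_le_one (by positivity)]; linarith
  have hδW : δ * W = 1 / (5488 * W ^ 4) := by rw [hδ]; field_simp
  have big : ∀ y : ℝ, δ ≤ y → y ≤ 1 → 2 * (δ * W) ≤
      ‖LFunction χ (1 + y + I * t)‖ := by
    intro y hy hy1
    have h := LFunction_pow_four_ge χ (hδ0.trans_le hy) hy1 t W (hW y (hδ0.trans_le hy) hy1)
    have h1 : (2 * (δ * W)) ^ 4 ≤ y ^ 3 / (343 * W) := by
      calc (2 * (δ * W)) ^ 4 = δ ^ 3 / (343 * W) * (5488 * W ^ 5 * δ) := by field_simp; ring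
        _ = δ ^ 3 / (343 * W) := by
            rw [show 5488 * W ^ 5 * δ = 1 by rw [hδ]; field_simp, mul_one]
        _ ≤ _ := by gcongr
    exact le_of_pow_le_pow_left₀ (by norm_num) (norm_nonneg _) (h1.trans h)
  have hδWpos : 0 < δ * W := by positivity
  rw [← hδW]
  by_cases hxδ : δ ≤ x
  · linarith [big x hxδ hx1]
  · push Not at hxδ
    have h1 := big δ le_rfl hδ1
    set g : ℝ → ℂ := fun y => LFunction χ (1 + y + I * t) with hg
    have hgd : ∀ y : ℝ, HasDerivAt g (deriv (LFunction χ) (1 + y + I * t)) y := by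
      intro y
      have hL := (DirichletCharacter.differentiableAt_LFunction χ (1 + y + I * t) (by
        rcases hχ with h | h
        · exact Or.inr h
        · left; intro h'; have := congrArg Complex.im h'; simp at this; exact h this)).hasDerivAt
      have hc : HasDerivAt (fun y : ℝ => (1 + (y : ℂ) + I * t)) 1 y := by
        simpa using ((Complex.ofRealCLM.hasDerivAt (x := y)).const_add (1:ℂ)).add_const (I * t)
      have := hL.comp y hc
      rw [mul_one] at this
      exact this
    have h2 : ‖g x - g δ‖ ≤ W * ‖x - δ‖ := by
      refine (convex_Icc (0:ℝ) 1).norm_image_sub_le_of_norm_hasDerivWithin_le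
        (fun y _ => (hgd y).hasDerivWithinAt) (fun y hy => hd y hy.1 hy.2) ⟨hδ0.le, hδ1⟩ ⟨hx.le, hx1⟩
    have h3 : ‖x - δ‖ ≤ δ := by rw [norm_eq_abs, abs_le]; constructor <;> linarith
    have h4 : ‖g δ‖ - ‖g x‖ ≤ ‖g x - g δ‖ := by rw [norm_sub_rev]; exact norm_sub_norm_le _ _
    have h5 : W * ‖x - δ‖ ≤ W * δ := by gcongr
    have h6 : 2 * (δ * W) ≤ ‖g δ‖ := h1
    change δ * W ≤ ‖g x‖
    linarith

open scoped ComplexOrder in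
theorem iteratedDeriv_alternating_of_deriv_eq (P : ℕ → ℂ) (hP : 0 ≤ P) (f : ℂ → ℂ)
    (hPs : ∀ s : ℂ, 1 < s.re → LSeriesSummable P s)
    (hf : ∀ s : ℂ, 1 < s.re → DifferentiableAt ℂ f s)
    (hfP : ∀ s : ℂ, 1 < s.re → deriv f s = -(LSeries P s * f s)) (h0 : 0 ≤ f 2) (m : ℕ) :
    0 ≤ (-1) ^ m * iteratedDeriv m f 2 := by
  have hopen : IsOpen {s : ℂ | 1 < s.re} := isOpen_lt continuous_const continuous_re
  have hmem : (2 : ℂ) ∈ {s : ℂ | 1 < s.re} := by simp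
  have habs : LSeries.abscissaOfAbsConv P < ((2 : ℝ) : EReal) := by
    have := (hPs (3/2 : ℝ) (by rw [ofReal_re]; norm_num)).abscissaOfAbsConv_le
    rw [ofReal_re] at this
    exact this.trans_lt (by exact_mod_cast (by norm_num : (3/2 : ℝ) < 2))
  have hPd : DifferentiableOn ℂ (LSeries P) {s : ℂ | 1 < s.re} := by
    intro s hs
    have hs' : 1 < s.re := hs
    have h1 := (hPs ((s.re + 1) / 2 : ℝ) (by rw [ofReal_re]; linarith)).abscissaOfAbsConv_le
    rw [ofReal_re] at h1
    exact (LSeries_hasDerivAt (h1.trans_lt (by exact_mod_cast (by linarith)))).differentiableAt.differentiableWithinAt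
  have hPc : ∀ n : ℕ, ContDiffAt ℂ n (LSeries P) 2 := fun n =>
    (hPd.analyticAt (hopen.mem_nhds hmem)).contDiffAt
  have hfo : DifferentiableOn ℂ f {s : ℂ | 1 < s.re} := fun s hs => (hf s hs).differentiableWithinAt
  have hfc : ∀ n : ℕ, ContDiffAt ℂ n f 2 := fun n => (hfo.analyticAt (hopen.mem_nhds hmem)).contDiffAt
  induction m using Nat.strong_induction_on with
  | _ m ih =>
    cases m with
    | zero => simpa using h0
    | succ m =>
      have e : deriv f =ᶠ[nhds 2] fun s => -(LSeries P s * f s) :=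
        Filter.eventually_of_mem (hopen.mem_nhds hmem) hfP
      rw [iteratedDeriv_succ', e.iteratedDeriv_eq, iteratedDeriv_fun_neg,
        iteratedDeriv_fun_mul (hPc m) (hfc m), pow_succ]
      have e2 : (-1 : ℂ) ^ m * -1 * -∑ i ∈ range (m + 1), (m.choose i : ℂ) *
          iteratedDeriv i (LSeries P) 2 * iteratedDeriv (m - i) f 2 =
          ∑ i ∈ range (m + 1), (m.choose i : ℂ) * ((-1) ^ i * iteratedDeriv i (LSeries P) 2) *
            ((-1) ^ (m - i) * iteratedDeriv (m - i) f 2) := by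
        rw [mul_assoc, neg_mul_neg, one_mul, mul_sum]
        refine sum_congr rfl fun i hi => ?_
        have : (-1 : ℂ) ^ m = (-1) ^ i * (-1) ^ (m - i) := by
          rw [← pow_add]; congr 1; have := mem_range.1 hi; omega
        rw [this]; ring
      rw [e2]
      refine sum_nonneg fun i hi => ?_
      refine mul_nonneg (mul_nonneg (by positivity) ?_) (ih (m - i) (by omega))
      have := LSeries.iteratedDeriv_alternating hP habs i
      simpa using this

theorem iteratedDeriv_inv_sub_one (m : ℕ) :
    iteratedDeriv m (fun s : ℂ => (s - 1)⁻¹) 2 = (-1) ^ m * m.factorial := by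
  rw [iteratedDeriv_comp_sub_const m (fun s : ℂ => s⁻¹) 1]
  simp only [iteratedDeriv_eq_iterate]
  have := iter_deriv_inv m ((2 : ℂ) - 1)
  rw [show (fun s : ℂ => s⁻¹) = Inv.inv from rfl, this]
  norm_num

open scoped ComplexOrder in
theorem estermann (P : ℕ → ℂ) (hP : 0 ≤ P) (G : ℂ → ℂ) (hG : Differentiable ℂ G)
    (hPs : ∀ s : ℂ, 1 < s.re → LSeriesSummable P s)
    (hfP : ∀ s : ℂ, 1 < s.re → deriv (fun s => G s / (s - 1)) s = -(LSeries P s * (G s / (s - 1))))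
    (c₀ M₀ : ℝ) (hc₀ : 0 ≤ c₀) (h0 : (c₀ : ℂ) ≤ G 2) (hM₀ : ∀ s : ℂ, ‖s - 2‖ ≤ 4 / 3 → ‖G s‖ ≤ M₀)
    (β : ℝ) (hβ : 5 / 6 ≤ β) (hβ1 : β < 1) (hGβ : 0 ≤ (G β).re) (M : ℕ) (hM : 1 ≤ M) :
    (1 - β) * (c₀ - 48 * M₀ * (7 / 8) ^ M) ≤ (G 1).re * (2 - β) ^ M := by
  have hMnn : 0 ≤ M₀ := (norm_nonneg _).trans (hM₀ 1 (by norm_num))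
  set f : ℂ → ℂ := fun s => G s / (s - 1) with hf
  set g : ℂ → ℂ := dslope G 1 with hg
  have hgd : Differentiable ℂ g := by
    intro s
    by_cases hs : s = 1
    · have := (Complex.differentiableOn_dslope (c := 1) (s := Set.univ) (f := G) Filter.univ_mem).2
        hG.differentiableOn
      exact (this s trivial).differentiableAt Filter.univ_mem
    · exact (differentiableAt_dslope_of_ne hs).2 (hG s)
  have hgs : ∀ s, s ≠ 1 → g s = f s - G 1 * (s - 1)⁻¹ := by
    intro s hs
    rw [hg, dslope_of_ne _ hs, slope_def_field, hf]
    have : s - 1 ≠ 0 := sub_ne_zero.2 hs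
    field_simp
  have hopen : IsOpen {s : ℂ | 1 < s.re} := isOpen_lt continuous_const continuous_re
  have hmem : (2 : ℂ) ∈ {s : ℂ | 1 < s.re} := by simp
  have hne : ∀ s : ℂ, 1 < s.re → s ≠ 1 := fun s hs h => by rw [h] at hs; simp at hs
  have hfd : ∀ s : ℂ, 1 < s.re → DifferentiableAt ℂ f s := fun s hs =>
    (hG s).div (by fun_prop) (sub_ne_zero.2 (hne s hs))
  have hf2 : 0 ≤ f 2 := by
    have h : (0 : ℂ) ≤ (c₀ : ℂ) := by exact_mod_cast hc₀
    have e : f 2 = G 2 := by simp only [hf]; norm_num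
    rw [e]; exact h.trans h0
  have hcm := iteratedDeriv_alternating_of_deriv_eq P hP f hPs hfd hfP hf2
  have hfo : DifferentiableOn ℂ f {s : ℂ | 1 < s.re} := fun s hs => (hfd s hs).differentiableWithinAt
  have hfc : ∀ n : ℕ, ContDiffAt ℂ n f 2 := fun n => (hfo.analyticAt (hopen.mem_nhds hmem)).contDiffAt
  have hdg : ∀ m : ℕ, iteratedDeriv m g 2 = iteratedDeriv m f 2 - G 1 * ((-1) ^ m * m.factorial) := by
    intro m
    have e : g =ᶠ[nhds 2] fun s => f s - G 1 * (s - 1)⁻¹ :=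
      Filter.eventually_of_mem (hopen.mem_nhds hmem) fun s hs => hgs s (hne s hs)
    have hinv : ContDiffAt ℂ m (fun s : ℂ => (s - 1)⁻¹) 2 :=
      ContDiffAt.inv (by fun_prop) (by norm_num)
    rw [e.iteratedDeriv_eq, iteratedDeriv_fun_sub (hfc m) (contDiffAt_const.mul hinv),
      iteratedDeriv_const_mul _ hinv, iteratedDeriv_inv_sub_one]
  set lam : ℝ := (G 1).re with hlam
  set c : ℕ → ℝ := fun m => ((-1) ^ m * iteratedDeriv m g 2 / m.factorial).re with hc
  have hc1 : ∀ m, c m = ((-1) ^ m * iteratedDeriv m f 2).re / m.factorial - lam := by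
    intro m
    have e1 : (-1 : ℂ) ^ m * (-1) ^ m = 1 := by rw [← mul_pow]; simp
    have hm : (m.factorial : ℂ) ≠ 0 := by exact_mod_cast m.factorial_ne_zero
    have e2 : (-1 : ℂ) ^ m * iteratedDeriv m g 2 / m.factorial =
        (-1) ^ m * iteratedDeriv m f 2 / m.factorial - G 1 := by
      rw [hdg]
      field_simp
      linear_combination (-(G 1) * m.factorial) * e1
    have e3 : c m = ((-1 : ℂ) ^ m * iteratedDeriv m g 2 / m.factorial).re := rfl
    rw [e3, e2, Complex.sub_re, Complex.div_natCast_re]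
  have hclow : ∀ m, -lam ≤ c m := by
    intro m
    rw [hc1]
    have := (Complex.nonneg_iff.1 (hcm m)).1
    have : 0 ≤ ((-1) ^ m * iteratedDeriv m f 2).re / m.factorial := by positivity
    linarith
  have hc0 : c₀ - lam ≤ c 0 := by
    rw [hc1]
    have e : f 2 = G 2 := by simp only [hf]; norm_num
    have := (Complex.le_def.1 h0).1
    rw [ofReal_re] at this
    simp [e]; linarith
  have hcb : ∀ m, |c m| ≤ 6 * M₀ * (3 / 4) ^ m := by
    intro m
    have hsph : ∀ z ∈ Metric.sphere (2 : ℂ) (4 / 3), ‖g z‖ ≤ 6 * M₀ := by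
      intro z hz
      rw [mem_sphere_iff_norm] at hz
      have h1 : 1 / 3 ≤ ‖z - 1‖ := by
        have := norm_sub_norm_le (z - 2) ((1 : ℂ) - 2)
        rw [sub_sub_sub_cancel_right, hz] at this
        norm_num at this; linarith
      have hz1 : z ≠ 1 := fun h => by rw [h] at h1; norm_num at h1
      rw [hg, dslope_of_ne _ hz1, slope_def_field, norm_div, div_le_iff₀ (by linarith)]
      have h2 := norm_sub_le (G z) (G 1)
      have h3 := hM₀ z hz.le
      have h4 := hM₀ 1 (by norm_num)
      nlinarith
    have h1 := Complex.norm_iteratedDeriv_le_of_forall_mem_sphere_norm_le m (by norm_num : (0:ℝ) < 4 / 3)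
      hgd.diffContOnCl hsph
    have hm : (0 : ℝ) < m.factorial := by exact_mod_cast m.factorial_pos
    refine (abs_re_le_norm _).trans ?_
    rw [norm_div, norm_mul, norm_pow, norm_neg, norm_one, one_pow, one_mul, norm_natCast,
      div_le_iff₀ hm]
    refine h1.trans (le_of_eq ?_)
    rw [div_eq_mul_inv, ← inv_pow, inv_div]; ring
  set u : ℝ := 2 - β with hu
  have hu1 : 1 < u := by linarith
  have hu2 : u ≤ 7 / 6 := by linarith
  have hsum : HasSum (fun m => c m * u ^ m) (g β).re := by
    have h := Complex.hasSum_re (Complex.hasSum_taylorSeries_of_entire hgd 2 β)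
    refine h.congr_fun ?_ |> fun h => h
    intro m
    simp only [hc, smul_eq_mul]
    rw [← Complex.re_mul_ofReal]
    congr 1
    have : ((β : ℂ) - 2) ^ m = (-1) ^ m * ((u ^ m : ℝ) : ℂ) := by
      rw [hu]; push_cast; rw [← mul_pow]; ring
    rw [this]; ring
  have hge : c₀ - lam * ∑ m ∈ range M, u ^ m - 48 * M₀ * (7 / 8) ^ M ≤ (g β).re := by
    rw [← hsum.tsum_eq, ← hsum.summable.sum_add_tsum_nat_add M]
    have h1 : c₀ - lam * ∑ m ∈ range M, u ^ m ≤ ∑ m ∈ range M, c m * u ^ m := by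
      obtain ⟨M', rfl⟩ : ∃ M', M = M' + 1 := ⟨M - 1, by omega⟩
      rw [sum_range_succ', sum_range_succ', mul_add]
      have : -(lam * ∑ k ∈ range M', u ^ (k + 1)) ≤ ∑ k ∈ range M', c (k + 1) * u ^ (k + 1) := by
        rw [mul_sum, ← sum_neg_distrib]
        refine sum_le_sum fun k _ => ?_
        rw [← neg_mul]
        exact mul_le_mul_of_nonneg_right (hclow _) (by positivity)
      simp only [pow_zero, mul_one]
      linarith
    have hgeo : HasSum (fun m : ℕ => 6 * M₀ * (7 / 8) ^ M * (7 / 8 : ℝ) ^ m) (48 * M₀ * (7 / 8) ^ M) := by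
      have := (hasSum_geometric_of_lt_one (by norm_num : (0:ℝ) ≤ 7 / 8) (by norm_num)).mul_left (6 * M₀ * (7 / 8) ^ M)
      have e : 6 * M₀ * (7 / 8) ^ M * (1 - 7 / 8 : ℝ)⁻¹ = 48 * M₀ * (7 / 8) ^ M := by
        rw [show (1 - 7 / 8 : ℝ)⁻¹ = 8 by norm_num]; ring
      rw [e] at this
      exact this
    have h2 : |∑' m, c (m + M) * u ^ (m + M)| ≤ 48 * M₀ * (7 / 8) ^ M := by
      rw [← norm_eq_abs]
      refine tsum_of_norm_bounded hgeo fun m => ?_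
      rw [norm_mul, norm_eq_abs, norm_of_nonneg (by positivity)]
      calc _ ≤ 6 * M₀ * (3 / 4) ^ (m + M) * (7 / 6) ^ (m + M) := by
            gcongr
            exact hcb _
        _ = 6 * M₀ * (7 / 8) ^ (m + M) := by rw [mul_assoc, ← mul_pow]; norm_num
        _ = _ := by rw [pow_add]; ring
    have := (abs_le.1 h2).1
    linarith
  have hgβ : (g β).re ≤ lam / (1 - β) := by
    have hβne : (β : ℂ) ≠ 1 := by exact_mod_cast hβ1.ne
    have hpos : 0 < 1 - β := by linarith
    rw [hg, dslope_of_ne _ hβne, slope_def_field]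
    have : (G β - G 1) / ((β : ℂ) - 1) = (G 1 - G β) / ((1 - β : ℝ) : ℂ) := by
      rw [← neg_div_neg_eq]; push_cast; ring
    rw [this, Complex.div_ofReal_re, Complex.sub_re]
    gcongr
    linarith
  have hgs : (∑ m ∈ range M, u ^ m) * (u - 1) = u ^ M - 1 := geom_sum_mul u M
  have hpos : 0 < 1 - β := by linarith
  have hfin := hge.trans hgβ
  rw [le_div_iff₀ hpos] at hfin
  have : u - 1 = 1 - β := by rw [hu]; ring
  rw [this] at hgs
  have : lam * u ^ M = lam + lam * ((∑ m ∈ range M, u ^ m) * (1 - β)) := by rw [hgs]; ring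
  rw [this]
  nlinarith

/-- `F` has the Dirichlet series `P` as negative logarithmic derivative on `Re s > 1`. -/
def NegLogDerivOf (P : ℕ → ℂ) (F : ℂ → ℂ) : Prop :=
  ∀ s : ℂ, 1 < s.re → LSeriesSummable P s ∧ DifferentiableAt ℂ F s ∧ deriv F s = -(LSeries P s * F s)

theorem NegLogDerivOf.mul {P Q : ℕ → ℂ} {F G : ℂ → ℂ} (hF : NegLogDerivOf P F) (hG : NegLogDerivOf Q G) :
    NegLogDerivOf (P + Q) (fun s => F s * G s) := by
  intro s hs
  obtain ⟨h1, h2, h3⟩ := hF s hs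
  obtain ⟨h4, h5, h6⟩ := hG s hs
  refine ⟨h1.add h4, h2.mul h5, ?_⟩
  rw [deriv_fun_mul h2 h5, h3, h6, LSeries_add h1 h4]
  ring

theorem negLogDerivOf_LFunction {q : ℕ} [NeZero q] (χ : DirichletCharacter ℂ q) :
    NegLogDerivOf ((fun n : ℕ => χ (n : ZMod q)) * fun n => ((vonMangoldt n : ℝ) : ℂ))
      (LFunction χ) := by
  intro s hs
  have hs1 : s ≠ 1 := fun h => by rw [h] at hs; simp at hs
  have hne : LFunction χ s ≠ 0 :=
    LFunction_ne_zero_of_one_le_re χ (Or.inr hs1) hs.le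
  refine ⟨χ.LSeriesSummable_twist_vonMangoldt hs, DirichletCharacter.differentiableAt_LFunction χ s (Or.inl hs1), ?_⟩
  rw [χ.LSeries_twist_vonMangoldt_eq hs, DirichletCharacter.deriv_LFunction_eq_deriv_LSeries χ hs,
    LFunction_eq_LSeries χ hs] at *
  field_simp

theorem norm_LFunction_two_sub_one_le {q : ℕ} [NeZero q] (χ : DirichletCharacter ℂ q) :
    ‖LFunction χ 2 - 1‖ ≤ 13 / 20 := by
  have h2 : (1 : ℝ) < (2 : ℂ).re := by norm_num
  rw [LFunction_eq_LSeries χ h2]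
  have hs := χ.LSeriesSummable_of_one_lt_re h2
  have hs' : Summable (LSeries.term (fun n : ℕ => χ (n : ZMod q)) 2) := hs
  rw [LSeries, hs'.tsum_eq_zero_add, LSeries.term_zero, zero_add,
    ((summable_nat_add_iff 1).2 hs').tsum_eq_zero_add, zero_add]
  have e1 : LSeries.term (fun n : ℕ => χ (n : ZMod q)) 2 1 = 1 := by
    rw [LSeries.term_of_ne_zero one_ne_zero]; simp
  rw [e1, add_sub_cancel_left]
  have hz := hasSum_zeta_two
  have hz1 : HasSum (fun n : ℕ => 1 / ((n + 2 : ℕ) : ℝ) ^ 2) (Real.pi ^ 2 / 6 - 1) := by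
    rw [hasSum_nat_add_iff (f := fun n : ℕ => 1 / (n : ℝ) ^ 2)]
    simpa [Finset.sum_range_succ] using hz
  refine (tsum_of_norm_bounded hz1 fun n => ?_).trans ?_
  · rw [LSeries.term_of_ne_zero (by omega), norm_div, Complex.norm_natCast_cpow_of_pos (by omega)]
    have := χ.norm_le_one ((n + 1 + 1 : ℕ) : ZMod q)
    have e : ((n + 1 + 1 : ℕ) : ℝ) ^ ((2 : ℂ).re) = ((n + 2 : ℕ) : ℝ) ^ 2 := by
      rw [show (2 : ℂ).re = ((2 : ℕ) : ℝ) by norm_num, rpow_natCast]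
    rw [e]
    gcongr
  · have := Real.pi_lt_d4
    have h0 := Real.pi_pos
    nlinarith

theorem apply_eq_of_sq_eq_one {q : ℕ} {χ : DirichletCharacter ℂ q} (h : χ ^ 2 = 1) (a : ZMod q) :
    χ a = 0 ∨ χ a = 1 ∨ χ a = -1 := by
  by_cases ha : IsUnit a
  · right
    have : χ a ^ 2 = 1 := by
      rw [← MulChar.pow_apply' _ two_ne_zero, h, MulChar.one_apply ha]
    have h3 : (χ a - 1) * (χ a + 1) = 0 := by linear_combination this
    rcases mul_eq_zero.1 h3 with h | h
    · left; linear_combination h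
    · right; linear_combination h
  · left; exact MulChar.map_nonunit χ ha

theorem conj_polefree {q : ℕ} [NeZero q] {χ : DirichletCharacter ℂ q} (h : χ ^ 2 = 1) (s : ℂ) :
    (starRingEnd ℂ) (polefree χ ((starRingEnd ℂ) s)) = polefree χ s := by
  have hd := differentiable_polefree χ
  have hopen : IsOpen {s : ℂ | 1 < s.re} := isOpen_lt continuous_const continuous_re
  have hd' : Differentiable ℂ (fun s => (starRingEnd ℂ) (polefree χ ((starRingEnd ℂ) s))) := by
    intro s
    have := (hd ((starRingEnd ℂ) s)).conj_conj
    rwa [Complex.conj_conj] at this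
  have h1 : ∀ s : ℂ, 1 < s.re → (starRingEnd ℂ) (polefree χ ((starRingEnd ℂ) s)) = polefree χ s := by
    intro s hs
    have hne : s ≠ 1 := fun h => by rw [h] at hs; simp at hs
    have hs' : 1 < ((starRingEnd ℂ) s).re := by simpa using hs
    have hne' : (starRingEnd ℂ) s ≠ 1 := fun h => by rw [h] at hs'; simp at hs'
    rw [polefree_eq χ hne, polefree_eq χ hne', LFunction_eq_LSeries χ hs,
      LFunction_eq_LSeries χ hs', map_mul, map_sub, Complex.conj_conj, map_one]
    congr 1
    rw [LSeries, LSeries, Complex.conj_tsum]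
    refine tsum_congr fun n => ?_
    rcases eq_or_ne n 0 with rfl | hn
    · simp
    rw [LSeries.term_of_ne_zero hn, LSeries.term_of_ne_zero hn, map_div₀]
    congr 1
    · rcases apply_eq_of_sq_eq_one h (n : ZMod q) with h | h | h <;> rw [h] <;> simp
    · have := Complex.cpow_conj (n : ℂ) s (by rw [Complex.natCast_arg]; exact Real.pi_pos.ne)
      rw [this, Complex.conj_conj, Complex.conj_natCast]
  have := (hd'.differentiableOn.analyticOnNhd isOpen_univ).eqOn_of_preconnected_of_eventuallyEq
    (hd.differentiableOn.analyticOnNhd isOpen_univ) isPreconnected_univ (Set.mem_univ (2 : ℂ))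
    (Filter.eventually_of_mem (hopen.mem_nhds (by simp : (2 : ℂ) ∈ {s : ℂ | 1 < s.re})) h1)
  exact this (Set.mem_univ s)

theorem polefree_im_ofReal {q : ℕ} [NeZero q] {χ : DirichletCharacter ℂ q} (h : χ ^ 2 = 1) (x : ℝ) :
    (polefree χ x).im = 0 := by
  have := conj_polefree h x
  rw [conj_ofReal] at this
  exact Complex.conj_eq_iff_im.1 this

theorem LFunction_im_ofReal {q : ℕ} [NeZero q] {χ : DirichletCharacter ℂ q} (h : χ ^ 2 = 1) {x : ℝ} (hx : x ≠ 1) :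
    (LFunction χ x).im = 0 := by
  have hx' : (x : ℂ) ≠ 1 := by exact_mod_cast hx
  have h1 := polefree_im_ofReal h x
  rw [polefree_eq χ hx', show ((x : ℂ) - 1) = ((x - 1 : ℝ) : ℂ) by push_cast; ring, Complex.im_ofReal_mul] at h1
  rcases mul_eq_zero.1 h1 with h | h
  · exact absurd (by linarith) hx
  · exact h

theorem le_re_LFunction_two {q : ℕ} [NeZero q] (χ : DirichletCharacter ℂ q) :
    7 / 20 ≤ (LFunction χ 2).re := by
  have h1 := (abs_le.1 ((abs_re_le_norm _).trans (norm_LFunction_two_sub_one_le χ))).1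
  simp at h1; linarith

open scoped ComplexOrder in
theorem le_LFunction_two {q : ℕ} [NeZero q] {χ : DirichletCharacter ℂ q} (h : χ ^ 2 = 1) :
    ((7 / 20 : ℝ) : ℂ) ≤ LFunction χ 2 := by
  have h2 := LFunction_im_ofReal h (x := 2) (by norm_num)
  rw [Complex.le_def, ofReal_re, Complex.ofReal_im]
  push_cast at h2
  exact ⟨le_re_LFunction_two χ, h2.symm⟩

theorem exists_pow_bounds {K δ : ℝ} (hK : 1 ≤ K) (hδ : 0 ≤ δ) :
    ∀ q : ℕ, 1 ≤ q → ∃ M : ℕ, 1 ≤ M ∧ K * q ^ 2 * (7 / 8) ^ M ≤ 1 ∧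
      (1 + δ) ^ M ≤ Real.exp (2 * δ) * K ^ (8 * δ) * (q : ℝ) ^ (16 * δ) := by
  intro q hq
  have hq' : (1 : ℝ) ≤ q := by exact_mod_cast hq
  set y : ℝ := K * q ^ 2 with hy
  have hq2 : (1 : ℝ) ≤ (q : ℝ) ^ 2 := one_le_pow₀ hq'
  have hy1 : 1 ≤ y := by nlinarith
  have hy0 : 0 < y := by linarith
  have hly : 0 ≤ log y := Real.log_nonneg hy1
  set M : ℕ := ⌈8 * log y⌉₊ + 1 with hM
  have hM1 : 8 * log y ≤ M := by
    rw [hM]; push_cast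
    linarith [Nat.le_ceil (8 * log y)]
  have hM2 : (M : ℝ) ≤ 8 * log y + 2 := by
    rw [hM]; push_cast
    linarith [Nat.ceil_lt_add_one (by positivity : 0 ≤ 8 * log y)]
  refine ⟨M, by omega, ?_, ?_⟩
  · have h78 : (7 / 8 : ℝ) ≤ Real.exp (-(1 / 8)) := by
      have := Real.add_one_le_exp (-(1 / 8) : ℝ)
      linarith
    have : (7 / 8 : ℝ) ^ M ≤ Real.exp (-log y) := by
      calc (7 / 8 : ℝ) ^ M ≤ Real.exp (-(1 / 8)) ^ M := by gcongr
        _ = Real.exp (M * (-(1 / 8))) := by rw [Real.exp_nat_mul]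
        _ ≤ _ := Real.exp_le_exp.2 (by linarith)
    rw [Real.exp_neg, Real.exp_log hy0] at this
    calc y * (7 / 8) ^ M ≤ y * y⁻¹ := by gcongr
      _ = 1 := mul_inv_cancel₀ hy0.ne'
  · calc (1 + δ) ^ M ≤ Real.exp δ ^ M := by
          gcongr; linarith [Real.add_one_le_exp δ]
      _ = Real.exp (M * δ) := by rw [Real.exp_nat_mul]
      _ ≤ Real.exp (2 * δ + log y * (8 * δ)) := Real.exp_le_exp.2 (by nlinarith)
      _ = Real.exp (2 * δ) * y ^ (8 * δ) := by rw [Real.exp_add, Real.rpow_def_of_pos hy0]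
      _ = _ := by
        rw [hy, mul_rpow (by positivity) (by positivity), ← rpow_natCast (q : ℝ) 2, ← Real.rpow_mul (by positivity)]
        rw [show ((2 : ℕ) : ℝ) * (8 * δ) = 16 * δ by push_cast; ring]; ring

open scoped ComplexOrder in
theorem estermann_of_polynomial_bound {P : ℕ → ℂ} (hP : 0 ≤ P) {G F : ℂ → ℂ} (hG : Differentiable ℂ G)
    (hF : NegLogDerivOf P F) (hGF : ∀ s : ℂ, 1 < s.re → G s = (s - 1) * F s)
    {c₀ K : ℝ} (hc₀ : 0 < c₀) (hc₁ : c₀ ≤ 1) (hK : 1 ≤ K) (h0 : (c₀ : ℂ) ≤ G 2) {q : ℕ} (hq : 1 ≤ q)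
    (hM₀ : ∀ s : ℂ, ‖s - 2‖ ≤ 4 / 3 → ‖G s‖ ≤ K * q ^ 2) {β δ : ℝ} (hδ : δ ≤ 1 / 6) (hβ : 1 - δ ≤ β) (hβ1 : β < 1)
    (hGβ : 0 ≤ (G β).re) :
    (1 - β) * (c₀ / 2) ≤ ‖G 1‖ * (Real.exp (2 * δ) * (96 * K / c₀) ^ (8 * δ) * (q : ℝ) ^ (16 * δ)) := by
  have hK' : 1 ≤ 96 * K / c₀ := by rw [le_div_iff₀ hc₀]; linarith
  have hδ0 : 0 ≤ δ := by linarith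
  obtain ⟨M, hM, h1, h2⟩ := exists_pow_bounds hK' hδ0 q hq
  have hev : ∀ s : ℂ, 1 < s.re → (fun s => G s / (s - 1)) =ᶠ[nhds s] F := by
    intro s hs
    refine Filter.eventually_of_mem ((isOpen_lt continuous_const continuous_re).mem_nhds hs) fun z hz => ?_
    have hz' : 1 < z.re := hz
    have : z - 1 ≠ 0 := fun h => by rw [sub_eq_zero.1 h] at hz'; simp at hz'
    simp only [hGF z hz']
    field_simp
  have h := estermann P hP G hG (fun s hs => (hF s hs).1) (fun s hs => by
    rw [(hev s hs).deriv_eq, (hF s hs).2.2]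
    have := (hev s hs).eq_of_nhds
    rw [this]) c₀ (K * q ^ 2) hc₀.le h0 hM₀ β (by linarith) hβ1 hGβ M hM
  have h3 : 48 * (K * q ^ 2) * (7 / 8) ^ M ≤ c₀ / 2 := by
    have : 48 * (K * q ^ 2) * (7 / 8) ^ M = c₀ / 2 * (96 * K / c₀ * q ^ 2 * (7 / 8) ^ M) := by
      field_simp; ring
    rw [this]; nlinarith
  calc (1 - β) * (c₀ / 2) ≤ (1 - β) * (c₀ - 48 * (K * q ^ 2) * (7 / 8) ^ M) := by
        apply mul_le_mul_of_nonneg_left _ (by linarith); linarith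
    _ ≤ (G 1).re * (2 - β) ^ M := h
    _ ≤ ‖G 1‖ * (1 + δ) ^ M := by
        have : (2 - β) ^ M ≤ (1 + δ) ^ M := pow_le_pow_left₀ (by linarith) (by linarith) M
        calc _ ≤ ‖G 1‖ * (2 - β) ^ M :=
              mul_le_mul_of_nonneg_right (Complex.re_le_norm _) (pow_nonneg (by linarith) M)
          _ ≤ _ := mul_le_mul_of_nonneg_left this (norm_nonneg _)
    _ ≤ _ := mul_le_mul_of_nonneg_left h2 (norm_nonneg _)

theorem re_pos_of_forall_ne_zero {F : ℂ → ℂ} (hF : Continuous F) {b : ℝ} (hb : b ≤ 2)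
    (hr : ∀ x : ℝ, x ∈ Set.Icc b 2 → F x ≠ 0 ∧ (F x).im = 0) (h2 : 0 < (F 2).re) : 0 < (F b).re := by
  by_contra h
  push Not at h
  have hc : ContinuousOn (fun x : ℝ => (F x).re) (Set.Icc b 2) := by fun_prop
  obtain ⟨x, hx, hx0⟩ := intermediate_value_Icc hb hc ⟨h, by push_cast; exact h2.le⟩
  exact (hr x hx).1 (Complex.ext hx0 (hr x hx).2)

theorem polefree_one_pos : 0 < (polefree (q := 1) 1 1).re := by
  have := re_pos_of_forall_ne_zero (differentiable_polefree (q := 1) 1).continuous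
    (b := 1) (by norm_num) (fun x hx => ⟨?_, polefree_im_ofReal (one_pow _) x⟩) ?_
  · simpa using this
  · rcases eq_or_ne x 1 with rfl | hx1
    · simp only [polefree, if_true, Complex.ofReal_one]
      exact DirichletCharacter.LFunctionTrivChar₁_apply_one_ne_zero 1
    · have hx' : (x : ℂ) ≠ 1 := by exact_mod_cast hx1
      rw [polefree_eq _ hx']
      exact mul_ne_zero (sub_ne_zero.2 hx')
        (LFunction_ne_zero_of_one_le_re _ (Or.inr hx') (by simpa using hx.1))
  · rw [polefree_eq _ (by norm_num)]
    have := le_re_LFunction_two (1 : DirichletCharacter ℂ 1)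
    rw [show (2 : ℂ) - 1 = 1 by norm_num, one_mul]
    linarith

theorem norm_LFunction_le_linear : ∃ C : ℝ, 1 ≤ C ∧ ∀ (q : ℕ) [NeZero q] (χ : DirichletCharacter ℂ q) (s : ℂ),
    χ ≠ 1 → ‖s - 2‖ ≤ 4 / 3 → ‖LFunction χ s‖ ≤ C * q := by
  obtain ⟨C, hC, h⟩ := norm_LFunction_le (η := 1 / 2) (by norm_num) le_rfl
  refine ⟨C * 4, by linarith, fun q _ χ s hχ hs => ?_⟩
  have h1 := abs_le.1 ((abs_re_le_norm _).trans hs)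
  have h2 := (abs_im_le_norm _).trans hs
  simp at h1 h2
  refine (h q χ s hχ (by linarith) (by linarith)).trans ?_
  rw [show 2 * (1 / 2 : ℝ) = 1 by norm_num, Real.rpow_one]
  have : (q : ℝ) * (|s.im| + 2) ≤ q * 4 := by gcongr; linarith
  nlinarith

theorem norm_polefree_one_le : ∃ C : ℝ, 1 ≤ C ∧ ∀ s : ℂ, ‖s - 2‖ ≤ 4 / 3 →
    ‖polefree (q := 1) 1 s‖ ≤ C := by
  obtain ⟨C, hC⟩ := (isCompact_closedBall (2 : ℂ) (4 / 3)).exists_bound_of_continuousOn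
    (differentiable_polefree (q := 1) 1).continuous.continuousOn
  exact ⟨max C 1, le_max_right _ _, fun s hs => (hC s (mem_closedBall_iff_norm.2 hs)).trans (le_max_left _ _)⟩

open scoped ComplexOrder in
/-- Siegel's lower bound when there is no real zero near one. -/
theorem siegel_of_no_zero {δ : ℝ} (hδ : 0 < δ) (hδ1 : δ ≤ 1 / 6)
    (hZ : 0 ≤ (polefree (q := 1) 1 ((1 - δ : ℝ) : ℂ)).re) :
    ∃ c : ℝ, 0 < c ∧ ∀ (q : ℕ) [NeZero q] (χ : DirichletCharacter ℂ q), χ ^ 2 = 1 → χ ≠ 1 →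
      (∀ β : ℝ, 1 - δ ≤ β → β < 1 → LFunction χ β ≠ 0) →
      c ≤ ‖LFunction χ 1‖ * (q : ℝ) ^ (16 * δ) := by
  obtain ⟨C1, hC1, h1⟩ := norm_LFunction_le_linear
  obtain ⟨C2, hC2, h2⟩ := norm_polefree_one_le
  set K := C2 * C1 with hK
  have hK1 : 1 ≤ K := by nlinarith
  set c₀ : ℝ := (7 / 20) * (7 / 20) with hc₀
  set D := Real.exp (2 * δ) * (96 * K / c₀) ^ (8 * δ) with hD
  have hDpos : 0 < D := by
    rw [hD]; have : 0 < 96 * K / c₀ := by rw [hc₀]; positivity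
    positivity
  refine ⟨δ * (c₀ / 2) / (C2 * D), by rw [hc₀]; positivity, fun q _ χ hχ2 hχ hnz => ?_⟩
  have hq : 1 ≤ q := Nat.one_le_iff_ne_zero.2 (NeZero.ne q)
  set Z := polefree (q := 1) 1 with hZdef
  have hlow : (c₀ : ℂ) ≤ Z 2 * LFunction χ 2 := by
    have e : Z 2 = LFunction (N := 1) 1 2 := by
      rw [hZdef, polefree_eq _ (by norm_num)]; norm_num
    have h3 := le_LFunction_two (one_pow 2 : (1 : DirichletCharacter ℂ 1) ^ 2 = 1)
    have h4 := le_LFunction_two hχ2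
    rw [e, hc₀, ofReal_mul]
    have h0 : (0 : ℂ) ≤ ((7 / 20 : ℝ) : ℂ) := by rw [Complex.zero_le_real]; norm_num
    exact mul_le_mul h3 h4 h0 (h0.trans h3)
  have hb := estermann_of_polynomial_bound (P := _) (F := fun s => LFunction (N := 1) 1 s *
      LFunction χ s) ?_ ((differentiable_polefree 1).mul (differentiable_LFunction hχ))
      ((negLogDerivOf_LFunction 1).mul (negLogDerivOf_LFunction χ)) ?_
      (c₀ := c₀) (K := K) (by rw [hc₀]; norm_num) (by rw [hc₀]; norm_num) hK1 hlow hq ?_ (β := 1 - δ) hδ1 le_rfl (by linarith) ?_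
  · rw [← hD] at hb
    have h3 : ‖(Z * LFunction χ) 1‖ ≤ C2 * ‖LFunction χ 1‖ := by
      rw [Pi.mul_apply, norm_mul]; gcongr; exact h2 1 (by norm_num)
    rw [div_le_iff₀ (by positivity)]
    have h4 := mul_le_mul_of_nonneg_right h3 (by positivity : 0 ≤ D * (q : ℝ) ^ (16 * δ))
    rw [sub_sub_cancel] at hb
    refine (hb.trans h4).trans (le_of_eq (by ring))
  · intro n
    simp only [Pi.add_apply, Pi.mul_apply, Pi.zero_apply, ← add_mul]
    have hv : (0 : ℂ) ≤ ((vonMangoldt n : ℝ) : ℂ) := by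
      rw [Complex.zero_le_real]; exact vonMangoldt_nonneg
    refine mul_nonneg ?_ hv
    have e : (1 : DirichletCharacter ℂ 1) (n : ZMod 1) = 1 := by
      rw [Subsingleton.elim (n : ZMod 1) 1]; exact map_one _
    rw [e]
    rcases apply_eq_of_sq_eq_one hχ2 (n : ZMod q) with h | h | h <;> rw [h] <;> norm_num
  · intro s hs
    have hne : s ≠ 1 := fun h => by rw [h] at hs; simp at hs
    rw [Pi.mul_apply, polefree_eq _ hne, mul_assoc]
  · intro s hs
    rw [Pi.mul_apply, norm_mul]
    have hq' : (1 : ℝ) ≤ q := by exact_mod_cast hq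
    calc _ ≤ C2 * (C1 * q) := by gcongr; exacts [h2 s hs, h1 q χ s hχ hs]
      _ ≤ C2 * (C1 * q ^ 2) := by gcongr; nlinarith
      _ = _ := by rw [hK]; ring
  · have h3 := polefree_im_ofReal (one_pow 2 : (1 : DirichletCharacter ℂ 1) ^ 2 = 1) (1 - δ)
    have h4 : 0 < (LFunction χ ((1 - δ : ℝ) : ℂ)).re := by
      refine re_pos_of_forall_ne_zero (differentiable_LFunction hχ).continuous (by linarith) ?_
        (by linarith [le_re_LFunction_two χ])
      intro x hx
      constructor
      · by_cases hx1 : x < 1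
        · exact hnz x hx.1 hx1
        · exact LFunction_ne_zero_of_one_le_re _ (Or.inl hχ) (by simpa using hx1)
      · rcases eq_or_ne x 1 with rfl | hx1
        · have hcl : IsClosed {y : ℝ | (LFunction χ y).im = 0} := by
            refine isClosed_eq ?_ continuous_const
            exact Complex.continuous_im.comp ((differentiable_LFunction hχ).continuous.comp
              Complex.continuous_ofReal)
          have hdense : Dense {y : ℝ | y ≠ 1} := dense_compl_singleton 1
          have hsub : {y : ℝ | y ≠ 1} ⊆ {y : ℝ | (LFunction χ y).im = 0} :=
            fun y hy => LFunction_im_ofReal hχ2 hy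
          exact (hcl.closure_subset_iff.2 hsub) (hdense 1)
        · exact LFunction_im_ofReal hχ2 hx1
    rw [Pi.mul_apply, Complex.mul_re, h3, zero_mul, sub_zero]
    exact mul_nonneg hZ h4.le

theorem changeLevel_natCast {q m : ℕ} (χ : DirichletCharacter ℂ q) (h : q ∣ m) {n : ℕ} (hn : IsUnit (n : ZMod m)) :
    changeLevel h χ (n : ZMod m) = χ (n : ZMod q) := by
  obtain ⟨u, hu⟩ := hn
  rw [← hu, DirichletCharacter.changeLevel_eq_cast_of_dvd, hu, ZMod.cast_natCast h]

/-- The product of two characters, as a character modulo the product of the levels. -/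
def prodChar {q r : ℕ} (χ : DirichletCharacter ℂ q) (ψ : DirichletCharacter ℂ r) : DirichletCharacter ℂ (q * r) :=
  changeLevel (dvd_mul_right q r) χ * changeLevel (dvd_mul_left r q) ψ

theorem prodChar_natCast {q r : ℕ} (χ : DirichletCharacter ℂ q) (ψ : DirichletCharacter ℂ r) (n : ℕ) :
    prodChar χ ψ (n : ZMod (q * r)) = χ (n : ZMod q) * ψ (n : ZMod r) := by
  by_cases h : IsUnit (n : ZMod (q * r))
  · rw [prodChar, MulChar.mul_apply, changeLevel_natCast _ _ h, changeLevel_natCast _ _ h]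
  · rw [MulChar.map_nonunit _ h]
    rw [ZMod.isUnit_iff_coprime, Nat.coprime_mul_iff_right, not_and_or, ← ZMod.isUnit_iff_coprime,
      ← ZMod.isUnit_iff_coprime] at h
    rcases h with h | h
    · rw [MulChar.map_nonunit _ h, zero_mul]
    · rw [MulChar.map_nonunit _ h, mul_zero]

theorem prodChar_sq {q r : ℕ} {χ : DirichletCharacter ℂ q} {ψ : DirichletCharacter ℂ r} (h : χ ^ 2 = 1) (h' : ψ ^ 2 = 1) :
    prodChar χ ψ ^ 2 = 1 := by
  rw [prodChar, mul_pow, ← map_pow, ← map_pow, h, h', map_one, map_one, one_mul]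

theorem prodChar_ne_one {q r : ℕ} [NeZero q] [NeZero r] {χ : DirichletCharacter ℂ q} {ψ : DirichletCharacter ℂ r}
    (hχ : χ.IsPrimitive) (hψ : ψ.IsPrimitive) (h' : ψ ^ 2 = 1) (hqr : q ≠ r) : prodChar χ ψ ≠ 1 := by
  intro h
  have e : changeLevel (dvd_mul_right q r) χ = changeLevel (dvd_mul_left r q) ψ := by
    have h2 : changeLevel (dvd_mul_left r q) ψ * changeLevel (dvd_mul_left r q) ψ = 1 := by
      rw [← map_mul, ← pow_two, h', map_one]
    exact (eq_inv_of_mul_eq_one_left h).trans (eq_inv_of_mul_eq_one_left h2).symm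
  have := congrArg DirichletCharacter.conductor e
  rw [DirichletCharacter.conductor_changeLevel, DirichletCharacter.conductor_changeLevel] at this
  rw [DirichletCharacter.isPrimitive_def] at hχ hψ
  exact hqr (by rw [← hχ, ← hψ, this])

open scoped ComplexOrder in
theorem siegel_of_zero {δ η : ℝ} (hδ1 : δ ≤ 1 / 6) (hη : 0 < η) (hη1 : η ≤ 1 / 2) {q₁ : ℕ} [NeZero q₁]
    {χ₁ : DirichletCharacter ℂ q₁} (hp : χ₁.IsPrimitive) (hχ₁2 : χ₁ ^ 2 = 1) (hχ₁ : χ₁ ≠ 1) {β : ℝ} (hβ : 1 - δ ≤ β)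
    (hβ1 : β < 1) (hz : LFunction χ₁ β = 0) :
    ∃ c : ℝ, 0 < c ∧ ∀ (q : ℕ) [NeZero q] (χ : DirichletCharacter ℂ q), χ.IsPrimitive → χ ^ 2 = 1 → χ ≠ 1 → q ≠ q₁ →
      c ≤ ‖LFunction χ 1‖ * (q : ℝ) ^ (16 * δ + 2 * η) := by
  obtain ⟨C1, hC1, h1⟩ := norm_LFunction_le_linear
  obtain ⟨C2, hC2, h2⟩ := norm_polefree_one_le
  obtain ⟨C3, hC3, h3⟩ := norm_LFunction_le hη hη1
  have hq₁ : (1 : ℝ) ≤ q₁ := by exact_mod_cast Nat.one_le_iff_ne_zero.2 (NeZero.ne q₁)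
  set K := C2 * (C1 * q₁) * C1 * (C1 * q₁) with hK
  have hK1 : 1 ≤ K := by
    have : 1 ≤ C1 * q₁ := by nlinarith
    rw [hK]
    exact one_le_mul_of_one_le_of_one_le (one_le_mul_of_one_le_of_one_le (one_le_mul_of_one_le_of_one_le hC2 this) hC1) this
  set c₀ : ℝ := (7 / 20) * (7 / 20) * (7 / 20) * (7 / 20) with hc₀
  set D := Real.exp (2 * δ) * (96 * K / c₀) ^ (8 * δ) with hD
  have hDpos : 0 < D := by
    rw [hD]; have : 0 < 96 * K / c₀ := by rw [hc₀]; positivity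
    positivity
  set Y := C2 * (C1 * q₁) * (C3 * (2 * q₁) ^ (2 * η)) with hY
  have hYpos : 0 < Y := by rw [hY]; positivity
  have hβpos : 0 < 1 - β := by linarith
  refine ⟨(1 - β) * (c₀ / 2) / (Y * D), by rw [hc₀]; positivity, fun q _ χ hpχ hχ2 hχ hqq => ?_⟩
  have hq : 1 ≤ q := Nat.one_le_iff_ne_zero.2 (NeZero.ne q)
  have hq' : (1 : ℝ) ≤ q := by exact_mod_cast hq
  have : NeZero (q₁ * q) := ⟨mul_ne_zero (NeZero.ne q₁) (NeZero.ne q)⟩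
  set ψ := prodChar χ₁ χ with hψ
  have hψ1 : ψ ≠ 1 := prodChar_ne_one hp hpχ hχ2 hqq.symm
  have hψ2 : ψ ^ 2 = 1 := prodChar_sq hχ₁2 hχ2
  set Z := polefree (q := 1) 1 with hZdef
  have hlow : (c₀ : ℂ) ≤ Z 2 * LFunction χ₁ 2 * LFunction χ 2 *
      LFunction ψ 2 := by
    have e : Z 2 = LFunction (N := 1) 1 2 := by
      rw [hZdef, polefree_eq _ (by norm_num)]; norm_num
    have h4 := le_LFunction_two (one_pow 2 : (1 : DirichletCharacter ℂ 1) ^ 2 = 1)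
    have h0 : (0 : ℂ) ≤ ((7 / 20 : ℝ) : ℂ) := by rw [Complex.zero_le_real]; norm_num
    rw [e, hc₀, ofReal_mul, ofReal_mul, ofReal_mul]
    have h5 := mul_le_mul h4 (le_LFunction_two hχ₁2) h0 (h0.trans h4)
    have h6 := mul_le_mul h5 (le_LFunction_two hχ2) h0 ((mul_nonneg h0 h0).trans h5)
    exact mul_le_mul h6 (le_LFunction_two hψ2) h0 ((mul_nonneg (mul_nonneg h0 h0) h0).trans h6)
  have hb := estermann_of_polynomial_bound (P := _)
      (F := fun s => LFunction (N := 1) 1 s *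
        LFunction χ₁ s * LFunction χ s * LFunction ψ s) ?_
      ((((differentiable_polefree 1).mul (differentiable_LFunction hχ₁)).mul
        (differentiable_LFunction hχ)).mul (differentiable_LFunction hψ1))
      ((((negLogDerivOf_LFunction 1).mul (negLogDerivOf_LFunction χ₁)).mul (negLogDerivOf_LFunction χ)).mul
        (negLogDerivOf_LFunction ψ)) ?_
      (c₀ := c₀) (K := K) (by rw [hc₀]; norm_num) (by rw [hc₀]; norm_num) hK1 hlow hq ?_ (β := β) hδ1 hβ hβ1 ?_
  · rw [← hD] at hb
    simp only [Pi.mul_apply, norm_mul] at hb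
    rw [div_le_iff₀ (by positivity)]
    refine hb.trans ?_
    have g1 := h2 1 (by norm_num)
    have g2 := h1 q₁ χ₁ 1 hχ₁ (by norm_num)
    have g3 := h3 (q₁ * q) ψ 1 hψ1 (by simp; linarith) (by simp)
    have g4 : ((q₁ * q : ℕ) * (|(1 : ℂ).im| + 2) : ℝ) ^ (2 * η) = (2 * q₁) ^ (2 * η) * (q : ℝ) ^ (2 * η) := by
      rw [← mul_rpow (by positivity) (by positivity)]; congr 1; simp; ring
    rw [g4] at g3
    calc _ ≤ C2 * (C1 * q₁) * ‖LFunction χ 1‖ * (C3 * ((2 * q₁) ^ (2 * η) * (q : ℝ) ^ (2 * η))) *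
          (D * (q : ℝ) ^ (16 * δ)) := by gcongr
      _ = _ := by
        rw [Real.rpow_add (by linarith)]
        rw [hY]; ring
  · intro n
    simp only [Pi.add_apply, Pi.mul_apply, Pi.zero_apply, ← add_mul]
    have hv : (0 : ℂ) ≤ ((vonMangoldt n : ℝ) : ℂ) := by
      rw [Complex.zero_le_real]; exact vonMangoldt_nonneg
    refine mul_nonneg ?_ hv
    have e : (1 : DirichletCharacter ℂ 1) (n : ZMod 1) = 1 := by
      rw [Subsingleton.elim (n : ZMod 1) 1]; exact map_one _
    rw [e, hψ, prodChar_natCast]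
    rcases apply_eq_of_sq_eq_one hχ2 (n : ZMod q) with h | h | h <;>
    rcases apply_eq_of_sq_eq_one hχ₁2 (n : ZMod q₁) with h' | h' | h' <;> rw [h, h'] <;> norm_num
  · intro s hs
    have hne : s ≠ 1 := fun h => by rw [h] at hs; simp at hs
    simp only [Pi.mul_apply]
    rw [polefree_eq _ hne]; ring
  · intro s hs
    simp only [Pi.mul_apply, norm_mul]
    have h4 := h1 (q₁ * q) ψ s hψ1 hs
    push_cast at h4
    calc _ ≤ C2 * (C1 * q₁) * (C1 * q) * (C1 * (q₁ * q)) := by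
          gcongr; exacts [h2 s hs, h1 q₁ χ₁ s hχ₁ hs, h1 q χ s hχ hs]
      _ = _ := by rw [hK]; ring
  · simp only [Pi.mul_apply]
    rw [hz]; simp

theorem exists_polefree_one_nonneg : ∃ δ₀ : ℝ, 0 < δ₀ ∧ ∀ δ : ℝ, 0 < δ → δ ≤ δ₀ →
    0 ≤ (polefree (q := 1) 1 ((1 - δ : ℝ) : ℂ)).re := by
  have hc : Continuous fun x : ℝ => (polefree (q := 1) 1 ((1 - x : ℝ) : ℂ)).re :=
    continuous_re.comp ((differentiable_polefree (q := 1) 1).continuous.comp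
      (Complex.continuous_ofReal.comp (by fun_prop)))
  have h0 : 0 < (fun x : ℝ => (polefree (q := 1) 1 ((1 - x : ℝ) : ℂ)).re) 0 := by
    simpa using polefree_one_pos
  obtain ⟨r, hr, h⟩ := Metric.eventually_nhds_iff.1 (hc.continuousAt.eventually (lt_mem_nhds h0))
  refine ⟨r / 2, by linarith, fun δ hδ hδr => (h ?_).le⟩
  rw [Real.dist_eq, sub_zero, abs_of_pos hδ]; linarith

theorem siegel {ε : ℝ} (hε : 0 < ε) : ∃ c : ℝ, 0 < c ∧ ∀ (q : ℕ) [NeZero q] (χ : DirichletCharacter ℂ q),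
    χ.IsPrimitive → χ ^ 2 = 1 → χ ≠ 1 → c ≤ ‖LFunction χ 1‖ * (q : ℝ) ^ ε := by
  obtain ⟨δ₀, hδ₀, hZ⟩ := exists_polefree_one_nonneg
  set δ := min (min (ε / 32) δ₀) (1 / 6) with hδd
  have hδ : 0 < δ := by rw [hδd]; positivity
  have hδ1 : δ ≤ 1 / 6 := min_le_right _ _
  have hδ2 : δ ≤ δ₀ := (min_le_left _ _).trans (min_le_right _ _)
  have hδ3 : δ ≤ ε / 32 := (min_le_left _ _).trans (min_le_left _ _)
  have hmono : ∀ (q : ℕ) [NeZero q] (y e : ℝ), 0 ≤ y → e ≤ ε → y * (q : ℝ) ^ e ≤ y * (q : ℝ) ^ ε := by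
    intro q _ y e hy he
    have hq := one_le_cast_of_neZero q
    gcongr
  by_cases hz : ∃ (q₁ : ℕ) (_ : NeZero q₁) (χ₁ : DirichletCharacter ℂ q₁) (β : ℝ), χ₁.IsPrimitive ∧ χ₁ ^ 2 = 1 ∧ χ₁ ≠ 1 ∧
      1 - δ ≤ β ∧ β < 1 ∧ LFunction χ₁ β = 0
  · obtain ⟨q₁, _, χ₁, β, hp, h2, h1, hβ, hβ1, hz⟩ := hz
    set η := min (ε / 4) (1 / 2) with hη
    have hη0 : 0 < η := by rw [hη]; positivity
    have hη1 : η ≤ ε / 4 := min_le_left _ _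
    obtain ⟨c, hc, h⟩ := siegel_of_zero hδ1 hη0 (min_le_right _ _) hp h2 h1 hβ hβ1 hz
    have : Nonempty {χ : DirichletCharacter ℂ q₁ // χ ≠ 1} := ⟨⟨χ₁, h1⟩⟩
    obtain ⟨ψ, hψ⟩ := Finite.exists_min (fun χ : {χ : DirichletCharacter ℂ q₁ // χ ≠ 1} =>
      ‖LFunction χ.1 1‖)
    have hψ0 : 0 < ‖LFunction ψ.1 1‖ :=
      norm_pos_iff.2 (DirichletCharacter.LFunction_apply_one_ne_zero ψ.2)
    refine ⟨min c ‖LFunction ψ.1 1‖, lt_min hc hψ0, fun q _ χ hpχ hχ2 hχ => ?_⟩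
    have hq := one_le_cast_of_neZero q
    by_cases hqq : q = q₁
    · subst hqq
      refine (min_le_right _ _).trans ((hψ ⟨χ, hχ⟩).trans ?_)
      exact le_mul_of_one_le_right (norm_nonneg _) (Real.one_le_rpow hq hε.le)
    · exact (min_le_left _ _).trans ((h q χ hpχ hχ2 hχ hqq).trans (hmono q _ _ (norm_nonneg _) (by linarith)))
  · push Not at hz
    obtain ⟨c, hc, h⟩ := siegel_of_no_zero hδ hδ1 (hZ δ hδ hδ2)
    refine ⟨c, hc, fun q _ χ hpχ hχ2 hχ => ?_⟩
    exact (h q χ hχ2 hχ fun β hβ hβ1 => hz q inferInstance χ β hpχ hχ2 hχ hβ hβ1).trans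
      (hmono q _ _ (norm_nonneg _) (by linarith))

theorem norm_LFunction_le_of_sub_one {η : ℝ} (hη : 0 < η) (hη2 : η ≤ 1 / 2) : ∃ C : ℝ, 1 ≤ C ∧
    ∀ (q : ℕ) [NeZero q] (χ : DirichletCharacter ℂ q) (s : ℂ) (τ : ℝ), 0 < τ → τ ≤ 1 → (χ ≠ 1 ∨ τ ≤ ‖s - 1‖) →
      1 - η ≤ s.re → s.re ≤ 4 → ‖LFunction χ s‖ ≤ C * (q * (|s.im| + 2)) ^ (2 * η) / τ := by
  obtain ⟨C, hC, h⟩ := norm_polefree_le hη hη2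
  obtain ⟨C', hC', h'⟩ := norm_LFunction_le hη hη2
  refine ⟨2 * C + C', by linarith, fun q _ χ s τ hτ hτ1 hs h1 h2 => ?_⟩
  have hQ : 0 ≤ ((q : ℝ) * (|s.im| + 2)) ^ (2 * η) := by positivity
  by_cases hχ : χ = 1
  · have hs' := hs.resolve_left (not_not.2 hχ)
    have hpos : 0 < ‖s - 1‖ := hτ.trans_le hs'
    have hne : s ≠ 1 := fun h => by rw [h] at hpos; simp at hpos
    have := h q χ s h1 h2
    rw [polefree_eq _ hne, norm_mul, if_pos hχ] at this
    rw [le_div_iff₀ hτ]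
    have h3 : ‖LFunction χ s‖ ≤ C * (q * (|s.im| + 2)) ^ (2 * η) * ((‖s - 1‖ + 1) / ‖s - 1‖) := by
      rw [mul_div_assoc', le_div_iff₀ hpos]; linarith
    have h4 : (‖s - 1‖ + 1) / ‖s - 1‖ * τ ≤ 2 := by
      rw [div_mul_eq_mul_div, div_le_iff₀ hpos]; nlinarith
    calc _ ≤ C * (q * (|s.im| + 2)) ^ (2 * η) * ((‖s - 1‖ + 1) / ‖s - 1‖) * τ := by gcongr
      _ = C * (q * (|s.im| + 2)) ^ (2 * η) * ((‖s - 1‖ + 1) / ‖s - 1‖ * τ) := by ring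
      _ ≤ C * (q * (|s.im| + 2)) ^ (2 * η) * 2 := by gcongr
      _ ≤ _ := by nlinarith
  · refine (h' q χ s hχ h1 h2).trans ?_
    rw [le_div_iff₀ hτ]
    have : 0 ≤ C' * ((q : ℝ) * (|s.im| + 2)) ^ (2 * η) := by positivity
    calc C' * ((q : ℝ) * (|s.im| + 2)) ^ (2 * η) * τ ≤ C' * ((q : ℝ) * (|s.im| + 2)) ^ (2 * η) * 1 := by gcongr
      _ ≤ _ := by nlinarith

theorem norm_deriv_LFunction_le {η : ℝ} (hη : 0 < η) (hη2 : η ≤ 1 / 2) : ∃ C : ℝ, 1 ≤ C ∧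
    ∀ (q : ℕ) [NeZero q] (χ : DirichletCharacter ℂ q) (s : ℂ), (χ ≠ 1 ∨ 1 ≤ |s.im|) →
      1 ≤ s.re → s.re ≤ 3 → ‖deriv (LFunction χ) s‖ ≤ C * (q * (|s.im| + 2)) ^ (2 * η) := by
  obtain ⟨C, hC, h⟩ := norm_LFunction_le_of_sub_one hη hη2
  refine ⟨C * 2 ^ (2 * η) / (1 / 2) / η, ?_, fun q _ χ s hs h1 h2 => ?_⟩
  · rw [le_div_iff₀ hη, le_div_iff₀ (by norm_num)]
    have : (1 : ℝ) ≤ 2 ^ (2 * η) := Real.one_le_rpow (by norm_num) (by positivity)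
    nlinarith
  have key : ∀ z : ℂ, ‖z - s‖ ≤ η → (χ ≠ 1 ∨ 1 / 2 ≤ ‖z - 1‖) ∧ 1 - η ≤ z.re ∧ z.re ≤ 4 ∧ |z.im| ≤ |s.im| + 1 / 2 := by
    intro z hz
    have a1 := abs_le.1 ((abs_re_le_norm _).trans hz)
    have a2 := (abs_im_le_norm _).trans hz
    rw [Complex.sub_re] at a1
    rw [Complex.sub_im] at a2
    have a3 := abs_sub_abs_le_abs_sub z.im s.im
    have a4 := abs_sub_abs_le_abs_sub s.im z.im
    rw [abs_sub_comm] at a4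
    refine ⟨hs.imp_right fun h => ?_, by linarith, by linarith, by linarith⟩
    have := abs_im_le_norm (z - 1)
    simp only [Complex.sub_im, Complex.one_im, sub_zero] at this
    linarith
  have hd : DifferentiableOn ℂ (LFunction χ) (Metric.closedBall s η) := by
    intro z hz
    rw [mem_closedBall_iff_norm] at hz
    refine (DirichletCharacter.differentiableAt_LFunction χ z ?_).differentiableWithinAt
    rcases (key z hz).1 with h | h
    · exact Or.inr h
    · left; rintro rfl; norm_num at h
  refine (Complex.norm_deriv_le_of_forall_mem_sphere_norm_le hη (hd.diffContOnCl_ball le_rfl)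
    (C := C * 2 ^ (2 * η) / (1 / 2) * (q * (|s.im| + 2)) ^ (2 * η)) ?_).trans (le_of_eq (by ring))
  intro z hz
  rw [mem_sphere_iff_norm] at hz
  obtain ⟨k1, k2, k3, k4⟩ := key z hz.le
  refine (h q χ z (1 / 2) (by norm_num) (by norm_num) k1 k2 k3).trans ?_
  rw [div_mul_eq_mul_div, mul_assoc, ← mul_rpow (by norm_num) (by positivity)]
  have hq0 : (0 : ℝ) ≤ q := Nat.cast_nonneg q
  have : (q : ℝ) * (|z.im| + 2) ≤ 2 * (q * (|s.im| + 2)) := by nlinarith [abs_nonneg s.im]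
  gcongr

theorem norm_LFunction_ge_of_sq {η : ℝ} (hη : 0 < η) (hη2 : η ≤ 1 / 2) : ∃ C : ℝ, 1 ≤ C ∧
    ∀ (q : ℕ) [NeZero q] (χ : DirichletCharacter ℂ q) (t τ : ℝ), 0 < τ → τ ≤ 1 → (χ ≠ 1 ∨ 1 ≤ |t|) →
      (χ ^ 2 ≠ 1 ∨ τ ≤ |t|) → ∀ x : ℝ, 0 < x → x ≤ 1 →
      1 / (5488 * (C * (q * (|t| + 2)) ^ (2 * η) / τ) ^ 4) ≤
        ‖LFunction χ (1 + x + I * t)‖ := by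
  obtain ⟨C1, hC1, h1⟩ := norm_LFunction_le_of_sub_one hη hη2
  obtain ⟨C2, hC2, h2⟩ := norm_deriv_LFunction_le hη hη2
  have h2η : (1 : ℝ) ≤ 2 ^ (2 * η) := Real.one_le_rpow (by norm_num) (by positivity)
  refine ⟨C1 * 2 ^ (2 * η) + C2, by nlinarith [mul_nonneg (by linarith : (0 : ℝ) ≤ C1) (by linarith : (0 : ℝ) ≤ 2 ^ (2 * η))], fun q _ χ t τ hτ hτ1 hχ hχ2 x hx hx1 => ?_⟩
  have hq := one_le_cast_of_neZero q
  have hQ : 1 ≤ ((q : ℝ) * (|t| + 2)) ^ (2 * η) :=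
    Real.one_le_rpow (by nlinarith [abs_nonneg t]) (by positivity)
  set Y := ((q : ℝ) * (|t| + 2)) ^ (2 * η) with hY
  refine LFunction_lower_of_bounds χ t _ ?_ ?_ ?_ ?_ x hx hx1
  · refine hχ.imp_right fun h h0 => ?_
    rw [h0, abs_zero] at h; linarith
  · rw [le_div_iff₀ hτ, one_mul]
    have : 1 ≤ C1 * 2 ^ (2 * η) + C2 := by
      nlinarith [mul_nonneg (by linarith : (0 : ℝ) ≤ C1) (by linarith : (0 : ℝ) ≤ 2 ^ (2 * η))]
    nlinarith
  · intro y hy hy1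
    have ei : (1 + (y : ℂ) + 2 * I * t).im = 2 * t := by simp
    have er : (1 + (y : ℂ) + 2 * I * t).re = 1 + y := by simp
    refine (h1 q (χ ^ 2) (1 + y + 2 * I * t) τ hτ hτ1 (hχ2.imp_right fun h => ?_) (by rw [er]; linarith)
      (by rw [er]; linarith)).trans ?_
    · have := abs_im_le_norm ((1 + (y : ℂ) + 2 * I * t) - 1)
      rw [Complex.sub_im, ei, Complex.one_im, sub_zero, abs_mul, abs_two] at this
      linarith
    · rw [ei, abs_mul, abs_two]
      gcongr ?_ / _
      have : ((q : ℝ) * (2 * |t| + 2)) ^ (2 * η) ≤ 2 ^ (2 * η) * Y := by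
        rw [hY, ← mul_rpow (by norm_num) (by positivity)]
        have : (q : ℝ) * (2 * |t| + 2) ≤ 2 * (q * (|t| + 2)) := by nlinarith
        gcongr
      nlinarith
  · intro y hy hy1
    have ei : (1 + (y : ℂ) + I * t).im = t := by simp
    have er : (1 + (y : ℂ) + I * t).re = 1 + y := by simp
    have := h2 q χ (1 + y + I * t) (by rwa [ei]) (by rw [er]; linarith) (by rw [er]; linarith)
    rw [ei] at this
    refine this.trans ?_
    rw [le_div_iff₀ hτ]
    have hpos : 0 ≤ C2 * Y := by positivity
    calc C2 * Y * τ ≤ C2 * Y * 1 := by gcongr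
      _ ≤ _ := by nlinarith [mul_nonneg (by positivity : 0 ≤ C1 * 2 ^ (2 * η)) (by linarith : 0 ≤ Y)]

theorem LFunction_pow_four_ge_real {q : ℕ} [NeZero q] (χ : DirichletCharacter ℂ q) {x : ℝ} (hx : 0 < x) (hx1 : x ≤ 1) (t : ℝ) :
    x / 7 ≤ ‖LFunction χ (1 + x + I * t)‖ := by
  have er : (1 + (x : ℂ) + 2 * I * t).re = 1 + x := by simp
  have h := LFunction_pow_four_ge χ hx hx1 t (7 / x) (by
    have := norm_LFunction_le_of_one_lt (χ ^ 2) (1 + x + 2 * I * t) (by rw [er]; linarith) (by rw [er]; linarith)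
    rwa [er, add_sub_cancel_left] at this)
  have h1 : (x / 7) ^ 4 = x ^ 3 / (343 * (7 / x)) := by field_simp; norm_num
  rw [← h1] at h
  exact le_of_pow_le_pow_left₀ (by norm_num) (norm_nonneg _) h

theorem norm_LFunction_sub_le {q : ℕ} [NeZero q] (χ : DirichletCharacter ℂ q) (hχ : χ ≠ 1) {W x t : ℝ} (hx : 0 ≤ x)
    (hx1 : x ≤ 2) (hd : ∀ s : ℂ, 1 ≤ s.re → s.re ≤ 3 → |s.im| ≤ |t| → ‖deriv (LFunction χ) s‖ ≤ W) :
    ‖LFunction χ (1 + x + I * t) - LFunction χ 1‖ ≤ W * (x + |t|) := by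
  have hconv : Convex ℝ {s : ℂ | (1 ≤ s.re ∧ s.re ≤ 3) ∧ |s.im| ≤ |t|} := by
    have h1 : {s : ℂ | (1 ≤ s.re ∧ s.re ≤ 3) ∧ |s.im| ≤ |t|} =
        Complex.reLm ⁻¹' (Set.Icc 1 3) ∩ Complex.imLm ⁻¹' (Set.Icc (-|t|) |t|) := by
      ext s; simp [abs_le]
    rw [h1]
    exact ((convex_Icc _ _).linear_preimage _).inter ((convex_Icc _ _).linear_preimage _)
  have h := hconv.norm_image_sub_le_of_norm_deriv_le (f := LFunction χ) (C := W)
    (fun s _ => (differentiable_LFunction hχ) s)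
    (fun s hs => hd s hs.1.1 hs.1.2 hs.2) (x := 1) (y := 1 + x + I * t) (by simp)
    (by simp; constructor <;> linarith)
  refine h.trans ?_
  have hW : 0 ≤ W := (norm_nonneg _).trans (hd 1 (by simp) (by simp) (by simp))
  gcongr
  rw [show (1 + (x : ℂ) + I * t - 1) = x + I * t by ring]
  refine (norm_add_le _ _).trans ?_
  rw [norm_mul, Complex.norm_I, one_mul, norm_real, norm_real, norm_of_nonneg hx, norm_eq_abs]

/-- Lower bound for primitive Dirichlet `L`-functions just to the right of the line `Re s = 1`. -/
theorem LFunction_lower {ε : ℝ} (hε : 0 < ε) : ∃ c : ℝ, 0 < c ∧ ∀ (q : ℕ) [NeZero q] (χ : DirichletCharacter ℂ q),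
    χ.IsPrimitive → χ ≠ 1 → ∀ x t : ℝ, 0 < x → x ≤ 1 →
      c ≤ ‖LFunction χ (1 + x + I * t)‖ * (q * (|t| + 2)) ^ ε := by
  set η := min (ε / 20) (1 / 2) with hηd
  have hη : 0 < η := by rw [hηd]; positivity
  have hη2 : η ≤ 1 / 2 := min_le_right _ _
  have hηε : 20 * η ≤ ε := by have := min_le_left (ε / 20) (1 / 2); linarith
  obtain ⟨C, hC, h1⟩ := norm_LFunction_ge_of_sq hη hη2
  obtain ⟨D, hD, h2⟩ := norm_deriv_LFunction_le hη hη2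
  obtain ⟨cs, hcs, h3⟩ := siegel hη
  set a := min (cs / (8 * D)) 1 with ha
  have ha0 : 0 < a := by rw [ha]; positivity
  have ha1 : a ≤ 1 := min_le_right _ _
  have haD : a * (8 * D) ≤ cs := by
    have : a ≤ cs / (8 * D) := min_le_left _ _
    rwa [le_div_iff₀ (by positivity)] at this
  refine ⟨min (min (a ^ 4 / (5488 * C ^ 4)) (a / 7)) (cs / 2), by positivity, fun q _ χ hp hχ x t hx hx1 => ?_⟩
  have hq := one_le_cast_of_neZero q
  set Q := (q : ℝ) * (|t| + 2) with hQd
  have hqQ : (q : ℝ) ≤ Q := by rw [hQd]; nlinarith [abs_nonneg t]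
  have hQ : 1 ≤ Q := hq.trans hqQ
  have hQ0 : 0 < Q := by linarith
  have hfin : ∀ y e c : ℝ, 0 ≤ y → e ≤ ε → c ≤ y * Q ^ e → c ≤ y * Q ^ ε := fun y e c hy he hc =>
    hc.trans (mul_le_mul_of_nonneg_left (Real.rpow_le_rpow_of_exponent_le hQ he) hy)
  set τ := a * Q ^ (-(3 * η)) with hτd
  have hτ0 : 0 < τ := by positivity
  have hτ1 : τ ≤ 1 := by
    have : Q ^ (-(3 * η)) ≤ 1 := Real.rpow_le_one_of_one_le_of_nonpos hQ (by linarith)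
    calc τ ≤ 1 * 1 := by rw [hτd]; gcongr
      _ = 1 := one_mul 1
  set y := ‖LFunction χ (1 + x + I * t)‖ with hy
  have hy0 : 0 ≤ y := norm_nonneg _
  by_cases hcase : χ ^ 2 ≠ 1 ∨ τ ≤ |t|
  · refine (min_le_left _ _).trans ((min_le_left _ _).trans (hfin y (20 * η) _ hy0 hηε ?_))
    have := h1 q χ t τ hτ0 hτ1 (Or.inl hχ) hcase x hx hx1
    rw [← hy, ← hQd] at this
    have e : 1 / (5488 * (C * Q ^ (2 * η) / τ) ^ 4) = a ^ 4 / (5488 * C ^ 4) * Q ^ (-(20 * η)) := by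
      have e1 : C * Q ^ (2 * η) / τ = C / a * Q ^ (5 * η) := by
        rw [hτd, rpow_neg hQ0.le, show 5 * η = 2 * η + 3 * η by ring, Real.rpow_add hQ0]
        field_simp
      have e2 : Q ^ (20 * η) = (Q ^ (5 * η)) ^ 4 := by
        rw [← rpow_natCast, ← Real.rpow_mul hQ0.le]; congr 1; push_cast; ring
      rw [e1, rpow_neg hQ0.le, e2]
      field_simp
    rw [e, rpow_neg hQ0.le, ← div_eq_mul_inv, div_le_iff₀ (by positivity)] at this
    exact this
  push Not at hcase
  obtain ⟨hsq, htτ⟩ := hcase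
  by_cases hxτ : τ ≤ x
  · refine (min_le_left _ _).trans ((min_le_right _ _).trans (hfin y (3 * η) _ hy0 (by linarith) ?_))
    have h := LFunction_pow_four_ge_real χ hx hx1 t
    have h4 : a * Q ^ (-(3 * η)) / 7 ≤ y := (by rw [← hτd]; linarith : a * Q ^ (-(3 * η)) / 7 ≤ x / 7).trans h
    rw [rpow_neg hQ0.le] at h4
    have hpos : 0 < Q ^ (3 * η) := by positivity
    calc a / 7 = a * (Q ^ (3 * η))⁻¹ / 7 * Q ^ (3 * η) := by field_simp
      _ ≤ _ := by gcongr
  · push Not at hxτ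
    refine (min_le_right _ _).trans (hfin y η _ hy0 (by linarith) ?_)
    have hsub := norm_LFunction_sub_le χ hχ (W := D * Q ^ (2 * η)) hx.le (by linarith) (t := t) (by
      intro s hs1 hs3 hst
      refine (h2 q χ s (Or.inl hχ) hs1 hs3).trans ?_
      rw [hQd]; gcongr)
    have hs := h3 q χ hp hsq hχ
    have hL : cs ≤ ‖LFunction χ 1‖ * Q ^ η := hs.trans (by gcongr)
    have hW : D * Q ^ (2 * η) * (x + |t|) * Q ^ η ≤ cs / 4 := by
      have : x + |t| ≤ 2 * τ := by linarith
      calc D * Q ^ (2 * η) * (x + |t|) * Q ^ η ≤ D * Q ^ (2 * η) * (2 * τ) * Q ^ η := by gcongr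
        _ = 2 * D * a * (Q ^ (2 * η) * Q ^ η * Q ^ (-(3 * η))) := by rw [hτd]; ring
        _ = 2 * D * a := by
            rw [← Real.rpow_add hQ0, ← Real.rpow_add hQ0, show 2 * η + η + -(3 * η) = 0 by ring, Real.rpow_zero, mul_one]
        _ ≤ _ := by linarith
    have h5 : ‖LFunction χ 1‖ ≤ y + D * Q ^ (2 * η) * (x + |t|) := by
      have := norm_sub_norm_le (LFunction χ 1) (LFunction χ (1 + x + I * t))
      rw [norm_sub_rev] at this
      linarith
    have h6 := mul_le_mul_of_nonneg_right h5 (by positivity : 0 ≤ Q ^ η)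
    nlinarith

/-- Lower bound for `(s - 1) ζ(s)` just to the right of the line `Re s = 1`. -/
theorem polefree_one_lower {ε : ℝ} (hε : 0 < ε) : ∃ c : ℝ, 0 < c ∧ ∀ x t : ℝ, 0 < x → x ≤ 1 →
      c * (|t| + 2) ≤ ‖polefree (q := 1) 1 (1 + x + I * t)‖ * (|t| + 2) ^ ε := by
  set η := min (ε / 8) (1 / 2) with hηd
  have hη : 0 < η := by rw [hηd]; positivity
  have hηε : 8 * η ≤ ε := by have := min_le_left (ε / 8) (1 / 2); linarith
  obtain ⟨C, hC, h1⟩ := norm_LFunction_ge_of_sq hη (min_le_right _ _)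
  have hcont := (differentiable_polefree (q := 1) 1).continuous
  have hK : IsCompact (Set.Icc (1 : ℝ) 2 ×ℂ Set.Icc (-1 : ℝ) 1) := isCompact_Icc.reProdIm isCompact_Icc
  obtain ⟨z, hz, hmin⟩ := hK.exists_isMinOn ⟨1, by simp [Complex.mem_reProdIm]⟩ hcont.norm.continuousOn
  have hz0 : 0 < ‖polefree (q := 1) 1 z‖ := by
    rw [norm_pos_iff]
    rw [Complex.mem_reProdIm] at hz
    rcases eq_or_ne z 1 with rfl | hz1
    · intro h; have := polefree_one_pos; rw [h] at this; simp at this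
    · rw [polefree_eq _ hz1]
      exact mul_ne_zero (sub_ne_zero.2 hz1) (LFunction_ne_zero_of_one_le_re _ (Or.inr hz1) hz.1.1)
  refine ⟨min (1 / (5488 * C ^ 4)) ‖polefree (q := 1) 1 z‖ / 3, by positivity, fun x t hx hx1 => ?_⟩
  have hT : 1 ≤ |t| + 2 := by linarith [abs_nonneg t]
  have hT0 : 0 < |t| + 2 := by linarith
  have hTe : 1 ≤ (|t| + 2) ^ ε := Real.one_le_rpow hT hε.le
  by_cases ht : 1 ≤ |t|
  · have hl := min_le_left (1 / (5488 * C ^ 4)) ‖polefree (q := 1) 1 z‖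
    have h := h1 1 1 t 1 one_pos le_rfl (Or.inr ht) (Or.inr ht) x hx hx1
    have hne : (1 + (x : ℂ) + I * t) ≠ 1 := fun h => by
      have := congrArg Complex.re h; simp at this; linarith
    have hs1 : |t| ≤ ‖(1 + (x : ℂ) + I * t) - 1‖ := by
      have := abs_im_le_norm ((1 + (x : ℂ) + I * t) - 1)
      simp only [Complex.sub_im, Complex.add_im, Complex.one_im, Complex.ofReal_im, Complex.mul_im, Complex.I_re, Complex.I_im,
        ofReal_re] at this
      norm_num at this
      exact this
    rw [polefree_eq _ hne, norm_mul]
    rw [Nat.cast_one, one_mul, div_one] at h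
    have e : (5488 * (C * (|t| + 2) ^ (2 * η)) ^ 4) = 5488 * C ^ 4 * (|t| + 2) ^ (8 * η) := by
      have e2 : (|t| + 2) ^ (8 * η) = ((|t| + 2) ^ (2 * η)) ^ 4 := by
        rw [← rpow_natCast, ← Real.rpow_mul hT0.le]; congr 1; push_cast; ring
      rw [e2]; ring
    rw [e, ← div_div, div_le_iff₀ (by positivity)] at h
    have h5 : (|t| + 2) ^ (8 * η) ≤ (|t| + 2) ^ ε := Real.rpow_le_rpow_of_exponent_le hT hηε
    calc _ ≤ 1 / (5488 * C ^ 4) * |t| := by nlinarith [show 0 ≤ 1 / (5488 * C ^ 4) by positivity]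
      _ ≤ ‖LFunction (N := 1) 1 (1 + x + I * t)‖ * (|t| + 2) ^ ε *
          ‖1 + (x : ℂ) + I * t - 1‖ := by
          gcongr
          exact h.trans (by gcongr)
      _ = _ := by ring
  · push Not at ht
    have hr := min_le_right (1 / (5488 * C ^ 4)) ‖polefree (q := 1) 1 z‖
    have h := hmin (a := 1 + x + I * t) (by
      rw [Complex.mem_reProdIm]; simp only [Set.mem_Icc]
      have := abs_le.1 ht.le
      simp; exact ⟨⟨hx.le, by linarith⟩, this⟩)
    have h' : ‖polefree (q := 1) 1 z‖ ≤
        ‖polefree (q := 1) 1 (1 + x + I * t)‖ := h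
    refine le_trans ?_ (h'.trans (le_mul_of_one_le_right (norm_nonneg _) hTe))
    nlinarith

/-- von Mangoldt coefficients twisted by `χ`, with the main term removed when `χ` is trivial. -/
def vm {q : ℕ} [NeZero q] (χ : DirichletCharacter ℂ q) (n : ℕ) : ℂ :=
  χ (n : ZMod q) * (((vonMangoldt n : ℝ) : ℂ) - if χ = 1 then 1 else 0)

theorem lseriesSummable_vm {q : ℕ} [NeZero q] (χ : DirichletCharacter ℂ q) {s : ℂ} (hs : 1 < s.re) :
    LSeriesSummable (vm χ) s := by
  have h1 := χ.LSeriesSummable_twist_vonMangoldt hs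
  have h2 := (χ.LSeriesSummable_of_one_lt_re hs).smul (if χ = 1 then (1 : ℂ) else 0)
  refine (h1.sub h2).congr fun n => ?_
  congr 1
  funext m
  simp only [vm, Pi.sub_apply, Pi.mul_apply, Pi.smul_apply, smul_eq_mul]
  ring

theorem LSeries_vm {q : ℕ} [NeZero q] (χ : DirichletCharacter ℂ q) {s : ℂ} (hs : 1 < s.re) :
    LSeries (vm χ) s = -(deriv (LFunction χ) s / LFunction χ s) -
      (if χ = 1 then LFunction χ s else 0) := by
  have h1 := χ.LSeriesSummable_twist_vonMangoldt hs
  have h2 := χ.LSeriesSummable_of_one_lt_re hs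
  have h3 := χ.LSeries_twist_vonMangoldt_eq hs
  rw [← DirichletCharacter.deriv_LFunction_eq_deriv_LSeries χ hs, ← LFunction_eq_LSeries χ hs, neg_div] at h3
  rw [← h3]
  split_ifs with h
  · rw [LFunction_eq_LSeries χ hs, ← LSeries_sub h1 h2]
    refine LSeries_congr (fun {n} _ => ?_) s
    simp only [vm, Pi.sub_apply, Pi.mul_apply, if_pos h]
    ring
  · rw [sub_zero]
    refine LSeries_congr (fun {n} _ => ?_) s
    simp only [vm, Pi.mul_apply, if_neg h]
    ring

theorem norm_LSeries_logMul_vm {q : ℕ} [NeZero q] (χ : DirichletCharacter ℂ q) (k : ℕ) {s : ℂ} (hs : 1 < s.re) :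
    ‖LSeries (LSeries.logMul^[k] (vm χ)) s‖ = ‖iteratedDeriv k (LSeries (vm χ)) s‖ := by
  have h1 := (lseriesSummable_vm χ (s := ((s.re + 1) / 2 : ℝ)) (by rw [ofReal_re]; linarith)).abscissaOfAbsConv_le
  rw [ofReal_re] at h1
  rw [LSeries_iteratedDeriv k (h1.trans_lt (by exact_mod_cast (by linarith : (s.re + 1) / 2 < s.re))), norm_mul, norm_pow, norm_neg, norm_one, one_pow, one_mul]

theorem shift_bounds {q : ℕ} [NeZero q] {η x t : ℝ} (hη2 : η ≤ 1 / 2) (hx : 0 < x) (hx1 : x ≤ 1) {z : ℂ}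
    (hz : ‖z - (1 + x + I * t)‖ ≤ η) :
    1 - η ≤ z.re ∧ z.re ≤ 4 ∧ (q : ℝ) * (|z.im| + 2) ≤ 2 * (q * (|t| + 2)) ∧ ‖z - 1‖ ≤ |t| + 2 ∧ |t| - 1 / 2 ≤ |z.im| := by
  have a1 := abs_le.1 ((abs_re_le_norm _).trans hz)
  have a2 := (abs_im_le_norm _).trans hz
  have er : (1 + (x : ℂ) + I * t).re = 1 + x := by simp
  have ei : (1 + (x : ℂ) + I * t).im = t := by simp
  rw [Complex.sub_re, er] at a1
  rw [Complex.sub_im, ei] at a2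
  have a3 := abs_sub_abs_le_abs_sub z.im t
  have a4 := abs_sub_abs_le_abs_sub t z.im
  rw [abs_sub_comm] at a4
  have hq := one_le_cast_of_neZero q
  refine ⟨by linarith, by linarith, by nlinarith [abs_nonneg t], ?_, by linarith⟩
  have : z - 1 = (z - (1 + x + I * t)) + (x + I * t) := by ring
  rw [this]
  refine (norm_add_le _ _).trans ?_
  have : ‖(x : ℂ) + I * t‖ ≤ x + |t| := by
    refine (norm_add_le _ _).trans ?_
    rw [norm_mul, Complex.norm_I, one_mul, norm_real, norm_real, norm_of_nonneg hx.le, norm_eq_abs]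
  linarith

theorem one_div_six_mul_le (k : ℕ) : (1 : ℝ) / (6 * (k + 1)) ≤ 1 / 2 := by
  apply one_div_le_one_div_of_le (by norm_num)
  linarith [(Nat.cast_nonneg k : (0 : ℝ) ≤ k)]

theorem norm_iteratedDeriv_logDeriv_LFunction_le (k : ℕ) : ∃ C : ℝ, 0 ≤ C ∧ ∀ (q : ℕ) [NeZero q] (χ : DirichletCharacter ℂ q),
    χ.IsPrimitive → χ ≠ 1 → ∀ x t : ℝ, 0 < x → x ≤ 1 →
      ‖iteratedDeriv k (fun s => deriv (LFunction χ) s / LFunction χ s)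
        (1 + x + I * t)‖ ≤ C * (q * (|t| + 2)) ^ (1 / 2 : ℝ) := by
  set η : ℝ := 1 / (6 * (k + 1)) with hηd
  have hη : 0 < η := by rw [hηd]; positivity
  have hη2 : η ≤ 1 / 2 := one_div_six_mul_le k
  obtain ⟨C, hC, h1⟩ := norm_LFunction_le hη hη2
  obtain ⟨c, hc, h2⟩ := LFunction_lower hη
  refine ⟨k.factorial * (8 * (C * 2 ^ (2 * η)) / (η * c)) ^ (k + 1), by positivity, fun q _ χ hp hχ x t hx hx1 => ?_⟩
  set Q := (q : ℝ) * (|t| + 2) with hQd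
  have hq := one_le_cast_of_neZero q
  have hQ : 0 < Q := by rw [hQd]; positivity
  have h3 := h2 q χ hp hχ x t hx hx1
  have := norm_iteratedDeriv_logDeriv_le (LFunction χ) (differentiable_LFunction hχ)
    (1 + x + I * t) (R := η) (M := C * 2 ^ (2 * η) * Q ^ (2 * η)) (m := c * Q ^ (-η)) hη (by positivity)
    (fun z hz => by
      obtain ⟨b1, b2, b3, -, -⟩ := shift_bounds (q := q) hη2 hx hx1 hz.le
      refine (h1 q χ z hχ b1 b2).trans ?_
      rw [mul_assoc, ← mul_rpow (by norm_num) hQ.le]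
      gcongr) (by
      rw [rpow_neg hQ.le, ← div_eq_mul_inv, div_le_iff₀ (by positivity)]; exact h3) k
  refine this.trans (le_of_eq ?_)
  have e : 8 * (C * 2 ^ (2 * η) * Q ^ (2 * η)) / (η * (c * Q ^ (-η))) = 8 * (C * 2 ^ (2 * η)) / (η * c) * Q ^ (3 * η) := by
    rw [rpow_neg hQ.le, show 3 * η = 2 * η + η by ring, Real.rpow_add hQ]
    field_simp
  rw [e, mul_pow, ← mul_assoc, ← rpow_natCast (Q ^ (3 * η)), ← Real.rpow_mul hQ.le]
  congr 2
  rw [hηd]; push_cast; field_simp; norm_num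

theorem norm_iteratedDeriv_logDeriv_polefree_le (k : ℕ) : ∃ C : ℝ, 0 ≤ C ∧ ∀ x t : ℝ, 0 < x → x ≤ 1 →
      ‖iteratedDeriv k (fun s => deriv (polefree (q := 1) 1) s / polefree (q := 1) 1 s)
        (1 + x + I * t)‖ ≤ C * (|t| + 2) ^ (1 / 2 : ℝ) := by
  set η : ℝ := 1 / (6 * (k + 1)) with hηd
  have hη : 0 < η := by rw [hηd]; positivity
  have hη2 : η ≤ 1 / 2 := one_div_six_mul_le k
  obtain ⟨C, hC, h1⟩ := norm_polefree_le hη hη2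
  obtain ⟨c, hc, h2⟩ := polefree_one_lower hη
  refine ⟨k.factorial * (8 * (C * 2 ^ (2 * η) * 2) / (η * c)) ^ (k + 1), by positivity, fun x t hx hx1 => ?_⟩
  set Q := |t| + 2 with hQd
  have hQ : 0 < Q := by rw [hQd]; positivity
  have h3 := h2 x t hx hx1
  have := norm_iteratedDeriv_logDeriv_le (polefree (q := 1) 1) (differentiable_polefree _)
    (1 + x + I * t) (R := η) (M := C * 2 ^ (2 * η) * Q ^ (2 * η) * (2 * Q)) (m := c * Q * Q ^ (-η)) hη (by positivity)
    (fun z hz => by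
      obtain ⟨b1, b2, b3, b4, -⟩ := shift_bounds (q := 1) hη2 hx hx1 hz.le
      refine (h1 1 1 z b1 b2).trans ?_
      rw [mul_assoc C (2 ^ (2 * η)), ← mul_rpow (by norm_num) hQ.le, if_pos rfl]
      rw [Nat.cast_one, one_mul, one_mul] at b3
      rw [Nat.cast_one, one_mul]
      gcongr
      linarith [abs_nonneg t]) (by
      rw [rpow_neg hQ.le, ← div_eq_mul_inv, div_le_iff₀ (by positivity)]; exact h3) k
  refine this.trans (le_of_eq ?_)
  have e : 8 * (C * 2 ^ (2 * η) * Q ^ (2 * η) * (2 * Q)) / (η * (c * Q * Q ^ (-η))) =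
      8 * (C * 2 ^ (2 * η) * 2) / (η * c) * Q ^ (3 * η) := by
    rw [rpow_neg hQ.le, show 3 * η = 2 * η + η by ring, Real.rpow_add hQ]
    field_simp
  rw [e, mul_pow, ← mul_assoc, ← rpow_natCast (Q ^ (3 * η)), ← Real.rpow_mul hQ.le]
  congr 2
  rw [hηd]; push_cast; field_simp; norm_num

theorem polefree_one_one : polefree (q := 1) 1 1 = 1 := by
  simp [polefree, DirichletCharacter.LFunctionTrivChar₁]

theorem norm_iteratedDeriv_dslope_polefree_le (k : ℕ) : ∃ C : ℝ, 0 ≤ C ∧ ∀ x t : ℝ, 0 < x → x ≤ 1 →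
      ‖iteratedDeriv k (dslope (polefree (q := 1) 1) 1) (1 + x + I * t)‖ ≤
        C * (|t| + 2) ^ (1 / 2 : ℝ) := by
  set g := dslope (polefree (q := 1) 1) 1 with hg
  have hgd : Differentiable ℂ g := by
    intro s
    have := (Complex.differentiableOn_dslope (c := 1) (s := Set.univ) (f := polefree (q := 1) 1)
      Filter.univ_mem).2 (differentiable_polefree _).differentiableOn
    exact (this s trivial).differentiableAt Filter.univ_mem
  set η : ℝ := 1 / 4 with hηd
  obtain ⟨C, hC, h1⟩ := norm_LFunction_le_of_sub_one (η := η) (by norm_num) (by norm_num)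
  obtain ⟨D, hD⟩ := (isCompact_closedBall (1 : ℂ) 1).exists_bound_of_continuousOn hgd.continuous.continuousOn
  have hD0 : 0 ≤ D := (norm_nonneg _).trans (hD 1 (by simp))
  refine ⟨k.factorial * (2 * C + 1 + D) / η ^ k, by positivity, fun x t hx hx1 => ?_⟩
  set Q := |t| + 2 with hQd
  have hQ : 1 ≤ Q := by rw [hQd]; linarith [abs_nonneg t]
  have hQ1 : 1 ≤ Q ^ (1 / 2 : ℝ) := Real.one_le_rpow hQ (by norm_num)
  refine (Complex.norm_iteratedDeriv_le_of_forall_mem_sphere_norm_le k (by norm_num : (0:ℝ) < η) hgd.diffContOnCl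
    (C := (2 * C + 1 + D) * Q ^ (1 / 2 : ℝ)) ?_).trans (le_of_eq (by ring))
  intro z hz
  rw [mem_sphere_iff_norm] at hz
  obtain ⟨b1, b2, b3, b4, -⟩ := shift_bounds (q := 1) (by norm_num) hx hx1 hz.le
  rw [Nat.cast_one, one_mul, one_mul] at b3
  by_cases hz1 : ‖z - 1‖ ≤ 1
  · have := hD z (mem_closedBall_iff_norm.2 hz1)
    nlinarith
  · push Not at hz1
    have hne : z ≠ 1 := fun h => by rw [h] at hz1; norm_num at hz1
    have h3 := h1 1 1 z 1 one_pos le_rfl (Or.inr hz1.le) b1 b2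
    rw [Nat.cast_one, one_mul, div_one] at h3
    have h4 : (|z.im| + 2) ^ (2 * η) ≤ 2 * Q ^ (1 / 2 : ℝ) := by
      calc (|z.im| + 2) ^ (2 * η) ≤ (2 * Q) ^ (2 * η) := by gcongr
        _ = 2 ^ (1 / 2 : ℝ) * Q ^ (1 / 2 : ℝ) := by
          rw [mul_rpow (by norm_num) (by linarith), hηd]; norm_num
        _ ≤ 2 ^ (1 : ℝ) * Q ^ (1 / 2 : ℝ) := by gcongr <;> norm_num
        _ = _ := by rw [Real.rpow_one]
    rw [hg, dslope_of_ne _ hne, slope_def_field, polefree_one_one, polefree_eq _ hne]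
    have h5 : z - 1 ≠ 0 := sub_ne_zero.2 hne
    have : ((z - 1) * LFunction (N := 1) 1 z - 1) / (z - 1) =
        LFunction (N := 1) 1 z - (z - 1)⁻¹ := by field_simp
    rw [this]
    refine (norm_sub_le _ _).trans ?_
    rw [norm_inv]
    have h6 : ‖z - 1‖⁻¹ ≤ 1 := inv_le_one_of_one_le₀ hz1.le
    have h7 : C * (|z.im| + 2) ^ (2 * η) ≤ C * (2 * Q ^ (1 / 2 : ℝ)) := by gcongr
    have h8 : 0 ≤ D * Q ^ (1 / 2 : ℝ) := mul_nonneg hD0 (by linarith)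
    calc _ ≤ C * (2 * Q ^ (1 / 2 : ℝ)) + 1 := add_le_add (h3.trans h7) h6
      _ ≤ _ := by linarith

theorem norm_LSeries_logMul_vm_le (k : ℕ) : ∃ C : ℝ, 0 ≤ C ∧ ∀ (q : ℕ) [NeZero q] (χ : DirichletCharacter ℂ q),
    χ.IsPrimitive → ∀ x t : ℝ, 0 < x → x ≤ 1 →
      ‖LSeries (LSeries.logMul^[k] (vm χ)) (1 + x + I * t)‖ ≤ C * (q * (|t| + 2)) ^ (1 / 2 : ℝ) := by
  obtain ⟨C1, h1, H1⟩ := norm_iteratedDeriv_logDeriv_LFunction_le k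
  obtain ⟨C2, h2, H2⟩ := norm_iteratedDeriv_logDeriv_polefree_le k
  obtain ⟨C3, h3, H3⟩ := norm_iteratedDeriv_dslope_polefree_le k
  refine ⟨C1 + C2 + C3, by positivity, fun q _ χ hp x t hx hx1 => ?_⟩
  have hs : 1 < (1 + (x : ℂ) + I * t).re := by simpa using hx
  set s := 1 + (x : ℂ) + I * t with hsd
  have hev : ∀ᶠ z in nhds s, 1 < z.re :=
    (isOpen_lt continuous_const continuous_re).mem_nhds hs
  rw [norm_LSeries_logMul_vm χ k hs]
  have hQ : 0 ≤ ((q : ℝ) * (|t| + 2)) ^ (1 / 2 : ℝ) := by positivity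
  by_cases hχ : χ = 1
  · have hq : q = 1 := by
      have := (DirichletCharacter.eq_one_iff_conductor_eq_one (χ := χ) ).1 hχ
      rwa [hp] at this
    subst hq
    subst hχ
    have e : LSeries (vm (1 : DirichletCharacter ℂ 1)) =ᶠ[nhds s] fun z =>
        -(deriv (polefree (q := 1) 1) z / polefree (q := 1) 1 z) -
          dslope (polefree (q := 1) 1) 1 z := by
      filter_upwards [hev] with z hz
      have hne : z ≠ 1 := fun h => by rw [h] at hz; norm_num at hz
      have h5 : z - 1 ≠ 0 := sub_ne_zero.2 hne
      have hL := LFunction_ne_zero_of_one_le_re (1 : DirichletCharacter ℂ 1) (Or.inr hne) hz.le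
      have hd : deriv (polefree (q := 1) 1) z =
          LFunction (N := 1) 1 z +
            (z - 1) * deriv (LFunction (N := 1) 1) z := by
        have : polefree (q := 1) 1 =ᶠ[nhds z]
            fun w => (w - 1) * LFunction (N := 1) 1 w := by
          filter_upwards [isOpen_ne.mem_nhds hne] with w hw
          exact polefree_eq _ hw
        rw [this.deriv_eq, deriv_fun_mul (by fun_prop) (DirichletCharacter.differentiableAt_LFunction _ _ (Or.inl hne))]
        simp
      rw [LSeries_vm _ hz, if_pos rfl, hd, dslope_of_ne _ hne, slope_def_field, polefree_one_one, polefree_eq _ hne]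
      field_simp
      ring
    have hne : s ≠ 1 := fun h => by rw [h] at hs; norm_num at hs
    have c1 : ContDiffAt ℂ k (fun z => deriv (polefree (q := 1) 1) z / polefree (q := 1) 1 z) s := by
      have hd := differentiable_polefree (q := 1) 1
      have := hd.contDiff (n := (k + 1 : ℕ))
      refine ContDiffAt.div ?_ hd.contDiff.contDiffAt ?_
      · exact (ContDiff.iterate_deriv' k 1 (by exact_mod_cast hd.contDiff)).contDiffAt
      · rw [polefree_eq _ hne]
        exact mul_ne_zero (sub_ne_zero.2 hne)
          (LFunction_ne_zero_of_one_le_re (1 : DirichletCharacter ℂ 1) (Or.inr hne) hs.le)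
    have c2 : ContDiffAt ℂ k (dslope (polefree (q := 1) 1) 1) s := by
      have := (Complex.differentiableOn_dslope (c := 1) (s := Set.univ) (f := polefree (q := 1) 1)
        Filter.univ_mem).2 (differentiable_polefree _).differentiableOn
      exact (differentiableOn_univ.1 this).contDiff.contDiffAt
    rw [e.iteratedDeriv_eq, iteratedDeriv_fun_sub c1.neg c2, iteratedDeriv_fun_neg]
    refine (norm_sub_le _ _).trans ?_
    rw [norm_neg]
    have a1 := H2 x t hx hx1
    have a2 := H3 x t hx hx1
    rw [Nat.cast_one, one_mul] at hQ ⊢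
    nlinarith [mul_nonneg h1 hQ]
  · have e : LSeries (vm χ) =ᶠ[nhds s] fun z =>
        -(deriv (LFunction χ) z / LFunction χ z) := by
      filter_upwards [hev] with z hz
      rw [LSeries_vm _ hz, if_neg hχ, sub_zero]
    rw [e.iteratedDeriv_eq, iteratedDeriv_fun_neg, norm_neg]
    have := H1 q χ hp hχ x t hx hx1
    nlinarith [mul_nonneg h2 hQ, mul_nonneg h3 hQ]

theorem integrableOn_mul_exp_neg {c : ℝ} (hc : 0 < c) :
    IntegrableOn (fun v : ℝ => v * Real.exp (-c * v)) (Set.Ioi 0) := by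
  have := integrableOn_rpow_mul_exp_neg_mul_rpow (p := 1) (s := 1) (by norm_num) one_pos hc
  simpa using this

theorem integral_mul_cexp_neg {s : ℂ} (hs : 0 < s.re) :
    ∫ v : ℝ in Set.Ioi 0, (v : ℂ) * Complex.exp (-(s * v)) = (s ^ 2)⁻¹ := by
  have hs0 : s ≠ 0 := fun h => by rw [h] at hs; simp at hs
  have hn : ∀ v : ℝ, ‖Complex.exp (-(s * v))‖ = Real.exp (-s.re * v) := fun v => by
    rw [Complex.norm_exp]; simp
  have := integral_Ioi_of_hasDerivAt_of_tendsto' (a := 0)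
    (f := fun v : ℝ => -(((v : ℂ) / s + (s ^ 2)⁻¹) * Complex.exp (-(s * v))))
    (f' := fun v : ℝ => (v : ℂ) * Complex.exp (-(s * v))) (m := 0) ?_ ?_ ?_
  · rw [this]; simp
  · intro v _
    have h1 : HasDerivAt (fun v : ℝ => (v : ℂ)) 1 v := Complex.ofRealCLM.hasDerivAt
    have h2 : HasDerivAt (fun v : ℝ => Complex.exp (-(s * v))) (Complex.exp (-(s * v)) * -(s * 1)) v :=
      (h1.const_mul s).fun_neg.cexp
    have h3 := ((((h1.div_const s).add_const ((s ^ 2)⁻¹)).fun_mul h2)).fun_neg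
    refine h3.congr_deriv ?_
    field_simp
    ring
  · refine (integrableOn_mul_exp_neg hs).mono' (Continuous.aestronglyMeasurable (by fun_prop)) ?_
    refine (ae_restrict_iff' measurableSet_Ioi).2 (Filter.Eventually.of_forall fun v hv => ?_)
    rw [norm_mul, hn, norm_real, norm_of_nonneg (le_of_lt hv)]
  · rw [tendsto_zero_iff_norm_tendsto_zero]
    have h1 := Real.tendsto_pow_mul_exp_neg_atTop_nhds_zero 1
    have h2 := (h1.comp (Filter.tendsto_id.const_mul_atTop hs)).mul_const (1 / (s.re * ‖s‖))
    have h4 := Real.tendsto_exp_neg_atTop_nhds_zero.comp (Filter.tendsto_id.const_mul_atTop hs)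
    have h3 := h2.add (h4.mul_const ‖(s ^ 2)⁻¹‖)
    rw [zero_mul, zero_mul, add_zero] at h3
    refine squeeze_zero' (Filter.Eventually.of_forall fun v => norm_nonneg _) ?_ h3
    filter_upwards [Filter.eventually_ge_atTop 0] with v hv
    rw [norm_neg, norm_mul, hn]
    simp only [Function.comp, id, pow_one]
    have : ‖(v : ℂ) / s + (s ^ 2)⁻¹‖ ≤ v / ‖s‖ + ‖(s ^ 2)⁻¹‖ := by
      refine (norm_add_le _ _).trans ?_
      rw [norm_div, norm_real, norm_of_nonneg hv]
    have hs1 : 0 < ‖s‖ := norm_pos_iff.2 hs0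
    calc _ ≤ (v / ‖s‖ + ‖(s ^ 2)⁻¹‖) * Real.exp (-s.re * v) := by gcongr
      _ = _ := by
        rw [neg_mul]; field_simp

theorem integrable_inv_sq_vertical {c : ℝ} (hc : 0 < c) :
    Integrable fun w : ℝ => (((c : ℂ) + I * (2 * Real.pi * w : ℝ)) ^ 2)⁻¹ := by
  have h0 : ∀ w : ℝ, (c : ℂ) + I * (2 * Real.pi * w : ℝ) ≠ 0 := fun w h => by
    have := congrArg Complex.re h
    simp at this; linarith
  have h1 := (integrable_inv_one_add_sq.const_mul (1 + 1 / c ^ 2))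
  refine h1.mono' ?_ (Filter.Eventually.of_forall fun w => ?_)
  · refine Continuous.aestronglyMeasurable ?_
    exact Continuous.inv₀ (by fun_prop) fun w => pow_ne_zero 2 (h0 w)
  · rw [norm_inv, norm_pow, Complex.sq_norm, Complex.normSq_apply]
    simp only [Complex.add_re, ofReal_re, Complex.mul_re, Complex.I_re, Complex.I_im, Complex.ofReal_im,
      Complex.add_im, Complex.mul_im]
    have hp : 1 ≤ Real.pi := by linarith [Real.pi_gt_three]
    simp only [mul_zero, zero_mul, sub_zero, zero_add, add_zero, one_mul]
    have hcw : 0 < c * c + 2 * Real.pi * w * (2 * Real.pi * w) :=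
      add_pos_of_pos_of_nonneg (mul_pos hc hc) (mul_self_nonneg _)
    rw [← one_div, ← one_div, div_le_iff₀ hcw]
    have : 0 < 1 + w ^ 2 := by positivity
    have hw : w ^ 2 ≤ 2 * Real.pi * w * (2 * Real.pi * w) := by
      have := mul_nonneg (sq_nonneg w) (by nlinarith : 0 ≤ 4 * Real.pi ^ 2 - 1)
      linarith
    have e : (1 + 1 / c ^ 2) * (1 / (1 + w ^ 2)) * (c ^ 2 + w ^ 2) = 1 + (c ^ 2 + w ^ 2 / c ^ 2) / (1 + w ^ 2) := by
      field_simp; ring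
    calc (1 : ℝ) ≤ 1 + (c ^ 2 + w ^ 2 / c ^ 2) / (1 + w ^ 2) := by
          have : 0 ≤ (c ^ 2 + w ^ 2 / c ^ 2) / (1 + w ^ 2) := by positivity
          linarith
      _ = (1 + 1 / c ^ 2) * (1 / (1 + w ^ 2)) * (c ^ 2 + w ^ 2) := e.symm
      _ ≤ _ := by
        gcongr
        exact (sq c).le

theorem perron_kernel {c : ℝ} (hc : 0 < c) (y : ℝ) :
    ∫ w : ℝ, Complex.exp (((c : ℂ) + I * (2 * Real.pi * w : ℝ)) * y) /
      ((c : ℂ) + I * (2 * Real.pi * w : ℝ)) ^ 2 = ((max y 0 : ℝ) : ℂ) := by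
  set f : ℝ → ℂ := fun v => ((max v 0 * Real.exp (-c * v) : ℝ) : ℂ) with hf
  have hfc : Continuous f := by rw [hf]; fun_prop
  have hind : (fun v : ℝ => max v 0 * Real.exp (-c * v)) = Set.indicator (Set.Ioi 0) fun v => v * Real.exp (-c * v) := by
    funext v
    by_cases hv : 0 < v
    · rw [Set.indicator_of_mem (by exact hv), max_eq_left hv.le]
    · rw [Set.indicator_of_notMem (by exact hv), max_eq_right (not_lt.1 hv), zero_mul]
  have hfi : Integrable f := by
    have : Integrable fun v : ℝ => max v 0 * Real.exp (-c * v) := by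
      rw [hind]
      exact (integrableOn_mul_exp_neg hc).integrable_indicator measurableSet_Ioi
    exact this.ofReal
  have hF : FourierTransform.fourier f = fun w : ℝ => (((c : ℂ) + I * (2 * Real.pi * w : ℝ)) ^ 2)⁻¹ := by
    funext w
    rw [Real.fourier_real_eq_integral_exp_smul]
    have e : (fun v : ℝ => Complex.exp (↑(-2 * Real.pi * v * w) * I) • f v) =
        Set.indicator (Set.Ioi 0) fun v : ℝ => (v : ℂ) *
          Complex.exp (-(((c : ℂ) + I * (2 * Real.pi * w : ℝ)) * v)) := by
      funext v
      have h1 : max v 0 * Real.exp (-c * v) = _ := congrFun hind v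
      simp only [hf, h1]
      by_cases hv : 0 < v
      · rw [Set.indicator_of_mem (by exact hv), Set.indicator_of_mem (by exact hv)]
        rw [smul_eq_mul, ofReal_mul v, Complex.ofReal_exp,
          mul_left_comm, ← Complex.exp_add]
        congr 2
        push_cast; ring
      · rw [Set.indicator_of_notMem (by exact hv), Set.indicator_of_notMem (by exact hv)]
        simp
    rw [e, integral_indicator measurableSet_Ioi, integral_mul_cexp_neg (by simpa using hc)]
  have h1 := hfi.fourierInv_fourier_eq (by rw [hF]; exact integrable_inv_sq_vertical hc) (v := y) hfc.continuousAt
  rw [Real.fourierInv_eq', hF] at h1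
  have e2 : (fun w : ℝ => Complex.exp (((c : ℂ) + I * (2 * Real.pi * w : ℝ)) * y) /
      ((c : ℂ) + I * (2 * Real.pi * w : ℝ)) ^ 2) = fun w : ℝ => Complex.exp ((c * y : ℝ)) *
      (Complex.exp (↑(2 * Real.pi * inner ℝ w y) * I) • (((c : ℂ) + I * (2 * Real.pi * w : ℝ)) ^ 2)⁻¹) := by
    funext w
    rw [smul_eq_mul, ← mul_assoc, ← Complex.exp_add, div_eq_mul_inv]
    congr 2
    simp only [RCLike.inner_apply, conj_trivial]
    push_cast; ring
  rw [e2, integral_const_mul, h1, hf]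
  simp only
  rw [← Complex.ofReal_exp, ← ofReal_mul]
  congr 1
  rw [mul_left_comm, ← Real.exp_add]
  simp

/-- Perron bound: smoothed partial sums are controlled by the Dirichlet series on a vertical line. -/
theorem perron_bound : ∃ I0 : ℝ, 0 ≤ I0 ∧ ∀ (a : ℕ → ℂ) (c K X : ℝ), 1 ≤ c → 1 ≤ X → LSeriesSummable a c →
    (∀ t : ℝ, ‖LSeries a (c + I * t)‖ ≤ K * (|t| + 2) ^ (1 / 2 : ℝ)) →
    ‖∑ n ∈ Icc 1 ⌊X⌋₊, a n * (log (X / n) : ℝ)‖ ≤ I0 * K * X ^ c := by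
  set J : ℝ → ℝ := fun w => 6 * (1 + ‖w‖) ^ (-(3 / 2 : ℝ)) with hJ
  have hJi : Integrable J :=
    (integrable_one_add_norm (by norm_num)).const_mul 6
  refine ⟨∫ w, J w, integral_nonneg fun w => by rw [hJ]; positivity, fun a c K X hc hX hs hK => ?_⟩
  have hc0 : 0 < c := by linarith
  have hX0 : 0 < X := by linarith
  set z : ℝ → ℂ := fun w => (c : ℂ) + I * (2 * Real.pi * w : ℝ) with hz
  have hzre : ∀ w, (z w).re = c := fun w => by simp [hz]
  have hz0 : ∀ w, z w ≠ 0 := fun w h => by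
    have := hzre w; rw [h, Complex.zero_re] at this; linarith
  have hK0 : 0 ≤ K := by
    have := (norm_nonneg _).trans (hK 0)
    exact nonneg_of_mul_nonneg_left this (by positivity)
  have hXz : ∀ w, ‖(X : ℂ) ^ z w‖ = X ^ c := fun w => by
    rw [Complex.norm_cpow_eq_rpow_re_of_pos hX0, hzre]
  set F : ℕ → ℝ → ℂ := fun n w => LSeries.term a (z w) n * ((X : ℂ) ^ z w * ((z w) ^ 2)⁻¹) with hF
  have hzc : Continuous z := by rw [hz]; fun_prop
  have hnorm : ∀ n w, ‖F n w‖ = ‖LSeries.term a c n‖ * X ^ c * ‖((z w) ^ 2)⁻¹‖ := fun n w => by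
    rw [hF]; simp only
    rw [norm_mul, norm_mul, hXz, LSeries.norm_term_eq, LSeries.norm_term_eq, hzre, ofReal_re, mul_assoc]
  have hv_int := integrable_inv_sq_vertical hc0
  have hFi : ∀ n, Integrable (F n) := fun n => by
    refine (hv_int.norm.const_mul (‖LSeries.term a c n‖ * X ^ c)).mono' ?_
      (Filter.Eventually.of_forall fun w => (hnorm n w).le)
    refine Continuous.aestronglyMeasurable ?_
    refine Continuous.mul ?_ (Continuous.mul ?_ (Continuous.inv₀ (by fun_prop) fun w => pow_ne_zero 2 (hz0 w)))
    · rcases eq_or_ne n 0 with rfl | hn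
      · simp only [LSeries.term_zero]; exact continuous_const
      · simp only [LSeries.term_of_ne_zero hn]
        refine continuous_const.div ?_ fun w => by simp [Complex.cpow_eq_zero_iff, hn]
        exact hzc.const_cpow (Or.inl (by exact_mod_cast hn))
    · exact hzc.const_cpow (Or.inl (by exact_mod_cast hX0.ne'))
  have hsum : Summable fun n => ∫ w, ‖F n w‖ := by
    simp_rw [hnorm]
    simp_rw [integral_const_mul]
    exact (hs.norm.mul_right _).mul_right _
  have h1 := hasSum_integral_of_summable_integral_norm hFi hsum
  have hG : ∀ n, ∫ w, F n w = if n ∈ Icc 1 ⌊X⌋₊ then a n * (log (X / n) : ℝ) else 0 := fun n => by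
    rcases eq_or_ne n 0 with rfl | hn
    · simp [hF]
    · have hn0 : (0 : ℝ) < n := by exact_mod_cast Nat.pos_of_ne_zero hn
      have e : F n = fun w => a n * (Complex.exp (z w * (log (X / n) : ℝ)) / (z w) ^ 2) := by
        funext w
        rw [hF]; simp only
        rw [LSeries.term_of_ne_zero hn, Complex.cpow_def_of_ne_zero (x := (n : ℂ)) (by exact_mod_cast hn),
          Complex.cpow_def_of_ne_zero (x := (X : ℂ)) (by exact_mod_cast hX0.ne'), Real.log_div hX0.ne' hn0.ne', ofReal_sub,
          mul_sub, Complex.exp_sub, Complex.ofReal_log hX0.le, Complex.ofReal_log hn0.le, mul_comm (z w), mul_comm (z w),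
          Complex.ofReal_natCast]
        ring
      rw [e, integral_const_mul, perron_kernel hc0]
      have hiff : n ∈ Icc 1 ⌊X⌋₊ ↔ (n : ℝ) ≤ X := by
        rw [mem_Icc, Nat.le_floor_iff hX0.le]
        exact ⟨fun h => h.2, fun h => ⟨Nat.pos_of_ne_zero hn, h⟩⟩
      split_ifs with h
      · rw [max_eq_left (Real.log_nonneg ((one_le_div hn0).2 (hiff.1 h)))]
      · rw [max_eq_right (Real.log_nonpos (by positivity) ((div_le_one hn0).2 (not_le.1 (mt hiff.2 h)).le))]
        simp
  simp_rw [hG] at h1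
  have h2 : ∑ n ∈ Icc 1 ⌊X⌋₊, a n * (log (X / n) : ℝ) = ∫ w, ∑' n, F n w := by
    rw [← h1.tsum_eq, tsum_eq_sum (s := Icc 1 ⌊X⌋₊) (fun n hn => if_neg hn)]
    exact sum_congr rfl fun n hn => (if_pos hn).symm
  rw [h2, mul_assoc, mul_comm (∫ w, J w), ← integral_const_mul]
  refine norm_integral_le_of_norm_le (hJi.const_mul _) (Filter.Eventually.of_forall fun w => ?_)
  rw [hF]; simp only
  rw [tsum_mul_right, norm_mul, norm_mul, hXz, norm_inv, norm_pow, Complex.sq_norm, Complex.normSq_apply]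
  have h3 := hK (2 * Real.pi * w)
  change ‖LSeries a (z w)‖ ≤ _ at h3
  have h4 : (|2 * Real.pi * w| + 2) ^ (1 / 2 : ℝ) ≤ 3 * (1 + ‖w‖) ^ (1 / 2 : ℝ) := by
    have : (3 : ℝ) = 9 ^ (1 / 2 : ℝ) := by
      rw [← Real.sqrt_eq_rpow, show (9 : ℝ) = 3 ^ 2 by norm_num, Real.sqrt_sq (by norm_num)]
    rw [this, ← mul_rpow (by norm_num) (by positivity)]
    gcongr
    rw [abs_mul, abs_of_pos Real.two_pi_pos, norm_eq_abs]
    nlinarith [abs_nonneg w, Real.pi_lt_four]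
  have h5 : ((z w).re * (z w).re + (z w).im * (z w).im)⁻¹ ≤ 2 * (1 + ‖w‖) ^ (-2 : ℝ) := by
    have him : (z w).im = 2 * Real.pi * w := by simp [hz]
    rw [hzre, him, rpow_neg (by positivity), Real.rpow_two, ← div_eq_mul_inv, inv_eq_one_div, div_le_div_iff₀
      (by nlinarith [mul_self_nonneg (2 * Real.pi * w)]) (by positivity), one_mul, norm_eq_abs]
    have hp : 1 ≤ Real.pi := by linarith [Real.pi_gt_three]
    have := mul_nonneg (sq_nonneg w) (by nlinarith : 0 ≤ 4 * Real.pi ^ 2 - 1)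
    nlinarith [sq_abs w, sq_nonneg (|w| - 1)]
  calc _ ≤ K * (3 * (1 + ‖w‖) ^ (1 / 2 : ℝ)) * (X ^ c * (2 * (1 + ‖w‖) ^ (-2 : ℝ))) := by
        have := h3.trans (mul_le_mul_of_nonneg_left h4 hK0)
        refine mul_le_mul this (mul_le_mul_of_nonneg_left h5 (by positivity)) ?_ (by positivity)
        exact mul_nonneg (by positivity) (inv_nonneg.2 (add_nonneg (mul_self_nonneg _) (mul_self_nonneg _)))
    _ = _ := by
      rw [hJ]; simp only
      rw [show -(3 / 2 : ℝ) = 1 / 2 + (-2) by norm_num, Real.rpow_add (by positivity)]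
      ring

theorem sum_Ioc_mul_eq_abel (b g : ℕ → ℂ) {M Y : ℕ} (hMY : M ≤ Y) :
    ∑ n ∈ Ioc M Y, b n * g n =
      ∑ n ∈ Ioc M Y, (∑ j ∈ Ioc M n, b j) * (g n - g (n + 1)) + (∑ j ∈ Ioc M Y, b j) * g (Y + 1) := by
  induction Y, hMY using Nat.le_induction with
  | base => simp
  | succ Y h ih =>
    rw [sum_Ioc_succ_top (by omega), sum_Ioc_succ_top (by omega), ih, sum_Ioc_succ_top (f := b) (by omega)]
    ring

theorem abel_norm_le (b g : ℕ → ℂ) {M Y : ℕ} (hMY : M ≤ Y) {B : ℝ}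
    (hB : ∀ y, M ≤ y → y ≤ Y → ‖∑ n ∈ Ioc M y, b n‖ ≤ B) :
    ‖∑ n ∈ Ioc M Y, b n * g n‖ ≤ B * (∑ n ∈ Ioc M Y, ‖g n - g (n + 1)‖ + ‖g (Y + 1)‖) := by
  rw [sum_Ioc_mul_eq_abel b g hMY, mul_add, mul_sum]
  refine (norm_add_le _ _).trans (add_le_add ((norm_sum_le _ _).trans (sum_le_sum fun n hn => ?_)) ?_)
  · rw [norm_mul]
    rw [mem_Ioc] at hn
    exact mul_le_mul_of_nonneg_right (hB n hn.1.le hn.2) (norm_nonneg _)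
  · rw [norm_mul]
    exact mul_le_mul_of_nonneg_right (hB Y hMY le_rfl) (norm_nonneg _)

theorem abel_antitone_norm_le (b : ℕ → ℂ) (g : ℕ → ℝ) {M Y : ℕ} (hMY : M ≤ Y) {B : ℝ}
    (hg : ∀ n, M < n → g (n + 1) ≤ g n) (hg0 : ∀ n, M < n → 0 ≤ g n)
    (hB : ∀ y, M ≤ y → y ≤ Y → ‖∑ n ∈ Ioc M y, b n‖ ≤ B) :
    ‖∑ n ∈ Ioc M Y, b n * (g n : ℂ)‖ ≤ B * g (M + 1) := by
  refine (abel_norm_le b (fun n => (g n : ℂ)) hMY hB).trans (le_of_eq ?_)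
  congr 1
  rw [norm_real, norm_of_nonneg (hg0 _ (by omega))]
  have : ∑ n ∈ Ioc M Y, ‖(g n : ℂ) - g (n + 1)‖ = ∑ n ∈ Ioc M Y, (g n - g (n + 1)) := by
    refine sum_congr rfl fun n hn => ?_
    rw [mem_Ioc] at hn
    rw [← ofReal_sub, norm_real, norm_of_nonneg (sub_nonneg.2 (hg n hn.1))]
  rw [this]
  clear this hB
  induction Y, hMY using Nat.le_induction with
  | base => simp
  | succ Y h ih => rw [sum_Ioc_succ_top (by omega)]; linarith

theorem logMul_iterate_apply (f : ℕ → ℂ) (k n : ℕ) :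
    LSeries.logMul^[k] f n = ((log n ^ k : ℝ) : ℂ) * f n := by
  induction k generalizing n with
  | zero => simp
  | succ k ih =>
    rw [Function.iterate_succ_apply', LSeries.logMul, ih, ← Complex.natCast_log, pow_succ]
    push_cast; ring

theorem norm_vm_le {q : ℕ} [NeZero q] (χ : DirichletCharacter ℂ q) {n : ℕ} :
    ‖vm χ n‖ ≤ log n + 1 := by
  rw [vm, norm_mul]
  have h1 : ‖((vonMangoldt n : ℝ) : ℂ) - if χ = 1 then 1 else 0‖ ≤ log n + 1 := by
    refine (norm_sub_le _ _).trans (add_le_add ?_ (by split_ifs <;> simp))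
    rw [norm_real, norm_of_nonneg vonMangoldt_nonneg]
    exact vonMangoldt_le_log
  calc _ ≤ 1 * _ := mul_le_mul_of_nonneg_right (χ.norm_le_one _) (norm_nonneg _)
    _ ≤ _ := by rw [one_mul]; exact h1

theorem log_pow_le_factorial_mul {x : ℝ} (hx : 1 ≤ x) (m : ℕ) : log x ^ m ≤ m.factorial * x := by
  have h := Real.pow_div_factorial_le_exp _ (Real.log_nonneg hx) m
  rw [Real.exp_log (by linarith), div_le_iff₀ (by positivity)] at h
  linarith

theorem norm_smoothed_vm_le (k : ℕ) : ∃ C : ℝ, 0 ≤ C ∧ ∀ (q : ℕ) [NeZero q] (χ : DirichletCharacter ℂ q),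
    χ.IsPrimitive → ∀ X : ℝ, 3 ≤ X →
      ‖∑ n ∈ Icc 1 ⌊X⌋₊, (((log n ^ k : ℝ) : ℂ) * vm χ n) * (log (X / n) : ℝ)‖ ≤ C * q * X := by
  obtain ⟨I0, hI0, h1⟩ := perron_bound
  obtain ⟨C, hC, h2⟩ := norm_LSeries_logMul_vm_le k
  refine ⟨I0 * C * Real.exp 1, by positivity, fun q _ χ hp X hX => ?_⟩
  have hlog : 1 ≤ log X := by
    rw [Real.le_log_iff_exp_le (by linarith)]; linarith [Real.exp_one_lt_d9]
  have hx0 : 0 < 1 / log X := by positivity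
  have hx1 : 1 / log X ≤ 1 := (div_le_one (by linarith)).2 hlog
  have hq := one_le_cast_of_neZero q
  have := h1 (LSeries.logMul^[k] (vm χ)) (1 + 1 / log X) (C * q) X (by linarith) (by linarith) ?_ ?_
  · simp_rw [logMul_iterate_apply] at this
    refine this.trans (le_of_eq ?_)
    rw [Real.rpow_add (by linarith), Real.rpow_one, Real.rpow_def_of_pos (x := X) (by linarith),
      mul_one_div_cancel (by linarith)]
    ring
  · have hs := (lseriesSummable_vm χ (s := ((1 + 1 / log X / 2 : ℝ) : ℂ)) (by rw [ofReal_re]; linarith)).abscissaOfAbsConv_le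
    rw [ofReal_re] at hs
    have : LSeries.abscissaOfAbsConv (vm χ) < (((1 + 1 / log X : ℝ) : ℂ)).re :=
      hs.trans_lt (by exact_mod_cast (by linarith : 1 + 1 / log X / 2 < 1 + 1 / log X))
    refine LSeriesSummable_of_abscissaOfAbsConv_lt_re ?_
    rwa [LSeries.absicssaOfAbsConv_logPowMul]
  · intro t
    have h3 := h2 q χ hp (1 / log X) t hx0 hx1
    push_cast at h3 ⊢
    refine h3.trans ?_
    rw [mul_rpow (by positivity) (by positivity), mul_assoc]
    gcongr
    calc (q : ℝ) ^ (1 / 2 : ℝ) ≤ (q : ℝ) ^ (1 : ℝ) := Real.rpow_le_rpow_of_exponent_le hq (by norm_num)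
      _ = q := Real.rpow_one _

theorem one_le_log_of_three_le {y : ℕ} (hy : 3 ≤ y) : 1 ≤ log y := by
  have : (3 : ℝ) ≤ y := by exact_mod_cast hy
  rw [Real.le_log_iff_exp_le (by linarith)]; linarith [Real.exp_one_lt_d9]

theorem norm_log_pow_vm_le {q : ℕ} [NeZero q] (χ : DirichletCharacter ℂ q) (k : ℕ) {n : ℕ} {B : ℝ} (hB : log n ≤ B) :
    ‖((log n ^ k : ℝ) : ℂ) * vm χ n‖ ≤ (B + 1) ^ (k + 1) := by
  have h0 : 0 ≤ log n := log_natCast_nonneg n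
  rw [norm_mul, norm_real, norm_of_nonneg (by positivity), pow_succ]
  have := (norm_vm_le χ (n := n))
  exact mul_le_mul (pow_le_pow_left₀ h0 (by linarith) _) (by linarith) (norm_nonneg _) (pow_nonneg (by linarith) _)

theorem norm_weighted_vm_le (m : ℕ) : ∃ C : ℝ, 0 ≤ C ∧ ∀ (q : ℕ) [NeZero q] (χ : DirichletCharacter ℂ q),
    χ.IsPrimitive → ∀ y : ℕ, 3 ≤ y →
      ‖∑ n ∈ Icc 1 y, ((log n ^ (2 * m + 1) : ℝ) : ℂ) * vm χ n‖ ≤ C * q * y * log y ^ (m + 1) := by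
  obtain ⟨C, hC, h1⟩ := norm_smoothed_vm_le (2 * m + 1)
  refine ⟨4 * C + 2 * 9 ^ (m + 1), by positivity, fun q _ χ hp y hy => ?_⟩
  have hq := one_le_cast_of_neZero q
  have hL := one_le_log_of_three_le hy
  have hy3 : (3 : ℝ) ≤ y := by exact_mod_cast hy
  set L := log y with hLd
  set h := (L ^ (m + 1))⁻¹ with hh
  have hLp : 1 ≤ L ^ (m + 1) := one_le_pow₀ hL
  have h0 : 0 < h := by positivity
  have h01 : h ≤ 1 := inv_le_one_of_one_le₀ hLp
  set b : ℕ → ℂ := fun n => ((log n ^ (2 * m + 1) : ℝ) : ℂ) * vm χ n with hb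
  set X := (y : ℝ) * Real.exp h with hX
  have he1 : Real.exp h - 1 ≤ 2 * h := by
    have := Real.abs_exp_sub_one_le (x := h) (by rwa [abs_of_pos h0])
    rw [abs_of_pos h0] at this
    exact (le_abs_self _).trans this
  have heone : 1 ≤ Real.exp h := Real.one_le_exp h0.le
  have hyX : (y : ℝ) ≤ X := by rw [hX]; nlinarith
  have hX3 : X ≤ 3 * y := by rw [hX]; nlinarith
  have hXy : X - y ≤ 2 * h * y := by rw [hX]; nlinarith
  have hyF : y ≤ ⌊X⌋₊ := Nat.le_floor hyX
  have hlogX : log X = L + h := by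
    rw [hX, Real.log_mul (by positivity) (Real.exp_pos _).ne', Real.log_exp]
  have T1 := h1 q χ hp X (by linarith)
  have T2 := h1 q χ hp y hy3
  rw [Nat.floor_natCast] at T2
  set T := ∑ n ∈ Icc 1 ⌊X⌋₊, b n * (log (X / n) : ℝ) with hT
  have hsplit : T = ∑ n ∈ Icc 1 y, b n * (log (X / n) : ℝ) + ∑ n ∈ Ioc y ⌊X⌋₊, b n * (log (X / n) : ℝ) := by
    rw [hT, ← sum_union]
    · refine sum_congr ?_ fun _ _ => rfl
      ext n; simp only [mem_union, mem_Icc, mem_Ioc]; omega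
    · rw [disjoint_left]; intro n; simp only [mem_Icc, mem_Ioc]; omega
  have hfirst : ∑ n ∈ Icc 1 y, b n * (log (X / n) : ℝ) =
      h * ∑ n ∈ Icc 1 y, b n + ∑ n ∈ Icc 1 y, b n * (log (y / n) : ℝ) := by
    rw [mul_sum, ← sum_add_distrib]
    refine sum_congr rfl fun n hn => ?_
    rw [mem_Icc] at hn
    have hn0 : (n : ℝ) ≠ 0 := by exact_mod_cast (by omega : n ≠ 0)
    rw [Real.log_div (by positivity) hn0, Real.log_div (by positivity) hn0, hlogX, ofReal_sub, ofReal_sub, Complex.ofReal_add]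
    ring
  set R := ∑ n ∈ Ioc y ⌊X⌋₊, b n * (log (X / n) : ℝ) with hR
  have hRb : ‖R‖ ≤ 2 * h * y * ((3 * L) ^ (2 * (m + 1)) * h) := by
    have : ∀ n ∈ Ioc y ⌊X⌋₊, ‖b n * (log (X / n) : ℝ)‖ ≤ (3 * L) ^ (2 * (m + 1)) * h := by
      intro n hn
      rw [mem_Ioc] at hn
      have hn1 : (y : ℝ) < n := by exact_mod_cast hn.1
      have hn2 : (n : ℝ) ≤ X := (Nat.le_floor_iff (by linarith)).1 hn.2
      have hln : log n ≤ L + h := by rw [← hlogX]; exact log_le_log (by linarith) hn2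
      have hln' : L ≤ log n := log_le_log (by linarith) hn1.le
      rw [norm_mul, norm_real]
      refine mul_le_mul ((norm_log_pow_vm_le χ _ hln).trans ?_) ?_ (norm_nonneg _) (by positivity)
      · rw [show 2 * (m + 1) = 2 * m + 1 + 1 by ring]
        gcongr
        linarith
      · rw [Real.log_div (by linarith) (by linarith), hlogX, norm_of_nonneg (by linarith)]
        linarith
    refine (norm_sum_le_of_le _ this).trans ?_
    rw [sum_const, Nat.card_Ioc, nsmul_eq_mul]
    gcongr
    rw [Nat.cast_sub hyF]
    have := Nat.floor_le (show 0 ≤ X by linarith)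
    linarith
  have hS : (h : ℂ) * ∑ n ∈ Icc 1 y, b n = T - ∑ n ∈ Icc 1 y, b n * (log (y / n) : ℝ) - R := by
    rw [hsplit, hfirst]; ring
  have hSn := congrArg norm hS
  rw [norm_mul, norm_real, norm_of_nonneg h0.le] at hSn
  have hS2 : h * ‖∑ n ∈ Icc 1 y, b n‖ ≤ C * q * X + C * q * y + 2 * h * y * ((3 * L) ^ (2 * (m + 1)) * h) := by
    rw [hSn]
    exact (norm_sub_le _ _).trans (add_le_add ((norm_sub_le _ _).trans (add_le_add T1 T2)) hRb)
  have hhL : h * L ^ (m + 1) = 1 := inv_mul_cancel₀ (by positivity)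
  refine le_of_mul_le_mul_left (hS2.trans ?_) h0
  have e1 : 2 * h * y * ((3 * L) ^ (2 * (m + 1)) * h) = 2 * 9 ^ (m + 1) * y * (h * L ^ (m + 1)) ^ 2 := by
    rw [mul_pow, pow_mul, pow_mul]; norm_num; ring
  rw [e1, show h * ((4 * C + 2 * 9 ^ (m + 1)) * q * y * L ^ (m + 1)) =
    (4 * C + 2 * 9 ^ (m + 1)) * q * y * (h * L ^ (m + 1)) by ring, hhL]
  have : C * q * X ≤ C * q * (3 * y) := by gcongr
  have h9 : (2 * 9 ^ (m + 1) * y : ℝ) ≤ 2 * 9 ^ (m + 1) * y * q := le_mul_of_one_le_right (by positivity) hq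
  linarith

/-- Siegel–Walfisz theorem for primitive characters; the trivial character modulo `1` gives the prime number theorem. -/
theorem siegel_walfisz (D : ℕ) : ∃ C : ℝ, 0 ≤ C ∧ ∀ (q : ℕ) [NeZero q] (χ : DirichletCharacter ℂ q),
    χ.IsPrimitive → ∀ N y : ℕ, 3 ≤ N → y ≤ N →
      ‖∑ n ∈ Icc 1 y, vm χ n‖ ≤ C * q * N / log N ^ D := by
  obtain ⟨C1, hC1, h1⟩ := norm_weighted_vm_le D
  set C2 := C1 + 2 * 2 ^ (2 * D + 2) with hC2
  set C3 : ℝ := 2 * 2 ^ (D + 1) * (D + 1).factorial with hC3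
  refine ⟨2 * C2 * 2 ^ (2 * D + 1) + C3, by positivity, fun q _ χ hp N y hN hy => ?_⟩
  have hq := one_le_cast_of_neZero q
  have hL := one_le_log_of_three_le hN
  have hN3 : (3 : ℝ) ≤ N := by exact_mod_cast hN
  set L := log N with hLd
  set b : ℕ → ℂ := fun n => ((log n ^ (2 * D + 1) : ℝ) : ℂ) * vm χ n with hb
  have hS : ∀ z ≤ N, ‖∑ n ∈ Icc 1 z, b n‖ ≤ C2 * q * N * L ^ (D + 1) := by
    intro z hz
    have hLp : 1 ≤ L ^ (D + 1) := one_le_pow₀ hL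
    rcases le_or_gt 3 z with h3 | h3
    · refine (h1 q χ hp z h3).trans ?_
      have hz0 : (3 : ℝ) ≤ z := by exact_mod_cast h3
      have hzN : (z : ℝ) ≤ N := by exact_mod_cast hz
      have hl0 := one_le_log_of_three_le h3
      have hlz : log z ≤ L := log_le_log (by linarith) hzN
      have : C1 ≤ C2 := by rw [hC2]; linarith [show (0:ℝ) < 2 * 2 ^ (2 * D + 2) by positivity]
      gcongr
    · have : ∀ n ∈ Icc 1 z, ‖b n‖ ≤ (2 : ℝ) ^ (2 * D + 2) := by
        intro n hn
        rw [mem_Icc] at hn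
        have hn2 : (n : ℝ) ≤ 2 := by exact_mod_cast (by omega : n ≤ 2)
        have hn1 : (1 : ℝ) ≤ n := by exact_mod_cast hn.1
        have := norm_log_pow_vm_le χ (2 * D + 1) (n := n) (B := 1)
          (by linarith [Real.log_le_sub_one_of_pos (show (0 : ℝ) < n by linarith)])
        rw [one_add_one_eq_two] at this
        exact this
      refine (norm_sum_le_of_le _ this).trans ?_
      rw [sum_const, Nat.card_Icc, nsmul_eq_mul]
      have hz2 : ((z + 1 - 1 : ℕ) : ℝ) ≤ 2 := by exact_mod_cast (by omega : z + 1 - 1 ≤ 2)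
      calc _ ≤ 2 * (2 : ℝ) ^ (2 * D + 2) := by gcongr
        _ ≤ C2 * 1 * 1 * 1 := by rw [hC2]; linarith
        _ ≤ _ := by gcongr; linarith
  set M := Nat.sqrt N with hM
  have hM1 : 1 ≤ M := Nat.sqrt_pos.2 (by omega)
  have hMN : (M : ℝ) ≤ Real.sqrt N := Real.nat_sqrt_le_real_sqrt
  have hMN2 : Real.sqrt N < M + 1 := Real.real_sqrt_lt_nat_sqrt_succ
  have hMle : M ≤ N := Nat.sqrt_le_self N
  have htriv : ∀ z ≤ M, ‖∑ n ∈ Icc 1 z, vm χ n‖ ≤ C3 * q * N / L ^ D := by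
    intro z hz
    have : ∀ n ∈ Icc 1 z, ‖vm χ n‖ ≤ 2 * L := by
      intro n hn
      rw [mem_Icc] at hn
      have hn1 : (1 : ℝ) ≤ n := by exact_mod_cast hn.1
      have hnN : (n : ℝ) ≤ N := by exact_mod_cast (hn.2.trans hz).trans hMle
      have : log n ≤ L := log_le_log (by linarith) hnN
      linarith [norm_vm_le χ (n := n)]
    refine (norm_sum_le_of_le _ this).trans ?_
    rw [sum_const, Nat.card_Icc, nsmul_eq_mul, Nat.add_sub_cancel, le_div_iff₀ (by positivity)]
    have hzM : (z : ℝ) ≤ Real.sqrt N := le_trans (by exact_mod_cast hz) hMN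
    have hs1 : 1 ≤ Real.sqrt N := Real.one_le_sqrt.2 (by linarith)
    have := log_pow_le_factorial_mul hs1 (D + 1)
    rw [Real.log_sqrt (by linarith), div_pow, div_le_iff₀ (by positivity)] at this
    calc (z : ℝ) * (2 * L) * L ^ D = 2 * z * L ^ (D + 1) := by ring
      _ ≤ 2 * Real.sqrt N * ((D + 1).factorial * Real.sqrt N * 2 ^ (D + 1)) := by gcongr
      _ = C3 * 1 * (Real.sqrt N * Real.sqrt N) := by rw [hC3]; ring
      _ ≤ C3 * q * N := by rw [Real.mul_self_sqrt (by linarith)]; gcongr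
  rcases le_or_gt y M with hyM | hyM
  · refine (htriv y hyM).trans ?_
    gcongr
    exact le_add_of_nonneg_left (by positivity)
  have hsplit : ∀ (f : ℕ → ℂ) (z : ℕ), M ≤ z → ∑ n ∈ Icc 1 z, f n = ∑ n ∈ Icc 1 M, f n + ∑ n ∈ Ioc M z, f n := by
    intro f z hz
    rw [← sum_union]
    · refine sum_congr ?_ fun _ _ => rfl
      ext n; simp only [mem_union, mem_Icc, mem_Ioc]; omega
    · rw [disjoint_left]; intro n; simp only [mem_Icc, mem_Ioc]; omega
  have hln : ∀ n, M < n → L / 2 ≤ log n := by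
    intro n hn
    rw [← Real.log_sqrt (by linarith)]
    refine log_le_log (Real.sqrt_pos.2 (by linarith)) (hMN2.le.trans ?_)
    exact_mod_cast hn
  have habel := abel_antitone_norm_le b (fun n => (log n ^ (2 * D + 1))⁻¹) hyM.le
    (B := 2 * (C2 * q * N * L ^ (D + 1)))
    (fun n hn => by
      have := hln n hn
      have hn0 : (0 : ℝ) < n := by exact_mod_cast (by omega : 0 < n)
      have hl : 0 < log n := by linarith
      have : log n ≤ log (n + 1 : ℕ) := log_le_log hn0 (by push_cast; linarith)
      gcongr)
    (fun n hn => by positivity)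
    (fun z hz1 hz2 => by
      have e := hsplit b z hz1
      rw [← sub_eq_iff_eq_add'] at e
      rw [← e, two_mul]
      exact (norm_sub_le _ _).trans (add_le_add (hS z (hz2.trans hy)) (hS M hMle)))
  have hbg : ∑ n ∈ Ioc M y, vm χ n = ∑ n ∈ Ioc M y, b n * (((log n ^ (2 * D + 1))⁻¹ : ℝ) : ℂ) := by
    refine sum_congr rfl fun n hn => ?_
    rw [mem_Ioc] at hn
    have hne : ((log n ^ (2 * D + 1) : ℝ) : ℂ) ≠ 0 := by
      have : 0 < log n := by linarith [hln n hn.1]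
      exact_mod_cast (by positivity : log n ^ (2 * D + 1) ≠ 0)
    rw [hb]; simp only
    rw [Complex.ofReal_inv, mul_assoc, mul_comm (vm χ n), mul_inv_cancel_left₀ hne]
  rw [← hbg] at habel
  rw [hsplit _ y hyM.le]
  refine (norm_add_le _ _).trans ((add_le_add (htriv M le_rfl) habel).trans ?_)
  have hg : (log (M + 1 : ℕ) ^ (2 * D + 1))⁻¹ ≤ ((L / 2) ^ (2 * D + 1))⁻¹ := by
    have := hln (M + 1) (by omega)
    gcongr
  calc _ ≤ C3 * q * N / L ^ D + 2 * (C2 * q * N * L ^ (D + 1)) * ((L / 2) ^ (2 * D + 1))⁻¹ := by gcongr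
    _ = _ := by
      have : L ≠ 0 := by positivity
      rw [div_pow, inv_div, show 2 * D + 1 = D + (D + 1) by ring, pow_add L]
      field_simp
      ring

/-- The additive character `x ↦ e(x) = exp(2 π i x)`. -/
def ex (x : ℝ) : ℂ := Complex.exp ((2 * Real.pi * x : ℝ) * I)

theorem norm_ex (x : ℝ) : ‖ex x‖ = 1 := Complex.norm_exp_ofReal_mul_I _

theorem ex_add (x y : ℝ) : ex (x + y) = ex x * ex y := by
  rw [ex, ex, ex, ← Complex.exp_add]; congr 1; push_cast; ring

theorem ex_neg (x : ℝ) : ex (-x) = (starRingEnd ℂ) (ex x) := by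
  rw [ex, ex, ← Complex.exp_conj, map_mul, Complex.conj_I, conj_ofReal]; congr 1; push_cast; ring

theorem ex_int (n : ℤ) : ex n = 1 := by
  rw [ex, Complex.exp_eq_one_iff]
  exact ⟨n, by push_cast; ring⟩

theorem ex_nat_mul (n : ℕ) (x : ℝ) : ex (n * x) = ex x ^ n := by
  rw [ex, ex, ← Complex.exp_nat_mul]; congr 1; push_cast; ring

theorem ex_add_int (x : ℝ) (n : ℤ) : ex (x + n) = ex x := by rw [ex_add, ex_int, mul_one]

/-- Distance to the nearest integer. -/
def nd (x : ℝ) : ℝ := |x - round x|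

theorem nd_nonneg (x : ℝ) : 0 ≤ nd x := abs_nonneg _

theorem nd_le_half (x : ℝ) : nd x ≤ 1 / 2 := abs_sub_round x

theorem nd_le (x : ℝ) (n : ℤ) : nd x ≤ |x - n| := round_le x n

theorem nd_neg (x : ℝ) : nd (-x) = nd x := by
  have h : ∀ x, nd (-x) ≤ nd x := fun x => by
    have := nd_le (-x) (-round x)
    rwa [show -x - ((-round x : ℤ) : ℝ) = -(x - round x) by push_cast; ring, abs_neg] at this
  exact le_antisymm (h x) (by simpa using h (-x))

theorem four_mul_nd_le (x : ℝ) : 4 * nd x ≤ ‖ex x - 1‖ := by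
  have h1 : ex x = ex (x - round x) := by
    conv_lhs => rw [← sub_add_cancel x (round x), ex_add_int]
  rw [h1, ex]
  have := Complex.norm_exp_I_mul_ofReal_sub_one (2 * Real.pi * (x - round x))
  rw [mul_comm I] at this
  rw [this, show 2 * Real.pi * (x - round x) / 2 = Real.pi * (x - round x) by ring]
  have h2 := Real.mul_abs_le_abs_sin (x := Real.pi * (x - round x)) (by
    rw [abs_mul, abs_of_pos Real.pi_pos]
    nlinarith [abs_sub_round x, Real.pi_pos])
  rw [abs_mul, abs_of_pos Real.pi_pos] at h2
  rw [norm_mul, norm_eq_abs, norm_eq_abs, abs_of_pos (by norm_num : (0:ℝ) < 2), nd]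
  have e : 2 / Real.pi * (Real.pi * |x - round x|) = 2 * |x - round x| := by
    field_simp
  linarith

/-- Majorant for a geometric sum of length at most `K` with ratio `e(x)`. -/
def geomBound (K x : ℝ) : ℝ := 2 * K / (1 + 2 * K * nd x)

theorem geomBound_nonneg {K : ℝ} (hK : 0 ≤ K) (x : ℝ) : 0 ≤ geomBound K x := by
  have := nd_nonneg x
  rw [geomBound]; positivity

theorem le_geomBound {K x A : ℝ} (hK : 0 ≤ K) (h1 : A ≤ K) (h2 : 2 * nd x * A ≤ 1) : A ≤ geomBound K x := by
  have := nd_nonneg x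
  rw [geomBound, le_div_iff₀ (by positivity)]
  nlinarith

theorem geomBound_le_of_le {K x d : ℝ} (hK : 0 ≤ K) (hd : 0 < d) (h : d ≤ nd x) : geomBound K x ≤ 1 / d := by
  rw [geomBound, div_le_div_iff₀ (by nlinarith [mul_nonneg hK (hd.le.trans h)]) hd]
  nlinarith [mul_le_mul_of_nonneg_left h hK]

theorem geomBound_le {K : ℝ} (hK : 0 ≤ K) (x : ℝ) : geomBound K x ≤ 2 * K := by
  have := nd_nonneg x
  rw [geomBound]
  exact div_le_self (by positivity) (by nlinarith [mul_nonneg hK this])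

theorem norm_sum_ex_le (x : ℝ) (a b : ℕ) {K : ℝ} (hK : ((b - a : ℕ) : ℝ) ≤ K) :
    ‖∑ n ∈ Ioc a b, ex (n * x)‖ ≤ geomBound K x := by
  have hK0 : 0 ≤ K := (Nat.cast_nonneg _).trans hK
  refine le_geomBound hK0 ?_ ?_
  · refine (norm_sum_le _ _).trans ?_
    simp_rw [norm_ex]
    simpa using hK
  · rcases le_total b a with h | h
    · simp [Ioc_eq_empty_of_le h]
    have h1 : (∑ n ∈ Ioc a b, ex (n * x)) * (ex x - 1) = ex x * (ex x ^ b - ex x ^ a) := by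
      simp_rw [ex_nat_mul]
      induction b, h using Nat.le_induction with
      | base => simp
      | succ b hb ih =>
        rw [sum_Ioc_succ_top (by omega), add_mul, ih ((Nat.cast_le.2 (by omega)).trans hK)]; ring
    have h2 := congrArg norm h1
    rw [norm_mul, norm_mul, norm_ex, one_mul] at h2
    have h3 : ‖ex x ^ b - ex x ^ a‖ ≤ 2 := by
      refine (norm_sub_le _ _).trans ?_
      rw [norm_pow, norm_pow, norm_ex]; norm_num
    nlinarith [four_mul_nd_le x, norm_nonneg (∑ n ∈ Ioc a b, ex (n * x))]


theorem sum_filter_geomBound_le {ι : Type*} (s : Finset ι) (v : ι → ℝ) {δ K : ℝ} (hδ : 0 < δ)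
    (hδ' : δ ≤ 1 / 2) (hK : 0 ≤ K) (h : ∀ i ∈ s, ∀ j ∈ s, i ≠ j → δ ≤ |nd (v i) - nd (v j)|) :
    ∑ i ∈ s, geomBound K (v i) ≤ 2 * K + δ⁻¹ * (1 + log δ⁻¹) := by
  classical
  have hinj : Set.InjOn (fun i => ⌊nd (v i) / δ⌋₊) s := by
    intro i hi j hj hij
    by_contra hne
    have h1 := h i hi j hj hne
    have a1 := Nat.floor_le (div_nonneg (nd_nonneg (v i)) hδ.le)
    have a2 := Nat.lt_floor_add_one (nd (v i) / δ)
    have b1 := Nat.floor_le (div_nonneg (nd_nonneg (v j)) hδ.le)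
    have b2 := Nat.lt_floor_add_one (nd (v j) / δ)
    simp only at hij
    rw [hij] at a1 a2
    have : |nd (v i) / δ - nd (v j) / δ| < 1 := by rw [abs_lt]; constructor <;> linarith
    rw [← sub_div, abs_div, abs_of_pos hδ, div_lt_one hδ] at this
    linarith
  set J := ⌊δ⁻¹⌋₊ with hJ
  have hJ1 : 1 ≤ J := Nat.le_floor (by push_cast; exact (one_le_inv₀ hδ).2 (by linarith))
  let f : ℕ → ℝ := fun j => if j = 0 then 2 * K else 1 / (j * δ)
  have hf : ∀ j, 0 ≤ f j := fun j => by dsimp only [f]; split_ifs <;> positivity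
  calc ∑ i ∈ s, geomBound K (v i) ≤ ∑ i ∈ s, f ⌊nd (v i) / δ⌋₊ := by
        refine sum_le_sum fun i _ => ?_
        dsimp only [f]
        split_ifs with h0
        · exact geomBound_le hK _
        · have : 0 < ⌊nd (v i) / δ⌋₊ := Nat.pos_of_ne_zero h0
          refine geomBound_le_of_le hK (by positivity) ?_
          exact (le_div_iff₀ hδ).1 (Nat.floor_le (div_nonneg (nd_nonneg (v i)) hδ.le))
    _ = ∑ j ∈ s.image (fun i => ⌊nd (v i) / δ⌋₊), f j := (sum_image hinj).symm
    _ ≤ ∑ j ∈ range (J + 1), f j := by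
        refine sum_le_sum_of_subset_of_nonneg ?_ fun j _ _ => hf j
        intro j hj
        obtain ⟨i, hi, rfl⟩ := mem_image.1 hj
        rw [mem_range, Nat.lt_succ_iff]
        refine Nat.floor_le_floor ?_
        rw [div_eq_mul_inv]
        exact mul_le_of_le_one_left (by positivity) ((nd_le_half _).trans (by norm_num))
    _ = 2 * K + δ⁻¹ * ∑ j ∈ range J, ((j : ℝ) + 1)⁻¹ := by
        rw [sum_range_succ', mul_sum, add_comm]
        congr 1
        refine sum_congr rfl fun j _ => ?_
        dsimp only [f]
        rw [if_neg (by omega)]; push_cast; rw [one_div, mul_inv, mul_comm]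
    _ ≤ _ := by
        have h1 := harmonic_le_one_add_log J
        rw [harmonic] at h1
        push_cast at h1
        have h2 : log J ≤ log δ⁻¹ :=
          log_le_log (by exact_mod_cast hJ1) (Nat.floor_le (by positivity))
        gcongr; linarith

theorem sum_geomBound_le {ι : Type*} (s : Finset ι) (t : ι → ℝ) {δ K : ℝ} (hδ : 0 < δ)
    (hδ' : δ ≤ 1 / 2) (hK : 0 ≤ K) (h : ∀ i ∈ s, ∀ j ∈ s, i ≠ j → δ ≤ nd (t i - t j)) (β : ℝ) :
    ∑ i ∈ s, geomBound K (t i - β) ≤ 4 * K + 2 * δ⁻¹ * (1 + log δ⁻¹) := by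
  classical
  let u : ι → ℝ := fun i => t i - β - round (t i - β)
  have hsep : ∀ i ∈ s, ∀ j ∈ s, i ≠ j → δ ≤ |u i - u j| := by
    intro i hi j hj hij
    refine (h i hi j hj hij).trans ?_
    refine (nd_le _ (round (t i - β) - round (t j - β))).trans_eq ?_
    dsimp only [u]; congr 1; push_cast; ring
  rw [← sum_filter_add_sum_filter_not s (fun i => 0 ≤ u i)]
  have h1 := sum_filter_geomBound_le (s.filter fun i => 0 ≤ u i) (fun i => t i - β) hδ hδ' hK (by
    intro i hi j hj hij
    rw [mem_filter] at hi hj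
    have := hsep i hi.1 j hj.1 hij
    change δ ≤ abs (|u i| - |u j|)
    rwa [abs_of_nonneg hi.2, abs_of_nonneg hj.2])
  have h2 := sum_filter_geomBound_le (s.filter fun i => ¬ 0 ≤ u i) (fun i => t i - β) hδ hδ' hK (by
    intro i hi j hj hij
    rw [mem_filter, not_le] at hi hj
    have := hsep i hi.1 j hj.1 hij
    change δ ≤ abs (|u i| - |u j|)
    rw [abs_of_neg hi.2, abs_of_neg hj.2, neg_sub_neg, abs_sub_comm]
    exact this)
  linarith

/-- Duality principle for bilinear forms. -/
theorem sum_norm_sq_dual {ι κ : Type*} (s : Finset ι) (u : Finset κ) (c : ι → κ → ℂ) {D : ℝ}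
    (hD : 0 ≤ D)
    (h : ∀ b : ι → ℂ, ∑ n ∈ u, ‖∑ i ∈ s, b i * c i n‖ ^ 2 ≤ D * ∑ i ∈ s, ‖b i‖ ^ 2) (a : κ → ℂ) :
    ∑ i ∈ s, ‖∑ n ∈ u, a n * c i n‖ ^ 2 ≤ D * ∑ n ∈ u, ‖a n‖ ^ 2 := by
  set S : ι → ℂ := fun i => ∑ n ∈ u, a n * c i n with hS
  set X := ∑ i ∈ s, ‖S i‖ ^ 2 with hX
  have hX0 : 0 ≤ X := sum_nonneg fun _ _ => by positivity
  have hb := h fun i => (starRingEnd ℂ) (S i)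
  simp_rw [Complex.norm_conj] at hb
  rw [← hX] at hb
  have h1 : (X : ℂ) = ∑ n ∈ u, a n * ∑ i ∈ s, (starRingEnd ℂ) (S i) * c i n := by
    simp_rw [mul_sum]
    rw [sum_comm, hX]
    push_cast
    refine sum_congr rfl fun i _ => ?_
    rw [← Complex.conj_mul']
    conv_lhs => rw [hS]
    rw [mul_sum]
    exact sum_congr rfl fun n _ => by ring
  have h2 : X ≤ ∑ n ∈ u, ‖a n‖ * ‖∑ i ∈ s, (starRingEnd ℂ) (S i) * c i n‖ := by
    have := norm_sum_le u fun n => a n * ∑ i ∈ s, (starRingEnd ℂ) (S i) * c i n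
    rw [← h1, norm_real, norm_of_nonneg hX0] at this
    simpa only [norm_mul] using this
  have h3 := sum_mul_sq_le_sq_mul_sq u (fun n => ‖a n‖) fun n => ‖∑ i ∈ s, (starRingEnd ℂ) (S i) * c i n‖
  have hA : 0 ≤ ∑ n ∈ u, ‖a n‖ ^ 2 := sum_nonneg fun _ _ => by positivity
  rcases hX0.eq_or_lt with h0 | h0
  · rw [← h0]; positivity
  · have h4 : X ^ 2 ≤ (∑ n ∈ u, ‖a n‖ ^ 2) * (D * X) :=
      (pow_le_pow_left₀ hX0 h2 2).trans (h3.trans (mul_le_mul_of_nonneg_left hb hA))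
    nlinarith

/-- The additive large sieve inequality. -/
theorem additive_large_sieve {ι : Type*} (s : Finset ι) (t : ι → ℝ) {δ : ℝ} (hδ : 0 < δ)
    (hδ' : δ ≤ 1 / 2) (h : ∀ i ∈ s, ∀ j ∈ s, i ≠ j → δ ≤ nd (t i - t j)) (M K : ℕ) (a : ℕ → ℂ) :
    ∑ i ∈ s, ‖∑ n ∈ Ioc M (M + K), a n * ex (n * t i)‖ ^ 2 ≤
      (4 * K + 2 * δ⁻¹ * (1 + log δ⁻¹)) * ∑ n ∈ Ioc M (M + K), ‖a n‖ ^ 2 := by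
  have hlog : 0 ≤ log δ⁻¹ := Real.log_nonneg ((one_le_inv₀ hδ).2 (by linarith))
  refine sum_norm_sq_dual s _ (fun i (n : ℕ) => ex (n * t i)) (by positivity) (fun b => ?_) a
  set Δ := 4 * (K : ℝ) + 2 * δ⁻¹ * (1 + log δ⁻¹) with hΔ
  have h1 : ((∑ n ∈ Ioc M (M + K), ‖∑ i ∈ s, b i * ex (n * t i)‖ ^ 2 : ℝ) : ℂ) =
      ∑ i ∈ s, ∑ j ∈ s, (starRingEnd ℂ) (b i) * b j * ∑ n ∈ Ioc M (M + K), ex (n * (t j - t i)) := by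
    push_cast
    simp_rw [← Complex.conj_mul', map_sum, sum_mul_sum, mul_sum]
    rw [sum_comm]
    refine sum_congr rfl fun i _ => ?_
    rw [sum_comm]
    refine sum_congr rfl fun j _ => sum_congr rfl fun n _ => ?_
    rw [mul_sub, sub_eq_add_neg, ex_add, ex_neg, map_mul]; ring
  have h2 : ∑ n ∈ Ioc M (M + K), ‖∑ i ∈ s, b i * ex (n * t i)‖ ^ 2 ≤
      ∑ i ∈ s, ∑ j ∈ s, ‖b i‖ * ‖b j‖ * geomBound K (t j - t i) := by
    have h3 := congrArg norm h1
    rw [norm_real, norm_of_nonneg (sum_nonneg fun _ _ => by positivity)] at h3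
    rw [h3]
    refine (norm_sum_le _ _).trans (sum_le_sum fun i _ => (norm_sum_le _ _).trans
      (sum_le_sum fun j _ => ?_))
    rw [norm_mul, norm_mul, Complex.norm_conj]
    exact mul_le_mul_of_nonneg_left (norm_sum_ex_le _ _ _ (by simp)) (by positivity)
  have hsym : ∀ i j, geomBound K (t j - t i) = geomBound K (t i - t j) := fun i j => by
    rw [geomBound, geomBound, ← nd_neg, neg_sub]
  have h4 : ∑ i ∈ s, ∑ j ∈ s, ‖b i‖ * ‖b j‖ * geomBound K (t j - t i) ≤
      ∑ i ∈ s, ∑ j ∈ s, (‖b i‖ ^ 2 / 2 * geomBound K (t j - t i) + ‖b j‖ ^ 2 / 2 * geomBound K (t i - t j)) := by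
    refine sum_le_sum fun i _ => sum_le_sum fun j _ => ?_
    rw [hsym i j, ← add_mul]
    refine mul_le_mul_of_nonneg_right ?_ (geomBound_nonneg (Nat.cast_nonneg _) _)
    nlinarith [sq_nonneg (‖b i‖ - ‖b j‖)]
  have h5 : ∑ i ∈ s, ∑ j ∈ s, ‖b i‖ ^ 2 / 2 * geomBound K (t j - t i) ≤ Δ / 2 * ∑ i ∈ s, ‖b i‖ ^ 2 := by
    rw [mul_sum]
    refine sum_le_sum fun i _ => ?_
    rw [← mul_sum]
    nlinarith [mul_le_mul_of_nonneg_left (sum_geomBound_le s t hδ hδ' (Nat.cast_nonneg K) h (t i))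
      (sq_nonneg ‖b i‖)]
  simp_rw [sum_add_distrib] at h4
  have h6 : ∑ i ∈ s, ∑ j ∈ s, ‖b j‖ ^ 2 / 2 * geomBound K (t i - t j) =
    ∑ i ∈ s, ∑ j ∈ s, ‖b i‖ ^ 2 / 2 * geomBound K (t j - t i) := sum_comm
  linarith

/-- The primitive Dirichlet characters modulo `r` (none for `r = 0`). -/
def primChars (r : ℕ) : Finset (DirichletCharacter ℂ r) := by
  classical
  exact if h : r = 0 then ∅ else
    haveI : NeZero r := ⟨h⟩
    univ.filter fun χ => χ.IsPrimitive

theorem mem_primChars {r : ℕ} [NeZero r] {χ : DirichletCharacter ℂ r} :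
    χ ∈ primChars r ↔ χ.IsPrimitive := by
  classical
  rw [primChars, dif_neg (NeZero.ne r)]
  simp

theorem conj_char {r : ℕ} [NeZero r] (χ : DirichletCharacter ℂ r) (a : ZMod r) :
    (starRingEnd ℂ) (χ a) = χ⁻¹ a := MulChar.star_apply' χ a

theorem stdAddChar_mul_eq_ex {r : ℕ} [NeZero r] (n : ℕ) (a : ZMod r) :
    ZMod.stdAddChar ((n : ZMod r) * a) = ex (n * (a.val / r)) := by
  have h : (n : ZMod r) * a = ((n * a.val : ℕ) : ℤ) := by
    push_cast; rw [ZMod.natCast_zmod_val]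
  rw [h, ZMod.stdAddChar_coe, ex]
  congr 1; push_cast; ring

theorem norm_gaussSum_sq {r : ℕ} [NeZero r] {χ : DirichletCharacter ℂ r} (hχ : χ.IsPrimitive) :
    ‖gaussSum χ ZMod.stdAddChar‖ ^ 2 = r := by
  have h1 := congrFun (ZMod.dft_dft (χ : ZMod r → ℂ)) (-1)
  have h2 : ZMod.dft (χ : ZMod r → ℂ) = fun k => χ⁻¹ (-k) * gaussSum χ ZMod.stdAddChar :=
    funext hχ.fourierTransform_eq_inv_mul_gaussSum
  rw [h2, ZMod.dft_apply] at h1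
  simp only [neg_neg, map_one, smul_eq_mul, mul_one, mul_neg] at h1
  have h3 : ∑ j : ZMod r, ZMod.stdAddChar j * (χ⁻¹ (-j) * gaussSum χ ZMod.stdAddChar) =
      gaussSum χ ZMod.stdAddChar * (starRingEnd ℂ) (gaussSum χ ZMod.stdAddChar) := by
    rw [← sum_equiv (Equiv.neg (ZMod r)) (s := univ) (t := univ)
      (f := fun j => ZMod.stdAddChar (-j) * (χ⁻¹ j * gaussSum χ ZMod.stdAddChar)) (by simp) (by simp),
      gaussSum, map_sum, mul_sum]
    refine sum_congr rfl fun j _ => ?_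
    rw [map_mul, conj_char, AddChar.map_neg_eq_conj]; ring
  rw [h3, Complex.mul_conj'] at h1
  exact_mod_cast h1

theorem sum_norm_sq_char {r : ℕ} [NeZero r] (S : ZMod r → ℂ) [DecidablePred (IsUnit : ZMod r → Prop)] :
    ∑ χ : DirichletCharacter ℂ r, ‖∑ a, χ a * S a‖ ^ 2 =
      r.totient * ∑ a : ZMod r with IsUnit a, ‖S a‖ ^ 2 := by
  have h : ∀ χ : DirichletCharacter ℂ r, ∑ a, χ a * S a = ∑ a : ZMod r with IsUnit a, χ a * S a := fun χ => by
    rw [sum_filter]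
    refine sum_congr rfl fun a _ => ?_
    split_ifs with ha
    · rfl
    · rw [χ.map_nonunit ha, zero_mul]
  apply Complex.ofReal_injective
  push_cast
  simp_rw [h, ← Complex.conj_mul', map_sum, sum_mul_sum]
  rw [sum_comm, mul_sum]
  refine sum_congr rfl fun a ha => ?_
  rw [sum_comm]
  have ha' := (mem_filter.1 ha).2
  have key : ∀ b, ∑ χ : DirichletCharacter ℂ r, (starRingEnd ℂ) (χ a * S a) * (χ b * S b) =
      (if a = b then (r.totient : ℂ) else 0) * ((starRingEnd ℂ) (S a) * S b) := fun b => by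
    rw [← DirichletCharacter.sum_char_inv_mul_char_eq ℂ ha' b, sum_mul]
    refine sum_congr rfl fun χ _ => ?_
    obtain ⟨u, rfl⟩ := ha'
    rw [map_mul, conj_char, MulChar.inv_apply, Ring.inverse_unit, ZMod.inv_coe_unit]
    ring
  simp_rw [key, ite_mul, zero_mul]
  rw [sum_ite_eq, if_pos ha]

theorem sum_primChars_le {r : ℕ} [NeZero r] (s : Finset ℕ) (a : ℕ → ℂ) :
    r / r.totient * ∑ χ ∈ primChars r, ‖∑ n ∈ s, a n * χ n‖ ^ 2 ≤
      ∑ m ∈ (range r).filter (·.Coprime r), ‖∑ n ∈ s, (starRingEnd ℂ) (a n) * ex (n * (m / r))‖ ^ 2 := by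
  classical
  have hφ : (0:ℝ) < r.totient := by exact_mod_cast Nat.totient_pos.2 (NeZero.pos r)
  set S : ZMod r → ℂ := fun b => ∑ n ∈ s, (starRingEnd ℂ) (a n) * ex (n * (b.val / r)) with hS
  have h1 : ∀ χ ∈ primChars r, r * ‖∑ n ∈ s, a n * χ n‖ ^ 2 = ‖∑ b, χ b * S b‖ ^ 2 := fun χ hχ => by
    rw [mem_primChars] at hχ
    rw [← norm_gaussSum_sq hχ, ← mul_pow, ← Complex.norm_conj (∑ n ∈ s, a n * χ n), ← norm_mul]
    congr 2
    simp_rw [hS, map_sum, mul_sum]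
    rw [sum_comm]
    refine sum_congr rfl fun n _ => ?_
    have h2 := gaussSum_mulShift_of_isPrimitive ZMod.stdAddChar hχ (n : ZMod r)
    rw [map_mul, conj_char, mul_left_comm, mul_comm (gaussSum _ _), ← h2, gaussSum, mul_sum]
    refine sum_congr rfl fun b _ => ?_
    rw [AddChar.mulShift_apply, stdAddChar_mul_eq_ex]; ring
  have h2 : ∑ m ∈ (range r).filter (·.Coprime r), ‖∑ n ∈ s, (starRingEnd ℂ) (a n) * ex (n * (m / r))‖ ^ 2 =
      ∑ b : ZMod r with IsUnit b, ‖S b‖ ^ 2 := by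
    refine sum_nbij' (fun m => (m : ZMod r)) (fun b => b.val) ?_ ?_ ?_ ?_ ?_
    · intro m hm
      rw [mem_filter, mem_range] at hm
      simpa [ZMod.isUnit_iff_coprime] using hm.2
    · intro b hb
      rw [mem_filter, mem_range]
      refine ⟨b.val_lt, ?_⟩
      rw [← ZMod.isUnit_iff_coprime, ZMod.natCast_zmod_val]
      exact (mem_filter.1 hb).2
    · intro m hm
      exact ZMod.val_cast_of_lt (mem_range.1 (mem_filter.1 hm).1)
    · intro b _
      exact ZMod.natCast_zmod_val b
    · intro m hm
      simp only [hS]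
      rw [ZMod.val_cast_of_lt (mem_range.1 (mem_filter.1 hm).1)]
  rw [h2, div_mul_eq_mul_div, div_le_iff₀ hφ, mul_comm _ (r.totient : ℝ), ← sum_norm_sq_char, mul_sum,
    sum_congr rfl h1]
  exact sum_le_sum_of_subset_of_nonneg (subset_univ _) fun _ _ _ => by positivity

theorem farey_spacing {R r r' m m' : ℕ} (hr : 1 ≤ r) (hrR : r ≤ R) (hr' : 1 ≤ r') (hrR' : r' ≤ R)
    (hm : m < r) (hm' : m' < r') (hc : m.Coprime r) (hc' : m'.Coprime r') (hne : ¬ (r = r' ∧ m = m')) :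
    1 / (2 * (R : ℝ) ^ 2) ≤ nd ((m / r : ℝ) - m' / r') := by
  set z := round ((m / r : ℝ) - m' / r') with hz
  have h0 : (m : ℤ) * r' - m' * r - z * r * r' ≠ 0 := by
    intro h
    have d1 : (r : ℤ) ∣ m * r' := ⟨m' + z * r', by linarith⟩
    have d2 : (r' : ℤ) ∣ m' * r := ⟨m - z * r, by linarith⟩
    have e1 : r ∣ r' := hc.symm.dvd_of_dvd_mul_left (by exact_mod_cast d1)
    have e2 : r' ∣ r := hc'.symm.dvd_of_dvd_mul_left (by exact_mod_cast d2)
    have e := Nat.dvd_antisymm e1 e2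
    subst e
    refine hne ⟨rfl, ?_⟩
    have h3 : (r : ℤ) * (m - m' - z * r) = 0 := by linarith
    rcases mul_eq_zero.1 h3 with h4 | h4
    · omega
    · have h5 : (m : ℤ) - m' = z * r := by linarith
      have hz0 : z = 0 := by
        have a1 : z * r < 1 * r := by omega
        have a2 : -1 * r < z * r := by omega
        have hr0 : (0:ℤ) < r := by omega
        have := lt_of_mul_lt_mul_right a1 hr0.le
        have := lt_of_mul_lt_mul_right a2 hr0.le
        omega
      rw [hz0] at h5; omega
  have h1 : (1:ℝ) ≤ |((m : ℝ) * r' - m' * r - z * r * r')| := by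
    have := Int.one_le_abs h0
    exact_mod_cast this
  have p1 : (0:ℝ) < r := by exact_mod_cast hr
  have p2 : (0:ℝ) < r' := by exact_mod_cast hr'
  have q1 : (r:ℝ) ≤ R := by exact_mod_cast hrR
  have q2 : (r':ℝ) ≤ R := by exact_mod_cast hrR'
  have e : (m / r : ℝ) - m' / r' - z = ((m : ℝ) * r' - m' * r - z * r * r') / (r * r') := by
    field_simp
  rw [nd, ← hz, e, abs_div, abs_of_pos (mul_pos p1 p2), div_le_div_iff₀ (by nlinarith) (mul_pos p1 p2)]
  have : (r:ℝ) * r' ≤ R ^ 2 := by nlinarith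
  nlinarith

/-- The multiplicative large sieve inequality. -/
theorem multiplicative_large_sieve (R : ℕ) (M K : ℕ) (a : ℕ → ℂ) (hR : 1 ≤ R) :
    ∑ r ∈ Icc 1 R, (r / r.totient : ℝ) * ∑ χ ∈ primChars r, ‖∑ n ∈ Ioc M (M + K), a n * χ n‖ ^ 2 ≤
      (4 * K + 4 * (R : ℝ) ^ 2 * (2 + 2 * log R)) * ∑ n ∈ Ioc M (M + K), ‖a n‖ ^ 2 := by
  have hR1 : (1:ℝ) ≤ R := by exact_mod_cast hR
  have h1 := additive_large_sieve ((Icc 1 R).sigma fun r => (range r).filter (·.Coprime r))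
    (fun x => (x.2 / x.1 : ℝ)) (δ := 1 / (2 * (R : ℝ) ^ 2)) (by positivity)
    (by rw [div_le_div_iff₀ (by positivity) (by norm_num)]; nlinarith) (by
      rintro ⟨r, m⟩ hi ⟨r', m'⟩ hj hij
      simp only [mem_sigma, mem_Icc, mem_filter, mem_range] at hi hj
      exact farey_spacing hi.1.1 hi.1.2 hj.1.1 hj.1.2 hi.2.1 hj.2.1 hi.2.2 hj.2.2 (by
        rintro ⟨rfl, rfl⟩; exact hij rfl)) M K (fun n => (starRingEnd ℂ) (a n))
  rw [sum_sigma] at h1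
  simp_rw [Complex.norm_conj] at h1
  refine (sum_le_sum fun r hr => ?_).trans (h1.trans ?_)
  · have : NeZero r := ⟨by have := (mem_Icc.1 hr).1; omega⟩
    exact sum_primChars_le _ a
  · refine mul_le_mul_of_nonneg_right ?_ (sum_nonneg fun _ _ => by positivity)
    rw [one_div, inv_inv, Real.log_mul (by norm_num) (by positivity), Real.log_pow]
    have := Real.log_two_lt_d9
    push_cast
    nlinarith [sq_nonneg (R : ℝ)]

/-- The divisor function, as a real number. -/
def tau (n : ℕ) : ℝ := n.divisors.card

theorem tau_nonneg (n : ℕ) : 0 ≤ tau n := Nat.cast_nonneg _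

theorem one_le_tau {n : ℕ} (hn : n ≠ 0) : 1 ≤ tau n := by
  have : 1 ≤ n.divisors.card := card_pos.2 (Nat.nonempty_divisors.2 hn)
  rw [tau]; exact_mod_cast this

theorem tau_mul_le (m n : ℕ) : tau (m * n) ≤ tau m * tau n := by
  rw [tau, tau, tau, Nat.divisors_mul]
  exact_mod_cast card_mul_le

theorem le_tau_mul_totient (n : ℕ) : (n : ℝ) ≤ tau n * n.totient := by
  rcases eq_or_ne n 0 with rfl | hn
  · simp
  have h := Nat.sum_totient n
  have h1 : ∑ d ∈ n.divisors, d.totient ≤ ∑ _d ∈ n.divisors, n.totient :=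
    sum_le_sum fun d hd => Nat.le_of_dvd (Nat.totient_pos.2 (Nat.pos_of_ne_zero hn))
      (Nat.totient_dvd_of_dvd (Nat.dvd_of_mem_divisors hd))
  rw [h, sum_const, smul_eq_mul] at h1
  rw [tau]; exact_mod_cast h1

theorem inv_totient_le {n : ℕ} (hn : 1 ≤ n) : (1 : ℝ) / n.totient ≤ tau n / n := by
  have h : (0:ℝ) < n.totient := by exact_mod_cast Nat.totient_pos.2 hn
  rw [div_le_div_iff₀ h (by exact_mod_cast hn), one_mul]
  exact le_tau_mul_totient n

/-- Grouping a sum over multiples: the hyperbola rearrangement of `∑_{n ≤ x} ∑_{d ∣ n} F d (n / d)`. -/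
theorem sum_divisors_eq {E : Type*} [AddCommMonoid E] (x : ℕ) (F : ℕ → ℕ → E) :
    ∑ n ∈ Icc 1 x, ∑ d ∈ n.divisorsAntidiagonal, F d.1 d.2 =
      ∑ m ∈ Icc 1 x, ∑ n ∈ Icc 1 (x / m), F m n := by
  rw [sum_sigma', sum_sigma']
  refine sum_bij' (fun a _ => ⟨a.2.1, a.2.2⟩) (fun b _ => ⟨b.1 * b.2, (b.1, b.2)⟩) ?_ ?_ ?_ ?_ ?_
  · rintro ⟨n, d, e⟩ h
    simp only [mem_sigma, mem_Icc, Nat.mem_divisorsAntidiagonal] at h ⊢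
    obtain ⟨⟨h1, h2⟩, h3, h4⟩ := h
    have hd : 0 < d := Nat.pos_of_ne_zero (by rintro rfl; simp at h3; omega)
    have he : 0 < e := Nat.pos_of_ne_zero (by rintro rfl; simp at h3; omega)
    refine ⟨⟨hd, by nlinarith⟩, he, (Nat.le_div_iff_mul_le hd).2 (by nlinarith)⟩
  · rintro ⟨m, n⟩ h
    simp only [mem_sigma, mem_Icc, Nat.mem_divisorsAntidiagonal] at h ⊢
    obtain ⟨⟨h1, h2⟩, h3, h4⟩ := h
    have h5 := (Nat.le_div_iff_mul_le (by omega)).1 h4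
    have : 0 < m * n := Nat.mul_pos h1 h3
    exact ⟨⟨this, by nlinarith⟩, trivial, this.ne'⟩
  · rintro ⟨n, d, e⟩ h
    simp only [mem_sigma, mem_Icc, Nat.mem_divisorsAntidiagonal] at h ⊢
    obtain ⟨_, rfl, _⟩ := h
    rfl
  · rintro ⟨m, n⟩ _; rfl
  · rintro ⟨n, d, e⟩ _; rfl

theorem sum_inv_le (x : ℕ) : ∑ n ∈ Icc 1 x, (1 : ℝ) / n ≤ 1 + log x := by
  have h := harmonic_le_one_add_log x
  rw [harmonic_eq_sum_Icc] at h
  push_cast at h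
  simpa [one_div] using h

theorem sum_tau_pow_div_le (j x : ℕ) :
    ∑ n ∈ Icc 1 x, tau n ^ j / n ≤ (1 + log x) ^ 2 ^ j := by
  induction j with
  | zero => simpa using sum_inv_le x
  | succ j ih =>
    have h0 : 0 ≤ ∑ n ∈ Icc 1 x, tau n ^ j / n :=
      sum_nonneg fun n _ => div_nonneg (pow_nonneg (tau_nonneg n) _) (Nat.cast_nonneg _)
    calc ∑ n ∈ Icc 1 x, tau n ^ (j + 1) / n
        = ∑ n ∈ Icc 1 x, ∑ d ∈ n.divisorsAntidiagonal, tau (d.1 * d.2) ^ j / ((d.1 * d.2 : ℕ) : ℝ) := by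
          refine sum_congr rfl fun n _ => ?_
          rw [sum_congr rfl fun d hd => by rw [(Nat.mem_divisorsAntidiagonal.1 hd).1], sum_const,
            nsmul_eq_mul, ← card_image_of_injOn (s := n.divisorsAntidiagonal) (f := Prod.fst) ?_,
            Nat.image_fst_divisorsAntidiagonal, pow_succ, tau]
          · ring
          · rintro ⟨a, b⟩ h ⟨a', b'⟩ h' (rfl : a = a')
            simp only [mem_coe, Nat.mem_divisorsAntidiagonal] at h h'
            have ha : 0 < a := Nat.pos_of_ne_zero (by rintro rfl; simp at h; omega)
            rw [Nat.eq_of_mul_eq_mul_left ha (h.1.trans h'.1.symm)]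
      _ = ∑ m ∈ Icc 1 x, ∑ n ∈ Icc 1 (x / m), tau (m * n) ^ j / ((m * n : ℕ) : ℝ) :=
          sum_divisors_eq x fun m n => tau (m * n) ^ j / ((m * n : ℕ) : ℝ)
      _ ≤ ∑ m ∈ Icc 1 x, ∑ n ∈ Icc 1 x, tau m ^ j / m * (tau n ^ j / n) := by
          refine sum_le_sum fun m _ => ?_
          refine (sum_le_sum fun n _ => ?_).trans (sum_le_sum_of_subset_of_nonneg
            (Icc_subset_Icc_right (Nat.div_le_self x m)) fun n _ _ => ?_)
          · rw [div_mul_div_comm, ← mul_pow]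
            push_cast
            have := tau_nonneg (m * n)
            gcongr
            exact tau_mul_le m n
          · have := tau_nonneg m; have := tau_nonneg n; positivity
      _ = (∑ n ∈ Icc 1 x, tau n ^ j / n) ^ 2 := by rw [sq, sum_mul_sum]
      _ ≤ _ := by rw [pow_succ 2 j, pow_mul]; exact pow_le_pow_left₀ h0 ih 2

theorem sum_tau_pow_le (j x : ℕ) : ∑ n ∈ Icc 1 x, tau n ^ j ≤ x * (1 + log x) ^ 2 ^ j := by
  refine le_trans ?_ (mul_le_mul_of_nonneg_left (sum_tau_pow_div_le j x) (Nat.cast_nonneg x))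
  rw [mul_sum]
  refine sum_le_sum fun n hn => ?_
  rw [mem_Icc] at hn
  have h1 : (0:ℝ) < n := by exact_mod_cast hn.1
  have h2 : (n:ℝ) ≤ x := by exact_mod_cast hn.2
  rw [mul_div_assoc', le_div_iff₀ h1, mul_comm]
  exact mul_le_mul_of_nonneg_right h2 (pow_nonneg (tau_nonneg n) _)

theorem sum_inv_totient_le (x : ℕ) : ∑ n ∈ Icc 1 x, (1 : ℝ) / n.totient ≤ (1 + log x) ^ 2 := by
  refine (sum_le_sum fun n hn => inv_totient_le (mem_Icc.1 hn).1).trans ?_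
  simpa using sum_tau_pow_div_le 1 x

/-- `log N` rounded up to an integer. -/
def ell (N : ℕ) : ℕ := ⌈log N⌉₊

theorem log_le_ell (N : ℕ) : log N ≤ ell N := Nat.le_ceil _

theorem two_le_ell {N : ℕ} (hN : 3 ≤ N) : 2 ≤ ell N := by
  have h : Real.exp 1 < N := Real.exp_one_lt_d9.trans_le (by
    have : (3:ℝ) ≤ N := by exact_mod_cast hN
    linarith)
  have : 1 < log N := (Real.lt_log_iff_exp_lt (by positivity)).2 h
  rw [ell, Nat.succ_le_iff, Nat.lt_ceil]; exact_mod_cast this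

theorem ell_le_two_mul {N : ℕ} (hN : 3 ≤ N) : (ell N : ℝ) ≤ 2 * log N := by
  have h := Nat.ceil_lt_add_one (Real.log_nonneg (by exact_mod_cast (by omega : 1 ≤ N) : (1:ℝ) ≤ N))
  have h2 := one_le_log_of_three_le hN
  rw [ell]; linarith

theorem one_add_log_le {N x : ℕ} (hN : 3 ≤ N) (hx : x ≤ N) : 1 + log x ≤ 2 * ell N := by
  have h1 : log x ≤ log N := by
    rcases Nat.eq_zero_or_pos x with rfl | h
    · simpa using log_natCast_nonneg N
    · exact log_le_log (by exact_mod_cast h) (by exact_mod_cast hx)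
  have := log_le_ell N
  have h2 : (2:ℝ) ≤ ell N := by exact_mod_cast two_le_ell hN
  linarith

/-- `log n` on primes. -/
def vth (n : ℕ) : ℝ := if n.Prime then log n else 0

theorem vth_nonneg (n : ℕ) : 0 ≤ vth n := by
  rw [vth]; split_ifs
  · exact log_natCast_nonneg n
  · rfl

theorem vth_le_log (n : ℕ) : vth n ≤ log n := by
  rw [vth]; split_ifs
  · rfl
  · exact log_natCast_nonneg n

theorem vth_le_vonMangoldt (n : ℕ) : vth n ≤ vonMangoldt n := by
  rw [vth]; split_ifs with h
  · rw [ArithmeticFunction.vonMangoldt_apply_prime h]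
  · exact vonMangoldt_nonneg

theorem sum_vonMangoldt_sub_vth_le {N y : ℕ} (hN : 1 ≤ N) (hy : y ≤ N) :
    ∑ n ∈ Icc 1 y, (vonMangoldt n - vth n) ≤ 2 * Real.sqrt N * log N := by
  refine (sum_le_sum_of_subset_of_nonneg (Icc_subset_Icc_right hy) fun n _ _ =>
    sub_nonneg.2 (vth_le_vonMangoldt n)).trans ?_
  refine le_trans ?_ (Chebyshev.psi_sub_theta_le (x := N) (by exact_mod_cast hN))
  rw [Chebyshev.psi_eq_sum_Icc, Chebyshev.theta_eq_sum_Icc, Nat.floor_natCast, sum_filter,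
    ← sum_sub_distrib]
  refine sum_le_sum_of_subset_of_nonneg (Icc_subset_Icc_left (by omega)) fun n _ _ =>
    sub_nonneg.2 (vth_le_vonMangoldt n)

theorem sum_primeFactors_log_le {k : ℕ} (hk : k ≠ 0) : ∑ p ∈ k.primeFactors, log p ≤ log k := by
  rw [← Real.log_prod (fun p hp => by exact_mod_cast (Nat.prime_of_mem_primeFactors hp).ne_zero),
    ← Nat.cast_prod]
  exact log_le_log (by exact_mod_cast prod_pos fun p hp => (Nat.prime_of_mem_primeFactors hp).pos)
    (by exact_mod_cast Nat.le_of_dvd (Nat.pos_of_ne_zero hk) (Nat.prod_primeFactors_dvd k))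

/-- Primes in arithmetic progressions, weighted by their logarithm. -/
def thetaAP (k : ℕ) (c : ZMod k) (y : ℕ) : ℝ := ∑ n ∈ Icc 1 y, if (n : ZMod k) = c then vth n else 0

/-- `‖∑_{n ≤ y} vm χ n‖` for an arbitrary modulus. -/
def vmN {r : ℕ} (χ : DirichletCharacter ℂ r) (y : ℕ) : ℝ :=
  if h : r = 0 then 0 else haveI : NeZero r := ⟨h⟩; ‖∑ n ∈ Icc 1 y, vm χ n‖

theorem vmN_eq {r : ℕ} [NeZero r] (χ : DirichletCharacter ℂ r) (y : ℕ) :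
    vmN χ y = ‖∑ n ∈ Icc 1 y, vm χ n‖ := by
  rw [vmN, dif_neg (NeZero.ne r)]

theorem vmN_nonneg {r : ℕ} (χ : DirichletCharacter ℂ r) (y : ℕ) : 0 ≤ vmN χ y := by
  rw [vmN]; split_ifs
  · rfl
  · exact norm_nonneg _

theorem norm_vm_primitive_sub_le {k : ℕ} [NeZero k] (χ : DirichletCharacter ℂ k) [NeZero χ.conductor] (n : ℕ) :
    ‖χ n * (vth n : ℂ) - (if χ = 1 then 1 else 0) - vm χ.primitiveCharacter n‖ ≤
      (vonMangoldt n - vth n) +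
        if n ∈ k.primeFactors then log n else 0 := by
  have h1 : (if χ.primitiveCharacter = 1 then (1:ℂ) else 0) = if χ = 1 then 1 else 0 := by
    refine if_congr ?_ rfl rfl
    rw [DirichletCharacter.eq_one_iff_conductor_eq_one, DirichletCharacter.eq_one_iff_conductor_eq_one,
      (DirichletCharacter.isPrimitive_def _).1 χ.primitiveCharacter_isPrimitive]
  have h2 : χ = 1 → χ.primitiveCharacter n = 1 := fun h => by
    have hc := DirichletCharacter.eq_one_iff_conductor_eq_one.1 h
    have : ∀ (m : ℕ) (ψ : DirichletCharacter ℂ m), m = 1 → ψ n = 1 := by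
      rintro m ψ rfl
      rw [DirichletCharacter.level_one ψ, Subsingleton.elim (n : ZMod 1) 1, map_one]
    exact this _ _ hc
  have h3 : χ n * (vth n : ℂ) - (if χ = 1 then 1 else 0) - vm χ.primitiveCharacter n =
      (χ n - χ.primitiveCharacter n) * (vth n : ℂ) -
        χ.primitiveCharacter n * ((vonMangoldt n - vth n : ℝ) : ℂ) := by
    rw [vm, h1]
    split_ifs with h
    · rw [h2 h]; push_cast; ring
    · push_cast; ring
  rw [h3]
  refine (norm_sub_le _ _).trans ?_
  rw [add_comm]
  refine add_le_add ?_ ?_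
  · rw [norm_mul, norm_real, norm_of_nonneg (sub_nonneg.2 (vth_le_vonMangoldt n))]
    exact mul_le_of_le_one_left (sub_nonneg.2 (vth_le_vonMangoldt n)) (DirichletCharacter.norm_le_one _ _)
  · have h4 : 0 ≤ if n ∈ k.primeFactors then log n else 0 := by
      split_ifs
      · exact log_natCast_nonneg n
      · rfl
    by_cases hn : n.Prime
    · by_cases hd : n ∣ k
      · rw [if_pos (Nat.mem_primeFactors.2 ⟨hn, hd, NeZero.ne k⟩), norm_mul, norm_real,
          norm_of_nonneg (vth_nonneg n)]
        have h5 : χ (n : ZMod k) = 0 := χ.map_nonunit (by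
          rw [ZMod.isUnit_iff_coprime, Nat.Prime.coprime_iff_not_dvd hn]; simpa using hd)
        rw [h5, zero_sub, norm_neg]
        exact (mul_le_of_le_one_left (vth_nonneg n) (DirichletCharacter.norm_le_one _ _)).trans (vth_le_log n)
      · have h5 := χ.primitiveCharacter_apply_of_isCoprime (a := n) (by
          rw [Nat.isCoprime_iff_coprime]; exact (Nat.Prime.coprime_iff_not_dvd hn).2 hd)
        rw [Int.cast_natCast, Int.cast_natCast] at h5
        rw [h5, sub_self, zero_mul, norm_zero]; exact h4
    · rw [vth, if_neg hn]; simpa using h4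

theorem norm_sum_char_vth_sub_le {k : ℕ} [NeZero k] (χ : DirichletCharacter ℂ k) {N y : ℕ} (hN : 1 ≤ N)
    (hy : y ≤ N) :
    ‖∑ n ∈ Icc 1 y, χ n * (vth n : ℂ) - (if χ = 1 then (y : ℂ) else 0)‖ ≤
      vmN χ.primitiveCharacter y + (2 * Real.sqrt N * log N + log k) := by
  have : NeZero χ.conductor := ⟨χ.conductor_ne_zero⟩
  have h1 : ∑ n ∈ Icc 1 y, χ n * (vth n : ℂ) - (if χ = 1 then (y : ℂ) else 0) =
      ∑ n ∈ Icc 1 y, (χ n * (vth n : ℂ) - (if χ = 1 then 1 else 0) - vm χ.primitiveCharacter n) +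
        ∑ n ∈ Icc 1 y, vm χ.primitiveCharacter n := by
    rw [← sum_add_distrib, sum_congr rfl fun n _ => sub_add_cancel _ _, sum_sub_distrib, sum_const]
    split_ifs <;> simp
  rw [h1, add_comm, vmN_eq]
  refine (norm_add_le _ _).trans (add_le_add le_rfl ((norm_sum_le _ _).trans
    ((sum_le_sum fun n _ => norm_vm_primitive_sub_le χ n).trans ?_)))
  rw [sum_add_distrib]
  refine add_le_add (sum_vonMangoldt_sub_vth_le hN hy) ?_
  rw [← sum_filter]
  refine le_trans (sum_le_sum_of_subset_of_nonneg (fun n hn => (mem_filter.1 hn).2) fun n _ _ =>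
    log_natCast_nonneg n) (sum_primeFactors_log_le (NeZero.ne k))

theorem sum_primitiveCharacter_le {k : ℕ} [NeZero k] (F : (r : ℕ) → DirichletCharacter ℂ r → ℝ)
    (hF : ∀ r χ, 0 ≤ F r χ) :
    ∑ χ : DirichletCharacter ℂ k, F _ χ.primitiveCharacter ≤ ∑ r ∈ k.divisors, ∑ χ ∈ primChars r, F r χ := by
  classical
  rw [sum_sigma']
  let g : DirichletCharacter ℂ k → (Σ r, DirichletCharacter ℂ r) := fun χ => ⟨_, χ.primitiveCharacter⟩
  have hg : Function.Injective g := by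
    intro χ ψ h
    have : ∀ (r s : ℕ) (a : DirichletCharacter ℂ r) (b : DirichletCharacter ℂ s) (hr : r ∣ k) (hs : s ∣ k),
        (⟨r, a⟩ : Σ r, DirichletCharacter ℂ r) = ⟨s, b⟩ →
          changeLevel hr a = changeLevel hs b := by
      rintro r s a b hr hs ⟨⟩; rfl
    have := this _ _ _ _ χ.conductor_dvd_level ψ.conductor_dvd_level h
    rwa [DirichletCharacter.changeLevel_primitiveCharacter,
      DirichletCharacter.changeLevel_primitiveCharacter] at this
  calc _ = ∑ x ∈ univ.image g, F x.1 x.2 := by rw [sum_image fun _ _ _ _ h => hg h]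
    _ ≤ _ := by
      refine sum_le_sum_of_subset_of_nonneg ?_ fun _ _ _ => hF _ _
      intro x hx
      obtain ⟨χ, -, rfl⟩ := mem_image.1 hx
      have : NeZero χ.conductor := ⟨χ.conductor_ne_zero⟩
      exact mem_sigma.2 ⟨Nat.mem_divisors.2 ⟨χ.conductor_dvd_level, NeZero.ne k⟩,
        mem_primChars.2 χ.primitiveCharacter_isPrimitive⟩

/-- Primes in a reduced residue class, in terms of primitive characters. -/
theorem abs_thetaAP_sub_le {k : ℕ} [NeZero k] {c : ZMod k} (hc : IsUnit c) {N y : ℕ} (hN : 1 ≤ N) (hy : y ≤ N) :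
    |thetaAP k c y - y / k.totient| ≤
      1 / k.totient * ∑ r ∈ k.divisors, ∑ χ ∈ primChars r, vmN χ y +
        (2 * Real.sqrt N * log N + log k) := by
  classical
  have hφ : (0:ℝ) < k.totient := by exact_mod_cast Nat.totient_pos.2 (NeZero.pos k)
  have hφ' : (k.totient : ℂ) ≠ 0 := by exact_mod_cast hφ.ne'
  set W := 2 * Real.sqrt N * log N + log k with hW
  have h1 : (k.totient : ℂ) * ((thetaAP k c y - y / k.totient : ℝ) : ℂ) =
      ∑ χ : DirichletCharacter ℂ k, χ c⁻¹ * (∑ n ∈ Icc 1 y, χ n * (vth n : ℂ) - (if χ = 1 then (y : ℂ) else 0)) := by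
    have e1 : ∑ χ : DirichletCharacter ℂ k, χ c⁻¹ * ∑ n ∈ Icc 1 y, χ n * (vth n : ℂ) =
        (k.totient : ℂ) * (thetaAP k c y : ℂ) := by
      simp_rw [mul_sum]
      rw [sum_comm, thetaAP]
      push_cast
      rw [mul_sum]
      refine sum_congr rfl fun n _ => ?_
      simp_rw [← mul_assoc]
      rw [← sum_mul, DirichletCharacter.sum_char_inv_mul_char_eq ℂ hc]
      by_cases h : c = (n : ZMod k)
      · simp [h]
      · simp [h, Ne.symm h]
    have e2 : ∑ χ : DirichletCharacter ℂ k, χ c⁻¹ * (if χ = 1 then (y : ℂ) else 0) = y := by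
      simp_rw [mul_ite, mul_zero]
      rw [sum_ite_eq' univ, if_pos (mem_univ _), MulChar.one_apply, one_mul]
      obtain ⟨u, rfl⟩ := hc
      rw [ZMod.inv_coe_unit]; exact u⁻¹.isUnit
    simp_rw [mul_sub]
    rw [sum_sub_distrib, e1, e2]
    push_cast
    field_simp
  have h2 := congrArg norm h1
  rw [norm_mul, norm_real, norm_eq_abs, norm_natCast] at h2
  have h3 : k.totient * |thetaAP k c y - y / k.totient| ≤
      ∑ χ : DirichletCharacter ℂ k, (vmN χ.primitiveCharacter y + W) := by
    rw [h2]
    refine (norm_sum_le _ _).trans (sum_le_sum fun χ _ => ?_)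
    rw [norm_mul]
    exact (mul_le_of_le_one_left (norm_nonneg _) (DirichletCharacter.norm_le_one _ _)).trans
      (norm_sum_char_vth_sub_le χ hN hy)
  have hcard : Fintype.card (DirichletCharacter ℂ k) = k.totient := by
    rw [← Nat.card_eq_fintype_card, DirichletCharacter.card_eq_totient_of_hasEnoughRootsOfUnity]
  rw [sum_add_distrib, sum_const, card_univ, hcard, nsmul_eq_mul] at h3
  have h4 := sum_primitiveCharacter_le (k := k) (fun r χ => vmN χ y) fun r χ => vmN_nonneg χ y
  have h5 : |thetaAP k c y - y / k.totient| = 1 / k.totient * (k.totient * |thetaAP k c y - y / k.totient|) := by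
    field_simp
  rw [h5, show W = 1 / k.totient * (k.totient * W) by field_simp, ← mul_add]
  exact mul_le_mul_of_nonneg_left (h3.trans (by linarith)) (by positivity)

theorem thetaAP_le_of_not_isUnit {k : ℕ} [NeZero k] {c : ZMod k} (hc : ¬ IsUnit c) (y : ℕ) :
    thetaAP k c y ≤ log k := by
  refine le_trans ?_ (sum_primeFactors_log_le (NeZero.ne k))
  rw [thetaAP]
  calc _ ≤ ∑ n ∈ Icc 1 y, if n ∈ k.primeFactors then log n else 0 := by
        refine sum_le_sum fun n _ => ?_
        split_ifs with h1 h2 h2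
        · exact vth_le_log n
        · rw [vth, if_neg]
          intro hp
          refine hc (h1 ▸ (ZMod.isUnit_iff_coprime n k).2 ((Nat.Prime.coprime_iff_not_dvd hp).2 fun hd => h2 ?_))
          exact Nat.mem_primeFactors.2 ⟨hp, hd, NeZero.ne k⟩
        · exact log_natCast_nonneg n
        · rfl
    _ ≤ _ := by
        rw [← sum_filter]
        exact sum_le_sum_of_subset_of_nonneg (fun n hn => (mem_filter.1 hn).2) fun n _ _ =>
          log_natCast_nonneg n

/-- The restriction of an arithmetic function to `n ≤ U`. -/
def truncAF (f : ArithmeticFunction ℝ) (U : ℕ) : ArithmeticFunction ℝ :=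
  ⟨fun n => if n ≤ U then f n else 0, by simp⟩

theorem truncAF_apply (f : ArithmeticFunction ℝ) (U n : ℕ) :
    truncAF f U n = if n ≤ U then f n else 0 := rfl

/-- The Möbius function with real values. -/
def muR : ArithmeticFunction ℝ := ((ArithmeticFunction.moebius : ArithmeticFunction ℤ) : ArithmeticFunction ℝ)

theorem abs_muR_le (n : ℕ) : |muR n| ≤ 1 := by
  rw [muR, ArithmeticFunction.intCoe_apply, ← Int.cast_abs]
  exact_mod_cast ArithmeticFunction.abs_moebius_le_one

/-- The coefficient of the large variable in Vaughan's identity. -/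
def vaughanBeta (U : ℕ) : ArithmeticFunction ℝ := (muR - truncAF muR U) * (ArithmeticFunction.zeta : ArithmeticFunction ℝ)

/-- The part of `Λ` supported on `n > U`. -/
def lamTail (U : ℕ) : ArithmeticFunction ℝ :=
  vonMangoldt - truncAF vonMangoldt U

theorem lamTail_apply (U n : ℕ) :
    lamTail U n = if n ≤ U then 0 else vonMangoldt n := by
  rw [lamTail, sub_eq_add_neg, ArithmeticFunction.add_apply, ArithmeticFunction.neg_apply, truncAF_apply]
  split_ifs <;> simp

theorem muR_sub_apply (U n : ℕ) : (muR - truncAF muR U) n = if n ≤ U then 0 else muR n := by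
  rw [sub_eq_add_neg, ArithmeticFunction.add_apply, ArithmeticFunction.neg_apply, truncAF_apply]
  split_ifs <;> simp

theorem vaughanBeta_eq (U m : ℕ) : vaughanBeta U m = ∑ d ∈ m.divisors, if d ≤ U then 0 else muR d := by
  rw [vaughanBeta, ArithmeticFunction.coe_mul_zeta_apply]
  exact sum_congr rfl fun d _ => muR_sub_apply U d

theorem abs_vaughanBeta_le (U m : ℕ) : |vaughanBeta U m| ≤ tau m := by
  rw [vaughanBeta_eq]
  refine (abs_sum_le_sum_abs _ _).trans ?_
  refine (sum_le_sum (g := fun _ => (1:ℝ)) fun d _ => ?_).trans (by simp [tau])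
  split_ifs
  · simp
  · exact abs_muR_le d

theorem vaughanBeta_eq_zero {U m : ℕ} (h : m ≤ U) : vaughanBeta U m = 0 := by
  rcases Nat.eq_zero_or_pos m with rfl | hm
  · simp
  rw [vaughanBeta_eq]
  exact sum_eq_zero fun d hd => if_pos ((Nat.divisor_le hd).trans h)

theorem lamTail_nonneg (U n : ℕ) : 0 ≤ lamTail U n := by
  rw [lamTail_apply]; split_ifs
  · rfl
  · exact vonMangoldt_nonneg

theorem lamTail_le_log (U n : ℕ) : lamTail U n ≤ log n := by
  rw [lamTail_apply]; split_ifs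
  · exact log_natCast_nonneg n
  · exact vonMangoldt_le_log

theorem vaughan_identity (U : ℕ) :
    (vonMangoldt : ArithmeticFunction ℝ) =
      truncAF vonMangoldt U + truncAF muR U * ArithmeticFunction.log
      - truncAF muR U * truncAF vonMangoldt U * (ArithmeticFunction.zeta : ArithmeticFunction ℝ)
      + vaughanBeta U * lamTail U := by
  have h1 := ArithmeticFunction.vonMangoldt_mul_zeta
  have h2 : muR * (ArithmeticFunction.zeta : ArithmeticFunction ℝ) = 1 := ArithmeticFunction.coe_moebius_mul_coe_zeta
  rw [vaughanBeta, lamTail, ← h1]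
  linear_combination (truncAF vonMangoldt U - vonMangoldt) * h2

theorem sum_mul_apply_eq (a b : ArithmeticFunction ℝ) (f : ℕ → ℂ) (y : ℕ) :
    ∑ n ∈ Icc 1 y, (((a * b) n : ℝ) : ℂ) * f n =
      ∑ m ∈ Icc 1 y, (a m : ℂ) * ∑ n ∈ Icc 1 (y / m), (b n : ℂ) * f (m * n) := by
  have h := sum_divisors_eq y (fun m n => (a m : ℂ) * ((b n : ℂ) * f (m * n)))
  simp_rw [mul_sum]
  rw [← h]
  refine sum_congr rfl fun n _ => ?_
  rw [ArithmeticFunction.mul_apply]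
  push_cast
  rw [sum_mul]
  refine sum_congr rfl fun d hd => ?_
  rw [(Nat.mem_divisorsAntidiagonal.1 hd).1]; ring

theorem abs_trunc_conv_le (U m : ℕ) :
    |(truncAF muR U * truncAF vonMangoldt U) m| ≤ log m := by
  rw [ArithmeticFunction.mul_apply, ← ArithmeticFunction.vonMangoldt_sum,
    ← Nat.sum_divisorsAntidiagonal' (f := fun _ d => vonMangoldt d)]
  refine (abs_sum_le_sum_abs _ _).trans (sum_le_sum fun d _ => ?_)
  have h0 : (0:ℝ) ≤ vonMangoldt d.2 := vonMangoldt_nonneg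
  rw [abs_mul, truncAF_apply, truncAF_apply]
  have h1 : |if d.1 ≤ U then muR d.1 else 0| ≤ 1 := by
    split_ifs
    · exact abs_muR_le _
    · simp
  have h2 : |if d.2 ≤ U then vonMangoldt d.2 else 0| ≤ vonMangoldt d.2 := by
    split_ifs
    · rw [abs_of_nonneg h0]
    · simpa only [abs_zero] using h0
  exact (mul_le_mul h1 h2 (abs_nonneg _) zero_le_one).trans (by rw [one_mul])

theorem trunc_conv_eq_zero {U m : ℕ} (h : U ^ 2 < m) :
    (truncAF muR U * truncAF vonMangoldt U) m = 0 := by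
  rw [ArithmeticFunction.mul_apply]
  refine sum_eq_zero fun d hd => ?_
  rw [truncAF_apply, truncAF_apply]
  by_cases h1 : d.1 ≤ U
  · by_cases h2 : d.2 ≤ U
    · have := (Nat.mem_divisorsAntidiagonal.1 hd).1
      nlinarith [Nat.mul_le_mul h1 h2]
    · rw [if_neg h2, mul_zero]
  · rw [if_neg h1, zero_mul]

theorem norm_sum_log_mul_le (b : ℕ → ℂ) {Y : ℕ} {B : ℝ}
    (hB : ∀ y ≤ Y, ‖∑ n ∈ Icc 1 y, b n‖ ≤ B) :
    ‖∑ n ∈ Icc 1 Y, (log n : ℂ) * b n‖ ≤ B * (2 * log Y) := by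
  have hI : ∀ y, Icc 1 y = Ioc 0 y := fun y => by ext; simp [Nat.succ_le_iff]
  have h := abel_norm_le b (fun n => ((log (min n Y : ℕ) : ℝ) : ℂ)) (Nat.zero_le Y)
    (B := B) (fun y _ hy => by rw [← hI]; exact hB y hy)
  have hB0 : 0 ≤ B := (norm_nonneg _).trans (hB 0 (Nat.zero_le _))
  have e1 : ∑ n ∈ Icc 1 Y, (log n : ℂ) * b n =
      ∑ n ∈ Ioc 0 Y, b n * ((log (min n Y : ℕ) : ℝ) : ℂ) := by
    rw [hI]
    refine sum_congr rfl fun n hn => ?_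
    rw [min_eq_left (mem_Ioc.1 hn).2, mul_comm]
  rw [e1]
  refine h.trans (mul_le_mul_of_nonneg_left ?_ hB0)
  have hm : ∀ n, 0 < n → log (min n Y : ℕ) ≤ log (min (n + 1) Y : ℕ) := fun n hn => by
    rcases Nat.eq_zero_or_pos Y with rfl | hY
    · simp
    · exact log_le_log (by exact_mod_cast lt_min hn hY) (by exact_mod_cast min_le_min_right _ (by omega))
  have e2 : ∀ n ∈ Ioc 0 Y, ‖((log (min n Y : ℕ) : ℝ) : ℂ) - ((log (min (n + 1) Y : ℕ) : ℝ) : ℂ)‖ =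
      log (min (n + 1) Y : ℕ) - log (min n Y : ℕ) := fun n hn => by
    rw [← ofReal_sub, norm_real, norm_eq_abs, abs_sub_comm, abs_of_nonneg]
    linarith [hm n (mem_Ioc.1 hn).1]
  rw [sum_congr rfl e2]
  have e3 : ∀ X, ∑ n ∈ Ioc 0 X, (log (min (n + 1) Y : ℕ) - log (min n Y : ℕ)) =
      log (min (X + 1) Y : ℕ) - log (min 1 Y : ℕ) := fun X => by
    induction X with
    | zero => simp
    | succ X ih => rw [← Finset.insert_Ioc_right_eq_Ioc_add_one (Nat.zero_le X), sum_insert (by simp), ih]; ring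
  rw [e3, min_eq_right (by omega : Y ≤ Y + 1), norm_real, norm_of_nonneg (log_natCast_nonneg _)]
  have := log_natCast_nonneg (min 1 Y)
  linarith

theorem vaughan_bound (f : ℕ → ℂ) (hf : ∀ n, ‖f n‖ ≤ 1) {U y : ℕ} {L : ℝ} (hL : log y ≤ L) (T : ℕ → ℝ)
    (hT : ∀ m ∈ Icc 1 (U ^ 2), ∀ z ≤ y / m, ‖∑ n ∈ Icc 1 z, f (m * n)‖ ≤ T m) :
    ‖∑ n ∈ Icc 1 y, ((vonMangoldt n : ℝ) : ℂ) * f n‖ ≤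
      U * L + 3 * L * ∑ m ∈ Icc 1 (U ^ 2), T m +
      ‖∑ m ∈ Icc 1 y, (vaughanBeta U m : ℂ) * ∑ n ∈ Icc 1 (y / m), (lamTail U n : ℂ) * f (m * n)‖ := by
  have hlog : ∀ n ∈ Icc 1 y, log n ≤ L := fun n hn => by
    rw [mem_Icc] at hn
    exact (log_le_log (by exact_mod_cast hn.1) (by exact_mod_cast hn.2)).trans hL
  have hL0 : 0 ≤ L := (log_natCast_nonneg y).trans hL
  have hT0 : ∀ m ∈ Icc 1 (U ^ 2), 0 ≤ T m := fun m hm => (norm_nonneg _).trans (hT m hm 0 (Nat.zero_le _))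
  have hid : ∑ n ∈ Icc 1 y, ((vonMangoldt n : ℝ) : ℂ) * f n =
      ∑ n ∈ Icc 1 y, ((truncAF vonMangoldt U n : ℝ) : ℂ) * f n
      + ∑ n ∈ Icc 1 y, (((truncAF muR U * ArithmeticFunction.log) n : ℝ) : ℂ) * f n
      - ∑ n ∈ Icc 1 y, (((truncAF muR U * truncAF vonMangoldt U * (ArithmeticFunction.zeta : ArithmeticFunction ℝ)) n : ℝ) : ℂ) * f n
      + ∑ n ∈ Icc 1 y, (((vaughanBeta U * lamTail U) n : ℝ) : ℂ) * f n := by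
    rw [← sum_add_distrib, ← sum_sub_distrib, ← sum_add_distrib]
    refine sum_congr rfl fun n _ => ?_
    conv_lhs => rw [vaughan_identity U]
    rw [ArithmeticFunction.add_apply, sub_eq_add_neg, ArithmeticFunction.add_apply, ArithmeticFunction.add_apply,
      ArithmeticFunction.neg_apply]
    push_cast; ring
  rw [hid]
  have b1 : ‖∑ n ∈ Icc 1 y, ((truncAF vonMangoldt U n : ℝ) : ℂ) * f n‖ ≤ U * L := by
    calc _ ≤ ∑ n ∈ Icc 1 y, if n ≤ U then L else 0 := (norm_sum_le _ _).trans (sum_le_sum fun n hn => by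
            rw [norm_mul, norm_real, norm_eq_abs, truncAF_apply]
            split_ifs
            · rw [abs_of_nonneg vonMangoldt_nonneg, ← mul_one L]
              exact mul_le_mul (vonMangoldt_le_log.trans (hlog n hn)) (hf n) (norm_nonneg _) hL0
            · simp)
      _ = ((Icc 1 y).filter (· ≤ U)).card * L := by rw [← sum_filter, sum_const, nsmul_eq_mul]
      _ ≤ U * L := by
        refine mul_le_mul_of_nonneg_right ?_ hL0
        have : ((Icc 1 y).filter (· ≤ U)) ⊆ Icc 1 U := fun n hn => by
          rw [mem_filter, mem_Icc] at hn; rw [mem_Icc]; omega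
        exact_mod_cast (card_le_card this).trans (by simp)
  have hsub : ∀ G : ℕ → ℝ, (∀ m ∈ Icc 1 y, G m ≤ if m ≤ U ^ 2 then T m else 0) →
      ∑ m ∈ Icc 1 y, G m ≤ ∑ m ∈ Icc 1 (U ^ 2), T m := fun G hG => by
    refine (sum_le_sum hG).trans ?_
    rw [← sum_filter]
    refine sum_le_sum_of_subset_of_nonneg (fun n hn => ?_) fun m hm _ => hT0 m hm
    rw [mem_filter, mem_Icc] at hn; rw [mem_Icc]; exact ⟨hn.1.1, hn.2⟩
  have hUU : ∀ {m}, m ≤ U → m ≤ U ^ 2 := fun {m} h => h.trans (Nat.le_self_pow two_ne_zero U)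
  have b2 : ‖∑ n ∈ Icc 1 y, (((truncAF muR U * ArithmeticFunction.log) n : ℝ) : ℂ) * f n‖ ≤
      2 * L * ∑ m ∈ Icc 1 (U ^ 2), T m := by
    rw [sum_mul_apply_eq]
    refine (norm_sum_le _ _).trans ?_
    refine le_trans ?_ (mul_le_mul_of_nonneg_left (hsub (fun m => if m ≤ U ^ 2 then T m else 0) fun m _ => le_rfl)
      (by positivity))
    rw [mul_sum]
    refine sum_le_sum fun m hm => ?_
    rw [norm_mul, norm_real, norm_eq_abs, truncAF_apply]
    by_cases h : m ≤ U
    · have hm' := mem_Icc.1 hm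
      have hmU : m ∈ Icc 1 (U ^ 2) := mem_Icc.2 ⟨hm'.1, hUU h⟩
      rw [if_pos h, if_pos (hUU h)]
      have h3 := norm_sum_log_mul_le (fun n => f (m * n)) (Y := y / m) (B := T m) (hT m hmU)
      simp only [ArithmeticFunction.log_apply]
      have h4 : log (y / m : ℕ) ≤ L := by
        rcases Nat.eq_zero_or_pos (y / m) with h0 | h0
        · rw [h0]; simpa using hL0
        · exact (log_le_log (by exact_mod_cast h0) (by exact_mod_cast Nat.div_le_self _ _)).trans hL
      calc _ ≤ 1 * (T m * (2 * log (y / m : ℕ))) := mul_le_mul (abs_muR_le m) h3 (norm_nonneg _) zero_le_one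
        _ ≤ _ := by nlinarith [hT0 m hmU]
    · rw [if_neg h, abs_zero, zero_mul]
      have : 0 ≤ if m ≤ U ^ 2 then T m else 0 := by
        split_ifs with h5
        · exact hT0 m (mem_Icc.2 ⟨(mem_Icc.1 hm).1, h5⟩)
        · rfl
      positivity
  have b3 : ‖∑ n ∈ Icc 1 y, (((truncAF muR U * truncAF vonMangoldt U * (ArithmeticFunction.zeta : ArithmeticFunction ℝ)) n : ℝ) : ℂ) * f n‖ ≤
      L * ∑ m ∈ Icc 1 (U ^ 2), T m := by
    rw [sum_mul_apply_eq]
    refine (norm_sum_le _ _).trans ?_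
    refine le_trans ?_ (mul_le_mul_of_nonneg_left (hsub (fun m => if m ≤ U ^ 2 then T m else 0) fun m _ => le_rfl)
      hL0)
    rw [mul_sum]
    refine sum_le_sum fun m hm => ?_
    rw [norm_mul, norm_real, norm_eq_abs]
    by_cases h : m ≤ U ^ 2
    · rw [if_pos h]
      have e : ∑ n ∈ Icc 1 (y / m), (((ArithmeticFunction.zeta : ArithmeticFunction ℝ) n : ℝ) : ℂ) * f (m * n) =
          ∑ n ∈ Icc 1 (y / m), f (m * n) := sum_congr rfl fun n hn => by
        have : n ≠ 0 := by have := (mem_Icc.1 hn).1; omega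
        simp [this]
      rw [e]
      exact mul_le_mul ((abs_trunc_conv_le U m).trans (hlog m hm)) (hT m (mem_Icc.2 ⟨(mem_Icc.1 hm).1, h⟩) _ le_rfl)
        (norm_nonneg _) hL0
    · rw [trunc_conv_eq_zero (by omega), if_neg h]; simp
  rw [sum_mul_apply_eq (vaughanBeta U)]
  refine (norm_add_le _ _).trans (add_le_add ((norm_sub_le _ _).trans ?_) le_rfl)
  refine (add_le_add ((norm_add_le _ _).trans (add_le_add b1 b2)) b3).trans (le_of_eq ?_)
  ring

theorem one_div_le_nd {q : ℕ} (hq : 0 < q) {a : ℤ} (h : ¬ (q : ℤ) ∣ a) : 1 / (q : ℝ) ≤ nd (a / q) := by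
  have hq' : (0:ℝ) < q := by exact_mod_cast hq
  set z := round ((a : ℝ) / q) with hz
  have h0 : a - z * q ≠ 0 := fun h0 => h ⟨z, by linarith⟩
  have h1 : (1:ℝ) ≤ |((a - z * q : ℤ) : ℝ)| := by
    rw [← Int.cast_abs]; exact_mod_cast Int.one_le_abs h0
  rw [nd, ← hz, div_le_iff₀ hq', ← abs_of_pos hq', ← abs_mul, abs_of_pos hq']
  have e : ((a:ℝ) / q - z) * q = ((a - z * q : ℤ) : ℝ) := by push_cast; field_simp
  rw [e]; exact h1

theorem sum_ex_orthogonal {H : ℕ} (hH : 0 < H) (a : ℤ) :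
    ∑ h ∈ range H, ex (h * (a / H)) = if (H : ℤ) ∣ a then (H : ℂ) else 0 := by
  have hH' : (H:ℝ) ≠ 0 := by exact_mod_cast hH.ne'
  split_ifs with hd
  · obtain ⟨c, rfl⟩ := hd
    have : ∀ h ∈ range H, ex ((h:ℝ) * (((H * c : ℤ) : ℝ) / H)) = 1 := fun h _ => by
      rw [← ex_int (h * c)]; congr 1; push_cast; field_simp
    rw [sum_congr rfl this]; simp
  · have h1 : ex ((a:ℝ) / H) ≠ 1 := fun h1 => by
      have h2 := four_mul_nd_le ((a:ℝ) / H)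
      have h3 := one_div_le_nd hH hd
      rw [h1, sub_self, norm_zero] at h2
      have : (0:ℝ) < 1 / H := by positivity
      linarith
    simp_rw [ex_nat_mul]
    rw [geom_sum_eq h1, ← ex_nat_mul, mul_div_cancel₀ _ hH', ex_int, sub_self, zero_div]

theorem indicator_le_eq {N n z : ℕ} (hn : 1 ≤ n) (hnN : n ≤ N) (hz : z ≤ N) :
    (if n ≤ z then (1:ℂ) else 0) = 1 / ((N + 1 : ℕ) : ℂ) *
      ∑ h ∈ range (N + 1), (∑ j ∈ Ioc 0 z, ex (j * (h / (N + 1 : ℕ)))) * ex (-(n * (h / (N + 1 : ℕ)))) := by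
  have hH : ((N + 1 : ℕ) : ℂ) ≠ 0 := by exact_mod_cast N.succ_ne_zero
  simp_rw [sum_mul]
  rw [sum_comm]
  have e : ∀ j ∈ Ioc 0 z, ∑ h ∈ range (N + 1), ex (j * (h / (N + 1 : ℕ))) * ex (-(n * (h / (N + 1 : ℕ)))) =
      if j = n then ((N + 1 : ℕ) : ℂ) else 0 := fun j hj => by
    rw [mem_Ioc] at hj
    have h1 := sum_ex_orthogonal (Nat.succ_pos N) ((j : ℤ) - n)
    have h2 : ((N + 1 : ℕ) : ℤ) ∣ (j : ℤ) - n ↔ j = n := by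
      constructor
      · intro hd
        have := Int.eq_zero_of_abs_lt_dvd hd (by rw [abs_lt]; push_cast; omega)
        omega
      · rintro rfl; simp
    simp only [Nat.succ_eq_add_one, h2] at h1
    rw [← h1]
    refine sum_congr rfl fun h _ => ?_
    rw [← ex_add]; congr 1; push_cast; ring
  rw [sum_congr rfl e, sum_ite_eq']
  have : n ∈ Ioc 0 z ↔ n ≤ z := by rw [mem_Ioc]; omega
  simp only [this]
  split_ifs
  · field_simp
  · simp

theorem sum_geomBound_range_le {N : ℕ} (hN : 1 ≤ N) :
    ∑ h ∈ range (N + 1), geomBound N (h / (N + 1 : ℕ)) ≤ ((N + 1 : ℕ) : ℝ) * (6 + 2 * log (N + 1 : ℕ)) := by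
  have hH : (0:ℝ) < (N + 1 : ℕ) := by positivity
  have h2 : (2:ℝ) ≤ (N + 1 : ℕ) := by exact_mod_cast (by omega : 2 ≤ N + 1)
  have h := sum_geomBound_le (range (N + 1)) (fun h => (h / (N + 1 : ℕ) : ℝ)) (δ := 1 / (N + 1 : ℕ)) (K := N)
    (by positivity) (by rw [div_le_div_iff₀ hH two_pos]; linarith) (by positivity)
    (fun i hi j hj hij => by
      rw [mem_range] at hi hj
      have := one_div_le_nd (Nat.succ_pos N) (a := (i : ℤ) - j) (fun hd => hij (by
        have := Int.eq_zero_of_abs_lt_dvd hd (by rw [abs_lt]; push_cast; omega)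
        omega))
      rw [← sub_div]; push_cast at this ⊢; exact this) 0
  simp only [sub_zero, one_div, inv_inv] at h
  refine h.trans ?_
  push_cast; nlinarith

/-- Separation of the variables `m`, `n` linked by a condition `n ≤ z m`. -/
theorem separate_variables {ι : Type*} (s : Finset ι) (w : ι → ℝ) (hw : ∀ i ∈ s, 0 ≤ w i) (x : ι → ℕ → ℂ)
    (S T : Finset ℕ) {N : ℕ} (hN : 1 ≤ N) (hT : ∀ n ∈ T, 1 ≤ n ∧ n ≤ N) (z : ℕ → ℕ) (hz : ∀ m ∈ S, z m ≤ N)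
    (a c : ℕ → ℝ) {D : ℝ}
    (h : ∀ α γ : ℕ → ℂ, (∀ m ∈ S, ‖α m‖ ≤ a m) → (∀ n ∈ T, ‖γ n‖ ≤ c n) →
      ∑ i ∈ s, w i * (‖∑ m ∈ S, α m * x i m‖ * ‖∑ n ∈ T, γ n * x i n‖) ≤ D)
    (α γ : ℕ → ℂ) (hα : ∀ m ∈ S, ‖α m‖ ≤ a m) (hγ : ∀ n ∈ T, ‖γ n‖ ≤ c n) :
    ∑ i ∈ s, w i * ‖∑ m ∈ S, α m * x i m * ∑ n ∈ T with n ≤ z m, γ n * x i n‖ ≤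
      D * (6 + 2 * log (N + 1 : ℕ)) := by
  have hH : (0:ℝ) < (N + 1 : ℕ) := by positivity
  have hN0 : (0:ℝ) < N := by exact_mod_cast hN
  set G : ℕ → ℝ := fun h => geomBound N (h / (N + 1 : ℕ)) with hG
  have hGpos : ∀ h, 0 < G h := fun h => by
    have := nd_nonneg (h / (N + 1 : ℕ) : ℝ)
    simp only [hG, geomBound]; positivity
  set A : ℕ → ℕ → ℂ := fun h m => α m * ((∑ j ∈ Ioc 0 (z m), ex (j * (h / (N + 1 : ℕ)))) / (G h : ℂ)) with hA
  set Γ : ℕ → ℕ → ℂ := fun h n => γ n * ex (-(n * (h / (N + 1 : ℕ)))) with hΓ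
  have key : ∀ i, ∑ m ∈ S, α m * x i m * ∑ n ∈ T with n ≤ z m, γ n * x i n =
      1 / ((N + 1 : ℕ) : ℂ) * ∑ h ∈ range (N + 1), (G h : ℂ) * ((∑ m ∈ S, A h m * x i m) * ∑ n ∈ T, Γ h n * x i n) := fun i => by
    have e1 : ∀ m ∈ S, α m * x i m * ∑ n ∈ T with n ≤ z m, γ n * x i n =
        1 / ((N + 1 : ℕ) : ℂ) * ∑ h ∈ range (N + 1), (G h : ℂ) * (A h m * x i m * ∑ n ∈ T, Γ h n * x i n) := fun m hm => by
      rw [sum_filter]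
      have e2 : ∀ n ∈ T, (if n ≤ z m then γ n * x i n else 0) = ∑ h ∈ range (N + 1), 1 / ((N + 1 : ℕ) : ℂ) *
          ((∑ j ∈ Ioc 0 (z m), ex (j * (h / (N + 1 : ℕ)))) * (Γ h n * x i n)) := fun n hn => by
        have h3 := indicator_le_eq (hT n hn).1 (hT n hn).2 (hz m hm)
        calc _ = (if n ≤ z m then (1:ℂ) else 0) * (γ n * x i n) := by split_ifs <;> simp
          _ = _ := by
            rw [h3, mul_assoc, sum_mul, mul_sum]
            refine sum_congr rfl fun h _ => ?_
            simp only [hΓ]; ring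
      rw [sum_congr rfl e2, sum_comm, mul_sum, mul_sum]
      refine sum_congr rfl fun h _ => ?_
      have hg : (G h : ℂ) ≠ 0 := by exact_mod_cast (hGpos h).ne'
      rw [← mul_sum, ← mul_sum]
      simp only [hA]
      generalize ∑ j ∈ Ioc 0 (z m), ex (j * (h / (N + 1 : ℕ))) = P
      field_simp
    rw [sum_congr rfl e1, ← mul_sum, sum_comm]
    congr 1
    refine sum_congr rfl fun h _ => ?_
    rw [← mul_sum, sum_mul]
  have hAle : ∀ h, ∀ m ∈ S, ‖A h m‖ ≤ a m := fun h m hm => by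
    simp only [hA]
    rw [norm_mul, norm_div, norm_real, norm_of_nonneg (hGpos h).le]
    have h1 : ‖∑ j ∈ Ioc 0 (z m), ex (j * (h / (N + 1 : ℕ)))‖ ≤ G h :=
      norm_sum_ex_le _ _ _ (by simpa using hz m hm)
    have h2 : ‖∑ j ∈ Ioc 0 (z m), ex (j * (h / (N + 1 : ℕ)))‖ / G h ≤ 1 := (div_le_one (hGpos h)).2 h1
    exact (mul_le_of_le_one_right (norm_nonneg _) h2).trans (hα m hm)
  have hΓle : ∀ h, ∀ n ∈ T, ‖Γ h n‖ ≤ c n := fun h n hn => by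
    simp only [hΓ]
    rw [norm_mul, norm_ex, mul_one]; exact hγ n hn
  calc _ ≤ ∑ i ∈ s, w i * (1 / ((N + 1 : ℕ) : ℝ) * ∑ h ∈ range (N + 1), G h *
        (‖∑ m ∈ S, A h m * x i m‖ * ‖∑ n ∈ T, Γ h n * x i n‖)) := sum_le_sum fun i hi => by
        refine mul_le_mul_of_nonneg_left ?_ (hw i hi)
        rw [key i, norm_mul, norm_div, norm_one, norm_natCast]
        refine mul_le_mul_of_nonneg_left ((norm_sum_le _ _).trans (sum_le_sum fun h _ => ?_)) (by positivity)
        rw [norm_mul, norm_mul, norm_real, norm_of_nonneg (hGpos h).le]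
    _ = 1 / ((N + 1 : ℕ) : ℝ) * ∑ h ∈ range (N + 1), G h *
        ∑ i ∈ s, w i * (‖∑ m ∈ S, A h m * x i m‖ * ‖∑ n ∈ T, Γ h n * x i n‖) := by
        simp_rw [mul_sum]
        rw [sum_comm]
        refine sum_congr rfl fun h _ => sum_congr rfl fun i _ => by ring
    _ ≤ 1 / ((N + 1 : ℕ) : ℝ) * ∑ h ∈ range (N + 1), G h * D := by
        refine mul_le_mul_of_nonneg_left (sum_le_sum fun k _ => ?_) (by positivity)
        exact mul_le_mul_of_nonneg_left (h _ _ (hAle k) (hΓle k)) (hGpos k).le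
    _ ≤ _ := by
        have hD : 0 ≤ D := le_trans (sum_nonneg fun i hi => mul_nonneg (hw i hi) (by positivity)) (h α γ hα hγ)
        rw [← sum_mul, ← mul_assoc, mul_comm]
        refine mul_le_mul_of_nonneg_left ?_ hD
        rw [one_div, inv_mul_le_iff₀ hH]
        exact sum_geomBound_range_le hN

theorem sum_dyadic {E : Type*} [AddCommMonoid E] (F : ℕ → E) (J : ℕ) :
    ∑ j ∈ range J, ∑ m ∈ Ico (2 ^ j) (2 ^ (j + 1)), F m = ∑ m ∈ Ico 1 (2 ^ J), F m := by
  induction J with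
  | zero => simp
  | succ J ih =>
    rw [sum_range_succ, ih, sum_Ico_consecutive _ Nat.one_le_two_pow (Nat.pow_le_pow_right two_pos (by omega))]

theorem natLog_two_le {N : ℕ} (hN : 3 ≤ N) : ((Nat.log 2 N + 1 : ℕ) : ℝ) ≤ 2 * ell N := by
  have h2 : (2:ℝ) ≤ ell N := by exact_mod_cast two_le_ell hN
  have h3 := log_le_ell N
  have h4 : (Nat.log 2 N : ℝ) * log 2 ≤ log N := by
    rw [← Real.log_pow]
    exact log_le_log (by positivity) (by exact_mod_cast Nat.pow_log_le_self 2 (by omega))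
  have h5 := Real.log_two_gt_d9
  have h6 : (0:ℝ) ≤ Nat.log 2 N := Nat.cast_nonneg _
  push_cast
  nlinarith

/-- The dyadic pieces of the bilinear part of `∑_{n ≤ y} Λ(n) χ(n)`. -/
def bilinPiece (N U y j : ℕ) {r : ℕ} (χ : DirichletCharacter ℂ r) : ℂ :=
  ∑ m ∈ Ico (2 ^ j) (2 ^ (j + 1)), (vaughanBeta U m : ℂ) * χ m *
    ∑ n ∈ (Ioc 0 (N / 2 ^ j)).filter (fun n => n ≤ y / m), (lamTail U n : ℂ) * χ n

theorem bilin_eq_sum {N U y : ℕ} (hy : y ≤ N) {r : ℕ} (χ : DirichletCharacter ℂ r) :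
    ∑ m ∈ Icc 1 y, (vaughanBeta U m : ℂ) * ∑ n ∈ Icc 1 (y / m), (lamTail U n : ℂ) * χ ((m * n : ℕ) : ZMod r) =
      ∑ j ∈ range (Nat.log 2 N + 1), bilinPiece N U y j χ := by
  set F : ℕ → ℂ := fun m => (vaughanBeta U m : ℂ) * ∑ n ∈ Icc 1 (y / m), (lamTail U n : ℂ) * χ ((m * n : ℕ) : ZMod r) with hF
  have h1 : ∀ j, bilinPiece N U y j χ = ∑ m ∈ Ico (2 ^ j) (2 ^ (j + 1)), F m := fun j => by
    refine sum_congr rfl fun m hm => ?_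
    rw [mem_Ico] at hm
    have e : (Ioc 0 (N / 2 ^ j)).filter (fun n => n ≤ y / m) = Icc 1 (y / m) := by
      ext n
      have : y / m ≤ N / 2 ^ j := (Nat.div_le_div_right hy).trans (Nat.div_le_div_left hm.1 (by positivity))
      simp only [mem_filter, mem_Ioc, mem_Icc]; omega
    rw [e]; simp only [hF]
    rw [mul_assoc, mul_sum]
    congr 1
    refine sum_congr rfl fun n _ => ?_
    push_cast; rw [map_mul]; ring
  simp_rw [h1]
  rw [sum_dyadic]
  refine sum_subset (fun n hn => ?_) fun n _ hn => ?_
  · rw [mem_Icc] at hn; rw [mem_Ico]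
    exact ⟨hn.1, lt_of_le_of_lt (hn.2.trans hy) (Nat.lt_pow_succ_log_self (by norm_num) N)⟩
  · rename_i hn'
    rw [mem_Ico] at hn'
    rw [mem_Icc] at hn
    have : y / n = 0 := Nat.div_eq_of_lt (by omega)
    rw [this]; simp

theorem bilinPiece_eq_zero {N U y j : ℕ} (h : 2 ^ (j + 1) ≤ U ∨ N / 2 ^ j ≤ U) {r : ℕ} (χ : DirichletCharacter ℂ r) :
    bilinPiece N U y j χ = 0 := by
  refine sum_eq_zero fun m hm => ?_
  rw [mem_Ico] at hm
  rcases h with h | h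
  · rw [vaughanBeta_eq_zero (by omega)]; simp
  · rw [sum_eq_zero fun n hn => ?_, mul_zero]
    rw [mem_filter, mem_Ioc] at hn
    rw [lamTail_apply, if_pos (by omega)]; simp

theorem sum_mul_mul_sq_le {ι : Type*} (s : Finset ι) (w a b : ι → ℝ) (hw : ∀ i ∈ s, 0 ≤ w i) :
    (∑ i ∈ s, w i * (a i * b i)) ^ 2 ≤ (∑ i ∈ s, w i * a i ^ 2) * ∑ i ∈ s, w i * b i ^ 2 := by
  have h := sum_mul_sq_le_sq_mul_sq s (fun i => Real.sqrt (w i) * a i) (fun i => Real.sqrt (w i) * b i)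
  have e1 : ∀ i ∈ s, Real.sqrt (w i) * a i * (Real.sqrt (w i) * b i) = w i * (a i * b i) := fun i hi => by
    nth_rw 3 [← Real.mul_self_sqrt (hw i hi)]; ring
  have e2 : ∀ c : ι → ℝ, ∀ i ∈ s, (Real.sqrt (w i) * c i) ^ 2 = w i * c i ^ 2 := fun c i hi => by
    rw [mul_pow, Real.sq_sqrt (hw i hi)]
  rwa [sum_congr rfl e1, sum_congr rfl (e2 a), sum_congr rfl (e2 b)] at h

theorem sum_bilinPiece_le {N U y j R : ℕ} (hN : 3 ≤ N) (hj : 2 ^ (j + 1) ≤ N) (hR : 1 ≤ R) (hRN : R ≤ N) (hy : y ≤ N) :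
    ∑ r ∈ Icc 1 R, (r / r.totient : ℝ) * ∑ χ ∈ primChars r, ‖bilinPiece N U y j χ‖ ≤
      Real.sqrt (2 ^ 13 * (ell N : ℝ) ^ 8 * N * (N + R ^ 2 * (2 ^ j + (N / 2 ^ j : ℕ)) + R ^ 4)) * (12 * ell N) := by
  set ℓ : ℝ := (ell N : ℝ) with hℓ
  have hl2 : (2:ℝ) ≤ ℓ := by rw [hℓ]; exact_mod_cast two_le_ell hN
  set X := N / 2 ^ j with hX
  have hXN : X ≤ N := Nat.div_le_self _ _
  have hMX : (2:ℝ) ^ j * X ≤ N := by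
    have := Nat.mul_div_le N (2 ^ j)
    rw [← hX] at this; exact_mod_cast this
  have hMN : (2:ℝ) ^ j ≤ N := by
    exact_mod_cast (Nat.pow_le_pow_right two_pos (Nat.le_succ j)).trans hj
  have hR1 : (1:ℝ) ≤ R := by exact_mod_cast hR
  have hlogR : 2 + 2 * log R ≤ 4 * ℓ := by have := one_add_log_le hN hRN; linarith
  set s : Finset (Σ r, DirichletCharacter ℂ r) := (Icc 1 R).sigma primChars with hs
  set D := Real.sqrt (2 ^ 13 * ℓ ^ 8 * N * (N + R ^ 2 * (2 ^ j + X) + R ^ 4)) with hD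
  have hsep := separate_variables s (fun i => (i.1 / i.1.totient : ℝ)) (fun i _ => by positivity)
    (fun i n => i.2 n) (Ico (2 ^ j) (2 ^ (j + 1))) (Ioc 0 X) (N := N) (by omega)
    (fun n hn => by rw [mem_Ioc] at hn; omega) (fun m => y / m) (fun m _ => (Nat.div_le_self _ _).trans hy)
    tau (fun _ => ℓ) (D := D) (fun α γ hα hγ => ?_) (fun m => (vaughanBeta U m : ℂ)) (fun n => (lamTail U n : ℂ))
    (fun m _ => by rw [norm_real]; exact abs_vaughanBeta_le U m)
    (fun n hn => by
      rw [mem_Ioc] at hn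
      rw [norm_real, norm_of_nonneg (lamTail_nonneg U n)]
      refine (lamTail_le_log U n).trans ((log_le_log (by exact_mod_cast hn.1) ?_).trans (log_le_ell N))
      exact_mod_cast (by omega : n ≤ N))
  · rw [hs, sum_sigma] at hsep
    simp only [← mul_sum] at hsep
    refine hsep.trans (mul_le_mul_of_nonneg_left ?_ (Real.sqrt_nonneg _))
    have h1 : log (N + 1 : ℕ) ≤ log N + 1 := by
      have h3 : (3:ℝ) ≤ N := by exact_mod_cast hN
      have h4 : log ((N + 1 : ℕ) / N) ≤ (N + 1 : ℕ) / N - 1 := Real.log_le_sub_one_of_pos (by positivity)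
      rw [Real.log_div (by positivity) (by positivity)] at h4
      have h5 : ((N + 1 : ℕ) : ℝ) / N - 1 ≤ 1 := by
        rw [sub_le_iff_le_add, div_le_iff₀ (by positivity)]; push_cast; linarith
      linarith
    have := log_le_ell N
    linarith
  · have hIco : Ico (2 ^ j) (2 ^ (j + 1)) = Ioc (2 ^ j - 1) (2 ^ j - 1 + 2 ^ j) := by
      have : 0 < 2 ^ j := by positivity
      ext n; rw [mem_Ico, mem_Ioc, pow_succ]; omega
    have hls : ∀ (M K : ℕ) (a : ℕ → ℂ), ∑ i ∈ s, (i.1 / i.1.totient : ℝ) * ‖∑ n ∈ Ioc M (M + K), a n * i.2 n‖ ^ 2 ≤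
        16 * ℓ * (K + R ^ 2) * ∑ n ∈ Ioc M (M + K), ‖a n‖ ^ 2 := fun M K a => by
      have h := multiplicative_large_sieve R M K a hR
      rw [hs, sum_sigma]
      simp only [← mul_sum]
      refine h.trans (mul_le_mul_of_nonneg_right ?_ (by positivity))
      have h5 : (R:ℝ) ^ 2 * (2 + 2 * log R) ≤ R ^ 2 * (4 * ℓ) := mul_le_mul_of_nonneg_left hlogR (by positivity)
      have h6 : (K:ℝ) * 2 ≤ K * ℓ := mul_le_mul_of_nonneg_left hl2 (by positivity)
      nlinarith [(Nat.cast_nonneg K : (0:ℝ) ≤ K)]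
    have hP : ∑ i ∈ s, (i.1 / i.1.totient : ℝ) * ‖∑ m ∈ Ico (2 ^ j) (2 ^ (j + 1)), α m * i.2 m‖ ^ 2 ≤
        512 * ℓ ^ 5 * 2 ^ j * (2 ^ j + R ^ 2) := by
      rw [hIco]
      refine (hls _ _ _).trans ?_
      rw [← hIco]
      have h7 : ∑ m ∈ Ico (2 ^ j) (2 ^ (j + 1)), ‖α m‖ ^ 2 ≤ 2 ^ (j + 1) * (2 * ℓ) ^ 4 := by
        calc _ ≤ ∑ m ∈ Icc 1 (2 ^ (j + 1)), tau m ^ 2 := by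
              refine (sum_le_sum fun m hm => pow_le_pow_left₀ (norm_nonneg _) (hα m hm) 2).trans
                (sum_le_sum_of_subset_of_nonneg (fun n hn => ?_) fun _ _ _ => by positivity)
              rw [mem_Ico] at hn; rw [mem_Icc]
              exact ⟨Nat.one_le_two_pow.trans hn.1, hn.2.le⟩
          _ ≤ _ := by
              refine (sum_tau_pow_le 2 _).trans ?_
              have h8 := one_add_log_le hN hj
              have h9 : 0 ≤ 1 + log (2 ^ (j + 1) : ℕ) := by have := log_natCast_nonneg (2 ^ (j + 1)); linarith
              push_cast at h8 h9 ⊢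
              exact mul_le_mul_of_nonneg_left (pow_le_pow_left₀ h9 h8 _) (by positivity)
      push_cast
      calc _ ≤ 16 * ℓ * (2 ^ j + R ^ 2) * (2 ^ (j + 1) * (2 * ℓ) ^ 4) := mul_le_mul_of_nonneg_left h7 (by positivity)
        _ = _ := by ring
    have hQ : ∑ i ∈ s, (i.1 / i.1.totient : ℝ) * ‖∑ n ∈ Ioc 0 X, γ n * i.2 n‖ ^ 2 ≤
        16 * ℓ ^ 3 * X * (X + R ^ 2) := by
      have h := hls 0 X γ
      rw [zero_add] at h
      refine h.trans ?_
      have h7 : ∑ n ∈ Ioc 0 X, ‖γ n‖ ^ 2 ≤ X * ℓ ^ 2 :=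
        (sum_le_sum fun n hn => pow_le_pow_left₀ (norm_nonneg _) (hγ n hn) 2).trans (by simp)
      calc _ ≤ 16 * ℓ * (X + R ^ 2) * (X * ℓ ^ 2) := mul_le_mul_of_nonneg_left h7 (by positivity)
        _ = _ := by ring
    refine Real.le_sqrt_of_sq_le ((sum_mul_mul_sq_le s _ _ _ fun i _ => by positivity).trans
      ((mul_le_mul hP hQ (sum_nonneg fun i _ => by positivity) (by positivity)).trans ?_))
    have h10 : (2:ℝ) ^ j * X * ((2 ^ j + R ^ 2) * (X + R ^ 2)) ≤ N * (N + R ^ 2 * (2 ^ j + X) + R ^ 4) := by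
      refine mul_le_mul hMX ?_ (by positivity) (by positivity)
      nlinarith
    calc _ = 2 ^ 13 * ℓ ^ 8 * (2 ^ j * X * ((2 ^ j + R ^ 2) * (X + R ^ 2))) := by ring
      _ ≤ 2 ^ 13 * ℓ ^ 8 * (N * (N + R ^ 2 * (2 ^ j + X) + R ^ 4)) := mul_le_mul_of_nonneg_left h10 (by positivity)
      _ = _ := by ring

theorem sum_bilinPiece_block_le {N y K e : ℕ} (hN : 3 ≤ N) (he : 1 ≤ e) (hy : y ≤ N)
    (hK : K ^ 2 * ell N ^ (2 * e) ≤ N) (i j : ℕ) :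
    ∑ r ∈ Ico (2 ^ i) (2 ^ (i + 1)), (if ell N ^ e < r ∧ r ≤ K then
      1 / (r.totient : ℝ) * ∑ χ ∈ primChars r, ‖bilinPiece N (ell N ^ (2 * e)) y j χ‖ else 0) ≤
      2 ^ 8 * (ell N : ℝ) ^ 4 * N / ell N ^ e * (12 * ell N) * 2 := by
  have hl2 : 2 ≤ ell N := two_le_ell hN
  have hU1 : 1 ≤ ell N ^ (2 * e) := Nat.one_le_pow _ _ (by omega)
  by_cases hd : 2 ^ (j + 1) ≤ ell N ^ (2 * e) ∨ N / 2 ^ j ≤ ell N ^ (2 * e)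
  · refine (le_of_eq (sum_eq_zero fun r _ => ?_)).trans (by positivity)
    split_ifs
    · rw [sum_eq_zero fun χ _ => by rw [bilinPiece_eq_zero hd, norm_zero], mul_zero]
    · rfl
  push Not at hd
  by_cases hi : ell N ^ e < 2 ^ (i + 1) ∧ 2 ^ i ≤ K
  swap
  · refine (le_of_eq (sum_eq_zero fun r hr => ?_)).trans (by positivity)
    rw [mem_Ico] at hr
    rw [if_neg]
    rintro ⟨h1, h2⟩
    exact hi ⟨by omega, by omega⟩
  have hWl : 4 ≤ ell N ^ (2 * e) := calc
    4 = 2 ^ 2 := rfl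
    _ ≤ ell N ^ 2 := Nat.pow_le_pow_left hl2 2
    _ ≤ _ := Nat.pow_le_pow_right (by omega) (by omega)
  have hK1 : 1 ≤ K := Nat.one_le_two_pow.trans hi.2
  have h2K : 2 * K ≤ N := by nlinarith
  set R := 2 ^ (i + 1) with hR
  have hR2 : R ≤ 2 * K := by rw [hR, pow_succ]; omega
  have hRN : R ≤ N := hR2.trans h2K
  have hR1 : 1 ≤ R := Nat.one_le_two_pow
  have hj : 2 ^ (j + 1) ≤ N := by
    have h3 : 2 ≤ N / 2 ^ j := by omega
    have := (Nat.le_div_iff_mul_le (by positivity)).1 h3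
    rw [pow_succ]; omega
  have hmain := sum_bilinPiece_le (U := ell N ^ (2 * e)) hN hj hR1 hRN hy
  set ℓ : ℝ := (ell N : ℝ) with hℓ
  have hl2' : (2:ℝ) ≤ ℓ := by rw [hℓ]; exact_mod_cast hl2
  have hR0 : (0:ℝ) < R := by exact_mod_cast hR1
  have hsq : Real.sqrt (2 ^ 13 * ℓ ^ 8 * N * (N + R ^ 2 * (2 ^ j + (N / 2 ^ j : ℕ)) + R ^ 4)) ≤
      2 ^ 8 * ℓ ^ 4 * N / ℓ ^ e * R := by
    refine Real.sqrt_le_iff.2 ⟨by positivity, ?_⟩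
    set X := N / 2 ^ j with hX
    set W : ℝ := ℓ ^ (2 * e) with hW
    have hWpos : 0 < W := by positivity
    have hMX : (2:ℝ) ^ j * X ≤ N := by
      have := Nat.mul_div_le N (2 ^ j)
      rw [← hX] at this; exact_mod_cast this
    have a1 : W ≤ (R:ℝ) ^ 2 := by
      have h : ell N ^ (2 * e) ≤ R ^ 2 := by
        rw [mul_comm, pow_mul]; exact Nat.pow_le_pow_left hi.1.le 2
      rw [hW, hℓ]; exact_mod_cast h
    have a2 : (2:ℝ) ^ j * W ≤ N := le_trans (mul_le_mul_of_nonneg_left (by rw [hW, hℓ]; exact_mod_cast hd.2.le) (by positivity)) hMX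
    have a3 : X * W ≤ 2 * (N:ℝ) := by
      have h : W ≤ 2 * 2 ^ j := by rw [hW, hℓ]; have := hd.1.le; rw [pow_succ] at this; exact_mod_cast (by omega : ell N ^ (2 * e) ≤ 2 * 2 ^ j)
      have h4 : (0:ℝ) ≤ X := Nat.cast_nonneg X
      nlinarith
    have a4 : (R:ℝ) ^ 2 * W ≤ 4 * N := by
      have h : R ^ 2 * ell N ^ (2 * e) ≤ 4 * N := by
        have : R ^ 2 ≤ (2 * K) ^ 2 := Nat.pow_le_pow_left hR2 2
        nlinarith
      rw [hW, hℓ]; exact_mod_cast h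
    have a5 : ((N:ℝ) + R ^ 2 * (2 ^ j + X) + R ^ 4) * W ≤ 8 * R ^ 2 * N := by
      have hN0 : (0:ℝ) ≤ N := Nat.cast_nonneg N
      have b1 : (N:ℝ) * W ≤ N * R ^ 2 := mul_le_mul_of_nonneg_left a1 hN0
      have b2 : (R:ℝ) ^ 2 * (2 ^ j * W) ≤ R ^ 2 * N := mul_le_mul_of_nonneg_left a2 (by positivity)
      have b3 : (R:ℝ) ^ 2 * (X * W) ≤ R ^ 2 * (2 * N) := mul_le_mul_of_nonneg_left a3 (by positivity)
      have b4 : (R:ℝ) ^ 2 * (R ^ 2 * W) ≤ R ^ 2 * (4 * N) := mul_le_mul_of_nonneg_left a4 (by positivity)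
      linarith
    have a6 : (N:ℝ) + R ^ 2 * (2 ^ j + X) + R ^ 4 ≤ 8 * R ^ 2 * N / W := by rwa [le_div_iff₀ hWpos]
    calc _ ≤ 2 ^ 13 * ℓ ^ 8 * N * (8 * R ^ 2 * N / W) := mul_le_mul_of_nonneg_left a6 (by positivity)
      _ = _ := by rw [hW, mul_comm 2 e, pow_mul]; field_simp; norm_num
  calc _ ≤ ∑ r ∈ Ico (2 ^ i) R, 2 / R * ((r / r.totient : ℝ) * ∑ χ ∈ primChars r, ‖bilinPiece N (ell N ^ (2 * e)) y j χ‖) := by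
        refine sum_le_sum fun r hr => ?_
        rw [mem_Ico] at hr
        have hr1 : 1 ≤ r := Nat.one_le_two_pow.trans hr.1
        have hG : 0 ≤ ∑ χ ∈ primChars r, ‖bilinPiece N (ell N ^ (2 * e)) y j χ‖ := sum_nonneg fun _ _ => norm_nonneg _
        split_ifs
        · rw [← mul_assoc]
          refine mul_le_mul_of_nonneg_right ?_ hG
          have h5 : (0:ℝ) < r.totient := by exact_mod_cast Nat.totient_pos.2 hr1
          rw [div_mul_div_comm, div_le_div_iff₀ h5 (by positivity)]
          have h6 : (R:ℝ) ≤ 2 * r := by exact_mod_cast (by rw [hR, pow_succ]; omega : R ≤ 2 * r)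
          nlinarith
        · positivity
    _ ≤ 2 / R * ∑ r ∈ Icc 1 R, (r / r.totient : ℝ) * ∑ χ ∈ primChars r, ‖bilinPiece N (ell N ^ (2 * e)) y j χ‖ := by
        rw [← mul_sum]
        refine mul_le_mul_of_nonneg_left (sum_le_sum_of_subset_of_nonneg (fun n hn => ?_) fun _ _ _ => ?_) (by positivity)
        · rw [mem_Ico] at hn; rw [mem_Icc]
          exact ⟨Nat.one_le_two_pow.trans hn.1, hn.2.le⟩
        · exact mul_nonneg (by positivity) (sum_nonneg fun _ _ => norm_nonneg _)
    _ ≤ 2 / R * (2 ^ 8 * ℓ ^ 4 * N / ℓ ^ e * R * (12 * ℓ)) :=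
        mul_le_mul_of_nonneg_left (hmain.trans (mul_le_mul_of_nonneg_right hsq (by positivity))) (by positivity)
    _ = _ := by field_simp

theorem sum_bilin_le {N y K e : ℕ} (hN : 3 ≤ N) (he : 1 ≤ e) (hy : y ≤ N) (hK : K ^ 2 * ell N ^ (2 * e) ≤ N) :
    ∑ r ∈ Icc 1 K, (if ell N ^ e < r then
      1 / (r.totient : ℝ) * ∑ χ ∈ primChars r, ‖∑ j ∈ range (Nat.log 2 N + 1), bilinPiece N (ell N ^ (2 * e)) y j χ‖ else 0) ≤
      2 ^ 15 * (ell N : ℝ) ^ 7 * N / ell N ^ e := by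
  set ℓ : ℝ := (ell N : ℝ) with hℓ
  have hl2 : (2:ℝ) ≤ ℓ := by rw [hℓ]; exact_mod_cast two_le_ell hN
  set J := Nat.log 2 N + 1 with hJ
  have hJl : (J : ℝ) ≤ 2 * ℓ := natLog_two_le hN
  have hKN : K < 2 ^ J := by
    refine lt_of_le_of_lt ?_ (Nat.lt_pow_succ_log_self (by norm_num) N)
    have := Nat.one_le_pow (2 * e) (ell N) (by have := two_le_ell hN; omega)
    nlinarith
  set V : ℝ := 2 ^ 8 * ℓ ^ 4 * N / ℓ ^ e * (12 * ℓ) * 2 with hV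
  have hV0 : 0 ≤ V := by positivity
  set G : ℕ → ℕ → ℝ := fun r j => if ell N ^ e < r ∧ r ≤ K then
      1 / (r.totient : ℝ) * ∑ χ ∈ primChars r, ‖bilinPiece N (ell N ^ (2 * e)) y j χ‖ else 0 with hG
  have hG0 : ∀ r j, 0 ≤ G r j := fun r j => by
    simp only [hG]
    split_ifs
    · exact mul_nonneg (by positivity) (sum_nonneg fun _ _ => norm_nonneg _)
    · rfl
  calc _ ≤ ∑ r ∈ Icc 1 K, ∑ j ∈ range J, G r j := sum_le_sum fun r hr => by
        rw [mem_Icc] at hr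
        simp only [hG, hr.2, and_true]
        split_ifs
        · rw [← mul_sum, sum_comm]
          exact mul_le_mul_of_nonneg_left (sum_le_sum fun χ _ => norm_sum_le _ _) (by positivity)
        · simp
    _ ≤ ∑ r ∈ Ico 1 (2 ^ J), ∑ j ∈ range J, G r j := by
        refine sum_le_sum_of_subset_of_nonneg (fun n hn => ?_) fun r _ _ => sum_nonneg fun j _ => hG0 r j
        rw [mem_Icc] at hn; rw [mem_Ico]; omega
    _ = ∑ i ∈ range J, ∑ j ∈ range J, ∑ r ∈ Ico (2 ^ i) (2 ^ (i + 1)), G r j := by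
        rw [← sum_dyadic]
        exact sum_congr rfl fun i _ => sum_comm
    _ ≤ ∑ i ∈ range J, ∑ j ∈ range J, V := sum_le_sum fun i _ => sum_le_sum fun j _ =>
        sum_bilinPiece_block_le hN he hy hK i j
    _ = (J : ℝ) ^ 2 * V := by simp; ring
    _ ≤ (2 * ℓ) ^ 2 * V := mul_le_mul_of_nonneg_right (pow_le_pow_left₀ (by positivity) hJl 2) hV0
    _ ≤ _ := by
        rw [hV]
        have : (2 * ℓ) ^ 2 * (2 ^ 8 * ℓ ^ 4 * N / ℓ ^ e * (12 * ℓ) * 2) = 24576 * (ℓ ^ 7 * N / ℓ ^ e) := by ring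
        rw [this]
        have h2 : 2 ^ 15 * ℓ ^ 7 * N / ℓ ^ e = 32768 * (ℓ ^ 7 * N / ℓ ^ e) := by ring
        rw [h2]
        exact mul_le_mul_of_nonneg_right (by norm_num) (by positivity)

theorem norm_sum_char_le {q : ℕ} [NeZero q] {χ : DirichletCharacter ℂ q} (hχ : χ ≠ 1) (z : ℕ) :
    ‖∑ n ∈ Icc 1 z, χ (n : ZMod q)‖ ≤ 2 * q := by
  have h := norm_sum_range_periodic_sub_le (fun n => χ ((n + 1 : ℕ) : ZMod q)) q (NeZero.pos q)
    (fun n => χ.norm_le_one _) (fun n => by congr 1; push_cast; simp) z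
  have hs : ∑ k ∈ range q, χ ((k + 1 : ℕ) : ZMod q) = 0 := by
    rw [← MulChar.sum_eq_zero_of_ne_one hχ]
    refine sum_nbij' (fun k => ((k + 1 : ℕ) : ZMod q)) (fun x => (x - 1).val) ?_ ?_ ?_ ?_ ?_
    · intro k _; exact mem_univ _
    · intro x _; exact mem_range.2 (ZMod.val_lt _)
    · intro k hk
      push_cast; rw [add_sub_cancel_right]; exact ZMod.val_cast_of_lt (mem_range.1 hk)
    · intro x _; push_cast; rw [ZMod.natCast_zmod_val, sub_add_cancel]
    · intro k _; rfl
  rw [hs, zero_div, zero_mul, sub_zero] at h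
  rw [range_eq_Ico, sum_Ico_add' (fun k : ℕ => χ (k : ZMod q)) 0 z 1] at h
  exact h

theorem card_primChars_le (r : ℕ) : #(primChars r) ≤ r.totient := by
  rcases Nat.eq_zero_or_pos r with rfl | hr
  · simp [primChars]
  have : NeZero r := ⟨hr.ne'⟩
  rw [← DirichletCharacter.card_eq_totient_of_hasEnoughRootsOfUnity ℂ r, Nat.card_eq_fintype_card]
  exact card_le_univ _

theorem inv_totient_mul_sum_le (r : ℕ) (F : DirichletCharacter ℂ r → ℝ) {B : ℝ} (hB : 0 ≤ B)
    (hF : ∀ χ ∈ primChars r, F χ ≤ B) : 1 / (r.totient : ℝ) * ∑ χ ∈ primChars r, F χ ≤ B := by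
  have h1 : ∑ χ ∈ primChars r, F χ ≤ r.totient * B := by
    refine (sum_le_sum hF).trans ?_
    rw [sum_const, nsmul_eq_mul]
    exact mul_le_mul_of_nonneg_right (by exact_mod_cast card_primChars_le r) hB
  rcases Nat.eq_zero_or_pos r.totient with h | h
  · rw [h]; simpa using hB
  · have h2 : (0:ℝ) < r.totient := by exact_mod_cast h
    rw [one_div, inv_mul_le_iff₀ h2]; exact h1

theorem vmN_le_vaughan {N y r e : ℕ} (hN : 3 ≤ N) (hy : y ≤ N) (hr : 1 < r) {χ : DirichletCharacter ℂ r}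
    (hχ : χ ∈ primChars r) :
    vmN χ y ≤ 7 * (ell N : ℝ) ^ (4 * e + 1) * r +
      ‖∑ j ∈ range (Nat.log 2 N + 1), bilinPiece N (ell N ^ (2 * e)) y j χ‖ := by
  have : NeZero r := ⟨by omega⟩
  have hχ1 : χ ≠ 1 := fun h => by
    have h2 := mem_primChars.1 hχ
    rw [DirichletCharacter.IsPrimitive, h, DirichletCharacter.conductor_one] at h2
    omega
  rw [vmN_eq, ← bilin_eq_sum hy]
  have hlog : log y ≤ ell N := by
    have := one_add_log_le hN hy
    refine le_trans ?_ (log_le_ell N)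
    rcases Nat.eq_zero_or_pos y with rfl | h
    · simpa using log_natCast_nonneg N
    · exact log_le_log (by exact_mod_cast h) (by exact_mod_cast hy)
  have h := vaughan_bound (fun n => χ (n : ZMod r)) (fun n => χ.norm_le_one _) (U := ell N ^ (2 * e)) hlog
    (fun _ => 2 * r) (fun m _ z _ => by
      push_cast
      simp only [map_mul]
      rw [← mul_sum, norm_mul]
      calc _ ≤ 1 * ‖∑ n ∈ Icc 1 z, χ (n : ZMod r)‖ := mul_le_mul_of_nonneg_right (χ.norm_le_one _) (norm_nonneg _)
        _ ≤ _ := by rw [one_mul]; exact norm_sum_char_le hχ1 z)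
  have e1 : ∑ n ∈ Icc 1 y, vm χ n = ∑ n ∈ Icc 1 y, ((vonMangoldt n : ℝ) : ℂ) * χ (n : ZMod r) :=
    sum_congr rfl fun n _ => by rw [vm, if_neg hχ1, sub_zero, mul_comm]
  rw [e1]
  refine h.trans (add_le_add ?_ le_rfl)
  set ℓ : ℝ := (ell N : ℝ) with hℓ
  have hl2 : (2:ℝ) ≤ ℓ := by rw [hℓ]; exact_mod_cast two_le_ell hN
  rw [sum_const, Nat.card_Icc, nsmul_eq_mul]
  push_cast
  have hr1 : (1:ℝ) ≤ r := by exact_mod_cast hr.le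
  have h2 : ℓ ^ (2 * e) * ℓ ≤ ℓ ^ (4 * e + 1) * r := by
    rw [← pow_succ]
    calc ℓ ^ (2 * e + 1) ≤ ℓ ^ (4 * e + 1) := pow_le_pow_right₀ (by linarith) (by omega)
      _ ≤ _ := le_mul_of_one_le_right (by positivity) hr1
  have h3 : 3 * ℓ * ((ℓ ^ (2 * e)) ^ 2 * (2 * r)) = 6 * (ℓ ^ (4 * e + 1) * r) := by
    rw [← pow_mul]; ring
  rw [h3]
  linarith

theorem sum_vmN_le (A : ℕ) : ∃ B : ℕ, ∃ C : ℝ, 0 ≤ C ∧ ∀ N y K : ℕ, 3 ≤ N → y ≤ N → K ^ 2 * ell N ^ (2 * B) ≤ N →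
    ∑ r ∈ Icc 1 K, 1 / (r.totient : ℝ) * ∑ χ ∈ primChars r, vmN χ y ≤ C * N / ell N ^ A := by
  obtain ⟨e, he⟩ : ∃ e, e = A + 7 := ⟨_, rfl⟩
  obtain ⟨C0, hC0, hSW⟩ := siegel_walfisz (2 * e + A)
  refine ⟨2 * e + A + 1, C0 * 2 ^ (2 * e + A) + 7 + 2 ^ 15, by positivity, fun N y K hN hy hK => ?_⟩
  have hl2 : (2:ℝ) ≤ ell N := by exact_mod_cast two_le_ell hN
  have hl2' := two_le_ell hN
  have hK' : K ^ 2 * ell N ^ (2 * e) ≤ N :=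
    (Nat.mul_le_mul_left _ (Nat.pow_le_pow_right (by omega) (by omega))).trans hK
  have hII := sum_bilin_le hN (by omega) hy hK'
  set ℓ : ℝ := (ell N : ℝ) with hℓ
  have hlpos : 0 < ℓ := by linarith
  have hN0 : (0:ℝ) ≤ N := Nat.cast_nonneg N
  have hlog : 0 < log N := by linarith [one_le_log_of_three_le hN]
  have hsmall : ∀ r ∈ Icc 1 K, r ≤ ell N ^ e →
      1 / (r.totient : ℝ) * ∑ χ ∈ primChars r, vmN χ y ≤ C0 * 2 ^ (2 * e + A) * N / ℓ ^ (e + A) := fun r hr hre => by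
    have : NeZero r := ⟨by rw [mem_Icc] at hr; omega⟩
    refine inv_totient_mul_sum_le r _ (by positivity) fun χ hχ => ?_
    rw [vmN_eq]
    refine (hSW r χ (mem_primChars.1 hχ) N y hN hy).trans ?_
    rw [div_le_div_iff₀ (by positivity) (by positivity)]
    have h1 : (r:ℝ) ≤ ℓ ^ e := by rw [hℓ]; exact_mod_cast hre
    have h2 : ℓ ^ (2 * e + A) ≤ 2 ^ (2 * e + A) * log N ^ (2 * e + A) := by
      rw [← mul_pow]; exact pow_le_pow_left₀ hlpos.le (ell_le_two_mul hN) _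
    calc C0 * r * N * ℓ ^ (e + A) ≤ C0 * ℓ ^ e * N * ℓ ^ (e + A) := by gcongr
      _ = C0 * N * ℓ ^ (2 * e + A) := by ring
      _ ≤ C0 * N * (2 ^ (2 * e + A) * log N ^ (2 * e + A)) := mul_le_mul_of_nonneg_left h2 (by positivity)
      _ = _ := by ring
  have hpoint : ∀ r ∈ Icc 1 K, 1 / (r.totient : ℝ) * ∑ χ ∈ primChars r, vmN χ y ≤
      (if r ≤ ell N ^ e then C0 * 2 ^ (2 * e + A) * N / ℓ ^ (e + A) else 0) + (7 * ℓ ^ (4 * e + 1) * K +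
      if ell N ^ e < r then
      1 / (r.totient : ℝ) * ∑ χ ∈ primChars r, ‖∑ j ∈ range (Nat.log 2 N + 1), bilinPiece N (ell N ^ (2 * e)) y j χ‖ else 0) := fun r hr => by
    by_cases h : r ≤ ell N ^ e
    · rw [if_pos h, if_neg (by omega)]
      have := hsmall r hr h
      have : 0 ≤ 7 * ℓ ^ (4 * e + 1) * K := by positivity
      linarith
    · rw [if_neg h, if_pos (by omega), zero_add]
      rw [mem_Icc] at hr
      have hr1 : 1 < r := by
        have := Nat.one_le_pow e (ell N) (by omega)
        omega
      have h2 : ∑ χ ∈ primChars r, vmN χ y ≤ ∑ χ ∈ primChars r, 7 * ℓ ^ (4 * e + 1) * K + ∑ χ ∈ primChars r,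
          ‖∑ j ∈ range (Nat.log 2 N + 1), bilinPiece N (ell N ^ (2 * e)) y j χ‖ := by
        rw [← sum_add_distrib]
        refine sum_le_sum fun χ hχ => (vmN_le_vaughan (e := e) hN hy hr1 hχ).trans (add_le_add ?_ le_rfl)
        exact mul_le_mul_of_nonneg_left (by exact_mod_cast hr.2) (by positivity)
      refine (mul_le_mul_of_nonneg_left h2 (by positivity)).trans ?_
      rw [mul_add]
      exact add_le_add (inv_totient_mul_sum_le r _ (by positivity) fun _ _ => le_rfl) le_rfl
  refine (sum_le_sum hpoint).trans ?_
  rw [sum_add_distrib, sum_add_distrib]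
  have p1 : ∑ r ∈ Icc 1 K, (if r ≤ ell N ^ e then C0 * 2 ^ (2 * e + A) * N / ℓ ^ (e + A) else 0) ≤
      C0 * 2 ^ (2 * e + A) * N / ℓ ^ A := by
    rw [← sum_filter, sum_const, nsmul_eq_mul]
    have h1 : #{r ∈ Icc 1 K | r ≤ ell N ^ e} ≤ ell N ^ e := by
      calc _ ≤ #(Icc 1 (ell N ^ e)) := card_le_card fun n hn => by
            rw [mem_filter, mem_Icc] at hn; rw [mem_Icc]; omega
        _ = _ := by simp
    calc _ ≤ ℓ ^ e * (C0 * 2 ^ (2 * e + A) * N / ℓ ^ (e + A)) :=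
          mul_le_mul_of_nonneg_right (by rw [hℓ]; exact_mod_cast h1) (by positivity)
      _ = _ := by rw [pow_add ℓ]; field_simp
  have p2 : ∑ r ∈ Icc 1 K, 7 * ℓ ^ (4 * e + 1) * K ≤ 7 * N / ℓ ^ A := by
    rw [sum_const, Nat.card_Icc, nsmul_eq_mul, Nat.add_sub_cancel, le_div_iff₀ (by positivity)]
    have h1 : (K:ℝ) ^ 2 * ℓ ^ (2 * (2 * e + A + 1)) ≤ N := by rw [hℓ]; exact_mod_cast hK
    have h2 : ℓ ^ (4 * e + 1 + A) ≤ ℓ ^ (2 * (2 * e + A + 1)) := pow_le_pow_right₀ (by linarith) (by omega)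
    calc (K:ℝ) * (7 * ℓ ^ (4 * e + 1) * K) * ℓ ^ A = 7 * (K ^ 2 * ℓ ^ (4 * e + 1 + A)) := by ring
      _ ≤ 7 * (K ^ 2 * ℓ ^ (2 * (2 * e + A + 1))) := by gcongr
      _ ≤ 7 * N := by linarith
  have p3 : 2 ^ 15 * ℓ ^ 7 * N / ℓ ^ e = 2 ^ 15 * N / ℓ ^ A := by rw [he, pow_add ℓ]; field_simp
  rw [p3] at hII
  refine (add_le_add p1 (add_le_add p2 hII)).trans (le_of_eq ?_)
  ring

theorem thetaAP_mono {k : ℕ} (c : ZMod k) {y y' : ℕ} (h : y ≤ y') : thetaAP k c y ≤ thetaAP k c y' := by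
  refine sum_le_sum_of_subset_of_nonneg (Icc_subset_Icc_right h) fun n _ _ => ?_
  split_ifs
  · exact vth_nonneg n
  · rfl

theorem thetaAP_nonneg {k : ℕ} (c : ZMod k) (y : ℕ) : 0 ≤ thetaAP k c y :=
  sum_nonneg fun n _ => by
    split_ifs
    · exact vth_nonneg n
    · rfl

theorem sum_inv_totient_mul_divisors_le {K : ℕ} (v : ℕ → ℝ) (hv : ∀ r, 0 ≤ v r) :
    ∑ k ∈ Icc 1 K, 1 / (k.totient : ℝ) * ∑ r ∈ k.divisors, v r ≤
      (1 + log K) ^ 2 * ∑ r ∈ Icc 1 K, 1 / (r.totient : ℝ) * v r := by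
  have h := sum_divisors_eq K (fun r j => 1 / ((r * j).totient : ℝ) * v r)
  have e1 : ∀ k ∈ Icc 1 K, 1 / (k.totient : ℝ) * ∑ r ∈ k.divisors, v r =
      ∑ d ∈ k.divisorsAntidiagonal, 1 / ((d.1 * d.2).totient : ℝ) * v d.1 := fun k _ => by
    rw [mul_sum, ← Nat.sum_divisorsAntidiagonal (f := fun r _ => 1 / (k.totient : ℝ) * v r)]
    exact sum_congr rfl fun d hd => by rw [(Nat.mem_divisorsAntidiagonal.1 hd).1]
  rw [sum_congr rfl e1, h, mul_sum]
  refine sum_le_sum fun r hr => ?_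
  rw [mem_Icc] at hr
  have hr0 : (0:ℝ) < r.totient := by exact_mod_cast Nat.totient_pos.2 hr.1
  calc _ ≤ ∑ j ∈ Icc 1 K, 1 / (j.totient : ℝ) * (1 / (r.totient : ℝ) * v r) := by
        refine (sum_le_sum fun j hj => ?_).trans (sum_le_sum_of_subset_of_nonneg
          (Icc_subset_Icc_right (Nat.div_le_self _ _)) fun j _ _ => ?_)
        · rw [mem_Icc] at hj
          have hj0 : (0:ℝ) < j.totient := by exact_mod_cast Nat.totient_pos.2 hj.1
          rw [← mul_assoc]
          refine mul_le_mul_of_nonneg_right ?_ (hv r)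
          rw [div_mul_div_comm, one_mul]
          refine one_div_le_one_div_of_le (by positivity) ?_
          rw [mul_comm]
          exact_mod_cast Nat.totient_super_multiplicative r j
        · exact mul_nonneg (by positivity) (mul_nonneg (by positivity) (hv r))
    _ ≤ _ := by
        rw [← sum_mul]
        exact mul_le_mul_of_nonneg_right (sum_inv_totient_le K) (mul_nonneg (by positivity) (hv r))

/-- The points of a regular subdivision of `[0, N]` into about `H` pieces. -/
def gridPoint (N H i : ℕ) : ℕ := min (i * N / H) N

theorem exists_gridPoint {N H y : ℕ} (hN : 1 ≤ N) (hH : 1 ≤ H) (hy : y ≤ N) :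
    ∃ i ≤ H, gridPoint N H i ≤ y ∧ y ≤ gridPoint N H (i + 1) ∧
      (gridPoint N H (i + 1) : ℝ) ≤ gridPoint N H i + (N / H + 1) := by
  refine ⟨y * H / N, ?_, ?_, ?_, ?_⟩
  · exact Nat.div_le_of_le_mul (Nat.mul_le_mul_right H hy)
  · refine (min_le_left _ _).trans (Nat.div_le_of_le_mul ?_)
    rw [mul_comm H y]; exact Nat.div_mul_le_self _ _
  · refine le_min ?_ hy
    rw [Nat.le_div_iff_mul_le (by omega)]
    have := Nat.lt_div_mul_add (a := y * H) (b := N) (by omega)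
    rw [add_mul, one_mul]; omega
  · have hH' : (0:ℝ) < H := by exact_mod_cast hH
    set i := y * H / N
    have hNH : (0:ℝ) ≤ N / H := by positivity
    rw [gridPoint, gridPoint]
    rcases le_total (i * N / H) N with h | h
    · rw [min_eq_left h]
      have h1 : ((min ((i + 1) * N / H) N : ℕ) : ℝ) ≤ ((i + 1) * N / H : ℕ) := by exact_mod_cast min_le_left _ _
      have h2 : (((i + 1) * N / H : ℕ) : ℝ) ≤ ((i + 1) * N : ℕ) / H := Nat.cast_div_le
      have h3 : ((i * N : ℕ) : ℝ) / H < ((i * N / H : ℕ) : ℝ) + 1 := by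
        rw [div_lt_iff₀ hH']
        have := Nat.lt_div_mul_add (a := i * N) (b := H) (by omega)
        rw [add_mul, one_mul]; exact_mod_cast this
      have h4 : (((i + 1) * N : ℕ) : ℝ) / H = ((i * N : ℕ) : ℝ) / H + N / H := by push_cast; ring
      linarith
    · rw [min_eq_right h]
      have h1 : ((min ((i + 1) * N / H) N : ℕ) : ℝ) ≤ N := by exact_mod_cast min_le_right _ _
      linarith

theorem abs_thetaAP_sub_main_le {N H k : ℕ} (hN : 3 ≤ N) (hH : 1 ≤ H) (hk : 1 ≤ k) (c : ZMod k) {y : ℕ} (hy : y ≤ N)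
    [Decidable (IsUnit c)] :
    |thetaAP k c y - (if IsUnit c then (y : ℝ) / k.totient else 0)| ≤
      ∑ i ∈ range (H + 2), (1 / (k.totient : ℝ) * ∑ r ∈ k.divisors, ∑ χ ∈ primChars r, vmN χ (gridPoint N H i) +
        (2 * Real.sqrt N * log N + log k)) + (N / H + 1) * (1 / (k.totient : ℝ)) := by
  have : NeZero k := ⟨by omega⟩
  set F : ℕ → ℝ := fun i => 1 / (k.totient : ℝ) * ∑ r ∈ k.divisors, ∑ χ ∈ primChars r, vmN χ (gridPoint N H i) +
        (2 * Real.sqrt N * log N + log k) with hF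
  have hlk := log_natCast_nonneg k
  have hlN := log_natCast_nonneg N
  have hF1 : ∀ i, log k ≤ F i := fun i => by
    have h1 : 0 ≤ 1 / (k.totient : ℝ) * ∑ r ∈ k.divisors, ∑ χ ∈ primChars r, vmN χ (gridPoint N H i) :=
      mul_nonneg (by positivity) (sum_nonneg fun r _ => sum_nonneg fun χ _ => vmN_nonneg χ _)
    have h2 : 0 ≤ 2 * Real.sqrt N * log N := by positivity
    simp only [hF]; linarith
  have hFs : ∀ i, i < H + 2 → F i ≤ ∑ i ∈ range (H + 2), F i := fun i hi =>
    single_le_sum (f := F) (fun i _ => hlk.trans (hF1 i)) (mem_range.2 hi)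
  have hφ : (0:ℝ) < k.totient := by exact_mod_cast Nat.totient_pos.2 hk
  have hlast : 0 ≤ ((N:ℝ) / H + 1) * (1 / (k.totient : ℝ)) := by positivity
  split_ifs with hc
  · obtain ⟨i, hi, h1, h2, h3⟩ := exists_gridPoint (by omega : 1 ≤ N) hH hy
    have hg : ∀ i, |thetaAP k c (gridPoint N H i) - (gridPoint N H i : ℝ) / k.totient| ≤ F i := fun i =>
      abs_thetaAP_sub_le hc (by omega) (min_le_right _ _)
    have a1 := abs_le.1 (hg i)
    have a2 := abs_le.1 (hg (i + 1))
    have m1 := thetaAP_mono c h1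
    have m2 := thetaAP_mono c h2
    have d1 : (gridPoint N H i : ℝ) / k.totient ≤ y / k.totient := by gcongr
    have d2 : (y : ℝ) / k.totient ≤ gridPoint N H (i + 1) / k.totient := by gcongr
    have d3 : (gridPoint N H (i + 1) : ℝ) / k.totient ≤ gridPoint N H i / k.totient + (N / H + 1) * (1 / (k.totient : ℝ)) := by
      rw [← div_eq_mul_one_div, ← add_div]; gcongr
    have s1 := hFs i (by omega)
    have s2 := hFs (i + 1) (by omega)
    rw [abs_le]; constructor <;> linarith
  · rw [sub_zero, abs_of_nonneg (thetaAP_nonneg c y)]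
    have := thetaAP_le_of_not_isUnit hc y
    have := hF1 0
    have := hFs 0 (by omega)
    linarith

open Classical in
theorem bombieri_vinogradov (A : ℕ) : ∃ B : ℕ, ∃ C : ℝ, 0 ≤ C ∧ ∀ N : ℕ, 3 ≤ N → ∃ E : ℕ → ℝ, (∀ k, 0 ≤ E k) ∧
    (∀ k : ℕ, 1 ≤ k → ∀ c : ZMod k, ∀ y ≤ N, |thetaAP k c y - (if IsUnit c then (y : ℝ) / k.totient else 0)| ≤ E k) ∧
    ∀ K : ℕ, K ^ 2 * ell N ^ (2 * B) ≤ N → ∑ k ∈ Icc 1 K, E k ≤ C * N / ell N ^ A := by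
  obtain ⟨B0, C0, hC0, h0⟩ := sum_vmN_le (2 * A + 4)
  refine ⟨B0 + 2 * A + 3, 8 * C0 + 14, by positivity, fun N hN => ?_⟩
  have hl2 : (2:ℝ) ≤ ell N := by exact_mod_cast two_le_ell hN
  have hl2' := two_le_ell hN
  have hlN := log_natCast_nonneg N
  set H := ell N ^ (A + 2) with hH
  have hH1 : 1 ≤ H := Nat.one_le_pow _ _ (by omega)
  refine ⟨fun k => ∑ i ∈ range (H + 2), (1 / (k.totient : ℝ) * ∑ r ∈ k.divisors, ∑ χ ∈ primChars r, vmN χ (gridPoint N H i) +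
        (2 * Real.sqrt N * log N + log k)) + (N / H + 1) * (1 / (k.totient : ℝ)), fun k => ?_,
        fun k hk c y hy => abs_thetaAP_sub_main_le hN hH1 hk c hy, fun K hK => ?_⟩
  · refine add_nonneg (sum_nonneg fun i _ => add_nonneg (mul_nonneg (by positivity) (sum_nonneg fun r _ =>
      sum_nonneg fun χ _ => vmN_nonneg χ _)) ?_) (by positivity)
    have := log_natCast_nonneg k
    positivity
  set ℓ : ℝ := (ell N : ℝ) with hℓ
  have hlpos : 0 < ℓ := by linarith
  rcases Nat.eq_zero_or_pos K with rfl | hK1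
  · simp; positivity
  have hKN : K ≤ N := by
    have := Nat.one_le_pow (2 * (B0 + 2 * A + 3)) (ell N) (by omega)
    nlinarith
  have hlN' : ell N ^ (2 * (B0 + 2 * A + 3)) ≤ N := by
    have : 1 ≤ K ^ 2 := Nat.one_le_pow _ _ hK1
    nlinarith [Nat.zero_le (ell N ^ (2 * (B0 + 2 * A + 3)))]
  have hlogK := one_add_log_le hN hKN
  have hlK := log_natCast_nonneg K
  rw [sum_add_distrib, sum_comm, ← mul_sum]
  have hHr : (H : ℝ) = ℓ ^ (A + 2) := by rw [hH]; push_cast; rfl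
  have hKs : (K:ℝ) * ℓ ^ (B0 + 2 * A + 3) ≤ Real.sqrt N := by
    refine Real.le_sqrt_of_sq_le ?_
    rw [mul_pow, ← pow_mul, mul_comm _ 2, hℓ]; exact_mod_cast hK
  have hsN : 1 ≤ Real.sqrt N := by
    rw [Real.one_le_sqrt]; exact_mod_cast (by omega : 1 ≤ N)
  have hi : ∀ i ∈ range (H + 2), ∑ k ∈ Icc 1 K, (1 / (k.totient : ℝ) * ∑ r ∈ k.divisors, ∑ χ ∈ primChars r, vmN χ (gridPoint N H i) +
        (2 * Real.sqrt N * log N + log k)) ≤ 4 * C0 * N / ℓ ^ (2 * A + 2) + 3 * (N / ℓ ^ (2 * A + 2)) := fun i _ => by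
    rw [sum_add_distrib]
    refine add_le_add ?_ ?_
    · refine (sum_inv_totient_mul_divisors_le (fun r => ∑ χ ∈ primChars r, vmN χ (gridPoint N H i))
        fun r => sum_nonneg fun χ _ => vmN_nonneg χ _).trans ?_
      calc _ ≤ (2 * ℓ) ^ 2 * (C0 * N / ℓ ^ (2 * A + 4)) := mul_le_mul (pow_le_pow_left₀ (by linarith) hlogK 2)
            (h0 N _ K hN (min_le_right _ _) ((Nat.mul_le_mul_left _ (Nat.pow_le_pow_right (by omega) (by omega))).trans hK))
            (sum_nonneg fun r _ => mul_nonneg (by positivity) (sum_nonneg fun χ _ => vmN_nonneg χ _)) (by positivity)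
        _ = _ := by rw [show 2 * A + 4 = (2 * A + 2) + 2 by ring, pow_add ℓ (2 * A + 2)]; field_simp; ring
    · calc _ ≤ ∑ k ∈ Icc 1 K, 3 * Real.sqrt N * ℓ := sum_le_sum fun k hk => by
            rw [mem_Icc] at hk
            have h1 : log k ≤ ℓ := (log_le_log (by exact_mod_cast hk.1) (by exact_mod_cast hk.2.trans hKN)).trans (log_le_ell N)
            have h2 : Real.sqrt N * log N ≤ Real.sqrt N * ℓ := mul_le_mul_of_nonneg_left (log_le_ell N) (by positivity)
            nlinarith
        _ = 3 * (K * Real.sqrt N * ℓ) := by rw [sum_const, Nat.card_Icc, nsmul_eq_mul, Nat.add_sub_cancel]; ring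
        _ ≤ _ := by
            refine mul_le_mul_of_nonneg_left ?_ (by norm_num)
            rw [le_div_iff₀ (by positivity)]
            have h3 : ℓ ^ (2 * A + 3) ≤ ℓ ^ (B0 + 2 * A + 3) := pow_le_pow_right₀ (by linarith) (by omega)
            calc K * Real.sqrt N * ℓ * ℓ ^ (2 * A + 2) = K * ℓ ^ (2 * A + 3) * Real.sqrt N := by ring
              _ ≤ K * ℓ ^ (B0 + 2 * A + 3) * Real.sqrt N := by gcongr
              _ ≤ Real.sqrt N * Real.sqrt N := by gcongr
              _ = N := Real.mul_self_sqrt (Nat.cast_nonneg N)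
  have p1 := sum_le_sum hi
  rw [sum_const, card_range, nsmul_eq_mul] at p1
  have hH2 : ((H + 2 : ℕ) : ℝ) ≤ 2 * ℓ ^ (A + 2) := by
    push_cast; rw [hHr]
    have : ℓ ^ 1 ≤ ℓ ^ (A + 2) := pow_le_pow_right₀ (by linarith) (by omega)
    linarith
  have p2 : ((H + 2 : ℕ) : ℝ) * (4 * C0 * N / ℓ ^ (2 * A + 2) + 3 * (N / ℓ ^ (2 * A + 2))) ≤ (8 * C0 + 6) * N / ℓ ^ A := by
    calc _ ≤ 2 * ℓ ^ (A + 2) * (4 * C0 * N / ℓ ^ (2 * A + 2) + 3 * (N / ℓ ^ (2 * A + 2))) :=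
          mul_le_mul_of_nonneg_right hH2 (by positivity)
      _ = _ := by rw [show 2 * A + 2 = (A + 2) + A by ring, pow_add ℓ (A + 2) A]; field_simp; ring
  have p3 : ((N:ℝ) / H + 1) * ∑ k ∈ Icc 1 K, 1 / (k.totient : ℝ) ≤ 8 * N / ℓ ^ A := by
    have h1 : ∑ k ∈ Icc 1 K, 1 / (k.totient : ℝ) ≤ (2 * ℓ) ^ 2 :=
      (sum_inv_totient_le K).trans (pow_le_pow_left₀ (by linarith) hlogK 2)
    have h2 : (1:ℝ) ≤ N / H := by
      rw [one_le_div (by exact_mod_cast hH1)]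
      exact_mod_cast (Nat.pow_le_pow_right (by omega) (by omega)).trans hlN'
    calc _ ≤ ((N:ℝ) / H + N / H) * (2 * ℓ) ^ 2 := mul_le_mul (by linarith) h1 (sum_nonneg fun _ _ => by positivity) (by positivity)
      _ = _ := by rw [hHr, pow_add ℓ A 2]; field_simp; norm_num
  refine (add_le_add (p1.trans p2) p3).trans (le_of_eq ?_)
  ring

theorem nd_le_nd_add (x y : ℝ) : nd x ≤ nd y + |x - y| := by
  refine (nd_le x (round y)).trans ?_
  rw [nd, add_comm]
  exact abs_sub_le x y _

theorem one_div_two_mul_le_nd {q : ℕ} {a : ℤ} {α : ℝ} (hq : 0 < q) (ha : IsCoprime a (q : ℤ))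
    {h : ℤ} (h0 : h ≠ 0) (h2 : |h| < q) (hα : |(h : ℝ)| * |α - a / q| ≤ 1 / (2 * (q : ℝ))) :
    1 / (2 * (q : ℝ)) ≤ nd (h * α) := by
  have hq' : (0:ℝ) < q := by exact_mod_cast hq
  have hnd : ¬ (q : ℤ) ∣ h * a := fun hd => by
    have h1 := Int.le_of_dvd (abs_pos.2 h0) ((dvd_abs _ _).2 (ha.symm.dvd_of_dvd_mul_right hd))
    have h3 := abs_pos.2 h0
    omega
  have h1 := one_div_le_nd hq hnd
  have h3 := nd_le_nd_add (((h * a : ℤ) : ℝ) / q) (h * α)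
  have h4 : |((h * a : ℤ) : ℝ) / q - h * α| ≤ 1 / (2 * q) := by
    rwa [show ((h * a : ℤ) : ℝ) / q - h * α = h * -(α - a / q) by push_cast; ring, abs_mul, abs_neg]
  have h6 : 1 / (q : ℝ) = 1 / (2 * q) + 1 / (2 * q) := by field_simp; norm_num
  linarith

/-- Distinct multiples `h α`, with `h` in an interval of length `q / 2` or `Q`, are separated modulo one. -/
def WellSpaced (q : ℕ) (α : ℝ) (Q : ℕ) : Prop :=
  2 ≤ q ∧ ∀ h : ℤ, h ≠ 0 → 2 * |h| ≤ q ∨ |h| ≤ Q → 1 / (2 * (q : ℝ)) ≤ nd (h * α)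

theorem WellSpaced.sum_geomBound_le {Q q : ℕ} {α : ℝ} (hs : WellSpaced q α Q) {K : ℝ} (hK : 0 ≤ K) (s : Finset ℕ)
    (hss : ∀ i ∈ s, ∀ j ∈ s, 2 * |(i : ℤ) - j| ≤ q ∨ |(i : ℤ) - j| ≤ Q) (β : ℝ) :
    ∑ i ∈ s, geomBound K (i * α - β) ≤ 4 * K + 4 * q * (1 + log (2 * q)) := by
  have hq : (2 : ℝ) ≤ q := by exact_mod_cast hs.1
  refine (_root_.sum_geomBound_le s (fun i : ℕ => (i : ℝ) * α) (δ := 1 / (2 * q)) (by positivity)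
    (by rw [div_le_div_iff₀] <;> linarith) hK (fun i hi j hj hij => ?_) β).trans (le_of_eq ?_)
  · have := hs.2 ((i : ℤ) - j) (by omega) (hss i hi j hj)
    push_cast at this
    rwa [sub_mul] at this
  · rw [one_div, inv_inv]; ring

theorem WellSpaced.sum_geomBound_small_le {Q q M : ℕ} {α : ℝ} (hs : WellSpaced q α Q) {K : ℝ} (hK : 0 ≤ K) (hM : M ≤ Q) :
    ∑ d ∈ Icc 1 M, geomBound K (d * α) ≤ 8 * q + 8 * q * (1 + log (2 * q)) := by
  have hq : (2 : ℝ) ≤ q := by exact_mod_cast hs.1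
  have h1 : ∀ d ∈ Icc 1 M, geomBound K (d * α) ≤ 2 * geomBound q (d * α - 0) := fun d hd => by
    rw [mem_Icc] at hd
    have h2 : 1 / (2 * (q : ℝ)) ≤ nd (d * α) := by
      simpa using hs.2 d (by omega) (Or.inr (by rw [abs_of_nonneg (by omega)]; omega))
    have h3 : 0 < nd ((d : ℝ) * α) := lt_of_lt_of_le (by positivity) h2
    refine (geomBound_le_of_le hK h3 le_rfl).trans ?_
    rw [sub_zero, geomBound, ← mul_div_assoc, div_le_div_iff₀ h3 (by positivity)]
    rw [div_le_iff₀ (by positivity)] at h2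
    linarith
  refine (sum_le_sum h1).trans ?_
  rw [← mul_sum]
  have := hs.sum_geomBound_le (K := q) (by positivity) (Icc 1 M) (fun i hi j hj => by
    rw [mem_Icc] at hi hj
    have : |(i : ℤ) - j| ≤ M := abs_le.2 ⟨by omega, by omega⟩
    exact Or.inr (this.trans (by exact_mod_cast hM))) 0
  linarith

theorem sum_range_mul_eq (f : ℕ → ℝ) (J b : ℕ) :
    ∑ h ∈ range (J * b), f h = ∑ j ∈ range J, ∑ i ∈ range b, f (j * b + i) := by
  induction J with
  | zero => simp
  | succ J ih => rw [add_mul, one_mul, sum_range_add, sum_range_succ, ih]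

theorem WellSpaced.sum_geomBound_range_le {Q q : ℕ} {α : ℝ} (hs : WellSpaced q α Q) {M : ℝ} (hM : 0 ≤ M) (K : ℕ) :
    ∑ h ∈ range K, geomBound M (h * α) ≤ (3 * K / q + 1) * (4 * M + 4 * q * (1 + log (2 * q))) := by
  have hq : (2 : ℝ) ≤ q := by exact_mod_cast hs.1
  have hq2 := hs.1
  set b := q / 2 with hb
  have hb1 : 1 ≤ b := by omega
  have hlog : 0 ≤ log (2 * q) := Real.log_nonneg (by linarith)
  calc _ ≤ ∑ h ∈ range ((K / b + 1) * b), geomBound M (h * α) :=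
        sum_le_sum_of_subset_of_nonneg (range_subset_range.2 (by
          have := Nat.lt_div_mul_add (a := K) (b := b) (by omega)
          rw [add_mul, one_mul]; omega)) fun _ _ _ => geomBound_nonneg hM _
    _ = ∑ j ∈ range (K / b + 1), ∑ i ∈ range b, geomBound M (i * α - -((j * b : ℕ) : ℝ) * α) := by
        rw [sum_range_mul_eq]
        refine sum_congr rfl fun j _ => sum_congr rfl fun i _ => ?_
        congr 1
        push_cast
        ring
    _ ≤ ∑ j ∈ range (K / b + 1), (4 * M + 4 * q * (1 + log (2 * q))) := sum_le_sum fun j _ =>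
        hs.sum_geomBound_le hM (range b) (fun i hi j hj => by
          rw [mem_range] at hi hj
          have : |(i : ℤ) - j| ≤ b := abs_le.2 ⟨by omega, by omega⟩
          exact Or.inl (by omega)) _
    _ ≤ _ := by
        rw [sum_const, card_range, nsmul_eq_mul]
        refine mul_le_mul_of_nonneg_right ?_ (by positivity)
        have h1 : ((K / b : ℕ) : ℝ) ≤ K / b := Nat.cast_div_le
        have h2 : (q : ℝ) ≤ 3 * b := by exact_mod_cast (by omega : q ≤ 3 * b)
        have h3 : (K : ℝ) / b ≤ 3 * K / q := by
          rw [div_le_div_iff₀ (by exact_mod_cast hb1) (by linarith)]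
          nlinarith [Nat.cast_nonneg (α := ℝ) K]
        push_cast
        linarith

theorem norm_sum_nat_mul_ex_le (x : ℝ) (M : ℕ) {K : ℝ} (hK : (M : ℝ) ≤ K) :
    ‖∑ m ∈ Icc 1 M, (m : ℂ) * ex (m * x)‖ ≤ 3 * K * geomBound K x := by
  rcases Nat.eq_zero_or_pos M with rfl | hM
  · have : 0 ≤ K := by simpa using hK
    simpa using mul_nonneg (by positivity) (geomBound_nonneg this x)
  have h1 : (1 : ℝ) ≤ M := by exact_mod_cast hM
  have h := abel_norm_le (fun m => ex (m * x)) (fun m => (m : ℂ)) (Nat.zero_le M) (B := geomBound K x) (fun y _ hy =>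
    norm_sum_ex_le x 0 y (by rw [Nat.sub_zero]; exact (Nat.cast_le.2 hy).trans hK))
  rw [show Icc 1 M = Ioc 0 M from rfl]
  simp_rw [mul_comm (Nat.cast _ : ℂ)]
  refine h.trans ?_
  have h2 : ∀ n : ℕ, ‖(n : ℂ) - ((n + 1 : ℕ) : ℂ)‖ = 1 := fun n => by
    rw [show (n : ℂ) - ((n + 1 : ℕ) : ℂ) = -1 by push_cast; ring, norm_neg, norm_one]
  simp_rw [h2]
  rw [sum_const, Nat.card_Ioc, nsmul_eq_mul, norm_natCast, mul_comm (geomBound K x)]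
  refine mul_le_mul_of_nonneg_right ?_ (geomBound_nonneg (by linarith) x)
  rw [Nat.sub_zero]
  push_cast
  linarith

theorem sum_mul_norm_sq_le (S I : Finset ℕ) (w : ℕ → ℝ) (hw : ∀ m ∈ S, 0 ≤ w m) (c : ℕ → ℕ → ℂ) :
    ∑ m ∈ S, w m * ‖∑ n ∈ I, c m n‖ ^ 2 ≤
      ∑ n ∈ I, ∑ n' ∈ I, ‖∑ m ∈ S, (w m : ℂ) * (c m n * (starRingEnd ℂ) (c m n'))‖ := by
  have h : ((∑ m ∈ S, w m * ‖∑ n ∈ I, c m n‖ ^ 2 : ℝ) : ℂ) =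
      ∑ n ∈ I, ∑ n' ∈ I, ∑ m ∈ S, (w m : ℂ) * (c m n * (starRingEnd ℂ) (c m n')) := by
    rw [Complex.ofReal_sum, sum_congr rfl fun n _ => sum_comm, sum_comm]
    refine sum_congr rfl fun m _ => ?_
    push_cast
    rw [← Complex.mul_conj', map_sum, sum_mul_sum, mul_sum]
    simp_rw [mul_sum]
  have h0 : 0 ≤ ∑ m ∈ S, w m * ‖∑ n ∈ I, c m n‖ ^ 2 := sum_nonneg fun m hm => mul_nonneg (hw m hm) (by positivity)
  rw [← abs_of_nonneg h0, ← norm_eq_abs, ← norm_real, h]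
  exact (norm_sum_le _ _).trans (sum_le_sum fun n _ => norm_sum_le _ _)

theorem sum_sum_le_two_mul (I : Finset ℕ) (F : ℕ → ℕ → ℝ) (h0 : ∀ n n', 0 ≤ F n n') (hF : ∀ n n', F n n' = F n' n) :
    ∑ n ∈ I, ∑ n' ∈ I, F n n' ≤ 2 * ∑ n ∈ I, ∑ n' ∈ I with n' ≤ n, F n n' := by
  have h1 : ∀ n ∈ I, ∑ n' ∈ I, F n n' ≤ ∑ n' ∈ I with n' ≤ n, F n n' + ∑ n' ∈ I, if n ≤ n' then F n' n else 0 := fun n _ => by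
    rw [sum_filter, ← sum_add_distrib]
    refine sum_le_sum fun n' _ => ?_
    rw [hF n' n]
    have := h0 n n'
    split_ifs <;> linarith
  refine (sum_le_sum h1).trans (le_of_eq ?_)
  rw [sum_add_distrib, two_mul]
  congr 1
  rw [sum_comm]
  exact sum_congr rfl fun n _ => (sum_filter _ _).symm

theorem sum_mul_geomBound_le {N U Q q : ℕ} {α : ℝ} (hs : WellSpaced q α Q) (hN : 3 ≤ N) (hU : 1 ≤ U) (hq : 2 * q ≤ N) :
    ∑ n ∈ Ioc U (N / U), ∑ n' ∈ Ioc U (N / U), 3 * ((N : ℝ) / max n n' : ℝ) * geomBound ((N : ℝ) / max n n') (((n : ℝ) - n') * α) ≤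
      192 * (ell N : ℝ) ^ 2 * ((N : ℝ) ^ 2 / q + (N : ℝ) ^ 2 / U + q * N) := by
  set ℓ : ℝ := (ell N : ℝ) with hℓ
  have hℓ2 : (2 : ℝ) ≤ ℓ := by rw [hℓ]; exact_mod_cast two_le_ell hN
  have hq2 : (2 : ℝ) ≤ q := by exact_mod_cast hs.1
  have hU1 : (1 : ℝ) ≤ U := by exact_mod_cast hU
  have hN0 : (3 : ℝ) ≤ N := by exact_mod_cast hN
  refine (sum_sum_le_two_mul _ _ (fun n n' => mul_nonneg (by positivity) (geomBound_nonneg (by positivity) _)) fun n n' => by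
    rw [max_comm n, geomBound, geomBound, show ((n' : ℝ) - n) * α = -(((n : ℝ) - n') * α) by ring, nd_neg]).trans ?_
  have hin : ∀ n ∈ Ioc U (N / U), ∑ n' ∈ Ioc U (N / U) with n' ≤ n,
      3 * ((N : ℝ) / max n n' : ℝ) * geomBound ((N : ℝ) / max n n') (((n : ℝ) - n') * α) ≤
      3 * ((12 * (N : ℝ) ^ 2 / q + 4 * (N : ℝ) ^ 2 / U + 8 * q * N * ℓ) * (1 / n) + 24 * N * ℓ) := fun n hn => by
    rw [mem_Ioc] at hn
    have hn0 : (U : ℝ) ≤ n := by exact_mod_cast hn.1.le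
    have hn1 : (0 : ℝ) < n := by linarith
    calc _ = ∑ n' ∈ Ioc U (N / U) with n' ≤ n, 3 * ((N : ℝ) / n) * geomBound ((N : ℝ) / n) (((n - n' : ℕ) : ℝ) * α) :=
          sum_congr rfl fun n' hn' => by
            rw [mem_filter] at hn'
            rw [max_eq_left (by exact_mod_cast hn'.2), Nat.cast_sub hn'.2]
      _ ≤ ∑ h ∈ range n, 3 * ((N : ℝ) / n) * geomBound ((N : ℝ) / n) (h * α) := by
          rw [← sum_image (s := (Ioc U (N / U)).filter (· ≤ n)) (g := fun n' => n - n')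
            (f := fun h : ℕ => 3 * ((N : ℝ) / n) * geomBound ((N : ℝ) / n) (h * α)) (fun x hx y hy hxy => by
              simp only [coe_filter, Set.mem_ofPred_eq] at hx hy hxy
              omega)]
          refine sum_le_sum_of_subset_of_nonneg (fun h hh => ?_) fun _ _ _ => mul_nonneg (by positivity) (geomBound_nonneg (by positivity) _)
          obtain ⟨x, hx, rfl⟩ := mem_image.1 hh
          rw [mem_filter, mem_Ioc] at hx
          rw [mem_range]
          omega
      _ ≤ 3 * ((N : ℝ) / n) * ((3 * n / q + 1) * (4 * (N / n) + 4 * q * (2 * ℓ))) := by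
          rw [← mul_sum]
          refine mul_le_mul_of_nonneg_left ((hs.sum_geomBound_range_le (by positivity) n).trans
            (mul_le_mul_of_nonneg_left ?_ (by positivity))) (by positivity)
          have := one_add_log_le hN hq
          push_cast at this
          have := mul_le_mul_of_nonneg_left this (by positivity : 0 ≤ 4 * (q : ℝ))
          linarith
      _ = 3 * ((12 * (N : ℝ) ^ 2 / q + 4 * (N : ℝ) ^ 2 / n + 8 * q * N * ℓ) * (1 / n) + 24 * N * ℓ) := by
          field_simp; ring
      _ ≤ _ := by gcongr
  refine (mul_le_mul_of_nonneg_left (sum_le_sum hin) two_pos.le).trans ?_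
  rw [← mul_sum, sum_add_distrib, ← mul_sum, sum_const, Nat.card_Ioc, nsmul_eq_mul]
  have h1 : ∑ n ∈ Ioc U (N / U), (1 : ℝ) / n ≤ 2 * ℓ :=
    ((sum_le_sum_of_subset_of_nonneg (fun n hn => by
      rw [mem_Ioc] at hn
      exact mem_Icc.2 ⟨by omega, hn.2.trans (Nat.div_le_self _ _)⟩) fun _ _ _ => by positivity).trans (sum_inv_le N)).trans
        (one_add_log_le hN le_rfl)
  have h2 : ((N / U - U : ℕ) : ℝ) ≤ N / U := (Nat.cast_le.2 (Nat.sub_le _ _)).trans Nat.cast_div_le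
  have h3 := mul_le_mul_of_nonneg_left h1 (by positivity : 0 ≤ 12 * (N : ℝ) ^ 2 / q + 4 * (N : ℝ) ^ 2 / U + 8 * q * N * ℓ)
  have h4 := mul_le_mul_of_nonneg_right h2 (by positivity : 0 ≤ 24 * (N : ℝ) * ℓ)
  have h5 : (N : ℝ) / U * (24 * N * ℓ) = 24 * ((N : ℝ) ^ 2 / U) * ℓ := by ring
  have h6 : (12 * (N : ℝ) ^ 2 / q + 4 * (N : ℝ) ^ 2 / U + 8 * q * N * ℓ) * (2 * ℓ) =
    24 * ((N : ℝ) ^ 2 / q) * ℓ + 8 * ((N : ℝ) ^ 2 / U) * ℓ + 16 * (q * N) * ℓ ^ 2 := by ring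
  have h7 : ℓ ≤ ℓ ^ 2 := by nlinarith
  have h8 : (N : ℝ) ^ 2 / q * ℓ ≤ (N : ℝ) ^ 2 / q * ℓ ^ 2 := mul_le_mul_of_nonneg_left h7 (by positivity)
  have h9 : (N : ℝ) ^ 2 / U * ℓ ≤ (N : ℝ) ^ 2 / U * ℓ ^ 2 := mul_le_mul_of_nonneg_left h7 (by positivity)
  have h10 : 0 ≤ (N : ℝ) ^ 2 / q * ℓ := by positivity
  have h11 : 0 ≤ (q : ℝ) * N * ℓ ^ 2 := by positivity
  nlinarith

theorem norm_typeII_le {N U Q q : ℕ} {α : ℝ} (hs : WellSpaced q α Q) (hN : 3 ≤ N) (hU : 1 ≤ U) (hq : 2 * q ≤ N) :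
    ‖∑ m ∈ Icc 1 N, (vaughanBeta U m : ℂ) * ∑ n ∈ Icc 1 (N / m), (lamTail U n : ℂ) * ex ((m * n : ℕ) * α)‖ ^ 2 ≤
      3072 * (ell N : ℝ) ^ 8 * ((N : ℝ) ^ 2 / q + (N : ℝ) ^ 2 / U + q * N) := by
  have hkey := sum_mul_geomBound_le hs hN hU hq
  set ℓ : ℝ := (ell N : ℝ) with hℓ
  set I := Ioc U (N / U) with hI
  let c : ℕ → ℕ → ℂ := fun m n => if m * n ≤ N then (lamTail U n : ℂ) * ex ((m * n : ℕ) * α) else 0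
  have h1 : ∀ m ∈ Icc 1 N, (vaughanBeta U m : ℂ) * ∑ n ∈ Icc 1 (N / m), (lamTail U n : ℂ) * ex ((m * n : ℕ) * α) =
      vaughanBeta U m * ∑ n ∈ I, c m n := fun m hm => by
    rw [mem_Icc] at hm
    rcases le_or_gt m U with hmU | hmU
    · simp [vaughanBeta_eq_zero hmU]
    · congr 1
      rw [← sum_filter]
      refine (sum_subset (fun n hn => ?_) fun n hn hn' => ?_).symm
      · rw [mem_filter, hI, mem_Ioc] at hn
        exact mem_Icc.2 ⟨by omega, (Nat.le_div_iff_mul_le hm.1).2 (by rw [mul_comm]; exact hn.2)⟩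
      · rw [mem_Icc] at hn
        have h2 : m * n ≤ N := by rw [mul_comm]; exact (Nat.le_div_iff_mul_le hm.1).1 hn.2
        have h3 : n ≤ U := by
          by_contra h
          refine hn' (mem_filter.2 ⟨mem_Ioc.2 ⟨by omega, ?_⟩, h2⟩)
          exact hn.2.trans (Nat.div_le_div_left hmU.le hU)
        rw [lamTail_apply, if_pos h3]
        simp
  rw [sum_congr rfl h1]
  have h2 : ‖∑ m ∈ Icc 1 N, (vaughanBeta U m : ℂ) * ∑ n ∈ I, c m n‖ ^ 2 ≤
      (∑ m ∈ Icc 1 N, tau m ^ 2 / m) * ∑ m ∈ Icc 1 N, (m : ℝ) * ‖∑ n ∈ I, c m n‖ ^ 2 := by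
    refine (pow_le_pow_left₀ (norm_nonneg _) (norm_sum_le _ _) 2).trans ?_
    refine (pow_le_pow_left₀ (sum_nonneg fun _ _ => norm_nonneg _) (sum_le_sum (g := fun m : ℕ =>
      (tau m / Real.sqrt m) * (Real.sqrt m * ‖∑ n ∈ I, c m n‖)) fun m hm => ?_) 2).trans
      ((sum_mul_sq_le_sq_mul_sq _ _ _).trans (le_of_eq ?_))
    · have hm' : 0 < Real.sqrt m := Real.sqrt_pos.2 (by exact_mod_cast (mem_Icc.1 hm).1)
      rw [norm_mul, norm_real, ← mul_assoc, div_mul_cancel₀ _ hm'.ne']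
      exact mul_le_mul_of_nonneg_right (abs_vaughanBeta_le U m) (norm_nonneg _)
    · simp_rw [div_pow, mul_pow, Real.sq_sqrt (Nat.cast_nonneg _)]
  have h3 : ∑ m ∈ Icc 1 N, tau m ^ 2 / m ≤ (2 * ℓ) ^ 4 := (sum_tau_pow_div_le 2 N).trans
    (pow_le_pow_left₀ (by have := log_natCast_nonneg N; linarith) (one_add_log_le hN le_rfl) 4)
  have h4 : ∀ n ∈ I, ∀ n' ∈ I, ‖∑ m ∈ Icc 1 N, (((m : ℝ) : ℝ) : ℂ) * (c m n * (starRingEnd ℂ) (c m n'))‖ ≤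
      ℓ ^ 2 * (3 * ((N : ℝ) / max n n' : ℝ) * geomBound ((N : ℝ) / max n n') (((n : ℝ) - n') * α)) := fun n hn n' hn' => by
    have hlam : ∀ n ∈ I, lamTail U n ≤ ℓ := fun n hn => by
      rw [hI, mem_Ioc] at hn
      exact (lamTail_le_log U n).trans ((log_le_log (by exact_mod_cast (by omega : 0 < n))
        (by exact_mod_cast hn.2.trans (Nat.div_le_self _ _))).trans (log_le_ell N))
    have hpos : 0 < max n n' := lt_max_of_lt_left (by rw [hI, mem_Ioc] at hn; omega)
    have h5 : ∑ m ∈ Icc 1 N, (((m : ℝ) : ℝ) : ℂ) * (c m n * (starRingEnd ℂ) (c m n')) =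
        (lamTail U n * lamTail U n' : ℂ) * ∑ m ∈ Icc 1 (N / max n n'), (m : ℂ) * ex (m * (((n : ℝ) - n') * α)) := by
      rw [mul_sum]
      have hsub : Icc 1 (N / max n n') = (Icc 1 N).filter (fun m => m * max n n' ≤ N) := by
        ext m
        rw [mem_filter, mem_Icc, mem_Icc, Nat.le_div_iff_mul_le hpos]
        constructor
        · exact fun h => ⟨⟨h.1, (Nat.le_mul_of_pos_right m hpos).trans h.2⟩, h.2⟩
        · exact fun h => ⟨h.1.1, h.2⟩
      rw [hsub, sum_filter]
      refine sum_congr rfl fun m _ => ?_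
      simp only [c]
      have hiff : m * max n n' ≤ N ↔ m * n ≤ N ∧ m * n' ≤ N := by
        rw [← Nat.mul_max_mul_left, max_le_iff]
      by_cases ha : m * n ≤ N
      · by_cases hb : m * n' ≤ N
        · rw [if_pos ha, if_pos hb, if_pos (hiff.2 ⟨ha, hb⟩), map_mul, ← ex_neg, conj_ofReal,
            show (m : ℝ) * (((n : ℝ) - n') * α) = ((m * n : ℕ) : ℝ) * α + -(((m * n' : ℕ) : ℝ) * α) by push_cast; ring, ex_add]
          push_cast
          ring
        · rw [if_neg hb, if_neg (fun h => hb (hiff.1 h).2)]; simp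
      · rw [if_neg ha, if_neg (fun h => ha (hiff.1 h).1)]; simp
    rw [h5, norm_mul, norm_mul, norm_real, norm_real, norm_of_nonneg (lamTail_nonneg _ _),
      norm_of_nonneg (lamTail_nonneg _ _), sq]
    refine mul_le_mul (mul_le_mul (hlam n hn) (hlam n' hn') (lamTail_nonneg _ _) (Nat.cast_nonneg _))
      (norm_sum_nat_mul_ex_le _ _ ?_) (norm_nonneg _) (by positivity)
    exact Nat.cast_div_le
  have h5 : ∑ m ∈ Icc 1 N, (m : ℝ) * ‖∑ n ∈ I, c m n‖ ^ 2 ≤ ℓ ^ 2 * (192 * ℓ ^ 2 * ((N : ℝ) ^ 2 / q + (N : ℝ) ^ 2 / U + q * N)) := by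
    refine (sum_mul_norm_sq_le _ I (fun m : ℕ => (m : ℝ)) (fun _ _ => Nat.cast_nonneg _) c).trans
      ((sum_le_sum fun n hn => sum_le_sum fun n' hn' => h4 n hn n' hn').trans ?_)
    simp_rw [← mul_sum]
    exact mul_le_mul_of_nonneg_left hkey (by positivity)
  refine h2.trans ((mul_le_mul h3 h5 (sum_nonneg fun _ _ => by positivity) (by positivity)).trans (le_of_eq ?_))
  ring

/-- The weights of the truncated singular series model for the primes. -/
def lamQ (Q d : ℕ) : ℝ := d * muR d * ∑ r ∈ Icc 1 Q with d ∣ r, muR r ^ 2 / r.totient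

/-- The truncated singular series model for the primes. -/
def LamQ (Q n : ℕ) : ℝ := ∑ d ∈ Icc 1 Q with d ∣ n, lamQ Q d

theorem sum_dvd_eq {E : Type*} [AddCommMonoid E] {d : ℕ} (hd : 0 < d) (Q : ℕ) (f : ℕ → E) :
    ∑ r ∈ Icc 1 Q with d ∣ r, f r = ∑ j ∈ Icc 1 (Q / d), f (d * j) := by
  symm
  refine sum_bij (fun j _ => d * j) (fun j hj => ?_) (fun i _ j _ h => Nat.eq_of_mul_eq_mul_left hd h) (fun r hr => ?_) fun _ _ => rfl
  · rw [mem_Icc] at hj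
    refine mem_filter.2 ⟨mem_Icc.2 ⟨Nat.mul_pos hd hj.1, ?_⟩, dvd_mul_right _ _⟩
    rw [mul_comm]
    exact (Nat.le_div_iff_mul_le hd).1 hj.2
  · rw [mem_filter, mem_Icc] at hr
    obtain ⟨⟨h1, h2⟩, j, rfl⟩ := hr
    refine ⟨j, mem_Icc.2 ⟨Nat.pos_of_mul_pos_left h1, (Nat.le_div_iff_mul_le hd).2 (by rwa [mul_comm])⟩, rfl⟩

theorem abs_lamQ_le {N Q d : ℕ} (hN : 3 ≤ N) (hQ : Q ≤ N) (hd : 0 < d) : |lamQ Q d| ≤ 4 * (ell N : ℝ) ^ 2 * tau d := by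
  have hmu : ∀ n, muR n ^ 2 ≤ 1 := fun n => by
    rw [← sq_abs]; exact pow_le_one₀ (abs_nonneg _) (abs_muR_le n)
  have h1 : ∑ r ∈ Icc 1 Q with d ∣ r, muR r ^ 2 / r.totient ≤ 1 / d.totient * (2 * (ell N : ℝ)) ^ 2 := by
    rw [sum_dvd_eq hd]
    calc _ ≤ ∑ j ∈ Icc 1 (Q / d), 1 / (d.totient : ℝ) * (1 / j.totient) := sum_le_sum fun j hj => by
          have hj0 := (mem_Icc.1 hj).1
          have h2 : (d.totient : ℝ) * j.totient ≤ (d * j).totient := by exact_mod_cast Nat.totient_super_multiplicative d j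
          have h3 : (0 : ℝ) < d.totient := by exact_mod_cast Nat.totient_pos.2 hd
          have h4 : (0 : ℝ) < j.totient := by exact_mod_cast Nat.totient_pos.2 hj0
          rw [div_mul_div_comm, one_mul]
          exact div_le_div₀ zero_le_one (hmu _) (by positivity) h2
      _ ≤ _ := by
          rw [← mul_sum]
          refine mul_le_mul_of_nonneg_left ((sum_inv_totient_le _).trans (pow_le_pow_left₀ ?_ ?_ 2)) (by positivity)
          · have := log_natCast_nonneg (Q / d); linarith
          · exact one_add_log_le hN ((Nat.div_le_self _ _).trans hQ)
  have h0 : 0 ≤ ∑ r ∈ Icc 1 Q with d ∣ r, muR r ^ 2 / r.totient := sum_nonneg fun _ _ => by positivity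
  have hd' : (0 : ℝ) < d := by exact_mod_cast hd
  rw [lamQ, abs_mul, abs_mul, abs_of_nonneg h0, Nat.abs_cast]
  have h5 : (d : ℝ) / d.totient ≤ tau d := by
    rw [div_le_iff₀ (by exact_mod_cast Nat.totient_pos.2 hd)]; exact le_tau_mul_totient d
  calc _ ≤ (d : ℝ) * 1 * (1 / d.totient * (2 * (ell N : ℝ)) ^ 2) := mul_le_mul
        (mul_le_mul_of_nonneg_left (abs_muR_le d) hd'.le) h1 h0 (by positivity)
    _ = d / d.totient * (4 * (ell N : ℝ) ^ 2) := by ring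
    _ ≤ tau d * (4 * (ell N : ℝ) ^ 2) := mul_le_mul_of_nonneg_right h5 (by positivity)
    _ = _ := by ring

theorem tau_le (d : ℕ) : tau d ≤ d := by
  rw [tau]; exact_mod_cast Nat.card_divisors_le_self d

theorem sum_LamQ_mul_eq (Q N : ℕ) (f : ℕ → ℂ) :
    ∑ n ∈ Icc 1 N, (LamQ Q n : ℂ) * f n = ∑ d ∈ Icc 1 Q, (lamQ Q d : ℂ) * ∑ n ∈ Icc 1 N with d ∣ n, f n := by
  simp_rw [LamQ, sum_filter, mul_sum, Complex.ofReal_sum, sum_mul]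
  rw [sum_comm]
  refine sum_congr rfl fun d _ => sum_congr rfl fun n _ => ?_
  split_ifs <;> simp

theorem norm_minor_arc_le {N Q V q : ℕ} {α : ℝ} (hs : WellSpaced q α Q) (hN : 3 ≤ N) (hV : 1 ≤ V) (hVQ : V ^ 4 ≤ Q) (hQ2 : 2 ≤ Q)
    (hq : Q < q) (hqN : q * Q ^ 2 ≤ N) :
    ‖∑ n ∈ Icc 1 N, ((vth n - LamQ Q n : ℝ) : ℂ) * ex (n * α)‖ ≤
      2 * Real.sqrt N * ell N + V ^ 2 * ell N + 96 * (ell N : ℝ) ^ 4 * (N / V) + 160 * (ell N : ℝ) ^ 3 * (N / Q) := by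
  have hQpos : 4 ≤ Q ^ 2 := by nlinarith
  have h2q : 2 * q ≤ N := by nlinarith
  have hQN : Q ≤ N := by nlinarith
  have hII := norm_typeII_le (U := V ^ 2) hs hN (Nat.one_le_pow _ _ hV) h2q
  set ℓ : ℝ := (ell N : ℝ) with hℓ
  have hℓ2 : (2 : ℝ) ≤ ℓ := by rw [hℓ]; exact_mod_cast two_le_ell hN
  have hN0 : (3 : ℝ) ≤ N := by exact_mod_cast hN
  have hV0 : (1 : ℝ) ≤ V := by exact_mod_cast hV
  have hQ0 : (2 : ℝ) ≤ Q := by exact_mod_cast hQ2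
  have hq0 : (Q : ℝ) < q := by exact_mod_cast hq
  have hqN' : (q : ℝ) ≤ N / Q ^ 2 := by rw [le_div_iff₀ (by positivity)]; exact_mod_cast hqN
  have hVQ' : (V : ℝ) ^ 2 ≤ Q := by
    exact_mod_cast (Nat.pow_le_pow_right hV (by norm_num : 2 ≤ 4)).trans hVQ
  have hI : ∀ M ≤ Q, ∑ d ∈ Icc 1 M, geomBound N (d * α) ≤ 20 * ℓ * q := fun M hM => by
    refine (hs.sum_geomBound_small_le (by positivity) hM).trans ?_
    have h1 := one_add_log_le hN h2q
    push_cast at h1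
    have := mul_le_mul_of_nonneg_left h1 (by positivity : 0 ≤ 8 * (q : ℝ))
    nlinarith
  have h1 : ‖∑ n ∈ Icc 1 N, ((vonMangoldt n : ℝ) : ℂ) * ex (n * α)‖ ≤
      V ^ 2 * ℓ + 3 * ℓ * (20 * ℓ * q) + 96 * ℓ ^ 4 * (N / V) := by
    refine (vaughan_bound (fun n => ex (n * α)) (fun n => (norm_ex _).le) (U := V ^ 2) (log_le_ell N)
      (fun m => geomBound N (m * α)) fun m hm z hz => ?_).trans (add_le_add (add_le_add ?_ ?_) ?_)
    · refine (le_of_eq ?_).trans (norm_sum_ex_le (m * α) 0 z (K := N) ?_)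
      · congr 1
        refine sum_congr rfl fun n _ => ?_
        congr 1
        push_cast; ring
      · exact Nat.cast_le.2 ((Nat.sub_le _ _).trans (hz.trans (Nat.div_le_self _ _)))
    · push_cast; exact le_rfl
    · exact mul_le_mul_of_nonneg_left (hI _ (by rw [← pow_mul]; exact hVQ)) (by positivity)
    · refine le_of_sq_le_sq (hII.trans ?_) (by positivity)
      have h2 : (N : ℝ) ^ 2 / q ≤ N ^ 2 / V ^ 2 := div_le_div_of_nonneg_left (by positivity) (by positivity) (by linarith)
      have h3 : (q : ℝ) * N ≤ N ^ 2 / V ^ 2 := by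
        rw [le_div_iff₀ (by positivity)]
        rw [le_div_iff₀ (by positivity)] at hqN'
        nlinarith [mul_le_mul_of_nonneg_left hVQ' (by positivity : 0 ≤ (q : ℝ)), mul_le_mul_of_nonneg_left (by nlinarith : (Q : ℝ) ≤ Q ^ 2) (by positivity : 0 ≤ (q : ℝ))]
      have h4 : (96 * ℓ ^ 4 * (N / V)) ^ 2 = 3072 * ℓ ^ 8 * (N ^ 2 / V ^ 2 + N ^ 2 / V ^ 2 + N ^ 2 / V ^ 2) := by
        rw [mul_pow, div_pow]; ring
      rw [h4]
      push_cast
      exact mul_le_mul_of_nonneg_left (by linarith) (by positivity)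
  have h2 : ‖∑ n ∈ Icc 1 N, ((vth n - vonMangoldt n : ℝ) : ℂ) * ex (n * α)‖ ≤ 2 * Real.sqrt N * ℓ := by
    refine (norm_sum_le _ _).trans (((sum_le_sum fun n _ => ?_).trans (sum_vonMangoldt_sub_vth_le (by omega) le_rfl)).trans
      (mul_le_mul_of_nonneg_left (log_le_ell N) (by positivity)))
    rw [norm_mul, norm_ex, mul_one, norm_real, Real.norm_of_nonpos (by linarith [vth_le_vonMangoldt n]), neg_sub]
  have h3 : ‖∑ n ∈ Icc 1 N, (LamQ Q n : ℂ) * ex (n * α)‖ ≤ 4 * ℓ ^ 2 * Q * (20 * ℓ * q) := by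
    rw [sum_LamQ_mul_eq]
    refine (norm_sum_le _ _).trans ((sum_le_sum (g := fun d : ℕ => 4 * ℓ ^ 2 * Q * geomBound N (d * α)) fun d hd => ?_).trans ?_)
    · rw [mem_Icc] at hd
      rw [norm_mul, norm_real]
      refine mul_le_mul ((abs_lamQ_le hN hQN hd.1).trans (mul_le_mul_of_nonneg_left
        ((tau_le d).trans (by exact_mod_cast hd.2)) (by positivity))) ?_ (norm_nonneg _) (by positivity)
      rw [sum_dvd_eq hd.1]
      refine (le_of_eq ?_).trans (norm_sum_ex_le (d * α) 0 (N / d) (K := N) ?_)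
      · congr 1
        refine sum_congr rfl fun n _ => ?_
        congr 1
        push_cast; ring
      · exact Nat.cast_le.2 ((Nat.sub_le _ _).trans (Nat.div_le_self _ _))
    · rw [← mul_sum]
      exact mul_le_mul_of_nonneg_left (hI Q le_rfl) (by positivity)
  have h4 : ∑ n ∈ Icc 1 N, ((vth n - LamQ Q n : ℝ) : ℂ) * ex (n * α) =
      ∑ n ∈ Icc 1 N, ((vth n - vonMangoldt n : ℝ) : ℂ) * ex (n * α) +
      ∑ n ∈ Icc 1 N, ((vonMangoldt n : ℝ) : ℂ) * ex (n * α) - ∑ n ∈ Icc 1 N, (LamQ Q n : ℂ) * ex (n * α) := by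
    rw [← sum_add_distrib, ← sum_sub_distrib]
    refine sum_congr rfl fun n _ => ?_
    push_cast; ring
  have h5 : 3 * ℓ * (20 * ℓ * q) + 4 * ℓ ^ 2 * Q * (20 * ℓ * q) ≤ 160 * ℓ ^ 3 * (N / Q) := by
    have h6 : (q : ℝ) * Q ≤ N / Q := by
      rw [le_div_iff₀ (by positivity)] at hqN' ⊢
      linarith
    have h7 := mul_le_mul_of_nonneg_left h6 (by positivity : 0 ≤ 160 * ℓ ^ 3)
    have h8 : 60 * ℓ ^ 2 * q ≤ 80 * ℓ ^ 3 * (q * Q) := by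
      have : ℓ ^ 2 * q ≤ ℓ ^ 3 * (q * Q) := by
        rw [show ℓ ^ 3 * (q * Q) = ℓ ^ 2 * q * (ℓ * Q) by ring]
        exact le_mul_of_one_le_right (by positivity) (by nlinarith)
      nlinarith [(by positivity : 0 ≤ ℓ ^ 2 * q)]
    linarith
  rw [h4]
  refine (norm_sub_le _ _).trans ?_
  have := norm_add_le (∑ n ∈ Icc 1 N, ((vth n - vonMangoldt n : ℝ) : ℂ) * ex (n * α))
    (∑ n ∈ Icc 1 N, ((vonMangoldt n : ℝ) : ℂ) * ex (n * α))
  linarith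

/-- The multiplicative function supported on squarefree integers with the given values at primes. -/
def sqfProd (g : ℕ → ℝ) (r : ℕ) : ℝ := if Squarefree r then ∏ p ∈ r.primeFactors, g p else 0

theorem sum_divisors_sqfProd (g : ℕ → ℝ) {P : ℕ} (hP : Squarefree P) :
    ∑ r ∈ P.divisors, sqfProd g r = ∏ p ∈ P.primeFactors, (1 + g p) := by
  rw [← (prod_congr rfl fun p hp => ?_ : ∏ p ∈ P.primeFactors, (1 + ArithmeticFunction.prodPrimeFactors g p) = _),
    (ArithmeticFunction.IsMultiplicative.prodPrimeFactors g).prodPrimeFactors_one_add_of_squarefree hP]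
  · refine sum_congr rfl fun r hr => ?_
    have hr' := hP.squarefree_of_dvd (Nat.dvd_of_mem_divisors hr)
    rw [sqfProd, if_pos hr', prodPrimeFactors_apply hr'.ne_zero]
  · have hp' := Nat.prime_of_mem_primeFactors hp
    rw [prodPrimeFactors_apply hp'.ne_zero, hp'.primeFactors, prod_singleton]

theorem eq_prod_of_squarefree {W : ℕ → ℝ} (h1 : W 1 = 1) (hp : ∀ p m, p.Prime → ¬ p ∣ m → W (p * m) = W p * W m)
    {d : ℕ} (hd : Squarefree d) : W d = ∏ p ∈ d.primeFactors, W p := by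
  induction d using induction_on_primes with
  | zero => exact absurd rfl hd.ne_zero
  | one => simp [h1]
  | prime_mul p a hpp ih =>
    have hpa : ¬ p ∣ a := fun h => hpp.not_isUnit (hd p (mul_dvd_mul_left p h))
    have ha := hd.squarefree_of_dvd (dvd_mul_left a p)
    rw [hp p a hpp hpa, ((Nat.Prime.coprime_iff_not_dvd hpp).2 hpa).primeFactors_mul, hpp.primeFactors, prod_union, prod_singleton, ih ha]
    rw [disjoint_singleton_left]
    exact fun h => hpa (Nat.dvd_of_mem_primeFactors h)

theorem totient_eq_prod_of_squarefree {r : ℕ} (hr : Squarefree r) : (r.totient : ℝ) = ∏ p ∈ r.primeFactors, ((p : ℝ) - 1) := by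
  have h := Nat.totient_mul_prod_primeFactors r
  rw [Nat.prod_primeFactors_of_squarefree hr, mul_comm r] at h
  rw [Nat.eq_of_mul_eq_mul_right (Nat.pos_of_ne_zero hr.ne_zero) h, Nat.cast_prod]
  exact prod_congr rfl fun p hp => by rw [Nat.cast_sub (Nat.prime_of_mem_primeFactors hp).one_lt.le, Nat.cast_one]

theorem sum_lamQ_mul {W : ℕ → ℝ} (h1 : W 1 = 1) (hp : ∀ p m, p.Prime → ¬ p ∣ m → W (p * m) = W p * W m) (Q : ℕ) :
    ∑ d ∈ Icc 1 Q, lamQ Q d * (W d / d) = ∑ r ∈ Icc 1 Q, sqfProd (fun p => (1 - W p) / (p - 1)) r := by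
  have hd : ∀ d ∈ Icc 1 Q, lamQ Q d * (W d / d) =
      ∑ r ∈ Icc 1 Q, if d ∣ r then muR d * W d * (muR r ^ 2 / r.totient) else 0 := fun d hd => by
    have : (d : ℝ) ≠ 0 := Nat.cast_ne_zero.2 (by rw [mem_Icc] at hd; omega)
    rw [lamQ, ← sum_filter, ← mul_sum]
    field_simp
  rw [sum_congr rfl hd, sum_comm]
  refine sum_congr rfl fun r hr => ?_
  rw [mem_Icc] at hr
  rw [← sum_filter, ← sum_mul, show (Icc 1 Q).filter (fun d => d ∣ r) = r.divisors by
    ext d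
    rw [mem_filter, mem_Icc, Nat.mem_divisors]
    exact ⟨fun h => ⟨h.2, by omega⟩, fun h => ⟨⟨Nat.pos_of_dvd_of_pos h.1 hr.1, (Nat.le_of_dvd hr.1 h.1).trans hr.2⟩, h.1⟩⟩]
  by_cases hsq : Squarefree r
  · have hmu : muR r ^ 2 = 1 := by
      have := ArithmeticFunction.moebius_sq_eq_one_of_squarefree hsq
      rw [muR, ArithmeticFunction.intCoe_apply]
      exact_mod_cast this
    have hsum : ∑ d ∈ r.divisors, muR d * W d = ∏ p ∈ r.primeFactors, (1 - W p) := by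
      rw [← (prod_congr rfl fun p hp => ?_ : ∏ p ∈ r.primeFactors, (1 - ArithmeticFunction.prodPrimeFactors W p) = _),
        (ArithmeticFunction.IsMultiplicative.prodPrimeFactors W).prodPrimeFactors_one_sub_of_squarefree _ hsq]
      · refine sum_congr rfl fun d hd => ?_
        have hd' := hsq.squarefree_of_dvd (Nat.dvd_of_mem_divisors hd)
        rw [eq_prod_of_squarefree h1 hp hd', prodPrimeFactors_apply hd'.ne_zero]
        rfl
      · have hp' := Nat.prime_of_mem_primeFactors hp
        rw [prodPrimeFactors_apply hp'.ne_zero, hp'.primeFactors, prod_singleton]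
    rw [sqfProd, if_pos hsq, hsum, hmu, totient_eq_prod_of_squarefree hsq, prod_div_distrib, mul_one_div]
  · rw [sqfProd, if_neg hsq, muR, ArithmeticFunction.intCoe_apply, ArithmeticFunction.moebius_eq_zero_of_not_squarefree hsq]
    simp

/-- The density of multiples of `d` among integers congruent to `b` modulo `q`, normalised by `d`. -/
def resW (q b d : ℕ) : ℝ := if q.gcd d ∣ b then (q.gcd d : ℝ) else 0

theorem resW_mul {q b p m : ℕ} (hp : p.Prime) (hm : ¬ p ∣ m) : resW q b (p * m) = resW q b p * resW q b m := by
  have hc := (Nat.Prime.coprime_iff_not_dvd hp).2 hm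
  have h1 : (q.gcd p * q.gcd m ∣ b) ↔ q.gcd p ∣ b ∧ q.gcd m ∣ b :=
    ⟨fun h => ⟨(dvd_mul_right _ _).trans h, (dvd_mul_left _ _).trans h⟩, fun h =>
      (hc.coprime_dvd_left (Nat.gcd_dvd_right q p)).coprime_dvd_right (Nat.gcd_dvd_right q m) |>.mul_dvd_of_dvd_of_dvd h.1 h.2⟩
  rw [resW, resW, resW, hc.gcd_mul, ite_zero_mul_ite_zero, Nat.cast_mul]
  simp only [h1]

theorem sum_sqfProd_resW {Q q b : ℕ} (hq : 0 < q) (hqQ : q ≤ Q) :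
    ∑ r ∈ Icc 1 Q, sqfProd (fun p => (1 - resW q b p) / (p - 1)) r = if q.Coprime b then (q : ℝ) / q.totient else 0 := by
  have hP : Squarefree (∏ p ∈ q.primeFactors, p) := by
    refine squarefree_prod_of_pairwise_isCoprime (fun p hp r hr hpr => ?_) fun p hp => (Nat.prime_of_mem_primeFactors hp).squarefree
    exact Nat.coprime_iff_isRelPrime.1 ((Nat.coprime_primes (Nat.prime_of_mem_primeFactors hp) (Nat.prime_of_mem_primeFactors hr)).2 hpr)
  have hPf : (∏ p ∈ q.primeFactors, p).primeFactors = q.primeFactors := Nat.primeFactors_prod fun p hp => Nat.prime_of_mem_primeFactors hp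
  have hPq : (∏ p ∈ q.primeFactors, p) ∣ q := Nat.prod_primeFactors_dvd q
  trans ∑ r ∈ (∏ p ∈ q.primeFactors, p).divisors, sqfProd (fun p => (1 - resW q b p) / (p - 1)) r
  · symm
    refine sum_subset (fun r hr => ?_) fun r hr hr' => ?_
    · have hd := (Nat.dvd_of_mem_divisors hr).trans hPq
      exact mem_Icc.2 ⟨Nat.pos_of_dvd_of_pos hd hq, (Nat.le_of_dvd hq hd).trans hqQ⟩
    · rw [sqfProd]
      split_ifs with hsq
      · by_contra h
        refine hr' (Nat.mem_divisors.2 ⟨?_, hP.ne_zero⟩)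
        rw [← Nat.prod_primeFactors_of_squarefree hsq]
        refine prod_dvd_prod_of_subset _ _ _ fun p hp => ?_
        by_contra hpq
        refine h (prod_eq_zero hp ?_)
        have hp' := Nat.prime_of_mem_primeFactors hp
        have hg : q.gcd p = 1 := by
          rw [Nat.gcd_comm]
          exact (Nat.Prime.coprime_iff_not_dvd hp').2 fun hd => hpq (Nat.mem_primeFactors.2 ⟨hp', hd, hq.ne'⟩)
        rw [resW, hg]
        simp
      · rfl
  rw [sum_divisors_sqfProd _ hP, hPf]
  have hloc : ∀ p ∈ q.primeFactors, 1 + (1 - resW q b p) / ((p : ℝ) - 1) = if p ∣ b then 0 else (p : ℝ) / (p - 1) := fun p hp => by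
    have hp' := Nat.prime_of_mem_primeFactors hp
    have h1 : (1 : ℝ) < p := by exact_mod_cast hp'.one_lt
    have h2 : (p : ℝ) - 1 ≠ 0 := by linarith
    rw [resW, Nat.gcd_eq_right (Nat.dvd_of_mem_primeFactors hp)]
    split_ifs
    · field_simp; ring
    · field_simp; ring
  rw [prod_congr rfl hloc]
  split_ifs with hc
  · rw [prod_congr rfl fun p hp => if_neg fun hd => (Nat.prime_of_mem_primeFactors hp).one_lt.ne'
      (Nat.eq_one_of_dvd_coprimes hc (Nat.dvd_of_mem_primeFactors hp) hd), prod_div_distrib]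
    have h : ((q.totient * ∏ p ∈ q.primeFactors, p : ℕ) : ℝ) = ((q * ∏ p ∈ q.primeFactors, (p - 1) : ℕ) : ℝ) := by
      rw [Nat.totient_mul_prod_primeFactors q]
    rw [Nat.cast_mul, Nat.cast_mul, Nat.cast_prod, Nat.cast_prod, prod_congr rfl fun p hp => (by
      rw [Nat.cast_sub (Nat.prime_of_mem_primeFactors hp).one_lt.le, Nat.cast_one] : ((p - 1 : ℕ) : ℝ) = p - 1)] at h
    rw [div_eq_div_iff (prod_ne_zero_iff.2 fun p hp => ?_) (Nat.cast_ne_zero.2 (Nat.totient_pos.2 hq).ne'), mul_comm, h]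
    have : (1 : ℝ) < p := by exact_mod_cast (Nat.prime_of_mem_primeFactors hp).one_lt
    linarith
  · obtain ⟨p, hp, hpq, hpb⟩ := Nat.Prime.not_coprime_iff_dvd.1 hc
    exact prod_eq_zero (Nat.mem_primeFactors.2 ⟨hp, hpq, hq.ne'⟩) (if_pos hpb)

theorem exists_crt {q d c b : ℕ} (h : c ≡ b [MOD q.gcd d]) :
    ∃ x, ∀ n, (n ≡ c [MOD q] ∧ n ≡ b [MOD d]) ↔ n ≡ x [MOD q.lcm d] := by
  obtain ⟨x, hx1, hx2⟩ := Nat.chineseRemainder' h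
  refine ⟨x, fun n => ⟨fun hn => ?_, fun hn => ?_⟩⟩
  · have h1 := (Nat.modEq_iff_dvd.1 (hn.1.trans hx1.symm))
    have h2 := (Nat.modEq_iff_dvd.1 (hn.2.trans hx2.symm))
    refine Nat.modEq_iff_dvd.2 ?_
    rw [Int.natCast_dvd] at h1 h2 ⊢
    exact Nat.lcm_dvd h1 h2
  · exact ⟨(hn.of_dvd (Nat.dvd_lcm_left q d)).trans hx1, (hn.of_dvd (Nat.dvd_lcm_right q d)).trans hx2⟩

theorem abs_card_modEq_sub_le {r : ℕ} (hr : 0 < r) (x y : ℕ) :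
    |((#{n ∈ Icc 1 y | n ≡ x [MOD r]} : ℕ) : ℝ) - y / r| ≤ 1 := by
  have h := Nat.Ioc_filter_modEq_card 0 y hr x
  have hr' : (0 : ℚ) < r := by exact_mod_cast hr
  have h0 : ⌊((0 : ℕ) - (x : ℚ)) / r⌋ ≤ ⌊((y : ℚ) - x) / r⌋ := Int.floor_le_floor (by
    rw [Nat.cast_zero]
    exact div_le_div_of_nonneg_right (by linarith [Nat.cast_nonneg (α := ℚ) y]) hr'.le)
  rw [max_eq_left (by omega)] at h
  have h1 : |((#{n ∈ Icc 1 y | n ≡ x [MOD r]} : ℕ) : ℚ) - y / r| ≤ 1 := by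
    have h2 : ((#{n ∈ Icc 1 y | n ≡ x [MOD r]} : ℕ) : ℚ) = ⌊((y : ℚ) - x) / r⌋ - ⌊((0 : ℕ) - (x : ℚ)) / r⌋ := by
      exact_mod_cast h
    have h3 := Int.floor_le (((y : ℚ) - x) / r)
    have h4 := Int.lt_floor_add_one (((y : ℚ) - x) / r)
    have h5 := Int.floor_le (((0 : ℕ) - (x : ℚ)) / r)
    have h6 := Int.lt_floor_add_one (((0 : ℕ) - (x : ℚ)) / r)
    have h7 : ((y : ℚ) - x) / r - ((0 : ℕ) - (x : ℚ)) / r = y / r := by rw [← sub_div]; simp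
    rw [h2, abs_le]
    constructor <;> linarith
  have h2 := (Rat.cast_le (K := ℝ)).2 h1
  rw [Rat.cast_abs] at h2
  push_cast at h2
  exact h2

theorem abs_sum_LamQ_residue_sub_le {N Q q : ℕ} (hN : 3 ≤ N) (hQN : Q ≤ N) (hq : 0 < q) (hqQ : q ≤ Q) (b y : ℕ) :
    |(∑ n ∈ Icc 1 y with n ≡ b [MOD q], LamQ Q n) - (if q.Coprime b then (y : ℝ) / q.totient else 0)| ≤
      4 * (ell N : ℝ) ^ 2 * Q ^ 2 := by
  have hq' : (0 : ℝ) < q := by exact_mod_cast hq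
  have h1 : ∑ n ∈ Icc 1 y with n ≡ b [MOD q], LamQ Q n =
      ∑ d ∈ Icc 1 Q, lamQ Q d * (#{n ∈ Icc 1 y | n ≡ b [MOD q] ∧ n ≡ 0 [MOD d]} : ℕ) := by
    simp_rw [LamQ, sum_filter, card_filter, Nat.cast_sum, mul_sum]
    have h0 : ∀ n, (if n ≡ b [MOD q] then ∑ d ∈ Icc 1 Q, (if d ∣ n then lamQ Q d else 0) else 0) =
        ∑ d ∈ Icc 1 Q, if n ≡ b [MOD q] then (if d ∣ n then lamQ Q d else 0) else 0 := fun n => by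
      split_ifs <;> simp
    rw [sum_congr rfl fun n _ => h0 n, sum_comm]
    refine sum_congr rfl fun d _ => sum_congr rfl fun n _ => ?_
    by_cases h1 : n ≡ b [MOD q] <;> by_cases h2 : d ∣ n <;> simp [h1, h2, Nat.modEq_zero_iff_dvd]
  have h2 : (if q.Coprime b then (y : ℝ) / q.totient else 0) = ∑ d ∈ Icc 1 Q, lamQ Q d * (y / q * (resW q b d / d)) := by
    have hW := sum_lamQ_mul (W := resW q b) (by simp [resW]) (fun p m hp hm => resW_mul hp hm) Q
    rw [sum_sqfProd_resW hq hqQ] at hW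
    simp_rw [mul_left_comm _ ((y : ℝ) / q)]
    rw [← mul_sum, hW]
    split_ifs
    · field_simp
    · simp
  have h3 : ∀ d ∈ Icc 1 Q, |((#{n ∈ Icc 1 y | n ≡ b [MOD q] ∧ n ≡ 0 [MOD d]} : ℕ) : ℝ) - y / q * (resW q b d / d)| ≤ 1 := fun d hd => by
    have hd0 : 0 < d := (mem_Icc.1 hd).1
    have hd' : (0 : ℝ) < d := by exact_mod_cast hd0
    rw [resW]
    split_ifs with hg
    · obtain ⟨x, hx⟩ := exists_crt (c := b) (b := 0) ((Nat.modEq_zero_iff_dvd).2 hg)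
      simp_rw [hx]
      have h4 : (y : ℝ) / q * ((q.gcd d : ℕ) / d) = y / (q.lcm d : ℕ) := by
        have h5 : ((q.gcd d : ℕ) : ℝ) * (q.lcm d : ℕ) = q * d := by exact_mod_cast Nat.gcd_mul_lcm q d
        have h6 : ((q.lcm d : ℕ) : ℝ) ≠ 0 := Nat.cast_ne_zero.2 (Nat.lcm_pos hq hd0).ne'
        rw [div_mul_div_comm, ← h5, mul_comm ((q.gcd d : ℕ) : ℝ), mul_div_mul_right]
        exact Nat.cast_ne_zero.2 (Nat.gcd_pos_of_pos_left _ hq).ne'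
      rw [h4]
      exact abs_card_modEq_sub_le (Nat.lcm_pos hq hd0) x y
    · rw [filter_false_of_mem fun n _ hn => hg ?_]
      · simp
      · have := (hn.1.of_dvd (Nat.gcd_dvd_left q d)).symm.trans (hn.2.of_dvd (Nat.gcd_dvd_right q d))
        exact (Nat.modEq_zero_iff_dvd).1 this
  rw [h1, h2, ← sum_sub_distrib]
  refine (abs_sum_le_sum_abs _ _).trans ((sum_le_sum fun d hd => ?_).trans (le_of_eq (?_ : ∑ d ∈ Icc 1 Q, 4 * (ell N : ℝ) ^ 2 * Q = _)))
  · rw [← mul_sub, abs_mul]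
    refine (mul_le_of_le_one_right (abs_nonneg _) (h3 d hd)).trans ((abs_lamQ_le hN hQN (mem_Icc.1 hd).1).trans
      (mul_le_mul_of_nonneg_left ((tau_le d).trans (by exact_mod_cast (mem_Icc.1 hd).2)) (by positivity)))
  · rw [sum_const, Nat.card_Icc, nsmul_eq_mul, Nat.add_sub_cancel]; ring

open Classical in
theorem norm_major_arc_le {N Q q : ℕ} (hN : 3 ≤ N) (hQN : Q ≤ N) (hq : 0 < q) (hqQ : q ≤ Q) (a : ℤ) (α : ℝ) {E : ℝ}
    (hE : ∀ c : ZMod q, ∀ y ≤ N, |thetaAP q c y - (if IsUnit c then (y : ℝ) / q.totient else 0)| ≤ E) :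
    ‖∑ n ∈ Icc 1 N, ((vth n - LamQ Q n : ℝ) : ℂ) * ex (n * α)‖ ≤
      q * (E + 4 * (ell N : ℝ) ^ 2 * Q ^ 2) * (N * (7 * |α - a / q|) + 1) := by
  have : NeZero q := ⟨hq.ne'⟩
  have hq' : (q : ℝ) ≠ 0 := Nat.cast_ne_zero.2 hq.ne'
  have hres : ∀ y : ℕ, y ≤ N → ∀ c : ZMod q, |∑ n ∈ (Icc 1 y).filter (fun n : ℕ => (n : ZMod q) = c), (vth n - LamQ Q n)| ≤
      E + 4 * (ell N : ℝ) ^ 2 * Q ^ 2 := fun y hy c => by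
    have h1 := hE c y hy
    have h2 := abs_sum_LamQ_residue_sub_le hN hQN hq hqQ c.val y
    have h3 : ∀ n : ℕ, n ≡ c.val [MOD q] ↔ (n : ZMod q) = c := fun n => by
      rw [← ZMod.natCast_eq_natCast_iff, ZMod.natCast_zmod_val]
    have h4 : q.Coprime c.val ↔ IsUnit c := by
      rw [Nat.coprime_comm, ← ZMod.isUnit_iff_coprime, ZMod.natCast_zmod_val]
    simp_rw [h3, h4] at h2
    rw [thetaAP, ← sum_filter] at h1
    rw [sum_sub_distrib]
    by_cases hc : IsUnit c
    · rw [if_pos hc] at h1 h2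
      rw [← sub_sub_sub_cancel_right _ _ ((y : ℝ) / q.totient)]
      exact (abs_sub _ _).trans (add_le_add h1 h2)
    · rw [if_neg hc, sub_zero] at h1 h2
      exact (abs_sub _ _).trans (add_le_add h1 h2)
  set β := α - a / q with hβ
  have hper : ∀ n : ℕ, ex (n * (a / q : ℝ)) = ex (((n : ZMod q).val : ℕ) * (a / q : ℝ)) := fun n => by
    have h1 : (n : ℝ) = (n % q : ℕ) + q * (n / q : ℕ) := by exact_mod_cast (Nat.mod_add_div n q).symm
    have h2 : (n : ℝ) * (a / q) = (n % q : ℕ) * (a / q : ℝ) + ((((n / q : ℕ) : ℤ) * a : ℤ) : ℝ) := by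
      rw [Int.cast_mul, Int.cast_natCast, h1, add_mul]
      congr 1
      field_simp
    rw [ZMod.val_natCast, h2, ex_add_int]
  have hS : ∀ y ≤ N, ‖∑ n ∈ Ioc 0 y, ((vth n - LamQ Q n : ℝ) : ℂ) * ex (n * (a / q : ℝ))‖ ≤
      q * (E + 4 * (ell N : ℝ) ^ 2 * Q ^ 2) := fun y hy => by
    rw [← sum_fiberwise (Ioc 0 y) (fun n : ℕ => (n : ZMod q)) (fun n => ((vth n - LamQ Q n : ℝ) : ℂ) * ex (n * (a / q : ℝ)))]
    refine (norm_sum_le _ _).trans ((sum_le_sum (g := fun _ => E + 4 * (ell N : ℝ) ^ 2 * Q ^ 2) fun c _ => ?_).trans (le_of_eq ?_))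
    · rw [sum_congr rfl fun n hn => by rw [hper n, (mem_filter.1 hn).2], ← sum_mul, norm_mul, norm_ex, mul_one,
        ← Complex.ofReal_sum, norm_real]
      exact hres y hy c
    · rw [sum_const, card_univ, ZMod.card, nsmul_eq_mul]
  have h := abel_norm_le (fun n => ((vth n - LamQ Q n : ℝ) : ℂ) * ex (n * (a / q : ℝ))) (fun n => ex (n * β)) (Nat.zero_le N)
    (fun y _ hy => hS y hy)
  refine (le_of_eq ?_).trans (h.trans (mul_le_mul_of_nonneg_left (add_le_add (?_ : _ ≤ (N : ℝ) * (7 * |β|)) (norm_ex _).le)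
    ((norm_nonneg _).trans (hS 0 (Nat.zero_le _)))))
  · congr 1
    refine sum_congr rfl fun n _ => ?_
    rw [mul_assoc, ← ex_add, hβ]
    congr 2
    ring
  · have h1 : ∀ n ∈ Ioc 0 N, ‖ex (n * β) - ex ((n + 1 : ℕ) * β)‖ ≤ 7 * |β| := fun n _ => by
      rw [Nat.cast_add, Nat.cast_one, add_mul, one_mul, ex_add, ← mul_one_sub, norm_mul, norm_ex, one_mul, norm_sub_rev, ex, mul_comm]
      refine Real.norm_exp_I_mul_ofReal_sub_one_le.trans ?_
      rw [norm_eq_abs, abs_mul, abs_of_pos (by positivity)]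
      nlinarith [Real.pi_lt_d2, abs_nonneg β]
    refine (sum_le_sum h1).trans (le_of_eq ?_)
    rw [sum_const, Nat.card_Ioc, nsmul_eq_mul, Nat.sub_zero]

theorem wellSpaced_of_approx {q n Q : ℕ} {a : ℤ} {α : ℝ} (hQ : 2 ≤ Q) (hQq : Q < q) (hqn : q ≤ n) (hQn : 2 * Q ≤ n + 1)
    (ha : IsCoprime a (q : ℤ)) (hα : |α - a / q| ≤ 1 / ((n + 1) * q)) : WellSpaced q α Q := by
  have hq0 : (0 : ℝ) < q := by exact_mod_cast (by omega : 0 < q)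
  refine ⟨by omega, fun h h0 hh => one_div_two_mul_le_nd (by omega) ha h0 ?_ ?_⟩
  · rcases hh with hh | hh
    · have : (2 : ℤ) * |h| ≤ q := hh
      have := abs_pos.2 h0
      omega
    · have : |h| ≤ (Q : ℤ) := hh
      omega
  · have hh' : 2 * |h| ≤ (n : ℤ) + 1 := by
      rcases hh with hh | hh
      · have : (2 : ℤ) * |h| ≤ q := hh
        omega
      · have : |h| ≤ (Q : ℤ) := hh
        omega
    have h1 : 2 * |(h : ℝ)| ≤ n + 1 := by exact_mod_cast hh'
    refine (mul_le_mul_of_nonneg_left hα (abs_nonneg _)).trans ?_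
    rw [mul_one_div, div_le_div_iff₀ (by positivity) (by positivity)]
    nlinarith [mul_le_mul_of_nonneg_right h1 hq0.le]

/-- Uniform power-of-logarithm saving for the exponential sum of the primes minus their Ramanujan model. -/
theorem expsum_bound (D e0 : ℕ) : ∃ e, e0 ≤ e ∧ ∃ M : ℕ, ∃ C : ℝ, 0 ≤ C ∧ ∀ N : ℕ, 3 ≤ N → ell N ^ M ≤ N → ∀ α : ℝ,
    ‖∑ n ∈ Icc 1 N, ((vth n - LamQ (ell N ^ e) n : ℝ) : ℂ) * ex (n * α)‖ ≤ C * N / (ell N : ℝ) ^ D := by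
  classical
  obtain ⟨e, he⟩ : ∃ e, e = e0 + 4 * (D + 4) := ⟨_, rfl⟩
  obtain ⟨B, C, hC, hBV⟩ := bombieri_vinogradov (2 * e + D)
  refine ⟨e, by omega, 4 * e + 2 + D + 2 * B, 8 * C + 259, by positivity, fun N hN hM α => ?_⟩
  have hl2 : 2 ≤ ell N := two_le_ell hN
  have hl1 : 1 ≤ ell N := by omega
  have hpow : ∀ j, j ≤ 4 * e + 2 + D + 2 * B → ell N ^ j ≤ N := fun j hj => (Nat.pow_le_pow_right hl1 hj).trans hM
  obtain ⟨Q, hQ⟩ : ∃ Q, Q = ell N ^ e := ⟨_, rfl⟩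
  have hQ2 : 2 ≤ Q := hQ ▸ hl2.trans (Nat.le_self_pow (by omega) _)
  have hQN : Q ≤ N := hQ ▸ hpow e (by omega)
  rw [← hQ]
  obtain ⟨n, hn⟩ : ∃ n, n = N / Q ^ 2 := ⟨_, rfl⟩
  have hQ0 : 0 < Q ^ 2 := by positivity
  have hnN : n * Q ^ 2 ≤ N := hn ▸ Nat.div_mul_le_self N _
  have hnN' : N < (n + 1) * Q ^ 2 := by rw [hn, mul_comm]; exact Nat.lt_mul_div_succ N hQ0
  have h2Q : 2 * Q ≤ n := by
    rw [hn, Nat.le_div_iff_mul_le hQ0]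
    calc 2 * Q * Q ^ 2 ≤ ell N * Q * Q ^ 2 := by gcongr
      _ = ell N ^ (1 + 3 * e) := by rw [hQ]; ring
      _ ≤ N := hpow _ (by omega)
  set ℓ : ℝ := (ell N : ℝ) with hℓ
  have hl0 : (0 : ℝ) < ℓ := by rw [hℓ]; exact_mod_cast (by omega : 0 < ell N)
  have hQℓ : (Q : ℝ) = ℓ ^ e := by rw [hQ, hℓ]; push_cast; rfl
  have hpow' : ∀ j, j ≤ 4 * e + 2 + D + 2 * B → ℓ ^ j ≤ N := fun j hj => by rw [hℓ]; exact_mod_cast hpow j hj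
  obtain ⟨r, hr1, hr2⟩ := Real.exists_rat_abs_sub_le_and_den_le α (n := n) (by omega)
  have hq0 : 0 < r.den := r.den_pos
  have hq' : (0 : ℝ) < r.den := by exact_mod_cast hq0
  rw [Rat.cast_def] at hr1
  have hN0 : (0 : ℝ) < N := by exact_mod_cast (by omega : 0 < N)
  rcases le_or_gt r.den Q with hqQ | hqQ
  · obtain ⟨E, hE0, hE1, hE2⟩ := hBV N hN
    have h1 := norm_major_arc_le hN hQN hq0 hqQ r.num α (E := E r.den) (fun c y hy => hE1 _ hq0 c y hy)
    have h2 : E r.den ≤ C * N / ℓ ^ (2 * e + D) := (single_le_sum (f := E) (fun k _ => hE0 k) (mem_Icc.2 ⟨hq0, hqQ⟩)).trans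
      (hE2 Q (by rw [hQ, ← pow_mul, ← pow_add]; exact hpow _ (by omega)))
    have h3 : r.den * (N * (7 * |α - r.num / r.den|) + 1) ≤ 8 * (Q : ℝ) ^ 2 := by
      have h4 : (N : ℝ) ≤ (n + 1) * Q ^ 2 := by exact_mod_cast hnN'.le
      have h5 : (r.den : ℝ) ≤ Q ^ 2 := by exact_mod_cast hqQ.trans (Nat.le_self_pow two_ne_zero _)
      have h6 : (N : ℝ) * (r.den * |α - r.num / r.den|) ≤ Q ^ 2 := by
        have h7 : r.den * |α - r.num / r.den| ≤ 1 / ((n : ℝ) + 1) := by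
          refine (mul_le_mul_of_nonneg_left hr1 hq'.le).trans (le_of_eq ?_)
          field_simp
        refine (mul_le_mul_of_nonneg_left h7 hN0.le).trans ?_
        rw [mul_one_div, div_le_iff₀ (by positivity)]
        linarith
      linarith
    have h8 : (E r.den + 4 * ℓ ^ 2 * Q ^ 2) * (8 * Q ^ 2) ≤ (8 * C + 259) * N / ℓ ^ D := by
      have h9 : E r.den * (8 * Q ^ 2) ≤ 8 * C * N / ℓ ^ D := by
        refine (mul_le_mul_of_nonneg_right h2 (by positivity)).trans (le_of_eq ?_)
        rw [hQℓ, pow_add, pow_mul']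
        field_simp
      have h10 : 4 * ℓ ^ 2 * Q ^ 2 * (8 * Q ^ 2) ≤ 32 * N / ℓ ^ D := by
        rw [le_div_iff₀ (by positivity), hQℓ]
        have := hpow' (4 * e + 2 + D) (by omega)
        calc 4 * ℓ ^ 2 * (ℓ ^ e) ^ 2 * (8 * (ℓ ^ e) ^ 2) * ℓ ^ D = 32 * ℓ ^ (4 * e + 2 + D) := by ring
          _ ≤ 32 * N := by linarith
      have h11 : (8 * C + 259) * N / ℓ ^ D = 8 * C * N / ℓ ^ D + 32 * N / ℓ ^ D + 227 * N / ℓ ^ D := by ring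
      have h12 : 0 ≤ 227 * N / ℓ ^ D := by positivity
      linarith
    refine h1.trans (le_trans (le_of_eq_of_le ?_ (mul_le_mul_of_nonneg_left h3
      (by have := hE0 r.den; positivity : (0 : ℝ) ≤ E r.den + 4 * ℓ ^ 2 * Q ^ 2))) h8)
    ring
  · have hV1 : 1 ≤ ell N ^ (D + 4) := Nat.one_le_pow _ _ hl1
    have hVQ : (ell N ^ (D + 4)) ^ 4 ≤ Q := by rw [hQ, ← pow_mul]; exact Nat.pow_le_pow_right hl1 (by omega)
    have ha : IsCoprime r.num (r.den : ℤ) := Rat.isCoprime_num_den r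
    have h1 := norm_minor_arc_le (wellSpaced_of_approx hQ2 hqQ hr2 (by omega) ha hr1) hN hV1 hVQ hQ2 hqQ
      ((Nat.mul_le_mul_right _ hr2).trans hnN)
    refine h1.trans ?_
    push_cast
    rw [← hℓ, hQℓ]
    have hs : √(N : ℝ) * √(N : ℝ) = N := Real.mul_self_sqrt hN0.le
    have a1 : 2 * √(N : ℝ) * ℓ ≤ 2 * N / ℓ ^ D := by
      rw [le_div_iff₀ (by positivity)]
      have h2 : ℓ ^ (D + 1) ≤ √(N : ℝ) := Real.le_sqrt_of_sq_le (by rw [← pow_mul]; exact hpow' _ (by omega))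
      have h3 := mul_le_mul_of_nonneg_left h2 (Real.sqrt_nonneg (N : ℝ))
      rw [hs, pow_succ] at h3
      linarith
    have a2 : (ℓ ^ (D + 4)) ^ 2 * ℓ ≤ N / ℓ ^ D := by
      rw [le_div_iff₀ (by positivity), ← pow_mul, ← pow_succ, ← pow_add]
      exact hpow' _ (by omega)
    have a3 : 96 * ℓ ^ 4 * (N / ℓ ^ (D + 4)) = 96 * N / ℓ ^ D := by rw [pow_add]; field_simp
    have a4 : 160 * ℓ ^ 3 * (N / ℓ ^ e) ≤ 160 * N / ℓ ^ D := by
      rw [mul_div_assoc', div_le_div_iff₀ (by positivity) (by positivity)]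
      have h2 : ℓ ^ (D + 3) ≤ ℓ ^ e := pow_le_pow_right₀ (by rw [hℓ]; exact_mod_cast hl1) (by omega)
      calc 160 * ℓ ^ 3 * N * ℓ ^ D = 160 * N * ℓ ^ (D + 3) := by ring
        _ ≤ _ := by gcongr
    have h11 : (8 * C + 259) * N / ℓ ^ D = 8 * (C * N / ℓ ^ D) + 2 * N / ℓ ^ D + N / ℓ ^ D + 96 * N / ℓ ^ D + 160 * N / ℓ ^ D := by ring
    have h12 : 0 ≤ C * N / ℓ ^ D := by positivity
    linarith

theorem sum_norm_sq_ex {N H : ℕ} (h : N < H) (a : ℕ → ℝ) :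
    ∑ j ∈ range H, ‖∑ n ∈ range (N + 1), (a n : ℂ) * ex (n * (j / H : ℝ))‖ ^ 2 = H * ∑ n ∈ range (N + 1), a n ^ 2 := by
  have hH : 0 < H := by omega
  apply Complex.ofReal_injective
  push_cast
  have h1 : ∀ j ∈ range H, ((‖∑ n ∈ range (N + 1), (a n : ℂ) * ex (n * (j / H : ℝ))‖ : ℂ)) ^ 2 =
      ∑ n ∈ range (N + 1), ∑ m ∈ range (N + 1), (a n : ℂ) * a m * ex (j * (((n - m : ℤ) : ℝ) / H)) := fun j _ => by
    rw [← Complex.mul_conj', map_sum, sum_mul_sum]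
    refine sum_congr rfl fun n _ => sum_congr rfl fun m _ => ?_
    rw [map_mul, conj_ofReal, ← ex_neg, mul_mul_mul_comm, ← ex_add]
    congr 2
    push_cast
    ring
  rw [sum_congr rfl h1, sum_comm, mul_sum]
  refine sum_congr rfl fun n hn => ?_
  rw [sum_comm, sum_eq_single_of_mem n hn]
  · rw [← mul_sum, sum_ex_orthogonal hH, if_pos (by simp)]
    ring
  · intro m hm hmn
    rw [← mul_sum, sum_ex_orthogonal hH, if_neg, mul_zero]
    intro hd
    rw [mem_range] at hn hm
    have := Int.eq_zero_of_abs_lt_dvd hd (by rw [abs_lt]; omega)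
    omega

/-- The mean square of the autocorrelation of `g`, bounded through the supremum of its Fourier transform. -/
theorem sum_autocorrelation_sq_le {N : ℕ} {g : ℕ → ℝ} (hg : ∀ n, N < n → g n = 0) {S : ℝ}
    (hS : ∀ α : ℝ, ‖∑ n ∈ range (N + 1), (g n : ℂ) * ex (n * α)‖ ≤ S) :
    ∑ h ∈ range (N + 1), (∑ n ∈ range (N + 1), g n * g (n + h)) ^ 2 ≤ S ^ 2 * ∑ n ∈ range (N + 1), g n ^ 2 := by
  obtain ⟨G, hG⟩ : ∃ G : ℕ → ℝ, G = fun h => ∑ n ∈ range (N + 1), g n * g (n + h) := ⟨_, rfl⟩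
  obtain ⟨H, hH⟩ : ∃ H, H = 2 * N + 1 := ⟨_, rfl⟩
  have hH0 : (0 : ℝ) < H := by exact_mod_cast (by omega : 0 < H)
  have h1 : ∀ h ∈ range (N + 1), (H : ℂ) * G h = ∑ n ∈ range (N + 1), ∑ m ∈ range (N + 1), (g n : ℂ) * g m *
      ∑ j ∈ range H, ex (j * (((m - n - h : ℤ) : ℝ) / H)) := fun h hh => by
    simp only [hG, Complex.ofReal_sum, ofReal_mul]
    rw [mul_sum]
    refine sum_congr rfl fun n hn => ?_
    rw [mem_range] at hn hh
    have h2 : ∀ m ∈ range (N + 1), (g n : ℂ) * g m * ∑ j ∈ range H, ex (j * (((m - n - h : ℤ) : ℝ) / H)) =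
        if m = n + h then (g n : ℂ) * g m * H else 0 := fun m hm => by
      rw [mem_range] at hm
      rw [sum_ex_orthogonal (by omega)]
      split_ifs with h3 h4 h4
      · rfl
      · have := Int.eq_zero_of_abs_lt_dvd h3 (by rw [abs_lt]; omega)
        omega
      · exact absurd (by rw [h4]; simp) h3
      · simp
    rw [sum_congr rfl h2, sum_ite_eq']
    split_ifs with h3
    · ring
    · rw [hg (n + h) (by simpa using h3)]; simp
  have h2 : ((H * ∑ h ∈ range (N + 1), G h ^ 2 : ℝ) : ℂ) = ∑ j ∈ range H,
      (starRingEnd ℂ) (∑ n ∈ range (N + 1), (g n : ℂ) * ex (n * (j / H : ℝ))) *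
      (∑ m ∈ range (N + 1), (g m : ℂ) * ex (m * (j / H : ℝ))) *
      (starRingEnd ℂ) (∑ h ∈ range (N + 1), (G h : ℂ) * ex (h * (j / H : ℝ))) := by
    push_cast
    rw [mul_sum]
    have h3 : ∀ h ∈ range (N + 1), (H : ℂ) * (G h : ℂ) ^ 2 = ∑ n ∈ range (N + 1), ∑ m ∈ range (N + 1), ∑ j ∈ range H, (g n : ℂ) * g m * G h *
        ex (j * (((m - n - h : ℤ) : ℝ) / H)) := fun h hh => by
      rw [pow_two, ← mul_assoc, h1 h hh, sum_mul]
      refine sum_congr rfl fun n _ => ?_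
      rw [sum_mul]
      refine sum_congr rfl fun m _ => ?_
      rw [mul_sum, sum_mul]
      exact sum_congr rfl fun j _ => by ring
    rw [sum_congr rfl h3]
    have h5 : ∀ j ∈ range H, (starRingEnd ℂ) (∑ n ∈ range (N + 1), (g n : ℂ) * ex (n * (j / H : ℝ))) *
        (∑ m ∈ range (N + 1), (g m : ℂ) * ex (m * (j / H : ℝ))) *
        (starRingEnd ℂ) (∑ h ∈ range (N + 1), (G h : ℂ) * ex (h * (j / H : ℝ))) =
        ∑ n ∈ range (N + 1), ∑ m ∈ range (N + 1), ∑ h ∈ range (N + 1), (starRingEnd ℂ) ((g n : ℂ) * ex (n * (j / H : ℝ))) *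
        ((g m : ℂ) * ex (m * (j / H : ℝ))) * (starRingEnd ℂ) ((G h : ℂ) * ex (h * (j / H : ℝ))) := fun j _ => by
      rw [map_sum, map_sum, sum_mul_sum, sum_mul]
      refine sum_congr rfl fun n _ => ?_
      rw [sum_mul]
      exact sum_congr rfl fun m _ => mul_sum _ _ _
    rw [sum_congr rfl h5, sum_comm, sum_comm (s := range H)]
    refine sum_congr rfl fun n _ => ?_
    rw [sum_comm, sum_comm (s := range H)]
    refine sum_congr rfl fun m _ => ?_
    rw [sum_comm]
    refine sum_congr rfl fun j _ => sum_congr rfl fun h _ => ?_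
    rw [map_mul, map_mul, conj_ofReal, conj_ofReal, ← ex_neg, ← ex_neg]
    have h4 : ex (j * (((m - n - h : ℤ) : ℝ) / H)) = ex (-(n * (j / H : ℝ))) * ex (m * (j / H : ℝ)) * ex (-(h * (j / H : ℝ))) := by
      rw [← ex_add, ← ex_add]
      congr 1
      push_cast
      ring
    rw [h4]
    ring
  have hS0 : 0 ≤ S := (norm_nonneg _).trans (hS 0)
  have hN : N < H := by omega
  have h3 : (H : ℝ) * ∑ h ∈ range (N + 1), G h ^ 2 ≤ S * ∑ j ∈ range H,
      ‖∑ n ∈ range (N + 1), (g n : ℂ) * ex (n * (j / H : ℝ))‖ * ‖∑ h ∈ range (N + 1), (G h : ℂ) * ex (h * (j / H : ℝ))‖ := by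
    have h4 := congrArg norm h2
    rw [norm_real, norm_of_nonneg (mul_nonneg hH0.le (sum_nonneg fun _ _ => sq_nonneg _))] at h4
    rw [h4, mul_sum]
    refine (norm_sum_le _ _).trans (sum_le_sum fun j _ => ?_)
    rw [norm_mul, norm_mul, Complex.norm_conj, Complex.norm_conj, ← mul_assoc]
    exact mul_le_mul_of_nonneg_right (mul_le_mul_of_nonneg_right (hS _) (norm_nonneg _)) (norm_nonneg _)
  have h4 := sum_mul_sq_le_sq_mul_sq (range H) (fun j : ℕ => ‖∑ n ∈ range (N + 1), (g n : ℂ) * ex (n * (j / H : ℝ))‖)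
    (fun j : ℕ => ‖∑ h ∈ range (N + 1), (G h : ℂ) * ex (h * (j / H : ℝ))‖)
  rw [sum_norm_sq_ex hN, sum_norm_sq_ex hN] at h4
  have h5 : ∑ h ∈ range (N + 1), (∑ n ∈ range (N + 1), g n * g (n + h)) ^ 2 = ∑ h ∈ range (N + 1), G h ^ 2 := by rw [hG]
  rw [h5]
  have hX0 : 0 ≤ ∑ h ∈ range (N + 1), G h ^ 2 := sum_nonneg fun _ _ => sq_nonneg _
  have hP0 : 0 ≤ ∑ n ∈ range (N + 1), g n ^ 2 := sum_nonneg fun _ _ => sq_nonneg _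
  generalize ∑ h ∈ range (N + 1), G h ^ 2 = X at *
  generalize ∑ n ∈ range (N + 1), g n ^ 2 = P at *
  generalize ∑ j ∈ range H, ‖∑ n ∈ range (N + 1), (g n : ℂ) * ex (n * (j / H : ℝ))‖ * ‖∑ h ∈ range (N + 1), (G h : ℂ) * ex (h * (j / H : ℝ))‖ = Y at *
  have h6 : (H * X) ^ 2 ≤ S ^ 2 * Y ^ 2 := by rw [← mul_pow]; exact pow_le_pow_left₀ (by positivity) h3 2
  have h7 : (H * X) ^ 2 ≤ S ^ 2 * (H * P * (H * X)) := h6.trans (mul_le_mul_of_nonneg_left h4 (sq_nonneg S))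
  rcases hX0.eq_or_lt with h8 | h8
  · rw [← h8]; positivity
  · have h9 : 0 < (H : ℝ) ^ 2 * X := by positivity
    refine le_of_mul_le_mul_left ?_ h9
    linarith

theorem sum_shift_mul_shift {N m m' : ℕ} {g : ℕ → ℝ} (hg : ∀ n, N < n → g n = 0) (hg0 : g 0 = 0) (hm : m ≤ N) (hmm : m' ≤ m) :
    ∑ n ∈ range (2 * N + 1), g (n - m) * g (n - m') = ∑ n ∈ range (N + 1), g n * g (n + (m - m')) := by
  have h1 : Ico m (m + (N + 1)) ⊆ range (2 * N + 1) := fun n hn => by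
    rw [mem_Ico] at hn
    rw [mem_range]
    omega
  rw [← sum_subset h1, sum_Ico_eq_sum_range, Nat.add_sub_cancel_left]
  · refine sum_congr rfl fun j _ => ?_
    rw [Nat.add_sub_cancel_left, show m + j - m' = j + (m - m') by omega]
  · intro n _ hn
    rw [mem_Ico] at hn
    rcases lt_or_ge n m with h | h
    · rw [Nat.sub_eq_zero_of_le h.le, hg0, zero_mul]
    · rw [hg (n - m) (by omega), zero_mul]

theorem card_residue_le {N k : ℕ} (hk : 0 < k) (hkN : k ≤ N) (c : ZMod k) :
    ((#((Icc 1 N).filter fun m : ℕ => (m : ZMod k) = c) : ℕ) : ℝ) ≤ 2 * N / k := by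
  have : NeZero k := ⟨hk.ne'⟩
  have h := abs_card_modEq_sub_le hk c.val N
  have h3 : ∀ n : ℕ, n ≡ c.val [MOD k] ↔ (n : ZMod k) = c := fun n => by
    rw [← ZMod.natCast_eq_natCast_iff, ZMod.natCast_zmod_val]
  simp_rw [h3] at h
  have hk' : (0 : ℝ) < k := by exact_mod_cast hk
  have h1 : (1 : ℝ) ≤ N / k := by rw [le_div_iff₀ hk', one_mul]; exact_mod_cast hkN
  have h2 := (abs_le.1 h).2
  have h4 : 2 * (N : ℝ) / k = N / k + N / k := by ring
  linarith

theorem sum_conv_sq_le {N k : ℕ} {g : ℕ → ℝ} (hg : ∀ n, N < n → g n = 0) (hg0 : g 0 = 0) (hk : 0 < k) (hkN : k ≤ N) (c : ZMod k)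
    {f : ℕ → ℝ} {L : ℝ} (hf : ∀ m ∈ Icc 1 N, |f m| ≤ L) (hfc : ∀ m : ℕ, (m : ZMod k) ≠ c → f m = 0) :
    ∑ n ∈ range (2 * N + 1), (∑ m ∈ Icc 1 N, f m * g (n - m)) ^ 2 ≤
      4 * L ^ 2 * (N / k) * ∑ h ∈ range (N + 1) with k ∣ h, |∑ n ∈ range (N + 1), g n * g (n + h)| := by
  obtain ⟨I, hI⟩ : ∃ I, I = (Icc 1 N).filter fun m : ℕ => (m : ZMod k) = c := ⟨_, rfl⟩
  obtain ⟨G, hG⟩ : ∃ G : ℕ → ℝ, G = fun h => ∑ n ∈ range (N + 1), g n * g (n + h) := ⟨_, rfl⟩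
  obtain ⟨T, hT⟩ : ∃ T : ℕ → ℕ → ℝ, T = fun m m' => |∑ n ∈ range (2 * N + 1), g (n - m) * g (n - m')| := ⟨_, rfl⟩
  have hmem : ∀ m, m ∈ I ↔ m ∈ Icc 1 N ∧ (m : ZMod k) = c := fun m => by rw [hI, mem_filter]
  have h1 : ∀ n, ∑ m ∈ Icc 1 N, f m * g (n - m) = ∑ m ∈ I, f m * g (n - m) := fun n => by
    rw [hI, sum_filter_of_ne]
    intro m _ hm
    by_contra h
    exact hm (by rw [hfc m h, zero_mul])
  have h2 : ∑ n ∈ range (2 * N + 1), (∑ m ∈ Icc 1 N, f m * g (n - m)) ^ 2 ≤ L ^ 2 * ∑ m ∈ I, ∑ m' ∈ I, T m m' := by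
    have h3 : ∑ n ∈ range (2 * N + 1), (∑ m ∈ Icc 1 N, f m * g (n - m)) ^ 2 =
        ∑ m ∈ I, ∑ m' ∈ I, f m * f m' * ∑ n ∈ range (2 * N + 1), g (n - m) * g (n - m') := by
      simp_rw [h1, pow_two, sum_mul_sum]
      rw [sum_comm]
      refine sum_congr rfl fun m _ => ?_
      rw [sum_comm]
      refine sum_congr rfl fun m' _ => ?_
      rw [mul_sum]
      exact sum_congr rfl fun n _ => by ring
    rw [h3, mul_sum]
    refine sum_le_sum fun m hm => ?_
    rw [mul_sum]
    refine sum_le_sum fun m' hm' => (le_abs_self _).trans ?_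
    rw [abs_mul, abs_mul, hT, pow_two]
    have a1 := hf m ((hmem m).1 hm).1
    have a2 := hf m' ((hmem m').1 hm').1
    exact mul_le_mul_of_nonneg_right (mul_le_mul a1 a2 (abs_nonneg _) ((abs_nonneg _).trans a1)) (abs_nonneg _)
  have h4 := sum_sum_le_two_mul I T (fun _ _ => by rw [hT]; exact abs_nonneg _) (fun m m' => by
    simp only [hT]
    exact congrArg _ (sum_congr rfl fun n _ => mul_comm _ _))
  have h5 : ∀ m ∈ I, ∑ m' ∈ I with m' ≤ m, T m m' ≤ ∑ h ∈ range (N + 1) with k ∣ h, |G h| := fun m hm => by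
    have hm1 := (hmem m).1 hm
    have h6 : ∑ m' ∈ I with m' ≤ m, T m m' = ∑ m' ∈ I with m' ≤ m, |G (m - m')| := sum_congr rfl fun m' hm' => by
      rw [hT, hG]
      exact congrArg _ (sum_shift_mul_shift hg hg0 (mem_Icc.1 hm1.1).2 (mem_filter.1 hm').2)
    have hinj : Set.InjOn (fun m' => m - m') ({m' ∈ I | m' ≤ m} : Finset ℕ) := fun x hx y hy hxy => by
      have hx1 := (mem_filter.1 (mem_coe.1 hx)).2
      have hy1 := (mem_filter.1 (mem_coe.1 hy)).2
      have hxy' : m - x = m - y := hxy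
      omega
    rw [h6, ← sum_image (g := fun m' => m - m') (f := fun h => |G h|) hinj]
    refine sum_le_sum_of_subset_of_nonneg (fun h hh => ?_) fun _ _ _ => abs_nonneg _
    obtain ⟨m', hm', rfl⟩ := mem_image.1 hh
    rw [mem_filter] at hm' ⊢
    have hm2 := (hmem m').1 hm'.1
    refine ⟨mem_range.2 ?_, ?_⟩
    · have := (mem_Icc.1 hm1.1).2
      omega
    · rw [← ZMod.natCast_eq_zero_iff, Nat.cast_sub hm'.2, hm1.2, hm2.2, sub_self]
  have h7 : ∑ m ∈ I, ∑ m' ∈ I with m' ≤ m, T m m' ≤ 2 * N / k * ∑ h ∈ range (N + 1) with k ∣ h, |G h| := by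
    refine (sum_le_sum h5).trans ?_
    rw [sum_const, nsmul_eq_mul, hI]
    exact mul_le_mul_of_nonneg_right (card_residue_le hk hkN c) (sum_nonneg fun _ _ => abs_nonneg _)
  have h8 : ∑ m ∈ I, ∑ m' ∈ I, T m m' ≤ 2 * (2 * N / k * ∑ h ∈ range (N + 1) with k ∣ h, |G h|) :=
    h4.trans (mul_le_mul_of_nonneg_left h7 zero_le_two)
  refine h2.trans ((mul_le_mul_of_nonneg_left h8 (sq_nonneg L)).trans (le_of_eq ?_))
  rw [hG]
  ring

theorem sum_sum_dvd_le (N K : ℕ) (F : ℕ → ℝ) (hF : ∀ h, 0 ≤ F h) :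
    ∑ k ∈ Icc 1 K, ∑ h ∈ range (N + 1) with k ∣ h, F h ≤ K * F 0 + ∑ h ∈ Icc 1 N, tau h * F h := by
  have h1 : ∀ k ∈ Icc 1 K, ∑ h ∈ range (N + 1) with k ∣ h, F h = F 0 + ∑ h ∈ Icc 1 N, if k ∣ h then F h else 0 := fun k _ => by
    rw [sum_filter, range_eq_Ico, sum_eq_sum_Ico_succ_bot (by omega), if_pos (dvd_zero k)]
    rfl
  rw [sum_congr rfl h1, sum_add_distrib, sum_const, Nat.card_Icc, nsmul_eq_mul, Nat.add_sub_cancel, sum_comm]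
  refine add_le_add le_rfl (sum_le_sum fun h hh => ?_)
  rw [← sum_filter, sum_const, nsmul_eq_mul, tau]
  refine mul_le_mul_of_nonneg_right (Nat.cast_le.2 (card_le_card fun k hk => ?_)) (hF h)
  rw [mem_filter] at hk
  exact Nat.mem_divisors.2 ⟨hk.2, by rw [mem_Icc] at hh; omega⟩

theorem sum_abs_conv_sq_le {N K : ℕ} (hN : 3 ≤ N) (hKN : K ≤ N) {g : ℕ → ℝ} (hg : ∀ n, N < n → g n = 0) (hg0 : g 0 = 0) {S P : ℝ}
    (hS : ∀ α : ℝ, ‖∑ n ∈ range (N + 1), (g n : ℂ) * ex (n * α)‖ ≤ S) (hP : ∑ n ∈ range (N + 1), g n ^ 2 ≤ P)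
    (c : ∀ k, ZMod k) {f : ℕ → ℕ → ℝ} (hf : ∀ k, ∀ m ∈ Icc 1 N, |f k m| ≤ ell N)
    (hfc : ∀ k, ∀ m : ℕ, (m : ZMod k) ≠ c k → f k m = 0) :
    (∑ k ∈ Icc 1 K, ∑ n ∈ Icc 1 N, |∑ m ∈ Icc 1 N, f k m * g (n - m)|) ^ 2 ≤
      8 * (N : ℝ) ^ 2 * (ell N : ℝ) ^ 3 * (K * P + S * √(16 * N * (ell N : ℝ) ^ 4 * P)) := by
  set ℓ : ℝ := (ell N : ℝ) with hℓ
  have hS0 : 0 ≤ S := (norm_nonneg _).trans (hS 0)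
  obtain ⟨G, hG⟩ : ∃ G : ℕ → ℝ, G = fun h => |∑ n ∈ range (N + 1), g n * g (n + h)| := ⟨_, rfl⟩
  have hG0 : ∀ h, 0 ≤ G h := fun h => by rw [hG]; exact abs_nonneg _
  obtain ⟨A, hA⟩ : ∃ A : ℕ → ℝ, A = fun k => ∑ h ∈ range (N + 1) with k ∣ h, G h := ⟨_, rfl⟩
  have hA0 : ∀ k, 0 ≤ A k := fun k => by rw [hA]; exact sum_nonneg fun h _ => hG0 h
  have h1 : ∀ k ∈ Icc 1 K, (∑ n ∈ Icc 1 N, |∑ m ∈ Icc 1 N, f k m * g (n - m)|) ≤ √(1 / k) * √(4 * ℓ ^ 2 * N ^ 2 * A k) := fun k hk => by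
    rw [mem_Icc] at hk
    rw [← Real.sqrt_mul (by positivity)]
    refine Real.le_sqrt_of_sq_le ?_
    have h2 := sum_conv_sq_le hg hg0 hk.1 (hk.2.trans hKN) (c k) (hf k) (hfc k)
    have h3 := sum_mul_sq_le_sq_mul_sq (Icc 1 N) (fun _ => (1 : ℝ)) (fun n => |∑ m ∈ Icc 1 N, f k m * g (n - m)|)
    simp only [one_mul, one_pow, sum_const, Nat.card_Icc, Nat.add_sub_cancel, nsmul_eq_mul, mul_one, sq_abs] at h3
    refine h3.trans ?_
    have h4 : ∑ n ∈ Icc 1 N, (∑ m ∈ Icc 1 N, f k m * g (n - m)) ^ 2 ≤ 4 * ℓ ^ 2 * (N / k) * A k := by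
      refine le_trans (sum_le_sum_of_subset_of_nonneg (fun n hn => ?_) fun _ _ _ => sq_nonneg _) (h2.trans (le_of_eq ?_))
      · rw [mem_Icc] at hn
        rw [mem_range]
        omega
      · rw [hA, hG]
    refine (mul_le_mul_of_nonneg_left h4 (Nat.cast_nonneg N)).trans (le_of_eq ?_)
    ring
  have h2 : ∑ k ∈ Icc 1 K, A k ≤ K * P + S * √(16 * N * ℓ ^ 4 * P) := by
    rw [hA]
    refine (sum_sum_dvd_le N K G hG0).trans (add_le_add ?_ ?_)
    · refine mul_le_mul_of_nonneg_left ?_ (Nat.cast_nonneg _)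
      rw [hG]
      refine le_trans (le_of_eq ?_) hP
      rw [← abs_of_nonneg (sum_nonneg fun n _ => sq_nonneg (g n) : 0 ≤ ∑ n ∈ range (N + 1), g n ^ 2)]
      exact congrArg _ (sum_congr rfl fun n _ => by rw [add_zero, pow_two])
    · refine abs_le_of_sq_le_sq' ?_ (by positivity) |>.2
      have h3 := sum_mul_sq_le_sq_mul_sq (Icc 1 N) tau G
      have h4 : ∑ n ∈ Icc 1 N, tau n ^ 2 ≤ 16 * N * ℓ ^ 4 := by
        refine (sum_tau_pow_le 2 N).trans ?_
        have h5 := pow_le_pow_left₀ (by linarith [log_natCast_nonneg N]) (one_add_log_le hN le_rfl) 4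
        refine (mul_le_mul_of_nonneg_left h5 (Nat.cast_nonneg N)).trans (le_of_eq ?_)
        ring
      have h6 : ∑ n ∈ Icc 1 N, G n ^ 2 ≤ S ^ 2 * P := by
        have h7 := (sum_autocorrelation_sq_le hg hS).trans (mul_le_mul_of_nonneg_left hP (sq_nonneg S))
        refine le_trans (le_trans (sum_le_sum_of_subset_of_nonneg (t := range (N + 1)) (fun n hn => ?_) fun _ _ _ => sq_nonneg _) (le_of_eq ?_)) h7
        · rw [mem_Icc] at hn
          rw [mem_range]
          omega
        · rw [hG]; exact sum_congr rfl fun h _ => sq_abs _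
      rw [mul_pow, Real.sq_sqrt (mul_nonneg (by positivity) ((sum_nonneg fun _ _ => sq_nonneg _).trans hP))]
      refine (h3.trans (mul_le_mul h4 h6 (sum_nonneg fun _ _ => sq_nonneg _) (by positivity))).trans (le_of_eq ?_)
      ring
  have h3 : (∑ k ∈ Icc 1 K, ∑ n ∈ Icc 1 N, |∑ m ∈ Icc 1 N, f k m * g (n - m)|) ^ 2 ≤
      (∑ k ∈ Icc 1 K, √(1 / (k : ℝ)) ^ 2) * ∑ k ∈ Icc 1 K, √(4 * ℓ ^ 2 * N ^ 2 * A k) ^ 2 :=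
    (pow_le_pow_left₀ (sum_nonneg fun _ _ => sum_nonneg fun _ _ => abs_nonneg _) (sum_le_sum h1) 2).trans
      (sum_mul_sq_le_sq_mul_sq _ _ _)
  have h4 : ∑ k ∈ Icc 1 K, √(1 / (k : ℝ)) ^ 2 ≤ 2 * ℓ := by
    rw [sum_congr rfl fun k _ => Real.sq_sqrt (one_div_nonneg.2 (Nat.cast_nonneg k))]
    exact (sum_inv_le K).trans (one_add_log_le hN hKN)
  have h5 : ∑ k ∈ Icc 1 K, √(4 * ℓ ^ 2 * N ^ 2 * A k) ^ 2 ≤ 4 * ℓ ^ 2 * N ^ 2 * (K * P + S * √(16 * N * ℓ ^ 4 * P)) := by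
    rw [sum_congr rfl fun k _ => Real.sq_sqrt (mul_nonneg (by positivity) (hA0 k)), ← mul_sum]
    exact mul_le_mul_of_nonneg_left h2 (by positivity)
  refine h3.trans ((mul_le_mul h4 h5 (sum_nonneg fun _ _ => sq_nonneg _) (by positivity)).trans (le_of_eq ?_))
  ring

theorem abs_prod_sub_sum_sqfProd_le (g : ℕ → ℝ) {P Q : ℕ} (hP : Squarefree P) (hQ : 0 < Q)
    (hPQ : ∀ r, Squarefree r → r ≤ Q → r ∣ P) :
    |∏ p ∈ P.primeFactors, (1 + g p) - ∑ r ∈ Icc 1 Q, sqfProd g r| ≤ (∏ p ∈ P.primeFactors, (1 + √p * |g p|)) / √Q := by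
  have hQ' : (0 : ℝ) < Q := by exact_mod_cast hQ
  have h1 : ∑ r ∈ Icc 1 Q, sqfProd g r = ∑ r ∈ P.divisors with r ≤ Q, sqfProd g r := by
    symm
    refine sum_subset (fun r hr => ?_) fun r hr hr' => ?_
    · rw [mem_filter] at hr
      exact mem_Icc.2 ⟨Nat.pos_of_mem_divisors hr.1, hr.2⟩
    · rw [sqfProd, if_neg]
      intro hs
      rw [mem_Icc] at hr
      exact hr' (mem_filter.2 ⟨Nat.mem_divisors.2 ⟨hPQ r hs hr.2, hP.ne_zero⟩, hr.2⟩)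
  rw [← sum_divisors_sqfProd g hP, ← sum_divisors_sqfProd (fun p => √p * |g p|) hP, h1,
    ← sum_filter_add_sum_filter_not P.divisors (fun r => r ≤ Q), add_sub_cancel_left, sum_div]
  refine (abs_sum_le_sum_abs _ _).trans (le_trans (sum_le_sum (g := fun r => sqfProd (fun p => √p * |g p|) r / √Q) fun r hr => ?_)
    (sum_le_sum_of_subset_of_nonneg (filter_subset _ _) fun r _ _ => ?_))
  · rw [mem_filter, not_le] at hr
    rw [sqfProd, sqfProd]
    split_ifs with hs
    · rw [prod_mul_distrib, ← Real.sqrt_prod _ (fun p _ => Nat.cast_nonneg p), ← Nat.cast_prod, Nat.prod_primeFactors_of_squarefree hs,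
        abs_prod, mul_div_right_comm]
      refine le_mul_of_one_le_left (prod_nonneg fun _ _ => abs_nonneg _) ?_
      rw [one_le_div (Real.sqrt_pos.2 hQ')]
      exact Real.sqrt_le_sqrt (by exact_mod_cast hr.2.le)
    · simp
  · rw [sqfProd]
    split_ifs
    · exact div_nonneg (prod_nonneg fun p _ => by positivity) (Real.sqrt_nonneg _)
    · simp

/-- The weight of the modulus `d` in the local analysis of `p₁ + p₂ = n`, `p₁ ≡ l (mod k)`. -/
def locW (k : ℕ) (l : ℤ) (n d : ℕ) : ℝ :=
  if ((k.gcd d : ℕ) : ℤ) ∣ n - l ∧ n.Coprime d then d * (k.gcd d).totient / d.totient else 0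

/-- The local factor, minus one, of the singular series. -/
def locG (k : ℕ) (l : ℤ) (n p : ℕ) : ℝ :=
  if p ∣ k then (if (p : ℤ) ∣ n - l then -1 else 1 / (p - 1)) else if p ∣ n then 1 / (p - 1) else -1 / ((p : ℝ) - 1) ^ 2

theorem locW_mul (k : ℕ) (l : ℤ) (n : ℕ) {p m : ℕ} (hp : p.Prime) (hpm : ¬ p ∣ m) :
    locW k l n (p * m) = locW k l n p * locW k l n m := by
  have hc : p.Coprime m := (Nat.Prime.coprime_iff_not_dvd hp).2 hpm
  have hc' : (k.gcd p).Coprime (k.gcd m) := (hc.coprime_dvd_left (Nat.gcd_dvd_right k p)).coprime_dvd_right (Nat.gcd_dvd_right k m)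
  have h1 : (((k.gcd (p * m) : ℕ) : ℤ) ∣ n - l ∧ n.Coprime (p * m)) ↔
      (((k.gcd p : ℕ) : ℤ) ∣ n - l ∧ n.Coprime p) ∧ ((k.gcd m : ℕ) : ℤ) ∣ n - l ∧ n.Coprime m := by
    rw [Nat.Coprime.gcd_mul k hc, Nat.coprime_mul_iff_right, Nat.cast_mul]
    refine ⟨fun h => ⟨⟨(dvd_mul_right _ _).trans h.1, h.2.1⟩, (dvd_mul_left _ _).trans h.1, h.2.2⟩, fun h => ⟨?_, h.1.2, h.2.2⟩⟩
    exact (Nat.isCoprime_iff_coprime.2 hc').mul_dvd h.1.1 h.2.1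
  simp only [locW, ite_zero_mul_ite_zero, h1]
  congr 1
  rw [Nat.Coprime.gcd_mul k hc, Nat.totient_mul hc', Nat.totient_mul hc]
  push_cast
  rw [div_mul_div_comm]
  ring

theorem locG_eq {k : ℕ} {l : ℤ} (hl : Int.gcd k l = 1) (n : ℕ) {p : ℕ} (hp : p.Prime) :
    (1 - locW k l n p) / (p - 1) = locG k l n p := by
  have h1 : (0 : ℝ) < p - 1 := by have : (1 : ℝ) < p := by exact_mod_cast hp.one_lt
                                  linarith
  have hφ : (p.totient : ℝ) = p - 1 := by rw [Nat.totient_prime hp, Nat.cast_sub hp.one_lt.le, Nat.cast_one]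
  have hcop : n.Coprime p ↔ ¬ p ∣ n := by rw [Nat.coprime_comm, Nat.Prime.coprime_iff_not_dvd hp]
  simp only [locG, locW, hcop]
  by_cases hk : p ∣ k
  · rw [Nat.gcd_eq_right hk, if_pos hk]
    by_cases hn : (p : ℤ) ∣ n - l
    · have h2 : ¬ p ∣ n := fun h => by
        have h3 : (p : ℤ) ∣ l := by
          have := dvd_sub (Int.natCast_dvd_natCast.2 h) hn
          rwa [sub_sub_cancel] at this
        have h4 := Int.dvd_coe_gcd (Int.natCast_dvd_natCast.2 hk) h3
        rw [hl] at h4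
        exact hp.one_lt.ne' (by exact_mod_cast Int.eq_one_of_dvd_one (by positivity) h4)
      rw [if_pos hn, if_pos ⟨hn, h2⟩, hφ, mul_div_assoc, div_self h1.ne', div_eq_iff h1.ne']
      ring
    · rw [if_neg hn, if_neg fun h => hn h.1, sub_zero]
  · have h2 : k.gcd p = 1 := by rw [← Nat.coprime_iff_gcd_eq_one, Nat.coprime_comm, Nat.Prime.coprime_iff_not_dvd hp]; exact hk
    rw [h2, if_neg hk, hφ]
    by_cases hn : p ∣ n
    · rw [if_pos hn, if_neg fun h => h.2 hn, sub_zero]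
    · rw [if_neg hn, if_pos ⟨by simp, hn⟩, Nat.totient_one]
      field_simp
      push_cast
      ring

theorem one_add_sqrt_mul_locG_le (k : ℕ) (l : ℤ) (n : ℕ) {p : ℕ} (hp : p.Prime) :
    1 + √p * |locG k l n p| ≤ (if p ∣ Int.gcd k (n - l) then √p else 1) * ((if p ∣ k then 4 else 1) * ((if p ∣ n then 4 else 1) *
      (1 + 4 * (√p / p ^ 2)))) := by
  have h2 : (2 : ℝ) ≤ p := by exact_mod_cast hp.two_le
  have h1 : (0 : ℝ) < p - 1 := by linarith
  have hs : √(p : ℝ) * √p = p := Real.mul_self_sqrt (by linarith)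
  have hs1 : 1 ≤ √(p : ℝ) := Real.one_le_sqrt.2 (by linarith)
  have hs2 : √(p : ℝ) / (p - 1) ≤ 2 := by
    rw [div_le_iff₀ h1]
    nlinarith
  have hs3 : 0 ≤ 4 * (√(p : ℝ) / p ^ 2) := by positivity
  have hg : 1 ≤ (if p ∣ Int.gcd k (n - l) then √(p : ℝ) else 1) := by split_ifs; exacts [hs1, le_rfl]
  have hk4 : (1 : ℝ) ≤ if p ∣ k then 4 else 1 := by split_ifs <;> norm_num
  have hn4 : (1 : ℝ) ≤ if p ∣ n then 4 else 1 := by split_ifs <;> norm_num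
  have key : √(p : ℝ) * |1 / ((p : ℝ) - 1)| ≤ 2 := by rw [abs_of_pos (by positivity), mul_one_div]; exact hs2
  rw [locG]
  by_cases hk : p ∣ k
  · have h3 : 1 ≤ (if p ∣ n then (4 : ℝ) else 1) * (1 + 4 * (√p / p ^ 2)) := by nlinarith
    rw [if_pos hk, if_pos hk]
    by_cases hn : (p : ℤ) ∣ n - l
    · have h4 : p ∣ Int.gcd k (n - l) := by
        rw [← Int.natCast_dvd_natCast]
        exact Int.dvd_coe_gcd (Int.natCast_dvd_natCast.2 hk) hn
      rw [if_pos hn, if_pos h4, abs_neg, abs_one]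
      nlinarith [mul_le_mul_of_nonneg_left h3 (by linarith : (0 : ℝ) ≤ √p)]
    · rw [if_neg hn]
      nlinarith [mul_le_mul hg h3 zero_le_one (by linarith)]
  · rw [if_neg hk, if_neg hk, one_mul]
    by_cases hn : p ∣ n
    · rw [if_pos hn, if_pos hn]
      nlinarith [mul_le_mul hg (by linarith : (1 : ℝ) ≤ 1 + 4 * (√p / p ^ 2)) zero_le_one (by linarith)]
    · rw [if_neg hn, if_neg hn, one_mul]
      refine le_trans ?_ (le_mul_of_one_le_left (by linarith) hg)
      rw [abs_div, abs_neg, abs_one, abs_of_pos (by positivity), mul_one_div, mul_div_assoc', add_le_add_iff_left,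
        div_le_div_iff₀ (by positivity) (by positivity)]
      have : (p : ℝ) ^ 2 ≤ 4 * (p - 1) ^ 2 := by nlinarith
      nlinarith [mul_le_mul_of_nonneg_left this (Real.sqrt_nonneg (p : ℝ))]

theorem prod_ite_dvd_le (P : ℕ) {D : ℕ} (hD : D ≠ 0) {x : ℕ → ℝ} (hx : ∀ p, p.Prime → 1 ≤ x p) :
    ∏ p ∈ P.primeFactors, (if p ∣ D then x p else 1) ≤ ∏ p ∈ D.primeFactors, x p := by
  rw [← prod_filter]
  refine Finset.prod_le_prod_of_subset_of_one_le (fun p hp => ?_) (fun p hp => ?_) fun p hp _ => hx p (Nat.prime_of_mem_primeFactors hp)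
  · rw [mem_filter] at hp
    exact Nat.mem_primeFactors.2 ⟨Nat.prime_of_mem_primeFactors hp.1, hp.2, hD⟩
  · exact zero_le_one.trans (hx p (Nat.prime_of_mem_primeFactors (mem_filter.1 hp).1))

theorem prod_four_le {k : ℕ} (hk : k ≠ 0) : ∏ _p ∈ k.primeFactors, (4 : ℝ) ≤ tau k ^ 2 := by
  have h : (2 : ℝ) ^ #k.primeFactors ≤ tau k := by
    rw [tau, Nat.card_divisors hk, ← prod_const]
    push_cast
    refine prod_le_prod (fun _ _ => zero_le_two) fun p hp => ?_
    have : (1 : ℝ) ≤ k.factorization p := by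
      exact_mod_cast (Nat.prime_of_mem_primeFactors hp).factorization_pos_of_dvd hk (Nat.dvd_of_mem_primeFactors hp)
    linarith
  rw [prod_const, show (4 : ℝ) = 2 ^ 2 by norm_num, ← pow_mul, mul_comm, pow_mul]
  exact pow_le_pow_left₀ (by positivity) h 2

theorem summable_sqrt_div_sq : Summable fun n : ℕ => √(n : ℝ) / (n : ℝ) ^ 2 := by
  refine (Real.summable_one_div_nat_rpow.2 (by norm_num : (1 : ℝ) < 3 / 2)).congr fun n => ?_
  rcases Nat.eq_zero_or_pos n with rfl | h
  · simp
  · have hn : (0 : ℝ) < n := by exact_mod_cast h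
    rw [div_eq_div_iff (by positivity) (by positivity), one_mul, Real.sqrt_eq_rpow, ← Real.rpow_add hn, ← rpow_natCast]
    norm_num

theorem prod_locG_le : ∃ C : ℝ, 0 ≤ C ∧ ∀ (P k : ℕ) (l : ℤ) (n : ℕ), k ≠ 0 → n ≠ 0 →
    ∏ p ∈ P.primeFactors, (1 + √p * |locG k l n p|) ≤ C * (√(Int.gcd k (n - l) : ℕ) * (tau k ^ 2 * tau n ^ 2)) := by
  refine ⟨Real.exp (4 * ∑' n : ℕ, √(n : ℝ) / (n : ℝ) ^ 2), (Real.exp_pos _).le, fun P k l n hk hn => ?_⟩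
  have hD : Int.gcd k (n - l) ≠ 0 := by
    rw [Ne, Int.gcd_eq_zero_iff]
    exact fun h => hk (by exact_mod_cast h.1)
  refine (prod_le_prod (fun p _ => by positivity) fun p hp =>
    one_add_sqrt_mul_locG_le k l n (Nat.prime_of_mem_primeFactors hp)).trans ?_
  rw [prod_mul_distrib, prod_mul_distrib, prod_mul_distrib, mul_comm (Real.exp _), mul_assoc, mul_assoc]
  have h4 : ∀ D, 0 ≤ ∏ p ∈ P.primeFactors, (if p ∣ D then (4 : ℝ) else 1) := fun D => prod_nonneg fun _ _ => by split_ifs <;> norm_num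
  refine mul_le_mul ?_ (mul_le_mul ((prod_ite_dvd_le P hk fun _ _ => by norm_num).trans (prod_four_le hk))
    (mul_le_mul ((prod_ite_dvd_le P hn fun _ _ => by norm_num).trans (prod_four_le hn)) ?_ (prod_nonneg fun _ _ => by positivity)
    (sq_nonneg _)) (mul_nonneg (h4 _) (prod_nonneg fun _ _ => by positivity)) (sq_nonneg _))
    (mul_nonneg (h4 _) (mul_nonneg (h4 _) (prod_nonneg fun _ _ => by positivity))) (Real.sqrt_nonneg _)
  · refine (prod_ite_dvd_le P hD (x := fun p => √(p : ℝ)) fun p hp => Real.one_le_sqrt.2 (by exact_mod_cast hp.one_lt.le)).trans ?_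
    rw [← Real.sqrt_prod _ (fun p _ => Nat.cast_nonneg p), ← Nat.cast_prod]
    exact Real.sqrt_le_sqrt (Nat.cast_le.2 (Nat.le_of_dvd (Nat.pos_of_ne_zero hD) (Nat.prod_primeFactors_dvd _)))
  · refine (prod_le_prod (fun p _ => by positivity) fun p _ => (add_comm _ _).trans_le (Real.add_one_le_exp _)).trans ?_
    rw [← Real.exp_sum, ← mul_sum]
    exact Real.exp_le_exp.2 (mul_le_mul_of_nonneg_left (summable_sqrt_div_sq.sum_le_tsum _ fun _ _ => by positivity) (by norm_num))

/-- The factor at `m` of the twin prime product; it is `1` unless `m` is an odd prime. -/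
def twinFactor (m : ℕ) : ℝ := if m.Prime then (if 2 < m then 1 - 1 / ((m : ℝ) - 1) ^ 2 else 1) else 1

theorem tendsto_prod_twinFactor : Filter.Tendsto (fun Z => 2 * ∏ m ∈ range Z, twinFactor m) Filter.atTop (nhds c0) := by
  have h1 : c0 = 2 * ∏' m : ℕ, twinFactor m := by
    have h := tprod_subtype {p : ℕ | p.Prime} (fun m : ℕ => if 2 < m then 1 - 1 / ((m : ℝ) - 1) ^ 2 else 1)
    have h' : Set.mulIndicator {p : ℕ | p.Prime} (fun m : ℕ => if 2 < m then 1 - 1 / ((m : ℝ) - 1) ^ 2 else 1) = twinFactor := by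
      funext m
      simp only [Set.mulIndicator_apply, Set.mem_ofPred_eq, twinFactor]
    rw [h'] at h
    rw [c0, ← h]
    rfl
  have h2 : Multipliable twinFactor := by
    have h3 : Summable fun m => ‖twinFactor m - 1‖ := by
      refine Summable.of_nonneg_of_le (fun _ => norm_nonneg _) (fun m => ?_) ((Real.summable_one_div_nat_pow.2 (by norm_num : 1 < 2)).mul_left 4)
      rw [twinFactor]
      split_ifs with hp h2
      · have h3 : (2 : ℝ) < m := by exact_mod_cast h2
        rw [sub_sub_cancel_left, norm_neg, norm_of_nonneg (by positivity), mul_one_div, div_le_div_iff₀ (by nlinarith) (by positivity)]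
        nlinarith
      · rw [sub_self, norm_zero]; positivity
      · rw [sub_self, norm_zero]; positivity
    have h4 := multipliable_one_add_of_summable h3
    simpa using h4
  rw [h1]
  exact h2.hasProd.tendsto_prod_nat.const_mul 2

theorem one_add_locG_eq {k : ℕ} {l : ℤ} {n : ℕ} (h : Int.gcd k (n - l) = 1) (hn : 2 ∣ n) {p : ℕ} (hp : p.Prime) :
    1 + locG k l n p = twinFactor p * ((if p = 2 then 2 else 1) *
      (if p ∣ n * k ∧ 2 < p then ((p : ℝ) - 1) / (p - 2) else 1)) := by
  have h0 : p ∣ k → ¬ (p : ℤ) ∣ n - l := fun h1 h2 => by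
    have h4 := Int.dvd_coe_gcd (Int.natCast_dvd_natCast.2 h1) h2
    rw [h] at h4
    exact hp.one_lt.ne' (by exact_mod_cast Int.eq_one_of_dvd_one (by positivity) h4)
  have h1 : locG k l n p = if p ∣ n * k then 1 / ((p : ℝ) - 1) else -1 / ((p : ℝ) - 1) ^ 2 := by
    simp only [locG, hp.dvd_mul]
    by_cases hk : p ∣ k
    · rw [if_pos hk, if_neg (h0 hk), if_pos (Or.inr hk)]
    · rw [if_neg hk]
      simp only [hk, or_false]
  rw [h1, twinFactor, if_pos hp]
  obtain rfl | h2 := hp.two_le.eq_or_lt'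
  · rw [if_pos (hn.mul_right k)]
    norm_num
  · have h3 : (2 : ℝ) < p := by exact_mod_cast h2
    rw [if_pos h2, if_neg h2.ne']
    have h4 : (p : ℝ) - 1 ≠ 0 := by linarith
    have h5 : (p : ℝ) - 2 ≠ 0 := by linarith
    by_cases h6 : p ∣ n * k
    · rw [if_pos h6, if_pos ⟨h6, h2⟩]
      field_simp
      ring
    · rw [if_neg h6, if_neg fun h => h6 h.1]
      ring

theorem tendsto_prod_locG {k : ℕ} {l : ℤ} {n : ℕ} (hk : k ≠ 0) (hn : n ≠ 0) (hl : Int.gcd k l = 1) :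
    Filter.Tendsto (fun Z => ∏ p ∈ range Z with p.Prime, (1 + locG k l n p)) Filter.atTop (nhds (S2 k l n)) := by
  rw [S2]
  by_cases h : Int.gcd (k : ℤ) ((n : ℤ) - l) = 1 ∧ 2 ∣ n
  · rw [if_pos h]
    refine (tendsto_prod_twinFactor.mul_const _).congr' ?_
    filter_upwards [Filter.eventually_gt_atTop (n * k + 2)] with Z hZ
    rw [prod_congr rfl fun p hp => one_add_locG_eq h.1 h.2 (mem_filter.1 hp).2, prod_mul_distrib, prod_mul_distrib,
      prod_ite_eq', if_pos (by simp [Nat.prime_two]; omega), mul_right_comm, mul_comm, mul_comm (2 : ℝ), mul_comm (lam _)]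
    congr 1
    · rw [prod_filter]
      exact prod_congr rfl fun m _ => by rw [twinFactor]; split_ifs <;> rfl
    · congr 1
      rw [lam, ← prod_filter]
      refine prod_congr ?_ fun _ _ => rfl
      ext p
      simp only [mem_filter, Nat.mem_primeFactors, mem_range]
      constructor
      · rintro ⟨⟨h1, h2, h3⟩, h4⟩
        exact ⟨⟨by have := Nat.le_of_dvd (Nat.pos_of_ne_zero h3) h2; omega, h1⟩, h2, h4⟩
      · rintro ⟨⟨h1, h2⟩, h3, h4⟩
        exact ⟨⟨h2, h3, mul_ne_zero hn hk⟩, h4⟩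
  · rw [if_neg h]
    obtain ⟨p, hp, h0⟩ : ∃ p, p.Prime ∧ 1 + locG k l n p = 0 := by
      by_cases h1 : Int.gcd (k : ℤ) ((n : ℤ) - l) = 1
      · refine ⟨2, Nat.prime_two, ?_⟩
        have h2 : ¬ 2 ∣ n := fun h' => h ⟨h1, h'⟩
        have h3 : ¬ 2 ∣ k := fun h' => by
          have h4 : ¬ (2 : ℤ) ∣ l := fun h4 => by
            have := Int.dvd_coe_gcd (Int.natCast_dvd_natCast.2 h') h4
            rw [hl] at this
            omega
          have h5 : (2 : ℤ) ∣ n - l := by omega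
          have := Int.dvd_coe_gcd (Int.natCast_dvd_natCast.2 h') h5
          rw [h1] at this
          omega
        rw [locG, if_neg h3, if_neg h2]
        norm_num
      · obtain ⟨p, hp, hd⟩ := Nat.exists_prime_and_dvd h1
        have h2 : (p : ℤ) ∣ (Int.gcd k (n - l) : ℕ) := Int.natCast_dvd_natCast.2 hd
        refine ⟨p, hp, ?_⟩
        rw [locG, if_pos (Int.natCast_dvd_natCast.1 (h2.trans (Int.gcd_dvd_left ..))), if_pos (h2.trans (Int.gcd_dvd_right ..))]
        norm_num
    refine tendsto_const_nhds.congr' ?_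
    filter_upwards [Filter.eventually_gt_atTop p] with Z hZ
    exact (prod_eq_zero (mem_filter.2 ⟨mem_range.2 hZ, hp⟩) h0).symm

theorem abs_S2_sub_le : ∃ C : ℝ, 0 ≤ C ∧ ∀ (k : ℕ) (l : ℤ) (n Q : ℕ), k ≠ 0 → n ≠ 0 → Int.gcd k l = 1 → 0 < Q →
    |S2 k l n - ∑ r ∈ Icc 1 Q, sqfProd (locG k l n) r| ≤ C * (√(Int.gcd k (n - l) : ℕ) * (tau k ^ 2 * tau n ^ 2)) / √Q := by
  obtain ⟨C, hC, h⟩ := prod_locG_le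
  refine ⟨C, hC, fun k l n Q hk hn hl hQ => ?_⟩
  refine le_of_tendsto ((tendsto_prod_locG hk hn hl).sub_const _).abs ?_
  filter_upwards [Filter.eventually_gt_atTop Q] with Z hZ
  have h1 : ∀ p ∈ (range Z).filter Nat.Prime, p.Prime := fun p hp => (mem_filter.1 hp).2
  have h2 := Nat.primeFactors_prod h1
  have h3 : Squarefree (∏ p ∈ range Z with p.Prime, p) :=
    Finset.squarefree_prod_of_pairwise_isCoprime (fun p hp q hq hpq =>
      Nat.coprime_iff_isRelPrime.1 ((Nat.coprime_primes (h1 p hp) (h1 q hq)).2 hpq)) fun p hp => (h1 p hp).prime.squarefree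
  have h4 := abs_prod_sub_sum_sqfProd_le (locG k l n) h3 hQ fun r hr hrQ => by
    rw [← Nat.prod_primeFactors_of_squarefree hr]
    refine prod_dvd_prod_of_subset _ _ _ fun p hp => mem_filter.2 ⟨mem_range.2 ?_, Nat.prime_of_mem_primeFactors hp⟩
    exact ((Nat.le_of_mem_primeFactors hp).trans hrQ).trans_lt hZ
  have h5 := h (∏ p ∈ range Z with p.Prime, p) k l n hk hn
  rw [h2] at h4 h5
  exact h4.trans (by gcongr)

/-- The indicator of `m ≡ l (mod k)`, `a ≤ m ≤ b`, weighted by `log m` on the primes. -/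
def progWt (k : ℕ) (l : ℤ) (a b m : ℕ) : ℝ := if (m : ZMod k) = (l : ZMod k) ∧ a ≤ m ∧ m ≤ b then vth m else 0

theorem natCast_eq_intCast_iff_dvd_sub (k m : ℕ) (l : ℤ) : (m : ZMod k) = (l : ZMod k) ↔ (k : ℤ) ∣ m - l := by
  rw [← Int.cast_natCast, ZMod.intCast_eq_intCast_iff_dvd_sub, ← dvd_neg, neg_sub]

theorem Phi2_eq {n a b : ℕ} (ha : 1 ≤ a) : Phi2 n a b = (Icc a (min b (n - 1))).card := by
  rw [Phi2]
  refine card_bij' (fun q _ => q.1) (fun m _ => (m, n - m)) ?_ ?_ ?_ ?_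
  · rintro ⟨x, y⟩ h
    simp only [mem_filter, mem_product, mem_Icc] at h ⊢
    omega
  · intro m h
    simp only [mem_filter, mem_product, mem_Icc] at h ⊢
    omega
  · rintro ⟨x, y⟩ h
    simp only [mem_filter, mem_product, mem_Icc] at h
    simp only [Prod.mk.injEq, true_and]
    omega
  · intros; rfl

theorem sum_thetaAP_sub {h : ℕ} (c : ZMod h) {a b : ℕ} (ha : 1 ≤ a) (hab : a ≤ b) :
    ∑ m ∈ Icc a b, (if (m : ZMod h) = c then vth m else 0) = thetaAP h c b - thetaAP h c (a - 1) := by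
  rw [thetaAP, thetaAP, eq_sub_iff_add_eq]
  have h1 : Icc 1 b = Icc a b ∪ Icc 1 (a - 1) := by ext; simp only [mem_union, mem_Icc]; omega
  rw [h1, sum_union (disjoint_left.2 fun x hx hx' => by simp only [mem_Icc] at hx hx'; omega)]

theorem abs_sum_progWt_dvd_sub_le {N : ℕ} {E : ℕ → ℝ} (hE0 : ∀ k, 0 ≤ E k)
    (hE : ∀ k : ℕ, 1 ≤ k → ∀ c : ZMod k, ∀ y ≤ N, |thetaAP k c y - (open Classical in if IsUnit c then (y : ℝ) / k.totient else 0)| ≤ E k)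
    {k : ℕ} (hk : 1 ≤ k) {l : ℤ} (hl : Int.gcd k l = 1) {n a : ℕ} (b : ℕ) (hn : n ≤ N) (ha : 1 ≤ a) {d : ℕ} (hd : 1 ≤ d) :
    |(∑ m ∈ Ico 1 n, if d ∣ n - m then progWt k l a b m else 0) - (Phi2 n a b : ℝ) / k.totient * (locW k l n d / d)| ≤ 2 * E (k.lcm d) := by
  classical
  have : NeZero k := ⟨by omega⟩
  have hE2 : 0 ≤ 2 * E (k.lcm d) := by have := hE0 (k.lcm d); positivity
  have hh : 1 ≤ k.lcm d := Nat.lcm_pos hk hd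
  have hcast := fun m => natCast_eq_intCast_iff_dvd_sub k m l
  have hs : (∑ m ∈ Ico 1 n, if d ∣ n - m then progWt k l a b m else 0) =
      ∑ m ∈ Icc a (min b (n - 1)), if (m : ZMod k) = (l : ZMod k) ∧ m ≡ n [MOD d] then vth m else 0 := by
    have h1 : ∀ m ∈ Ico 1 n, (if d ∣ n - m then progWt k l a b m else 0) =
        if m ∈ Icc a (min b (n - 1)) then (if (m : ZMod k) = (l : ZMod k) ∧ m ≡ n [MOD d] then vth m else 0) else 0 := fun m hm => by
      rw [mem_Ico] at hm
      have h2 : m ∈ Icc a (min b (n - 1)) ↔ a ≤ m ∧ m ≤ b := by rw [mem_Icc]; omega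
      have h3 : d ∣ n - m ↔ m ≡ n [MOD d] := (Nat.modEq_iff_dvd' hm.2.le).symm
      rw [progWt]
      simp only [h2, h3]
      by_cases h4 : m ≡ n [MOD d] <;> by_cases h5 : (m : ZMod k) = (l : ZMod k) <;> simp [h4, h5]
    rw [sum_congr rfl h1, ← sum_filter]
    refine sum_congr ?_ fun _ _ => rfl
    ext m
    simp only [mem_filter, mem_Ico, mem_Icc]
    omega
  rw [hs, Phi2_eq ha]
  rcases lt_or_ge (min b (n - 1)) a with hab | hab
  · rw [Icc_eq_empty (by omega)]
    simpa using hE0 _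
  by_cases hg : ((k.gcd d : ℕ) : ℤ) ∣ n - l
  swap
  · rw [locW, if_neg fun h => hg h.1, sum_eq_zero]
    · simpa using hE0 _
    · intro m _
      rw [if_neg]
      rintro ⟨h1, h2⟩
      refine hg ?_
      have h3 := (Int.natCast_dvd_natCast.2 (Nat.gcd_dvd_left k d)).trans ((hcast m).1 h1)
      have h4 := (Int.natCast_dvd_natCast.2 (Nat.gcd_dvd_right k d)).trans (Nat.modEq_iff_dvd.1 h2)
      simpa using dvd_add h4 h3
  obtain ⟨c, hc⟩ : ∃ c : ℕ, (c : ZMod k) = (l : ZMod k) := ⟨(l : ZMod k).val, ZMod.natCast_zmod_val _⟩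
  have hck := (hcast c).1 hc
  obtain ⟨x, hx⟩ := exists_crt (q := k) (d := d) (c := c) (b := n) (by
    rw [Nat.modEq_iff_dvd]
    have := dvd_sub hg ((Int.natCast_dvd_natCast.2 (Nat.gcd_dvd_left k d)).trans hck)
    simpa using this)
  have hx1 := (hx x).2 rfl
  have hiff : ∀ m : ℕ, ((m : ZMod k) = (l : ZMod k) ∧ m ≡ n [MOD d]) ↔ (m : ZMod (k.lcm d)) = (x : ZMod (k.lcm d)) := fun m => by
    rw [ZMod.natCast_eq_natCast_iff, ← hx, ← hc, ZMod.natCast_eq_natCast_iff]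
  have hu : IsUnit (x : ZMod (k.lcm d)) ↔ n.Coprime d := by
    have h1 : x.Coprime k := by
      have h2 : (k : ℤ) ∣ x - l := (hcast x).1 (by rw [← hc, ZMod.natCast_eq_natCast_iff]; exact hx1.1)
      rw [Nat.coprime_iff_gcd_eq_one, Nat.gcd_comm, ← hl]
      have h3 : (x : ℤ) = l + (x - l) := by ring
      rw [← Int.gcd_natCast_natCast, h3]
      obtain ⟨t, ht⟩ := h2
      rw [ht, Int.gcd_add_mul_left_right]
    have h2 : x.Coprime d ↔ n.Coprime d := by
      rw [Nat.coprime_iff_gcd_eq_one, Nat.coprime_iff_gcd_eq_one, hx1.2.gcd_eq]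
    rw [ZMod.isUnit_iff_coprime, ← h2]
    constructor
    · exact fun h => h.coprime_dvd_right (Nat.dvd_lcm_right k d)
    · exact fun h => (h1.mul_right h).coprime_dvd_right (Nat.lcm_dvd_mul k d)
  simp only [hiff]
  rw [sum_thetaAP_sub _ ha hab, Nat.card_Icc]
  have hb1 := hE _ hh (x : ZMod (k.lcm d)) (min b (n - 1)) (by omega)
  have ha1 := hE _ hh (x : ZMod (k.lcm d)) (a - 1) (by omega)
  have hmain : ((min b (n - 1) + 1 - a : ℕ) : ℝ) / k.totient * (locW k l n d / d) =
      (if IsUnit (x : ZMod (k.lcm d)) then ((min b (n - 1) : ℕ) : ℝ) / (k.lcm d).totient else 0) -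
      (if IsUnit (x : ZMod (k.lcm d)) then ((a - 1 : ℕ) : ℝ) / (k.lcm d).totient else 0) := by
    rw [locW]
    by_cases hnd : n.Coprime d
    · rw [if_pos ⟨hg, hnd⟩, if_pos (hu.2 hnd), if_pos (hu.2 hnd)]
      have h1 : (k.lcm d).totient * (k.gcd d).totient = k.totient * d.totient := by
        have := Nat.totient_gcd_mul_totient_mul k d
        have h2 := Nat.totient_gcd_mul_totient_mul (k.gcd d) (k.lcm d)
        rw [Nat.gcd_eq_left ((Nat.gcd_dvd_left k d).trans (Nat.dvd_lcm_left k d)), Nat.gcd_mul_lcm] at h2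
        have h3 : 0 < k.gcd d := Nat.gcd_pos_of_pos_left d hk
        have h4 : k.gcd d * ((k.lcm d).totient * (k.gcd d).totient) = k.gcd d * (k.totient * d.totient) := by
          rw [mul_comm (k.lcm d).totient, mul_comm (k.gcd d), ← h2, this]; ring
        exact Nat.eq_of_mul_eq_mul_left h3 h4
      have h1' : ((k.lcm d).totient : ℝ) * (k.gcd d).totient = k.totient * d.totient := by exact_mod_cast h1
      have p1 : (k.totient : ℝ) ≠ 0 := Nat.cast_ne_zero.2 (Nat.totient_pos.2 hk).ne'
      have p2 : (d.totient : ℝ) ≠ 0 := Nat.cast_ne_zero.2 (Nat.totient_pos.2 hd).ne'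
      have p3 : ((k.lcm d).totient : ℝ) ≠ 0 := Nat.cast_ne_zero.2 (Nat.totient_pos.2 hh).ne'
      have p4 : (d : ℝ) ≠ 0 := Nat.cast_ne_zero.2 (by omega)
      have h5 : ((min b (n - 1) + 1 - a : ℕ) : ℝ) = ((min b (n - 1) : ℕ) : ℝ) - ((a - 1 : ℕ) : ℝ) := by
        rw [eq_sub_iff_add_eq]; norm_cast; omega
      rw [← sub_div, ← h5]
      generalize ((min b (n - 1) + 1 - a : ℕ) : ℝ) = t
      field_simp
      linear_combination t * h1'
    · rw [if_neg fun h => hnd h.2, if_neg fun h => hnd (hu.1 h), if_neg fun h => hnd (hu.1 h)]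
      simp
  rw [hmain, abs_le]
  rw [abs_le] at hb1 ha1
  constructor <;> linarith [hb1.1, hb1.2, ha1.1, ha1.2]

theorem abs_sum_progWt_mul_LamQ_sub_le {N : ℕ} {E : ℕ → ℝ} (hN : 3 ≤ N) (hE0 : ∀ k, 0 ≤ E k)
    (hE : ∀ k : ℕ, 1 ≤ k → ∀ c : ZMod k, ∀ y ≤ N, |thetaAP k c y - (open Classical in if IsUnit c then (y : ℝ) / k.totient else 0)| ≤ E k)
    {k : ℕ} (hk : 1 ≤ k) {l : ℤ} (hl : Int.gcd k l = 1) {n a : ℕ} (b : ℕ) (hn : n ≤ N) (ha : 1 ≤ a) {Q : ℕ} (hQ : Q ≤ N) :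
    |∑ m ∈ Ico 1 n, progWt k l a b m * LamQ Q (n - m) - (Phi2 n a b : ℝ) / k.totient * ∑ r ∈ Icc 1 Q, sqfProd (locG k l n) r| ≤
      8 * (ell N : ℝ) ^ 2 * Q * ∑ d ∈ Icc 1 Q, E (k.lcm d) := by
  have h1 : ∑ m ∈ Ico 1 n, progWt k l a b m * LamQ Q (n - m) =
      ∑ d ∈ Icc 1 Q, lamQ Q d * ∑ m ∈ Ico 1 n, if d ∣ n - m then progWt k l a b m else 0 := by
    simp_rw [LamQ, sum_filter, mul_sum]
    rw [sum_comm]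
    refine sum_congr rfl fun d _ => sum_congr rfl fun m _ => ?_
    split_ifs <;> ring
  have h2 : ∑ r ∈ Icc 1 Q, sqfProd (locG k l n) r = ∑ d ∈ Icc 1 Q, lamQ Q d * (locW k l n d / d) := by
    rw [sum_lamQ_mul (by simp [locW]) (fun p m hp hpm => locW_mul k l n hp hpm)]
    refine sum_congr rfl fun r _ => ?_
    rw [sqfProd, sqfProd]
    split_ifs
    · exact prod_congr rfl fun p hp => (locG_eq hl n (Nat.prime_of_mem_primeFactors hp)).symm
    · rfl
  rw [h1, h2, mul_sum, ← sum_sub_distrib, mul_sum]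
  refine (abs_sum_le_sum_abs _ _).trans (sum_le_sum fun d hd => ?_)
  rw [mem_Icc] at hd
  have h3 := abs_sum_progWt_dvd_sub_le hE0 hE hk hl b hn ha hd.1
  have h4 := abs_lamQ_le hN hQ hd.1
  have h5 : tau d ≤ Q := (tau_le d).trans (by exact_mod_cast hd.2)
  rw [mul_left_comm, ← mul_sub, abs_mul]
  calc _ ≤ 4 * (ell N : ℝ) ^ 2 * Q * (2 * E (k.lcm d)) := by
        refine mul_le_mul (h4.trans ?_) h3 (abs_nonneg _) (by positivity)
        gcongr
    _ = _ := by ring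

theorem sum_sum_lcm_le {E : ℕ → ℝ} (hE : ∀ k, 0 ≤ E k) (K Q : ℕ) :
    ∑ k ∈ Icc 1 K, ∑ d ∈ Icc 1 Q, E (k.lcm d) ≤ (Q : ℝ) ^ 2 * ∑ h ∈ Icc 1 (K * Q), E h := by
  rw [sum_comm]
  have h1 : ∀ d ∈ Icc 1 Q, ∑ k ∈ Icc 1 K, E (k.lcm d) ≤ Q * ∑ h ∈ Icc 1 (K * Q), E h := fun d hd => by
    rw [mem_Icc] at hd
    have hinj : Set.InjOn (fun k : ℕ => (k.lcm d, k.gcd d)) (Icc 1 K : Finset ℕ) := fun k _ k' _ h => by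
      rw [Prod.mk.injEq] at h
      have := Nat.gcd_mul_lcm k d
      rw [h.1, h.2, Nat.gcd_mul_lcm] at this
      exact (Nat.eq_of_mul_eq_mul_right hd.1 this).symm
    calc _ = ∑ x ∈ (Icc 1 K).image (fun k : ℕ => (k.lcm d, k.gcd d)), E x.1 := (sum_image hinj).symm
      _ ≤ ∑ x ∈ Icc 1 (K * Q) ×ˢ Icc 1 Q, E x.1 := by
          refine sum_le_sum_of_subset_of_nonneg (fun x hx => ?_) fun _ _ _ => hE _
          obtain ⟨k, hk, rfl⟩ := mem_image.1 hx
          rw [mem_Icc] at hk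
          rw [mem_product, mem_Icc, mem_Icc]
          exact ⟨⟨Nat.lcm_pos hk.1 hd.1, (Nat.le_of_dvd (Nat.mul_pos hk.1 hd.1) (Nat.lcm_dvd_mul k d)).trans (Nat.mul_le_mul hk.2 hd.2)⟩,
            Nat.gcd_pos_of_pos_left d hk.1, (Nat.le_of_dvd hd.1 (Nat.gcd_dvd_right k d)).trans hd.2⟩
      _ = _ := by rw [sum_product]; simp [mul_sum]
  refine (sum_le_sum h1).trans (le_of_eq ?_)
  rw [sum_const, Nat.card_Icc, nsmul_eq_mul, Nat.add_sub_cancel]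
  ring

theorem I2_eq (k : ℕ) (l : ℤ) (n a b : ℕ) : I2 k l n a b = ∑ m ∈ Ico 1 n, progWt k l a b m * vth (n - m) := by
  have h1 : ∀ p ∈ range (n + 1), (∑ p2 ∈ range (n + 1),
      if p.Prime ∧ p2.Prime ∧ p + p2 = n ∧ (k : ℤ) ∣ (p : ℤ) - l ∧ a ≤ p ∧ p ≤ b then log p * log p2 else 0) =
      progWt k l a b p * vth (n - p) := fun p hp => by
    rw [mem_range] at hp
    rw [sum_eq_single (n - p) (fun q _ hq => if_neg fun h => hq (by omega)) (fun h => absurd (mem_range.2 (by omega)) h),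
      progWt, vth, vth]
    have h3 : p + (n - p) = n := by omega
    simp only [natCast_eq_intCast_iff_dvd_sub, h3, true_and]
    by_cases h4 : p.Prime <;> by_cases h5 : (n - p).Prime <;> simp [h4, h5]
  rw [I2, sum_congr rfl h1]
  symm
  refine sum_subset (fun m hm => ?_) fun m hm hm' => ?_
  · rw [mem_Ico] at hm
    exact mem_range.2 (by omega)
  · have h2 : m = 0 ∨ n - m = 0 := by simp only [mem_range, mem_Ico] at hm hm'; omega
    rcases h2 with rfl | h2
    · simp [progWt, vth]
    · rw [h2]
      simp [vth]

theorem abs_LamQ_le {N Q n : ℕ} (hN : 3 ≤ N) (hQ : Q ≤ N) (hn : 0 < n) : |LamQ Q n| ≤ 4 * (ell N : ℝ) ^ 2 * tau n ^ 2 := by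
  have h1 : ∀ d ∈ (Icc 1 Q).filter (· ∣ n), |lamQ Q d| ≤ 4 * (ell N : ℝ) ^ 2 * tau n := fun d hd => by
    rw [mem_filter, mem_Icc] at hd
    refine (abs_lamQ_le hN hQ hd.1.1).trans (mul_le_mul_of_nonneg_left ?_ (by positivity))
    exact Nat.cast_le.2 (card_le_card (Nat.divisors_subset_of_dvd hn.ne' hd.2))
  have h2 : (#((Icc 1 Q).filter (· ∣ n)) : ℝ) ≤ tau n :=
    Nat.cast_le.2 (card_le_card fun d hd => Nat.mem_divisors.2 ⟨(mem_filter.1 hd).2, hn.ne'⟩)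
  have h3 := tau_nonneg n
  calc _ ≤ _ := (abs_sum_le_sum_abs _ _).trans (sum_le_card_nsmul _ _ _ h1)
    _ ≤ tau n * (4 * (ell N : ℝ) ^ 2 * tau n) := by rw [nsmul_eq_mul]; gcongr
    _ = _ := by ring

theorem sum_gcd_le {N k : ℕ} (hk : 0 < k) (hkN : k ≤ N) (l : ℤ) :
    ∑ n ∈ Icc 1 N, ((Int.gcd k (n - l) : ℕ) : ℝ) ≤ 2 * N * tau k := by
  have h1 : ∀ n ∈ Icc 1 N, ((Int.gcd k (n - l) : ℕ) : ℝ) ≤ ∑ d ∈ k.divisors, if ((n : ℕ) : ZMod d) = (l : ZMod d) then (d : ℝ) else 0 := fun n _ => by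
    have h2 : Int.gcd k (n - l) ∈ k.divisors := Nat.mem_divisors.2 ⟨Int.natCast_dvd_natCast.1 (Int.gcd_dvd_left ..), hk.ne'⟩
    refine le_trans (le_of_eq ?_) (single_le_sum (fun d _ => by split_ifs <;> positivity) h2)
    rw [if_pos ((natCast_eq_intCast_iff_dvd_sub _ _ _).2 (Int.gcd_dvd_right ..))]
  refine (sum_le_sum h1).trans ?_
  rw [sum_comm]
  refine (sum_le_card_nsmul _ _ (2 * N : ℝ) fun d hd => ?_).trans (le_of_eq ?_)
  · have hd0 := Nat.pos_of_mem_divisors hd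
    have h3 := card_residue_le hd0 ((Nat.divisor_le hd).trans hkN) (l : ZMod d)
    have hd1 : (0 : ℝ) < d := by exact_mod_cast hd0
    rw [le_div_iff₀ hd1] at h3
    rw [← sum_filter, sum_const, nsmul_eq_mul]
    exact h3
  · rw [nsmul_eq_mul, tau]
    ring

theorem sum_tau_pow_four_le {N : ℕ} (hN : 3 ≤ N) : ∑ n ∈ Icc 1 N, tau n ^ 4 ≤ N * (2 * (ell N : ℝ)) ^ 16 :=
  (sum_tau_pow_le 4 N).trans (by
    have := one_add_log_le hN le_rfl
    have := log_natCast_nonneg N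
    norm_num only
    gcongr)

theorem sum_singular_tail_le {C : ℝ} (hC : 0 ≤ C) {N K Q A : ℕ} (hN : 3 ≤ N) (hK : K ≤ N) {l : ℕ → ℤ} {a b : ℕ → ℕ} (ha : ∀ k, 1 ≤ a k)
    (hQ : (ell N : ℝ) ^ (32 + A) ≤ √Q)
    (h : ∀ k n : ℕ, k ≠ 0 → n ≠ 0 → |S2 k (l k) n - ∑ r ∈ Icc 1 Q, sqfProd (locG k (l k) n) r| ≤
      C * (√(Int.gcd k (n - l k) : ℕ) * (tau k ^ 2 * tau n ^ 2)) / √Q) :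
    ∑ k ∈ Icc 1 K, ∑ n ∈ Icc 1 N, (Phi2 n (a k) (b k) : ℝ) / k.totient * |S2 k (l k) n - ∑ r ∈ Icc 1 Q, sqfProd (locG k (l k) n) r| ≤
      3 * 2 ^ 32 * C * N ^ 2 / (ell N : ℝ) ^ A := by
  have hℓ : (2 : ℝ) ≤ ell N := by exact_mod_cast two_le_ell hN
  have hs : 0 < √(Q : ℝ) := lt_of_lt_of_le (by positivity) hQ
  have h1 : ∀ k ∈ Icc 1 K, ∑ n ∈ Icc 1 N, (Phi2 n (a k) (b k) : ℝ) / k.totient * |S2 k (l k) n - ∑ r ∈ Icc 1 Q, sqfProd (locG k (l k) n) r| ≤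
      3 * C * N ^ 2 * (2 * (ell N : ℝ)) ^ 16 / √Q * (tau k ^ 4 / k) := fun k hk => by
    rw [mem_Icc] at hk
    have hk0 : (0 : ℝ) < k := by exact_mod_cast hk.1
    have ht := one_le_tau (n := k) (by omega)
    have h2 : ∀ n ∈ Icc 1 N, (Phi2 n (a k) (b k) : ℝ) / k.totient * |S2 k (l k) n - ∑ r ∈ Icc 1 Q, sqfProd (locG k (l k) n) r| ≤
        C * N * tau k ^ 3 / k / √Q * (((Int.gcd k (n - l k) : ℕ) : ℝ) + tau n ^ 4) := fun n hn => by
      rw [mem_Icc] at hn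
      have h3 : (Phi2 n (a k) (b k) : ℝ) ≤ N := by
        rw [Phi2_eq (ha k), Nat.card_Icc]
        exact_mod_cast (by have := ha k; omega : min (b k) (n - 1) + 1 - a k ≤ N)
      have h4 : (Phi2 n (a k) (b k) : ℝ) / k.totient ≤ N * (tau k / k) := by
        rw [← mul_one_div]
        exact mul_le_mul h3 (inv_totient_le hk.1) (by positivity) (by positivity)
      have h5 : √((Int.gcd k (n - l k) : ℕ) : ℝ) * tau n ^ 2 ≤ ((Int.gcd k (n - l k) : ℕ) : ℝ) + tau n ^ 4 := by
        have := Real.sq_sqrt (Nat.cast_nonneg (α := ℝ) (Int.gcd k (n - l k)))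
        nlinarith [sq_nonneg (√((Int.gcd k (n - l k) : ℕ) : ℝ) - tau n ^ 2), Real.sqrt_nonneg ((Int.gcd k (n - l k) : ℕ) : ℝ), sq_nonneg (tau n ^ 2)]
      refine (mul_le_mul h4 (h k n (by omega) (by omega)) (abs_nonneg _) (by positivity)).trans ?_
      calc _ = C * N * tau k ^ 3 / k / √Q * (√((Int.gcd k (n - l k) : ℕ) : ℝ) * tau n ^ 2) := by ring
        _ ≤ _ := by gcongr
    refine (sum_le_sum h2).trans ?_
    rw [← mul_sum, sum_add_distrib]
    have h3 := sum_gcd_le hk.1 (hk.2.trans hK) (l k)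
    have h4 : ∑ n ∈ Icc 1 N, tau n ^ 4 ≤ N * (2 * (ell N : ℝ)) ^ 16 := sum_tau_pow_four_le hN
    have h5 : (1 : ℝ) ≤ (2 * (ell N : ℝ)) ^ 16 := one_le_pow₀ (by linarith)
    have h6 : ∑ n ∈ Icc 1 N, ((Int.gcd k (n - l k) : ℕ) : ℝ) + ∑ n ∈ Icc 1 N, tau n ^ 4 ≤ 3 * N * (2 * (ell N : ℝ)) ^ 16 * tau k := by
      generalize (2 * (ell N : ℝ)) ^ 16 = t at *
      have h7 : (N : ℝ) * tau k ≤ N * tau k * t := le_mul_of_one_le_right (by positivity) h5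
      have h8 : (N : ℝ) * t ≤ N * t * tau k := le_mul_of_one_le_right (by positivity) ht
      linarith
    refine (mul_le_mul_of_nonneg_left h6 (by positivity)).trans (le_of_eq (by ring))
  refine (sum_le_sum h1).trans ?_
  rw [← mul_sum]
  have h2 : ∑ k ∈ Icc 1 K, tau k ^ 4 / k ≤ (2 * (ell N : ℝ)) ^ 16 := (sum_tau_pow_div_le 4 K).trans (by
    have := one_add_log_le hN hK
    have := log_natCast_nonneg K
    norm_num only
    gcongr)
  calc _ ≤ 3 * C * N ^ 2 * (2 * (ell N : ℝ)) ^ 16 / (ell N : ℝ) ^ (32 + A) * (2 * (ell N : ℝ)) ^ 16 := by gcongr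
    _ = _ := by rw [pow_add]; field_simp

theorem sum_abs_Delta2_le (A : ℕ) : ∃ B : ℕ, ∃ C : ℝ, 0 ≤ C ∧ ∀ N K : ℕ, 3 ≤ N → K ^ 2 * ell N ^ B ≤ N →
    ∀ l : ℕ → ℤ, ∀ a b : ℕ → ℕ, (∀ k : ℕ, Int.gcd k (l k) = 1) → (∀ k, 1 ≤ a k) →
      ∑ k ∈ Icc 1 K, ∑ n ∈ Icc 1 N, |Delta2 k (l k) n (a k) (b k)| ≤ C * N ^ 2 / (ell N : ℝ) ^ A := by
  obtain ⟨e, he, M, C1, hC1, hS⟩ := expsum_bound (15 + 2 * A) (2 * (32 + A))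
  obtain ⟨B, C2, hC2, hBV⟩ := bombieri_vinogradov (2 + 3 * e + A)
  obtain ⟨C3, hC3, hT⟩ := abs_S2_sub_le
  refine ⟨2 * (e + B + (23 + 2 * A)) + M, (1 + 8 * (25 * 2 ^ 16 + 5120 * C1)) + 8 * C2 + 3 * 2 ^ 32 * C3, by positivity,
    fun N K hN hK l a b hl ha => ?_⟩
  obtain ⟨E, hE0, hE, hEs⟩ := hBV N hN
  have hℓn := two_le_ell hN
  have hℓ : (2 : ℝ) ≤ ell N := by exact_mod_cast hℓn
  rcases Nat.eq_zero_or_pos K with rfl | hK0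
  · simp only [Icc_eq_empty_of_lt Nat.zero_lt_one, sum_empty]
    positivity
  have hmono : ∀ x i : ℕ, i ≤ 2 * (e + B + (23 + 2 * A)) + M → x ≤ K ^ 2 → x * ell N ^ i ≤ N := fun x i hi hx =>
    (Nat.mul_le_mul hx (Nat.pow_le_pow_right (by omega) hi)).trans hK
  have hK1 : 1 ≤ K ^ 2 := Nat.one_le_pow _ _ hK0
  have hQN : ell N ^ e ≤ N := by simpa using hmono 1 e (by omega) hK1
  have hKℓ : K * ell N ^ (23 + 2 * A) ≤ N := hmono K _ (by omega) (Nat.le_self_pow two_ne_zero K)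
  have hKN : K ≤ N := by simpa using hmono K 0 (by omega) (Nat.le_self_pow two_ne_zero K)
  have hsum := hEs (K * ell N ^ e) (by
    rw [mul_pow, ← pow_mul, mul_assoc, ← pow_add]
    exact hmono _ _ (by omega) le_rfl)
  obtain ⟨Q, hQ⟩ : ∃ Q, Q = ell N ^ e := ⟨_, rfl⟩
  have hS' := hS N hN (by simpa using hmono 1 M (by omega) hK1)
  rw [← hQ] at hQN hsum hS'
  have hQ0 : 0 < Q := by rw [hQ]; positivity
  obtain ⟨g, hg⟩ : ∃ g : ℕ → ℝ, g = fun n => if n ∈ Icc 1 N then vth n - LamQ Q n else 0 := ⟨_, rfl⟩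
  have hlog : ∀ n ∈ Icc 1 N, vth n ≤ ell N := fun n hn => by
    rw [mem_Icc] at hn
    exact (vth_le_log n).trans ((log_le_log (by exact_mod_cast hn.1) (by exact_mod_cast hn.2)).trans (log_le_ell N))
  have hrange : ∀ {F : ℕ → ℂ}, ∑ n ∈ range (N + 1), (g n : ℂ) * F n = ∑ n ∈ Icc 1 N, ((vth n - LamQ Q n : ℝ) : ℂ) * F n := fun {F} => by
    symm
    refine (sum_congr rfl fun n hn => by rw [hg]; simp only [if_pos hn]).trans
      (sum_subset (fun n hn => mem_range.2 (by rw [mem_Icc] at hn; omega)) fun n _ hn => by rw [hg]; simp only [if_neg hn]; simp)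
  have hP : ∑ n ∈ range (N + 1), g n ^ 2 ≤ 25 * 2 ^ 16 * N * (ell N : ℝ) ^ 20 := by
    have h1 : ∑ n ∈ range (N + 1), g n ^ 2 ≤ ∑ n ∈ Icc 1 N, 25 * (ell N : ℝ) ^ 4 * tau n ^ 4 := by
      rw [← sum_subset (s₁ := Icc 1 N) (fun n hn => mem_range.2 (by rw [mem_Icc] at hn; omega)) fun n _ hn => by rw [hg]; simp only [if_neg hn]; simp]
      refine sum_le_sum fun n hn => ?_
      have h0 : 0 < n := (mem_Icc.1 hn).1
      have h2 := abs_LamQ_le hN hQN h0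
      have h3 := one_le_pow₀ (n := 2) (one_le_tau h0.ne')
      have h4 : |vth n - LamQ Q n| ≤ 5 * (ell N : ℝ) ^ 2 * tau n ^ 2 := by
        refine (abs_sub _ _).trans ?_
        rw [abs_of_nonneg (vth_nonneg n)]
        have h5 : (ell N : ℝ) ≤ (ell N : ℝ) ^ 2 * tau n ^ 2 := by nlinarith [mul_le_mul_of_nonneg_left h3 (sq_nonneg (ell N : ℝ))]
        linarith [hlog n hn]
      rw [hg]
      simp only [if_pos hn]
      rw [← sq_abs]
      calc _ ≤ _ := pow_le_pow_left₀ (abs_nonneg _) h4 2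
        _ = _ := by ring
    rw [← mul_sum] at h1
    have h4 : ∑ n ∈ Icc 1 N, tau n ^ 4 ≤ N * (2 * (ell N : ℝ)) ^ 16 := sum_tau_pow_four_le hN
    calc _ ≤ _ := h1.trans (mul_le_mul_of_nonneg_left h4 (by positivity))
      _ = _ := by ring
  have hconv : ∀ k, ∀ n ∈ Icc 1 N, ∑ m ∈ Icc 1 N, progWt k (l k) (a k) (b k) m * g (n - m) =
      I2 k (l k) n (a k) (b k) - ∑ m ∈ Ico 1 n, progWt k (l k) (a k) (b k) m * LamQ Q (n - m) := fun k n hn => by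
    rw [mem_Icc] at hn
    rw [I2_eq, ← sum_sub_distrib]
    symm
    refine (sum_congr rfl fun m hm => ?_).trans (sum_subset (fun m hm => ?_) fun m hm hm' => ?_)
    · rw [mem_Ico] at hm
      rw [hg]
      simp only [if_pos (mem_Icc.2 (by omega : 1 ≤ n - m ∧ n - m ≤ N)), mul_sub]
    · rw [mem_Ico] at hm
      exact mem_Icc.2 (by omega)
    · rw [mem_Icc] at hm
      rw [mem_Ico] at hm'
      rw [hg]
      simp only [if_neg fun h : n - m ∈ Icc 1 N => hm' (by rw [mem_Icc] at h; omega), mul_zero]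
  have hT1 : ∑ k ∈ Icc 1 K, ∑ n ∈ Icc 1 N, |∑ m ∈ Icc 1 N, progWt k (l k) (a k) (b k) m * g (n - m)| ≤
      (1 + 8 * (25 * 2 ^ 16 + 5120 * C1)) * (N ^ 2 / (ell N : ℝ) ^ A) := by
    have h1 := sum_abs_conv_sq_le hN hKN (g := g) (fun n hn => by rw [hg]; exact if_neg fun h => by rw [mem_Icc] at h; omega)
      (by rw [hg]; exact if_neg fun h => by rw [mem_Icc] at h; omega) (fun α => by rw [hrange]; exact hS' α) hP (fun k => (l k : ZMod k))
      (f := fun k m => progWt k (l k) (a k) (b k) m) (fun k m hm => by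
        rw [progWt]
        split_ifs
        · rw [abs_of_nonneg (vth_nonneg m)]; exact hlog m hm
        · simp)
      (fun k m hm => if_neg fun h => hm h.1)
    have h2 : √(16 * N * (ell N : ℝ) ^ 4 * (25 * 2 ^ 16 * N * (ell N : ℝ) ^ 20)) = 5120 * N * (ell N : ℝ) ^ 12 := by
      rw [Real.sqrt_eq_iff_mul_self_eq (by positivity) (by positivity)]
      ring
    have h3 : (K : ℝ) ≤ N / (ell N : ℝ) ^ (23 + 2 * A) := by
      rw [le_div_iff₀ (by positivity)]
      exact_mod_cast hKℓ
    rw [h2] at h1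
    refine abs_le_of_sq_le_sq' (h1.trans ?_) (by positivity) |>.2
    calc _ ≤ 8 * (N : ℝ) ^ 2 * (ell N : ℝ) ^ 3 * (N / (ell N : ℝ) ^ (23 + 2 * A) * (25 * 2 ^ 16 * N * (ell N : ℝ) ^ 20) +
          C1 * N / (ell N : ℝ) ^ (15 + 2 * A) * (5120 * N * (ell N : ℝ) ^ 12)) := by gcongr
      _ = 8 * (25 * 2 ^ 16 + 5120 * C1) * (N ^ 2 / (ell N : ℝ) ^ A) ^ 2 := by
          rw [pow_add, pow_add, div_pow, ← pow_mul, ← pow_mul, mul_comm A 2]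
          field_simp
      _ ≤ _ := by
          rw [mul_pow]
          refine mul_le_mul_of_nonneg_right ?_ (by positivity)
          nlinarith
  have hT2 : ∑ k ∈ Icc 1 K, ∑ n ∈ Icc 1 N, 8 * (ell N : ℝ) ^ 2 * Q * ∑ d ∈ Icc 1 Q, E (k.lcm d) ≤ 8 * C2 * (N ^ 2 / (ell N : ℝ) ^ A) := by
    have h1 := (sum_sum_lcm_le hE0 K Q).trans (mul_le_mul_of_nonneg_left hsum (by positivity))
    simp only [sum_const, Nat.card_Icc, Nat.add_sub_cancel, nsmul_eq_mul, ← mul_sum]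
    calc _ ≤ (N : ℝ) * (8 * (ell N : ℝ) ^ 2 * Q * ((Q : ℝ) ^ 2 * (C2 * N / (ell N : ℝ) ^ (2 + 3 * e + A)))) := by gcongr
      _ = _ := by
          rw [hQ, pow_add, pow_add, mul_comm 3 e, pow_mul]
          push_cast
          field_simp
  have hT3 := sum_singular_tail_le hC3 hN hKN (b := b) ha (Q := Q) (A := A) (by
    rw [Real.le_sqrt (by positivity) (by positivity), hQ, ← pow_mul, mul_comm]
    exact_mod_cast Nat.pow_le_pow_right (by omega) he) fun k n hk hn => hT k (l k) n Q hk hn (hl k) hQ0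
  have hpt : ∀ k ∈ Icc 1 K, ∀ n ∈ Icc 1 N, |Delta2 k (l k) n (a k) (b k)| ≤
      |∑ m ∈ Icc 1 N, progWt k (l k) (a k) (b k) m * g (n - m)| + 8 * (ell N : ℝ) ^ 2 * Q * ∑ d ∈ Icc 1 Q, E (k.lcm d) +
      (Phi2 n (a k) (b k) : ℝ) / k.totient * |S2 k (l k) n - ∑ r ∈ Icc 1 Q, sqfProd (locG k (l k) n) r| := fun k hk n hn => by
    have h1 := abs_sum_progWt_mul_LamQ_sub_le hN hE0 hE (mem_Icc.1 hk).1 (hl k) (b k) (mem_Icc.1 hn).2 (ha k) hQN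
    have h2 : (0 : ℝ) ≤ (Phi2 n (a k) (b k) : ℝ) / k.totient := by positivity
    rw [hconv k n hn, Delta2]
    rw [abs_le] at h1
    have h3 := neg_le_abs (I2 k (l k) n (a k) (b k) - ∑ m ∈ Ico 1 n, progWt k (l k) (a k) (b k) m * LamQ Q (n - m))
    have h4 := le_abs_self (I2 k (l k) n (a k) (b k) - ∑ m ∈ Ico 1 n, progWt k (l k) (a k) (b k) m * LamQ Q (n - m))
    have h5 := mul_le_mul_of_nonneg_left (neg_le_abs (S2 k (l k) n - ∑ r ∈ Icc 1 Q, sqfProd (locG k (l k) n) r)) h2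
    have h6 := mul_le_mul_of_nonneg_left (le_abs_self (S2 k (l k) n - ∑ r ∈ Icc 1 Q, sqfProd (locG k (l k) n) r)) h2
    rw [div_mul_eq_mul_div, mul_comm (S2 _ _ _), ← div_mul_eq_mul_div, abs_le]
    constructor <;> linarith
  refine (sum_le_sum fun k hk => sum_le_sum (hpt k hk)).trans ?_
  simp only [sum_add_distrib]
  refine (add_le_add (add_le_add hT1 hT2) hT3).trans (le_of_eq (by ring))

theorem Delta2_zero (k : ℕ) (l : ℤ) (a b : ℕ) : Delta2 k l 0 a b = 0 := by
  simp [Delta2, I2_eq, Phi2]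


/-- for any A > 0 there is B > 0 with
∑_{k ≤ √N (log N)^{-B}} max_{(l,k)=1} max_{J} ∑_{n ≤ N} |Δ⁽²⁾_{k,l}(n, J)| ≪ N² (log N)^{-A};
the maxima are expressed via arbitrary choice functions l, a, b of k. -/
theorem binary_goldbach_progressions_average :
    ∀ A : ℝ, 0 < A → ∃ B : ℝ, 0 < B ∧ ∃ C : ℝ, 0 < C ∧ ∃ N0 : ℕ, ∀ N : ℕ, N0 ≤ N →
      ∀ l : ℕ → ℤ, ∀ a b : ℕ → ℕ,
        (∀ k : ℕ, Int.gcd (k : ℤ) (l k) = 1) →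
        (∀ k : ℕ, 1 ≤ a k ∧ b k ≤ N) →
        (∑ k ∈ Finset.Icc 1 N,
            if (k : ℝ) ≤ Real.sqrt N * Real.log N ^ (-B) then
              ∑ n ∈ Finset.range (N + 1), |Delta2 k (l k) n (a k) (b k)|
            else 0) ≤
          C * (N : ℝ) ^ 2 * Real.log N ^ (-A) := by
  intro A hA
  obtain ⟨B, C, hC, h⟩ := sum_abs_Delta2_le ⌈A⌉₊
  refine ⟨B + 1, by positivity, C + 1, by positivity, 9, fun N hN l a b hl hab => ?_⟩
  have hN3 : 3 ≤ N := by omega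
  have hL : 2 ≤ Real.log N := by
    have h1 : Real.log 9 = 2 * Real.log 3 := by
      rw [show (9 : ℝ) = 3 ^ 2 by norm_num, Real.log_pow]; norm_num
    have h2 : Real.log 9 ≤ Real.log N := Real.log_le_log (by norm_num) (by exact_mod_cast hN)
    have h3 : 1 ≤ Real.log (3 : ℕ) := one_le_log_of_three_le le_rfl
    push_cast at h3
    linarith
  have hL0 : 0 < Real.log N := by linarith
  obtain ⟨K, hK⟩ : ∃ K, K = ⌊√(N : ℝ) * Real.log N ^ (-((B : ℝ) + 1))⌋₊ := ⟨_, rfl⟩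
  have hKB : K ^ 2 * ell N ^ B ≤ N := by
    have h1 : (K : ℝ) ≤ √(N : ℝ) / Real.log N ^ B := by
      rw [hK]
      refine (Nat.floor_le (by positivity)).trans ?_
      rw [div_eq_mul_inv, ← Real.rpow_natCast, ← Real.rpow_neg hL0.le]
      refine mul_le_mul_of_nonneg_left (Real.rpow_le_rpow_of_exponent_le (by linarith) (by linarith)) (Real.sqrt_nonneg _)
    have h2 : (ell N : ℝ) ≤ Real.log N ^ 2 := (ell_le_two_mul hN3).trans (by nlinarith)
    have h3 : (K : ℝ) ^ 2 * (ell N : ℝ) ^ B ≤ N := by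
      calc _ ≤ (√(N : ℝ) / Real.log N ^ B) ^ 2 * (Real.log N ^ 2) ^ B := by gcongr
        _ = N := by
          rw [div_pow, Real.sq_sqrt (Nat.cast_nonneg N), ← pow_mul, ← pow_mul, mul_comm 2 B]
          field_simp
    exact_mod_cast h3
  have hpow : Real.log N ^ A ≤ (ell N : ℝ) ^ ⌈A⌉₊ := by
    rw [← Real.rpow_natCast]
    exact (Real.rpow_le_rpow_of_exponent_le (by linarith) (Nat.le_ceil A)).trans
      (Real.rpow_le_rpow hL0.le (log_le_ell N) (Nat.cast_nonneg _))
  have hn : ∀ k, ∑ n ∈ range (N + 1), |Delta2 k (l k) n (a k) (b k)| = ∑ n ∈ Icc 1 N, |Delta2 k (l k) n (a k) (b k)| := fun k => by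
    refine (sum_subset (fun n hn => mem_range.2 (by rw [mem_Icc] at hn; omega)) fun n hn hn' => ?_).symm
    obtain rfl : n = 0 := by rw [mem_range] at hn; rw [mem_Icc] at hn'; omega
    rw [Delta2_zero, abs_zero]
  rw [← sum_filter]
  calc _ ≤ ∑ k ∈ Icc 1 K, ∑ n ∈ Icc 1 N, |Delta2 k (l k) n (a k) (b k)| := by
        simp only [hn]
        refine sum_le_sum_of_subset_of_nonneg (fun k hk => ?_) fun _ _ _ => sum_nonneg fun _ _ => abs_nonneg _
        rw [mem_filter, mem_Icc] at hk
        rw [mem_Icc, hK]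
        exact ⟨hk.1.1, Nat.le_floor hk.2⟩
    _ ≤ C * N ^ 2 / (ell N : ℝ) ^ ⌈A⌉₊ := h N K hN3 hKB l a b hl fun k => (hab k).1
    _ ≤ (C + 1) * (N : ℝ) ^ 2 / Real.log N ^ A := by
        gcongr
        linarith
    _ = _ := by rw [Real.rpow_neg hL0.le, div_eq_mul_inv]
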